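/- There exists a constant C such that for every n ≥ 1, every β ≥ 0, and every injective map π : Fin n → ℝ², the number of simple graphs G on vertex set Fin n that admit a polyline drawing with vertex mapping π having total number of bends at most β is at most 2^{n·log₂(1 + β/n) + C·n}. (Equivalently, every such graph can be encoded using n·log₂(1 + β/n) + O(n) bits.) -/

import Mathlib

open Finset
open scoped Classical

noncomputable section

/-- The polyline traced by a list of points: the union of the closed segments
between consecutive points. -/
def polylineOf (pts : List (ℝ × ℝ)) : Set (ℝ × ℝ) :=
  ⋃ p ∈ pts.zip pts.tail, segment ℝ p.1 p.2

/-- The curve drawn for the edge `{u, v}`: the polyline through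
`π u`, the bend points assigned to `(u, v)`, and `π v`. -/
def edgeCurve {n : ℕ} (π : Fin n → ℝ × ℝ) (bends : Fin n → Fin n → List (ℝ × ℝ))
    (u v : Fin n) : Set (ℝ × ℝ) :=
  polylineOf (π u :: (bends u v ++ [π v]))

/-- `bends` is a polyline drawing of `G` with vertex mapping `π`:
each edge `{u,v}` of `G` is assigned the finite sequence of bend points `bends u v`
(recorded consistently in both directions); the polyline of every edge is a simple
arc from `π u` to `π v`; the polylines of two distinct edges intersect exactly in
the images under `π` of the shared endpoints; and no polyline passes through the
image of a vertex that is not an endpoint of its edge. -/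
structure IsPolylineDrawing {n : ℕ} (G : SimpleGraph (Fin n)) (π : Fin n → ℝ × ℝ)
    (bends : Fin n → Fin n → List (ℝ × ℝ)) : Prop where
  symm : ∀ u v : Fin n, bends v u = (bends u v).reverse
  arc : ∀ u v : Fin n, G.Adj u v → ∃ γ : ℝ → ℝ × ℝ,
    ContinuousOn γ (Set.Icc 0 1) ∧ Set.InjOn γ (Set.Icc 0 1) ∧
    γ 0 = π u ∧ γ 1 = π v ∧ γ '' Set.Icc 0 1 = edgeCurve π bends u v
  inter : ∀ u v x y : Fin n, G.Adj u v → G.Adj x y → s(u, v) ≠ s(x, y) →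
    edgeCurve π bends u v ∩ edgeCurve π bends x y =
      π '' (({u, v} : Set (Fin n)) ∩ ({x, y} : Set (Fin n)))
  noVertex : ∀ u v w : Fin n, G.Adj u v → w ≠ u → w ≠ v →
    π w ∉ edgeCurve π bends u v

/-- The total number of bends of a drawing: the sum over all edges of the number
of bend points of that edge (each unordered edge is counted once, hence the
division by 2 of the sum over ordered pairs). -/
def totalBends {n : ℕ} (G : SimpleGraph (Fin n))
    (bends : Fin n → Fin n → List (ℝ × ℝ)) : ℝ :=
  (∑ u : Fin n, ∑ v : Fin n,
    if G.Adj u v then ((bends u v).length : ℝ) else 0) / 2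

namespace PolylineCount

section Separator
variable {V : Type*} (G : SimpleGraph V)

/-- The finite set `Y` is nonempty and connected in `G`. -/
def Conn (Y : Finset V) : Prop :=
  Y.Nonempty ∧ ∀ a ∈ Y, ∀ b ∈ Y, Relation.ReflTransGen (fun x y => G.Adj x y ∧ y ∈ Y) a b

/-- Some vertex of `A` is adjacent to some vertex of `B`. -/
def Touch (A B : Finset V) : Prop := ∃ a ∈ A, ∃ b ∈ B, G.Adj a b

/-- The graph induced by `G` on `U` has no `K₅` minor. -/
def MinorFree (U : Finset V) : Prop :=
  ¬ ∃ C : Fin 5 → Finset V, (∀ i, C i ⊆ U) ∧ (∀ i, Conn G (C i)) ∧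
    (∀ i j, i ≠ j → Disjoint (C i) (C j)) ∧ ∀ i j, i ≠ j → Touch G (C i) (C j)

variable {G}

lemma Touch.symm {A B : Finset V} (h : Touch G A B) : Touch G B A := by
  obtain ⟨a, ha, b, hb, hab⟩ := h
  exact ⟨b, hb, a, ha, hab.symm⟩

lemma Touch.mono {A B A' B' : Finset V} (h : Touch G A B) (hA : A ⊆ A') (hB : B ⊆ B') :
    Touch G A' B' := by
  obtain ⟨a, ha, b, hb, hab⟩ := h
  exact ⟨a, hA ha, b, hB hb, hab⟩

lemma MinorFree.mono {U U' : Finset V} (h : MinorFree G U) (hU : U' ⊆ U) : MinorFree G U' := by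
  rintro ⟨C, h1, h2⟩
  exact h ⟨C, fun i => (h1 i).trans hU, h2⟩

lemma conn_singleton (v : V) : Conn G {v} := by
  refine ⟨singleton_nonempty v, ?_⟩
  intro a ha b hb
  rw [mem_singleton] at ha hb
  subst ha; subst hb
  exact .refl

lemma reach_mono {Y Y' : Finset V} (h : Y ⊆ Y') {a b : V}
    (hr : Relation.ReflTransGen (fun x y => G.Adj x y ∧ y ∈ Y) a b) :
    Relation.ReflTransGen (fun x y => G.Adj x y ∧ y ∈ Y') a b :=
  Relation.ReflTransGen.mono (r := fun x y => G.Adj x y ∧ y ∈ Y)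
    (fun _ _ hxy => ⟨hxy.1, h hxy.2⟩) a b hr

lemma reach_symm {Y : Finset V} {a b : V} (ha : a ∈ Y)
    (hr : Relation.ReflTransGen (fun x y => G.Adj x y ∧ y ∈ Y) a b) :
    b ∈ Y ∧ Relation.ReflTransGen (fun x y => G.Adj x y ∧ y ∈ Y) b a := by
  induction hr with
  | refl => exact ⟨ha, .refl⟩
  | tail h1 h2 ih => exact ⟨h2.2, .head ⟨h2.1.symm, ih.1⟩ ih.2⟩

lemma conn_of_center {Y : Finset V} {c : V} (hc : c ∈ Y)
    (h : ∀ a ∈ Y, Relation.ReflTransGen (fun x y => G.Adj x y ∧ y ∈ Y) c a) : Conn G Y :=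
  ⟨⟨c, hc⟩, fun a ha b hb => ((reach_symm hc (h a ha)).2).trans (h b hb)⟩

lemma Conn.union {A B : Finset V} (hA : Conn G A) (hB : Conn G B)
    (h : Touch G A B ∨ ¬ Disjoint A B) : Conn G (A ∪ B) := by
  have key : ∃ a ∈ A, ∃ b ∈ B,
      Relation.ReflTransGen (fun x y => G.Adj x y ∧ y ∈ A ∪ B) a b := by
    rcases h with ⟨a, ha, b, hb, hab⟩ | h
    · exact ⟨a, ha, b, hb, .single ⟨hab, mem_union_right _ hb⟩⟩
    · obtain ⟨a, ha, hb⟩ := not_disjoint_iff.1 h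
      exact ⟨a, ha, a, hb, .refl⟩
  obtain ⟨a, ha, b, hb, hab⟩ := key
  refine conn_of_center (c := a) (mem_union_left _ ha) fun x hx => ?_
  rcases mem_union.1 hx with hx | hx
  · exact reach_mono subset_union_left (hA.2 a ha x hx)
  · exact hab.trans (reach_mono subset_union_right (hB.2 b hb x hx))

lemma Conn.insert {A : Finset V} (hA : Conn G A) {a v : V} (ha : a ∈ A) (h : G.Adj a v) :
    Conn G (insert v A) := by
  rw [insert_eq]
  exact (conn_singleton v).union hA (.inl ⟨v, mem_singleton_self v, a, ha, h.symm⟩)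

/-- The vertices of `Y` reachable from `A` inside `Y`. -/
def reachSet (G : SimpleGraph V) (Y A : Finset V) : Finset V :=
  Y.filter fun v => ∃ a ∈ A, a ∈ Y ∧ Relation.ReflTransGen (fun x y => G.Adj x y ∧ y ∈ Y) a v

lemma reachSet_subset (Y A : Finset V) : reachSet G Y A ⊆ Y := filter_subset _ _

lemma subset_reachSet {Y A : Finset V} (h : A ⊆ Y) : A ⊆ reachSet G Y A := fun a ha =>
  mem_filter.2 ⟨h ha, a, ha, h ha, .refl⟩

lemma reachSet_closed {Y A : Finset V} {u v : V} (hu : u ∈ reachSet G Y A) (hv : v ∈ Y)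
    (h : G.Adj u v) : v ∈ reachSet G Y A := by
  obtain ⟨_, a, ha, haY, hr⟩ := mem_filter.1 hu
  exact mem_filter.2 ⟨hv, a, ha, haY, hr.tail ⟨h, hv⟩⟩

lemma reachSet_reach {Y A : Finset V} {a v : V} (ha : a ∈ Y) (haA : a ∈ A)
    (h : Relation.ReflTransGen (fun x y => G.Adj x y ∧ y ∈ Y) a v) :
    Relation.ReflTransGen (fun x y => G.Adj x y ∧ y ∈ reachSet G Y A) a v ∧
      v ∈ reachSet G Y A := by
  induction h with
  | refl => exact ⟨.refl, mem_filter.2 ⟨ha, a, haA, ha, .refl⟩⟩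
  | tail _ h2 ih =>
    have := reachSet_closed ih.2 h2.2 h2.1
    exact ⟨ih.1.tail ⟨h2.1, this⟩, this⟩

lemma reachSet_conn {Y A : Finset V} (hA : Conn G A) (h : A ⊆ Y) : Conn G (reachSet G Y A) := by
  obtain ⟨c, hc⟩ := hA.1
  refine conn_of_center (c := c) (subset_reachSet h hc) fun v hv => ?_
  obtain ⟨_, a, ha, haY, hr⟩ := mem_filter.1 hv
  exact (reach_mono (subset_reachSet h) (hA.2 c hc a ha)).trans (reachSet_reach haY ha hr).1

/-- A connected set meeting a set closed under adjacency inside `Y` stays in it. -/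
lemma Conn.subset_of_closed {K Y B : Finset V} (hK : Conn G K) (hKY : K ⊆ Y)
    (hB : ∀ u ∈ B, ∀ v ∈ Y, G.Adj u v → v ∈ B) (hm : ¬ Disjoint K B) : K ⊆ B := by
  obtain ⟨c, hcK, hcB⟩ := not_disjoint_iff.1 hm
  intro v hv
  have := hK.2 c hcK v hv
  induction this with
  | refl => exact hcB
  | tail _ h2 ih =>
    exact hB _ (ih (reach_symm hcK (by assumption)).1) _ (hKY h2.2) h2.1

lemma exists_component {K Y : Finset V} (hK : Conn G K) (h : K ⊆ Y) :
    ∃ K', K ⊆ K' ∧ K' ⊆ Y ∧ Conn G K' ∧ ∀ u ∈ K', ∀ v ∈ Y, G.Adj u v → v ∈ K' :=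
  ⟨reachSet G Y K, subset_reachSet h, reachSet_subset _ _, reachSet_conn hK h,
    fun _ hu _ hv => reachSet_closed hu hv⟩

/-- `v` lies in a connected subset of `K` of size at most `m` meeting the sets
`A j`, `j ∈ I`, `j < i`. -/
def SmallTree (G : SimpleGraph V) (K : Finset V) (I : Finset (Fin 5)) (A : Fin 5 → Finset V)
    (i : ℕ) (m : ℕ) (v : V) : Prop :=
  ∃ T, T ⊆ K ∧ Conn G T ∧ v ∈ T ∧ T.card ≤ m ∧ ∀ j ∈ I, j.val < i → ¬ Disjoint T (A j)

lemma SmallTree.mono {K : Finset V} {I : Finset (Fin 5)} {A : Fin 5 → Finset V}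
    {i m m' : ℕ} {v : V} (h : SmallTree G K I A i m v) (hm : m ≤ m') :
    SmallTree G K I A i m' v := by
  obtain ⟨T, h1, h2, h3, h4, h5⟩ := h
  exact ⟨T, h1, h2, h3, h4.trans hm, h5⟩

lemma tree_or_cut {K : Finset V} (I : Finset (Fin 5)) (A : Fin 5 → Finset V)
    {q : ℕ} (hq : 1 ≤ q) :
    (∃ T, T ⊆ K ∧ Conn G T ∧ T.card ≤ q ∧ ∀ j ∈ I, ¬ Disjoint T (A j)) ∨
    ∃ Z, Z ⊆ K ∧ Z.card * q ≤ 6 * K.card ∧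
      ∀ Y, Y ⊆ K \ Z → Conn G Y → ∃ j ∈ I, Disjoint Y (A j) := by
  by_cases hT : ∃ T, T ⊆ K ∧ Conn G T ∧ T.card ≤ q ∧ ∀ j ∈ I, ¬ Disjoint T (A j)
  · exact .inl hT
  right
  let Z : ℕ → Finset V := fun d => K.filter fun v =>
    ∃ i ∈ range 6, SmallTree G K I A i (d + 1) v ∧ ¬ SmallTree G K I A i d v
  have hsum : ∑ d ∈ range q, (Z d).card ≤ 6 * K.card := by
    calc ∑ d ∈ range q, (Z d).card
        ≤ ∑ d ∈ range q, ∑ i ∈ range 6, ∑ v ∈ K,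
          (if SmallTree G K I A i (d + 1) v ∧ ¬ SmallTree G K I A i d v then 1 else 0) := by
          refine sum_le_sum fun d _ => ?_
          rw [sum_comm, card_filter]
          refine sum_le_sum fun v _ => ?_
          split_ifs with h
          · obtain ⟨i, hi, h⟩ := h
            refine le_trans ?_ (single_le_sum (fun _ _ => Nat.zero_le _) hi)
            simp [h]
          · exact Nat.zero_le _
      _ = ∑ i ∈ range 6, ∑ v ∈ K, ∑ d ∈ range q,
          (if SmallTree G K I A i (d + 1) v ∧ ¬ SmallTree G K I A i d v then 1 else 0) := by
          rw [sum_comm]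
          exact sum_congr rfl fun i _ => sum_comm
      _ ≤ ∑ i ∈ range 6, ∑ v ∈ K, 1 := by
          refine sum_le_sum fun i _ => sum_le_sum fun v _ => ?_
          rw [← card_filter, card_le_one]
          intro a ha b hb
          simp only [mem_filter] at ha hb
          by_contra hne
          rcases lt_or_gt_of_ne hne with h | h
          · exact hb.2.2 (ha.2.1.mono h)
          · exact ha.2.2 (hb.2.1.mono h)
      _ = 6 * K.card := by simp
  obtain ⟨d, hd, hZ⟩ : ∃ d ∈ range q, (Z d).card * q ≤ 6 * K.card := by
    by_contra! hcon
    have h1 : ∑ d ∈ range q, 6 * K.card < ∑ d ∈ range q, (Z d).card * q :=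
      sum_lt_sum_of_nonempty ⟨0, mem_range.2 hq⟩ hcon
    rw [sum_const, card_range, smul_eq_mul, ← sum_mul] at h1
    have h2 := Nat.mul_le_mul_right q hsum
    linarith
  refine ⟨Z d, filter_subset _ _, hZ, fun Y hY hYc => ?_⟩
  by_contra! hmeet
  have hYK : Y ⊆ K := hY.trans sdiff_subset
  have down : ∀ i < 6, ∀ v ∈ Y, SmallTree G K I A i (d + 1) v → SmallTree G K I A i d v := by
    intro i hi v hv h
    by_contra hn
    exact (mem_sdiff.1 (hY hv)).2 (mem_filter.2 ⟨hYK hv, i, mem_range.2 hi, h, hn⟩)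
  have spread : ∀ i < 6, (∃ v ∈ Y, SmallTree G K I A i d v) →
      ∀ v ∈ Y, SmallTree G K I A i d v := by
    rintro i hi ⟨c, hc, hcT⟩ v hv
    have := hYc.2 c hc v hv
    induction this with
    | refl => exact hcT
    | tail h1 h2 ih =>
      obtain ⟨T, t1, t2, t3, t4, t5⟩ := ih (reach_symm hc h1).1
      refine down i hi _ hv ⟨insert _ T, insert_subset (hYK hv) t1, t2.insert t3 h2.1,
        mem_insert_self _ _, (card_insert_le _ _).trans (by omega), fun j hj hji hdis => ?_⟩
      exact t5 j hj hji (hdis.mono_left (subset_insert _ _))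
  have all : ∀ i < 6, ∀ v ∈ Y, SmallTree G K I A i d v := by
    intro i
    induction i with
    | zero =>
      intro h0 v hv
      refine down 0 h0 v hv ⟨{v}, ?_, conn_singleton v, mem_singleton_self v, by simp, ?_⟩
      · simpa using hYK hv
      · intro j _ hj; omega
    | succ i ih =>
      intro hi
      apply spread _ hi
      have hi5 : i < 5 := by omega
      by_cases hmem : (⟨i, hi5⟩ : Fin 5) ∈ I
      · obtain ⟨v, hvY, hvA⟩ := not_disjoint_iff.1 (hmeet _ hmem)
        obtain ⟨T, t1, t2, t3, t4, t5⟩ := ih (by omega) v hvY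
        refine ⟨v, hvY, T, t1, t2, t3, t4, fun j hj hji => ?_⟩
        by_cases hje : j.val = i
        · have : j = ⟨i, hi5⟩ := Fin.ext hje
          subst this
          exact not_disjoint_iff.2 ⟨v, t3, hvA⟩
        · exact t5 j hj (by omega)
      · obtain ⟨v, hvY⟩ := hYc.1
        obtain ⟨T, t1, t2, t3, t4, t5⟩ := ih (by omega) v hvY
        refine ⟨v, hvY, T, t1, t2, t3, t4, fun j hj hji => ?_⟩
        by_cases hje : j.val = i
        · have : j = ⟨i, hi5⟩ := Fin.ext hje
          subst this
          exact absurd hj hmem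
        · exact t5 j hj (by omega)
  obtain ⟨v, hvY⟩ := hYc.1
  obtain ⟨T, t1, t2, _, t4, t5⟩ := all 5 (by norm_num) v hvY
  exact hT ⟨T, t1, t2, t4.trans (by have := mem_range.1 hd; omega),
    fun j hj => t5 j hj j.isLt⟩

/-- A partial `K₅` minor (branch sets `C i`, `i ∈ I`) enclosing a heavy connected set `K`. -/
structure SepState (G : SimpleGraph V) (U : Finset V) (w : V → ℝ) (q : ℕ)
    (I : Finset (Fin 5)) (C X : Fin 5 → Finset V) (K : Finset V) : Prop where
  conn : ∀ i ∈ I, Conn G (C i)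
  sub : ∀ i ∈ I, C i ⊆ U
  X_sub : ∀ i ∈ I, X i ⊆ C i
  X_card : ∀ i ∈ I, (X i).card ≤ q
  disj : ∀ i ∈ I, ∀ j ∈ I, i ≠ j → Disjoint (C i) (C j)
  touch : ∀ i ∈ I, ∀ j ∈ I, i ≠ j → Touch G (C i) (C j)
  K_sub : K ⊆ U
  K_conn : Conn G K
  heavy : ∑ v ∈ U, w v < 2 * ∑ v ∈ K, w v
  K_disj : ∀ i ∈ I, Disjoint (C i) K
  nbr : ∀ u ∈ K, ∀ v ∈ U, v ∉ K → G.Adj u v → ∃ i ∈ I, v ∈ X i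

lemma heavy_meet {U K K' : Finset V} {w : V → ℝ} (hw : ∀ v, 0 ≤ w v) (hK : K ⊆ U) (hK' : K' ⊆ U)
    (h : ∑ v ∈ U, w v < 2 * ∑ v ∈ K, w v) (h' : ∑ v ∈ U, w v < 2 * ∑ v ∈ K', w v) :
    ¬ Disjoint K K' := by
  intro hd
  have : ∑ v ∈ K ∪ K', w v ≤ ∑ v ∈ U, w v :=
    sum_le_sum_of_subset_of_nonneg (union_subset hK hK') fun _ _ _ => hw _
  rw [sum_union hd] at this
  linarith

/-- A graph without `K₅` minor has a small set whose removal leaves no heavy component. -/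
theorem exists_separator {U : Finset V} (hU : MinorFree G U) {w : V → ℝ} (hw : ∀ v, 0 ≤ w v)
    {q : ℕ} (hq : 1 ≤ q) (hqU : 6 * U.card ≤ q * q) :
    ∃ S, S ⊆ U ∧ S.card ≤ 5 * q ∧
      ∀ K, K ⊆ U \ S → Conn G K → 2 * ∑ v ∈ K, w v ≤ ∑ v ∈ U, w v := by
  by_contra! hcon
  have comp : ∀ S, S ⊆ U → S.card ≤ 5 * q → ∃ K, K ⊆ U \ S ∧ Conn G K ∧
      (∑ v ∈ U, w v < 2 * ∑ v ∈ K, w v) ∧ ∀ u ∈ K, ∀ v ∈ U \ S, G.Adj u v → v ∈ K := by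
    intro S hS hSc
    obtain ⟨K, h1, h2, h3⟩ := hcon S hS hSc
    obtain ⟨K', k1, k2, k3, k4⟩ := exists_component h2 h1
    refine ⟨K', k2, k3, h3.trans_le ?_, k4⟩
    have := sum_le_sum_of_subset_of_nonneg (f := w) k1 fun _ _ _ => hw _
    linarith
  have main : ∀ N : ℕ, ∀ I C X K, SepState G U w q I C X K → 6 * K.card + I.card ≤ N → False := by
    intro N
    induction N with
    | zero =>
      intro I C X K hs hN
      have := hs.K_conn.1.card_pos
      omega
    | succ N ih =>
      intro I C X K hs hN
      have hI5 : I.card ≤ 5 := by simpa using card_le_univ I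
      obtain ⟨e, he⟩ : ∃ e, e ∉ I := by
        by_contra! hall
        exact hU ⟨C, fun i => hs.sub i (hall i), fun i => hs.conn i (hall i),
          fun i j => hs.disj i (hall i) j (hall j), fun i j => hs.touch i (hall i) j (hall j)⟩
      have hI4 : I.card ≤ 4 := by
        have : I.card < (univ : Finset (Fin 5)).card :=
          card_lt_card ((ssubset_univ_iff).2 fun h => he (h ▸ mem_univ e))
        simpa using Nat.lt_succ_iff.1 this
      by_cases hdrop : ∃ i ∈ I, ¬ Touch G (C i) K
      · obtain ⟨i, hi, hti⟩ := hdrop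
        have hsub : ∀ j ∈ I.erase i, j ∈ I := fun j hj => mem_of_mem_erase hj
        refine ih (I.erase i) C X K ⟨fun j hj => hs.conn j (hsub j hj),
          fun j hj => hs.sub j (hsub j hj), fun j hj => hs.X_sub j (hsub j hj),
          fun j hj => hs.X_card j (hsub j hj),
          fun j hj l hl => hs.disj j (hsub j hj) l (hsub l hl),
          fun j hj l hl => hs.touch j (hsub j hj) l (hsub l hl), hs.K_sub, hs.K_conn, hs.heavy,
          fun j hj => hs.K_disj j (hsub j hj), fun u hu v hv hvK huv => ?_⟩ ?_
        · obtain ⟨j, hj, hvj⟩ := hs.nbr u hu v hv hvK huv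
          refine ⟨j, mem_erase.2 ⟨?_, hj⟩, hvj⟩
          rintro rfl
          exact hti ⟨v, hs.X_sub j hj hvj, u, hu, huv.symm⟩
        · rw [card_erase_of_mem hi]
          have := card_pos.2 ⟨i, hi⟩
          omega
      push Not at hdrop
      let A : Fin 5 → Finset V := fun i => K.filter fun v => ∃ c ∈ C i, G.Adj c v
      have hXU : I.biUnion X ⊆ U := biUnion_subset.2 fun i hi => (hs.X_sub i hi).trans (hs.sub i hi)
      have hXK : Disjoint (I.biUnion X) K := by
        rw [disjoint_biUnion_left]
        exact fun i hi => (hs.K_disj i hi).mono_left (hs.X_sub i hi)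
      have hXcard : (I.biUnion X).card ≤ 4 * q :=
        card_biUnion_le.trans ((sum_le_card_nsmul _ _ q fun i hi => hs.X_card i hi).trans
          (by rw [smul_eq_mul]; exact Nat.mul_le_mul_right _ hI4))
      -- a heavy component avoiding the boundary and a small subset of `K`
      have heavyComp : ∀ Z, Z ⊆ K → Z.card ≤ q → ∃ K', K' ⊆ K \ Z ∧ Conn G K' ∧
          (∑ v ∈ U, w v < 2 * ∑ v ∈ K', w v) ∧
          ∀ u ∈ K', ∀ v ∈ U, v ∉ I.biUnion X → v ∉ Z → G.Adj u v → v ∈ K' := by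
        intro Z hZ hZq
        obtain ⟨K', k1, k2, k3, k4⟩ := comp (I.biUnion X ∪ Z)
          (union_subset hXU (hZ.trans hs.K_sub)) ((card_union_le _ _).trans (by omega))
        have hsubK : K' ⊆ K := by
          refine k2.subset_of_closed (Y := U \ (I.biUnion X ∪ Z)) k1 (fun u hu v hv huv => ?_)
            (heavy_meet hw (k1.trans sdiff_subset) hs.K_sub k3 hs.heavy)
          by_contra hvK
          obtain ⟨i, hi, hvi⟩ := hs.nbr u hu v (mem_sdiff.1 hv).1 hvK huv
          exact (mem_sdiff.1 hv).2 (mem_union_left _ (mem_biUnion.2 ⟨i, hi, hvi⟩))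
        refine ⟨K', fun v hv => mem_sdiff.2 ⟨hsubK hv, fun hvZ =>
          (mem_sdiff.1 (k1 hv)).2 (mem_union_right _ hvZ)⟩, k2, k3, fun u hu v hv h1 h2 huv => ?_⟩
        exact k4 u hu v (mem_sdiff.2 ⟨hv, by simp only [mem_union, not_or]; exact ⟨h1, h2⟩⟩) huv
      rcases tree_or_cut (G := G) (K := K) I A hq with
        ⟨T, hTK, hTc, hTq, hTA⟩ | ⟨Z, hZK, hZq, hZcut⟩
      · obtain ⟨K', k1, k2, k3, k4⟩ := heavyComp T hTK hTq
        have hne : ∀ j ∈ I, j ≠ e := fun j hj h => he (h ▸ hj)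
        have hTtouch : ∀ j ∈ I, Touch G (C j) T := by
          intro j hj
          obtain ⟨v, hvT, hvA⟩ := not_disjoint_iff.1 (hTA j hj)
          obtain ⟨_, c, hc, hcv⟩ := mem_filter.1 hvA
          exact ⟨c, hc, v, hvT, hcv⟩
        have hTdisj : ∀ j ∈ I, Disjoint (C j) T := fun j hj => (hs.K_disj j hj).mono_right hTK
        have hlt : K'.card < K.card := by
          refine card_lt_card ⟨k1.trans sdiff_subset, fun h => ?_⟩
          obtain ⟨v, hv⟩ := hTc.1
          exact (mem_sdiff.1 (k1 (h (hTK hv)))).2 hv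
        refine ih (insert e I) (Function.update C e T) (Function.update X e T) K'
          ⟨?_, ?_, ?_, ?_, ?_, ?_, k1.trans (sdiff_subset.trans hs.K_sub), k2, k3, ?_, ?_⟩ ?_
        · intro j hj
          rcases mem_insert.1 hj with rfl | hj
          · simpa using hTc
          · simpa [Function.update_of_ne (hne j hj)] using hs.conn j hj
        · intro j hj
          rcases mem_insert.1 hj with rfl | hj
          · simpa using hTK.trans hs.K_sub
          · simpa [Function.update_of_ne (hne j hj)] using hs.sub j hj
        · intro j hj
          rcases mem_insert.1 hj with rfl | hj
          · simp
          · simpa [Function.update_of_ne (hne j hj)] using hs.X_sub j hj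
        · intro j hj
          rcases mem_insert.1 hj with rfl | hj
          · simpa using hTq
          · simpa [Function.update_of_ne (hne j hj)] using hs.X_card j hj
        · intro i hi j hj hij
          rcases mem_insert.1 hi with rfl | hi' <;> rcases mem_insert.1 hj with rfl | hj'
          · exact absurd rfl hij
          · simpa [Function.update_of_ne (hne j hj')] using (hTdisj j hj').symm
          · simpa [Function.update_of_ne (hne i hi')] using hTdisj i hi'
          · simpa [Function.update_of_ne (hne i hi'), Function.update_of_ne (hne j hj')]
              using hs.disj i hi' j hj' hij
        · intro i hi j hj hij
          rcases mem_insert.1 hi with rfl | hi' <;> rcases mem_insert.1 hj with rfl | hj'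
          · exact absurd rfl hij
          · simpa [Function.update_of_ne (hne j hj')] using (hTtouch j hj').symm
          · simpa [Function.update_of_ne (hne i hi')] using hTtouch i hi'
          · simpa [Function.update_of_ne (hne i hi'), Function.update_of_ne (hne j hj')]
              using hs.touch i hi' j hj' hij
        · intro j hj
          rcases mem_insert.1 hj with rfl | hj
          · simpa using disjoint_sdiff.mono_right k1
          · simpa [Function.update_of_ne (hne j hj)]
              using (hs.K_disj j hj).mono_right (k1.trans sdiff_subset)
        · intro u hu v hv hvK' huv
          by_cases hvT : v ∈ T
          · exact ⟨e, mem_insert_self _ _, by simpa using hvT⟩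
          · by_cases hvX : v ∈ I.biUnion X
            · obtain ⟨i, hi, hvi⟩ := mem_biUnion.1 hvX
              exact ⟨i, mem_insert_of_mem hi, by simpa [Function.update_of_ne (hne i hi)] using hvi⟩
            · exact absurd (k4 u hu v hv hvX hvT huv) hvK'
        · have : (insert e I).card ≤ 5 := by simpa using card_le_univ (insert e I)
          omega
      · have hZq' : Z.card ≤ q := by
          have h1 := card_le_card hs.K_sub
          have h2 : Z.card * q ≤ q * q := hZq.trans (by omega)
          exact le_of_mul_le_mul_right h2 (by omega)
        obtain ⟨K₂, k1, k2, k3, k4⟩ := heavyComp Z hZK hZq'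
        obtain ⟨i, hi, hiA⟩ := hZcut K₂ k1 k2
        have hK2K : K₂ ⊆ K := k1.trans sdiff_subset
        have hAsub : A i ⊆ K \ K₂ := fun v hv =>
          mem_sdiff.2 ⟨(mem_filter.1 hv).1, fun h => disjoint_left.1 hiA h hv⟩
        set E := reachSet G (K \ K₂) (A i) with hE
        have hEK : E ⊆ K := (reachSet_subset _ _).trans sdiff_subset
        have hAE : A i ⊆ E := subset_reachSet hAsub
        have hE2 : ∀ v ∈ E, v ∉ K₂ := fun v hv => (mem_sdiff.1 (reachSet_subset _ _ hv)).2
        have hAne : (A i).Nonempty := by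
          obtain ⟨c, hc, v, hv, hcv⟩ := hdrop i hi
          exact ⟨v, mem_filter.2 ⟨hv, c, hc, hcv⟩⟩
        have hCE : Conn G (C i ∪ E) := by
          obtain ⟨c, hc⟩ := (hs.conn i hi).1
          refine conn_of_center (c := c) (mem_union_left _ hc) fun v hv => ?_
          rcases mem_union.1 hv with hv | hv
          · exact reach_mono subset_union_left ((hs.conn i hi).2 c hc v hv)
          · obtain ⟨_, a, ha, haY, hr⟩ := mem_filter.1 hv
            obtain ⟨_, c', hc', hca⟩ := mem_filter.1 ha
            exact ((reach_mono subset_union_left ((hs.conn i hi).2 c hc c' hc')).tail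
              ⟨hca, mem_union_right _ (hAE ha)⟩).trans
              (reach_mono subset_union_right (reachSet_reach haY ha hr).1)
        let X' : Finset V := E.filter fun v => ∃ u ∈ K₂, G.Adj u v
        have hX'Z : X' ⊆ Z := by
          intro v hv
          obtain ⟨hvE, u, hu, huv⟩ := mem_filter.1 hv
          by_contra hvZ
          exact hE2 v hvE (k4 u hu v (hs.K_sub (hEK hvE))
            (fun h => disjoint_left.1 hXK h (hEK hvE)) hvZ huv)
        have hK2E : K₂ ⊆ K \ E := fun v hv => mem_sdiff.2 ⟨hK2K hv, fun h => hE2 v h hv⟩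
        have hKE : Conn G (K \ E) := by
          obtain ⟨c, hc⟩ := k2.1
          refine conn_of_center (c := c) (hK2E hc) fun v hv => ?_
          have hvK := (mem_sdiff.1 hv).1
          have hr := hs.K_conn.2 v hvK c (hK2K hc)
          suffices h : Relation.ReflTransGen (fun x y => G.Adj x y ∧ y ∈ K \ E) v c from
            (reach_symm hv h).2
          have gen : ∀ x, Relation.ReflTransGen (fun x y => G.Adj x y ∧ y ∈ K) x c → x ∈ K \ E →
              Relation.ReflTransGen (fun x y => G.Adj x y ∧ y ∈ K \ E) x c := by
            intro x hx
            induction hx using Relation.ReflTransGen.head_induction_on with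
            | refl => exact fun _ => .refl
            | @head a b h1 _ ih =>
              intro ha
              by_cases haK : a ∈ K₂
              · exact reach_mono hK2E (k2.2 a haK c hc)
              · by_cases hbE : b ∈ E
                · exact absurd (reachSet_closed hbE (mem_sdiff.2 ⟨(mem_sdiff.1 ha).1, haK⟩)
                    h1.1.symm) (mem_sdiff.1 ha).2
                · have hb := mem_sdiff.2 ⟨h1.2, hbE⟩
                  exact .head ⟨h1.1, hb⟩ (ih hb)
          exact gen v hr hv
        have hlt : (K \ E).card < K.card := by
          refine card_lt_card ⟨sdiff_subset, fun h => ?_⟩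
          obtain ⟨v, hv⟩ := hAne
          exact (mem_sdiff.1 (h (hEK (hAE hv)))).2 (hAE hv)
        refine ih I (Function.update C i (C i ∪ E)) (Function.update X i X') (K \ E)
          ⟨?_, ?_, ?_, ?_, ?_, ?_, sdiff_subset.trans hs.K_sub, hKE, ?_, ?_, ?_⟩ (by omega)
        · intro j hj
          by_cases hji : j = i
          · subst hji; simpa using hCE
          · simpa [Function.update_of_ne hji] using hs.conn j hj
        · intro j hj
          by_cases hji : j = i
          · subst hji; simpa using union_subset (hs.sub j hj) (hEK.trans hs.K_sub)
          · simpa [Function.update_of_ne hji] using hs.sub j hj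
        · intro j hj
          by_cases hji : j = i
          · subst hji; simpa using (filter_subset _ _).trans subset_union_right
          · simpa [Function.update_of_ne hji] using hs.X_sub j hj
        · intro j hj
          by_cases hji : j = i
          · subst hji; simpa using (card_le_card hX'Z).trans hZq'
          · simpa [Function.update_of_ne hji] using hs.X_card j hj
        · intro j hj l hl hjl
          by_cases hji : j = i
          · subst hji
            simp only [Function.update_self, Function.update_of_ne hjl.symm, disjoint_union_left]
            exact ⟨hs.disj j hj l hl hjl, ((hs.K_disj l hl).mono_right hEK).symm⟩
          · by_cases hli : l = i
            · subst hli
              simp only [Function.update_self, Function.update_of_ne hji, disjoint_union_right]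
              exact ⟨hs.disj j hj l hl hjl, (hs.K_disj j hj).mono_right hEK⟩
            · simpa [Function.update_of_ne hji, Function.update_of_ne hli] using hs.disj j hj l hl hjl
        · have hsub : ∀ j, C j ⊆ Function.update C i (C i ∪ E) j := by
            intro j
            by_cases hji : j = i
            · subst hji; simp
            · simp [Function.update_of_ne hji]
          exact fun j hj l hl hjl => (hs.touch j hj l hl hjl).mono (hsub j) (hsub l)
        · have := sum_le_sum_of_subset_of_nonneg (f := w) hK2E fun _ _ _ => hw _
          linarith
        · intro j hj
          by_cases hji : j = i
          · subst hji
            simp only [Function.update_self, disjoint_union_left]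
            exact ⟨(hs.K_disj j hj).mono_right sdiff_subset, disjoint_sdiff⟩
          · simpa [Function.update_of_ne hji] using (hs.K_disj j hj).mono_right sdiff_subset
        · intro u hu v hv hvK huv
          obtain ⟨huK, huE⟩ := mem_sdiff.1 hu
          by_cases hvE : v ∈ E
          · refine ⟨i, hi, ?_⟩
            simp only [Function.update_self]
            refine mem_filter.2 ⟨hvE, u, ?_, huv⟩
            by_contra hu2
            exact huE (reachSet_closed hvE (mem_sdiff.2 ⟨huK, hu2⟩) huv.symm)
          · have hvK' : v ∉ K := fun h => hvK (mem_sdiff.2 ⟨h, hvE⟩)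
            obtain ⟨j, hj, hvj⟩ := hs.nbr u huK v hv hvK' huv
            have hji : j ≠ i := by
              rintro rfl
              exact huE (hAE (mem_filter.2 ⟨huK, v, hs.X_sub j hj hvj, huv.symm⟩))
            exact ⟨j, hj, by simpa [Function.update_of_ne hji] using hvj⟩
  obtain ⟨K, k1, k2, k3, k4⟩ := comp ∅ (empty_subset _) (by simp)
  refine main _ ∅ (fun _ => ∅) (fun _ => ∅) K ⟨by simp, by simp, by simp, by simp, by simp, by simp,
    k1.trans sdiff_subset, k2, k3, by simp, fun u hu v hv hvK huv => ?_⟩ le_rfl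
  exact absurd (k4 u hu v (by simpa using hv) huv) hvK

lemma exists_max_card {U A : Finset V} {P : Finset V → Prop} (hA : A ⊆ U) (h : P A) :
    ∃ A, A ⊆ U ∧ P A ∧ ∀ B, B ⊆ U → P B → B.card ≤ A.card := by
  obtain ⟨B, hB, hmax⟩ := (U.powerset.filter P).exists_max_image card
    ⟨A, mem_filter.2 ⟨mem_powerset.2 hA, h⟩⟩
  rw [mem_filter, mem_powerset] at hB
  exact ⟨B, hB.1, hB.2, fun C hC hP => hmax C (mem_filter.2 ⟨mem_powerset.2 hC, hP⟩)⟩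

lemma exists_sides {U S : Finset V} {w : V → ℝ} (hw : ∀ v, 0 ≤ w v)
    (hS : ∀ K, K ⊆ U \ S → Conn G K → 2 * ∑ v ∈ K, w v ≤ ∑ v ∈ U, w v) :
    ∃ A B : Finset V, Disjoint A B ∧ A ∪ B = U \ S ∧ (∀ a ∈ A, ∀ b ∈ B, ¬ G.Adj a b) ∧
      3 * ∑ v ∈ A, w v ≤ 2 * ∑ v ∈ U, w v ∧ 3 * ∑ v ∈ B, w v ≤ 2 * ∑ v ∈ U, w v := by
  set W := ∑ v ∈ U, w v with hW
  have hWS : ∀ A, A ⊆ U \ S → ∑ v ∈ A, w v + ∑ v ∈ (U \ S) \ A, w v ≤ W := by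
    intro A hA
    rw [add_comm, sum_sdiff hA]
    exact sum_le_sum_of_subset_of_nonneg sdiff_subset fun _ _ _ => hw _
  have hW0 : 0 ≤ W := sum_nonneg fun _ _ => hw _
  have split : ∀ A, A ⊆ U \ S → (∀ a ∈ A, ∀ b ∈ U \ S, G.Adj a b → b ∈ A) →
      W ≤ 3 * ∑ v ∈ A, w v ∨ A = U \ S → 3 * ∑ v ∈ A, w v ≤ 2 * W →
      ∃ A B : Finset V, Disjoint A B ∧ A ∪ B = U \ S ∧ (∀ a ∈ A, ∀ b ∈ B, ¬ G.Adj a b) ∧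
      3 * ∑ v ∈ A, w v ≤ 2 * W ∧ 3 * ∑ v ∈ B, w v ≤ 2 * W := by
    intro A hA hcl h1 h2
    refine ⟨A, (U \ S) \ A, disjoint_sdiff, union_sdiff_of_subset hA, ?_, h2, ?_⟩
    · intro a ha b hb hab
      exact (mem_sdiff.1 hb).2 (hcl a ha b (mem_sdiff.1 hb).1 hab)
    · rcases h1 with h1 | rfl
      · have := hWS A hA
        linarith
      · simpa using hW0
  obtain ⟨A, hA, ⟨hcl, hA2⟩, hmax⟩ := exists_max_card (U := U \ S)
    (P := fun A => (∀ a ∈ A, ∀ b ∈ U \ S, G.Adj a b → b ∈ A) ∧ 3 * ∑ v ∈ A, w v ≤ 2 * W)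
    (A := ∅) (empty_subset _) ⟨by simp, by simpa using hW0⟩
  by_cases hA1 : W ≤ 3 * ∑ v ∈ A, w v ∨ A = U \ S
  · exact split A hA hcl hA1 hA2
  push Not at hA1
  obtain ⟨v, hv, hvA⟩ : ∃ v ∈ U \ S, v ∉ A := by
    by_contra! h
    exact hA1.2 (subset_antisymm hA h)
  obtain ⟨K, k1, k2, k3, k4⟩ := exists_component (conn_singleton (G := G) v)
    (singleton_subset_iff.2 hv)
  have hKv : v ∈ K := k1 (mem_singleton_self v)
  have hK2 := hS K k2 k3
  by_cases hu : 3 * ∑ v ∈ A ∪ K, w v ≤ 2 * W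
  · have := hmax (A ∪ K) (union_subset hA k2) ⟨?_, hu⟩
    · have hlt : A.card < (A ∪ K).card := card_lt_card
        ⟨subset_union_left, fun h => hvA (h (mem_union_right _ hKv))⟩
      omega
    · intro a ha b hb hab
      rcases mem_union.1 ha with ha | ha
      · exact mem_union_left _ (hcl a ha b hb hab)
      · exact mem_union_right _ (k4 a ha b hb hab)
  · have h1 : ∑ v ∈ A ∪ K, w v ≤ ∑ v ∈ A, w v + ∑ v ∈ K, w v := by
      rw [← sum_union_inter]
      have : 0 ≤ ∑ v ∈ A ∩ K, w v := sum_nonneg fun _ _ => hw _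
      linarith
    exact split K k2 k4 (.inl (by linarith)) (by linarith)

/-- **Separator theorem** for graphs without `K₅` minor. -/
theorem exists_balanced_separator {U : Finset V} (hU : MinorFree G U) {w : V → ℝ}
    (hw : ∀ v, 0 ≤ w v) :
    ∃ S A B : Finset V, S ⊆ U ∧ Disjoint A B ∧ A ∪ B = U \ S ∧
      (∀ a ∈ A, ∀ b ∈ B, ¬ G.Adj a b) ∧ (S.card : ℝ) ≤ 20 * √(U.card : ℝ) ∧
      3 * ∑ v ∈ A, w v ≤ 2 * ∑ v ∈ U, w v ∧ 3 * ∑ v ∈ B, w v ≤ 2 * ∑ v ∈ U, w v := by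
  rcases U.eq_empty_or_nonempty with rfl | hne
  · exact ⟨∅, ∅, ∅, by simp⟩
  have hU1 : (1 : ℝ) ≤ U.card := by exact_mod_cast hne.card_pos
  set q := ⌈√(6 * U.card : ℝ)⌉₊ with hq
  have hq0 : √(6 * U.card : ℝ) ≤ q := Nat.le_ceil _
  have hpos : 0 < √(6 * U.card : ℝ) := Real.sqrt_pos.2 (by positivity)
  have hq1 : 1 ≤ q := Nat.ceil_pos.2 hpos
  have hqq : 6 * U.card ≤ q * q := by
    have := Real.mul_self_sqrt (show (0 : ℝ) ≤ 6 * U.card by positivity)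
    have h2 : (6 * U.card : ℝ) ≤ q * q := by nlinarith
    exact_mod_cast h2
  have hqle : (q : ℝ) ≤ √(6 * U.card : ℝ) + 1 := (Nat.ceil_lt_add_one hpos.le).le
  obtain ⟨S, hSU, hSc, hS⟩ := exists_separator hU hw hq1 hqq
  obtain ⟨A, B, h1, h2, h3, h4⟩ := exists_sides hw hS
  refine ⟨S, A, B, hSU, h1, h2, h3, ?_, h4⟩
  have h5 : √(6 * U.card : ℝ) ≤ 3 * √(U.card : ℝ) := by
    rw [Real.sqrt_le_left (by positivity), mul_pow, Real.sq_sqrt (by positivity)]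
    linarith
  have h6 : 1 ≤ √(U.card : ℝ) := Real.one_le_sqrt.2 hU1
  have h7 : (S.card : ℝ) ≤ 5 * q := by exact_mod_cast hSc
  linarith

end Separator

section Planar

/-- The polyline through a list of points, by recursion. -/
def curve : List (ℝ × ℝ) → Set (ℝ × ℝ)
  | [] => ∅
  | [a] => {a}
  | a :: b :: t => segment ℝ a b ∪ curve (b :: t)

@[simp] lemma curve_singleton (a : ℝ × ℝ) : curve [a] = {a} := rfl
lemma curve_cons (a b : ℝ × ℝ) (t : List (ℝ × ℝ)) :
    curve (a :: b :: t) = segment ℝ a b ∪ curve (b :: t) := rfl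

lemma head_mem_curve (a : ℝ × ℝ) (t : List (ℝ × ℝ)) : a ∈ curve (a :: t) := by
  cases t with
  | nil => exact rfl
  | cons b t => exact .inl (left_mem_segment ℝ a b)

lemma getLast_mem_curve (a : ℝ × ℝ) (t : List (ℝ × ℝ)) :
    (a :: t).getLast (List.cons_ne_nil _ _) ∈ curve (a :: t) := by
  induction t generalizing a with
  | nil => exact rfl
  | cons b t ih => exact .inr (by simpa using ih b)

/-- The plane vector from `z` to `p`, as a complex number. -/
def toC (z p : ℝ × ℝ) : ℂ := ⟨p.1 - z.1, p.2 - z.2⟩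

lemma toC_ne_zero {z p : ℝ × ℝ} (h : z ≠ p) : toC z p ≠ 0 := by
  intro h0
  have h1 := congrArg Complex.re h0
  have h2 := congrArg Complex.im h0
  simp only [toC, Complex.zero_re, Complex.zero_im] at h1 h2
  exact h (Prod.ext (by linarith) (by linarith))

lemma toC_neg (z p : ℝ × ℝ) : toC p z = -toC z p := by
  apply Complex.ext <;> simp [toC]

/-- The oriented angle under which the segment from `r` to `s` is seen from `z`. -/
def view (z r s : ℝ × ℝ) : ℝ := Complex.arg (toC z s / toC z r)

/-- The total angle under which a polyline is seen from `z`. -/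
def viewList (z : ℝ × ℝ) : List (ℝ × ℝ) → ℝ
  | [] => 0
  | [_] => 0
  | a :: b :: t => view z a b + viewList z (b :: t)

lemma arg_div_of_re_pos {a b : ℂ} (ha : 0 < a.re) (hb : 0 < b.re) :
    Complex.arg (b / a) = Complex.arg b - Complex.arg a := by
  have ha' := abs_lt.1 (Complex.abs_arg_lt_pi_div_two_iff.2 (.inl ha))
  have hb' := abs_lt.1 (Complex.abs_arg_lt_pi_div_two_iff.2 (.inl hb))
  have ha0 : a ≠ 0 := fun h => by simp [h] at ha
  have hb0 : b ≠ 0 := fun h => by simp [h] at hb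
  have hinv : Complex.arg a⁻¹ = -Complex.arg a := by
    rw [Complex.arg_inv, if_neg]
    have := Real.pi_pos
    linarith [ha'.2]
  rw [div_eq_mul_inv, Complex.arg_mul hb0 (inv_ne_zero ha0), hinv]
  · ring
  · rw [hinv]
    constructor <;> linarith [ha'.1, ha'.2, hb'.1, hb'.2]

lemma view_segments {p q r s : ℝ × ℝ} (h : Disjoint (segment ℝ p q) (segment ℝ r s)) :
    view p r s + view s p q - view q r s - view r p q = 0 := by
  have hcomp : ∀ a b : ℝ × ℝ, IsCompact (segment ℝ a b) := fun a b => by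
    rw [segment_eq_image]
    exact isCompact_Icc.image (by fun_prop)
  obtain ⟨f, u, v, hf1, huv, hf2⟩ := geometric_hahn_banach_compact_closed
    (convex_segment p q) (hcomp p q) (convex_segment r s) (hcomp r s).isClosed h
  set w : ℂ := ⟨f (1, 0), -f (0, 1)⟩ with hw
  have hfe : ∀ z : ℝ × ℝ, f z = z.1 * f (1, 0) + z.2 * f (0, 1) := by
    intro z
    have : z = z.1 • ((1, 0) : ℝ × ℝ) + z.2 • ((0, 1) : ℝ × ℝ) := by ext <;> simp
    conv_lhs => rw [this]
    rw [map_add, map_smul, map_smul, smul_eq_mul, smul_eq_mul]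
  have hpos : ∀ x ∈ segment ℝ p q, ∀ y ∈ segment ℝ r s, 0 < (toC x y * w).re := by
    intro x hx y hy
    have h1 := hf1 x hx
    have h2 := hf2 y hy
    rw [hfe] at h1 h2
    simp only [toC, hw, Complex.mul_re]
    nlinarith
  have hp := left_mem_segment ℝ p q
  have hq := right_mem_segment ℝ p q
  have hr := left_mem_segment ℝ r s
  have hs := right_mem_segment ℝ r s
  have hw0 : w ≠ 0 := fun h0 => by simpa [h0] using hpos p hp r hr
  have e1 : ∀ x ∈ segment ℝ p q,
      view x r s = Complex.arg (toC x s * w) - Complex.arg (toC x r * w) := by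
    intro x hx
    rw [view, ← arg_div_of_re_pos (hpos x hx r hr) (hpos x hx s hs), mul_div_mul_right _ _ hw0]
  have e2 : ∀ y ∈ segment ℝ r s,
      view y p q = Complex.arg (toC q y * w) - Complex.arg (toC p y * w) := by
    intro y hy
    rw [view, ← arg_div_of_re_pos (hpos p hp y hy) (hpos q hq y hy), mul_div_mul_right _ _ hw0,
      toC_neg q y, toC_neg p y, neg_div_neg_eq]
  rw [e1 p hp, e1 q hq, e2 s hs, e2 r hr]
  ring

lemma viewList_segment {p q : ℝ × ℝ} (r : ℝ × ℝ) (t : List (ℝ × ℝ))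
    (h : Disjoint (segment ℝ p q) (curve (r :: t))) :
    viewList p (r :: t) + view ((r :: t).getLast (List.cons_ne_nil _ _)) p q
      - viewList q (r :: t) - view r p q = 0 := by
  induction t generalizing r with
  | nil => simp [viewList]
  | cons s t ih =>
    rw [curve_cons, Set.disjoint_union_right] at h
    have h1 := ih s h.2
    have h2 := view_segments h.1
    simp only [viewList, List.getLast_cons_cons]
    linarith

lemma viewList_curves (p : ℝ × ℝ) (l : List (ℝ × ℝ)) (r : ℝ × ℝ) (t : List (ℝ × ℝ))
    (h : Disjoint (curve (p :: l)) (curve (r :: t))) :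
    viewList p (r :: t) + viewList ((r :: t).getLast (List.cons_ne_nil _ _)) (p :: l)
      - viewList ((p :: l).getLast (List.cons_ne_nil _ _)) (r :: t) - viewList r (p :: l) = 0 := by
  induction l generalizing p with
  | nil => simp [viewList]
  | cons q l ih =>
    rw [curve_cons, Set.disjoint_union_left] at h
    have h1 := ih q h.2
    have h2 := viewList_segment r t h.1
    simp only [viewList, List.getLast_cons_cons] at h1 ⊢
    linarith

/-- The unit vector pointing from `z` to `p`. -/
def dir (z p : ℝ × ℝ) : ℂ := toC z p / ‖toC z p‖

lemma dir_ne_zero {z p : ℝ × ℝ} (h : z ≠ p) : dir z p ≠ 0 := by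
  have := toC_ne_zero h
  simp [dir, this]

lemma dir_neg (z p : ℝ × ℝ) : dir p z = -dir z p := by
  rw [dir, toC_neg, norm_neg, neg_div, dir]

lemma exp_view {z r s : ℝ × ℝ} (hr : z ≠ r) (hs : z ≠ s) :
    Complex.exp (view z r s * Complex.I) * dir z r = dir z s := by
  have h1 := toC_ne_zero hr
  have h2 := toC_ne_zero hs
  have h := Complex.norm_mul_exp_arg_mul_I (toC z s / toC z r)
  rw [norm_div] at h
  have n1 : (‖toC z r‖ : ℂ) ≠ 0 := by simpa using h1
  have n2 : (‖toC z s‖ : ℂ) ≠ 0 := by simpa using h2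
  push_cast at h
  simp only [view, dir]
  field_simp at h ⊢
  linear_combination h

lemma exp_viewList {z : ℝ × ℝ} (r : ℝ × ℝ) (t : List (ℝ × ℝ)) (h : z ∉ curve (r :: t)) :
    Complex.exp (viewList z (r :: t) * Complex.I) * dir z r =
      dir z ((r :: t).getLast (List.cons_ne_nil _ _)) := by
  induction t generalizing r with
  | nil => simp [viewList]
  | cons s t ih =>
    rw [curve_cons, Set.mem_union, not_or] at h
    have h1 := ih s h.2
    have hr : z ≠ r := fun e => h.1 (e ▸ left_mem_segment ℝ _ _)
    have hs : z ≠ s := fun e => h.1 (e ▸ right_mem_segment ℝ _ _)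
    simp only [viewList, List.getLast_cons_cons]
    rw [← h1, ← exp_view hr hs]
    push_cast
    rw [add_mul, Complex.exp_add]
    ring

/-- `a` and `b` are joined by a polyline inside `D`. -/
def Joined (D : Set (ℝ × ℝ)) (a b : ℝ × ℝ) : Prop :=
  ∃ t, (a :: t).getLast (List.cons_ne_nil _ _) = b ∧ curve (a :: t) ⊆ D

lemma curve_append (a : ℝ × ℝ) (t : List (ℝ × ℝ)) (b : ℝ × ℝ) (t' : List (ℝ × ℝ))
    (h : (a :: t).getLast (List.cons_ne_nil _ _) = b) :
    curve (a :: (t ++ t')) = curve (a :: t) ∪ curve (b :: t') := by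
  induction t generalizing a with
  | nil =>
    simp only [List.getLast_singleton] at h
    subst h
    simp only [List.nil_append, curve_singleton]
    exact (Set.union_eq_self_of_subset_left
      (Set.singleton_subset_iff.2 (head_mem_curve _ _))).symm
  | cons c t ih =>
    rw [List.getLast_cons_cons] at h
    rw [List.cons_append, curve_cons, ih c h, curve_cons, Set.union_assoc]

lemma getLast_append' (a : ℝ × ℝ) (t : List (ℝ × ℝ)) (b : ℝ × ℝ) (t' : List (ℝ × ℝ))
    (h : (a :: t).getLast (List.cons_ne_nil _ _) = b) :
    (a :: (t ++ t')).getLast (List.cons_ne_nil _ _) =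
      (b :: t').getLast (List.cons_ne_nil _ _) := by
  induction t generalizing a with
  | nil =>
    simp only [List.getLast_singleton] at h
    subst h
    rfl
  | cons c t ih =>
    rw [List.getLast_cons_cons] at h
    simp only [List.cons_append, List.getLast_cons_cons]
    exact ih c h

lemma Joined.trans {D : Set (ℝ × ℝ)} {a b c : ℝ × ℝ} (h1 : Joined D a b) (h2 : Joined D b c) :
    Joined D a c := by
  obtain ⟨t, ht, htD⟩ := h1
  obtain ⟨t', ht', htD'⟩ := h2
  refine ⟨t ++ t', ?_, ?_⟩
  · rw [getLast_append' a t b t' ht, ht']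
  · rw [curve_append a t b t' ht]
    exact Set.union_subset htD htD'

lemma Joined.mono {D D' : Set (ℝ × ℝ)} {a b : ℝ × ℝ} (h : Joined D a b) (hD : D ⊆ D') :
    Joined D' a b := by
  obtain ⟨t, ht, htD⟩ := h
  exact ⟨t, ht, htD.trans hD⟩

/-- `K₅` has no drawing in which independent edges are disjoint. -/
theorem not_drawn_K5 (c : Fin 5 → ℝ × ℝ) (D : Fin 5 → Fin 5 → Set (ℝ × ℝ))
    (hD : ∀ i j, i < j → Joined (D i j) (c i) (c j))
    (hdis : ∀ i j k l, i < j → k < l → i ≠ k → i ≠ l → j ≠ k → j ≠ l →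
      Disjoint (D i j) (D k l)) : False := by
  choose! t ht htD using hD
  let b : Fin 5 → Fin 5 → Fin 5 → ℝ := fun i k l => viewList (c i) (c k :: t k l)
  have rel : ∀ i j k l, i < j → k < l → i ≠ k → i ≠ l → j ≠ k → j ≠ l →
      b i k l + b l i j - b j k l - b k i j = 0 := by
    intro i j k l hij hkl h1 h2 h3 h4
    have := viewList_curves (c i) (t i j) (c k) (t k l)
      ((hdis i j k l hij hkl h1 h2 h3 h4).mono (htD i j hij) (htD k l hkl))
    rw [ht i j hij, ht k l hkl] at this
    exact this
  have off : ∀ i k l, k < l → i ≠ k → i ≠ l → c i ∉ curve (c k :: t k l) := by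
    intro i k l hkl hik hil hmem
    obtain ⟨j, hji, hjk, hjl⟩ : ∃ j, j ≠ i ∧ j ≠ k ∧ j ≠ l := by
      clear hmem; revert hkl hik hil; revert i k l; decide
    rcases lt_or_gt_of_ne hji with h | h
    · refine Set.disjoint_left.1 ((hdis j i k l h hkl hjk hjl hik hil).mono (htD _ _ h)
        (htD _ _ hkl)) ?_ hmem
      have := getLast_mem_curve (c j) (t j i)
      rwa [ht j i h] at this
    · exact Set.disjoint_left.1 ((hdis i j k l h hkl hik hil hjk hjl).mono (htD _ _ h)
        (htD _ _ hkl)) (head_mem_curve _ _) hmem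
  have eb : ∀ i k l, k < l → i ≠ k → i ≠ l →
      Complex.exp (b i k l * Complex.I) * dir (c i) (c k) = dir (c i) (c l) := by
    intro i k l hkl hik hil
    have := exp_viewList _ _ (off i k l hkl hik hil)
    rwa [ht k l hkl] at this
  have inj : ∀ i k, i ≠ k → c i ≠ c k := by
    intro i k hik h
    obtain ⟨l, hil, hkl⟩ : ∃ l, i ≠ l ∧ k ≠ l := by
      clear h; revert hik; revert i k; decide
    rcases lt_or_gt_of_ne hkl with hl | hl
    · exact off i k l hl hik hil (h ▸ head_mem_curve _ _)
    · refine off i l k hl hil hik ?_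
      have := getLast_mem_curve (c l) (t l k)
      rwa [ht l k hl, ← h] at this
  have r0123 := rel 0 1 2 3 (by decide) (by decide) (by decide) (by decide) (by decide) (by decide)
  have r0124 := rel 0 1 2 4 (by decide) (by decide) (by decide) (by decide) (by decide) (by decide)
  have r0134 := rel 0 1 3 4 (by decide) (by decide) (by decide) (by decide) (by decide) (by decide)
  have r0213 := rel 0 2 1 3 (by decide) (by decide) (by decide) (by decide) (by decide) (by decide)
  have r0214 := rel 0 2 1 4 (by decide) (by decide) (by decide) (by decide) (by decide) (by decide)
  have r0234 := rel 0 2 3 4 (by decide) (by decide) (by decide) (by decide) (by decide) (by decide)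
  have r0312 := rel 0 3 1 2 (by decide) (by decide) (by decide) (by decide) (by decide) (by decide)
  have r0314 := rel 0 3 1 4 (by decide) (by decide) (by decide) (by decide) (by decide) (by decide)
  have r0324 := rel 0 3 2 4 (by decide) (by decide) (by decide) (by decide) (by decide) (by decide)
  have r0412 := rel 0 4 1 2 (by decide) (by decide) (by decide) (by decide) (by decide) (by decide)
  have r0413 := rel 0 4 1 3 (by decide) (by decide) (by decide) (by decide) (by decide) (by decide)
  have r0423 := rel 0 4 2 3 (by decide) (by decide) (by decide) (by decide) (by decide) (by decide)
  have r1234 := rel 1 2 3 4 (by decide) (by decide) (by decide) (by decide) (by decide) (by decide)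
  have r1324 := rel 1 3 2 4 (by decide) (by decide) (by decide) (by decide) (by decide) (by decide)
  have r1423 := rel 1 4 2 3 (by decide) (by decide) (by decide) (by decide) (by decide) (by decide)
  have ht0 : b 4 0 1 + b 0 1 4 + b 2 0 4 = b 2 0 1 + b 2 1 4 + b 1 0 4 := by linarith
  have hexp : Complex.exp (b 4 0 1 * Complex.I) * Complex.exp (b 0 1 4 * Complex.I) *
      Complex.exp (b 2 0 4 * Complex.I) = Complex.exp (b 2 0 1 * Complex.I) *
      Complex.exp (b 2 1 4 * Complex.I) * Complex.exp (b 1 0 4 * Complex.I) := by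
    simp only [← Complex.exp_add, ← add_mul]
    exact_mod_cast congrArg (fun x : ℝ => Complex.exp (x * Complex.I)) ht0
  have e1 := eb 4 0 1 (by decide) (by decide) (by decide)
  have e2 := eb 0 1 4 (by decide) (by decide) (by decide)
  have e3 := eb 2 0 4 (by decide) (by decide) (by decide)
  have e4 := eb 2 0 1 (by decide) (by decide) (by decide)
  have e5 := eb 2 1 4 (by decide) (by decide) (by decide)
  have e6 := eb 1 0 4 (by decide) (by decide) (by decide)
  rw [dir_neg (c 0) (c 4), dir_neg (c 1) (c 4)] at e1
  rw [dir_neg (c 0) (c 1)] at e6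
  have n01 := dir_ne_zero (inj 0 1 (by decide))
  have n04 := dir_ne_zero (inj 0 4 (by decide))
  have n14 := dir_ne_zero (inj 1 4 (by decide))
  have n20 := dir_ne_zero (inj 2 0 (by decide))
  have n21 := dir_ne_zero (inj 2 1 (by decide))
  have n24 := dir_ne_zero (inj 2 4 (by decide))
  rw [← eq_div_iff (neg_ne_zero.2 n04)] at e1
  rw [← eq_div_iff n01] at e2
  rw [← eq_div_iff n20] at e3 e4
  rw [← eq_div_iff n21] at e5
  rw [← eq_div_iff (neg_ne_zero.2 n01)] at e6
  rw [e1, e2, e3, e4, e5, e6] at hexp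
  field_simp at hexp
  norm_num at hexp

/-- The graph `G` on `U` has a polyline drawing in which independent edges are disjoint. -/
def Drawn {V : Type*} (G : SimpleGraph V) (U : Finset V) : Prop :=
  ∃ (c : V → ℝ × ℝ) (D : V → V → Set (ℝ × ℝ)),
    (∀ v ∈ U, ∀ w ∈ U, G.Adj v w → Joined (D v w) (c v) (c w)) ∧
    ∀ v ∈ U, ∀ w ∈ U, ∀ x ∈ U, ∀ y ∈ U, G.Adj v w → G.Adj x y →
      v ≠ x → v ≠ y → w ≠ x → w ≠ y → Disjoint (D v w) (D x y)

theorem Drawn.minorFree {V : Type*} {G : SimpleGraph V} {U : Finset V} (h : Drawn G U) :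
    MinorFree G U := by
  obtain ⟨c, D, hD, hdis⟩ := h
  rintro ⟨C, hCU, hCc, hCd, hCt⟩
  choose z hz using fun i => (hCc i).1
  let E : Fin 5 → Fin 5 → Set (ℝ × ℝ) := fun i j =>
    {p | ∃ v ∈ C i ∪ C j, ∃ w ∈ C i ∪ C j, G.Adj v w ∧ p ∈ D v w}
  refine not_drawn_K5 (fun i => c (z i)) E ?_ ?_
  · intro i j hij
    obtain ⟨x, hx, y, hy, hxy⟩ := hCt i j hij.ne
    have step : ∀ v ∈ C i ∪ C j, ∀ w ∈ C i ∪ C j, G.Adj v w → Joined (E i j) (c v) (c w) := by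
      intro v hv w hw hvw
      have hU : C i ∪ C j ⊆ U := union_subset (hCU i) (hCU j)
      exact (hD v (hU hv) w (hU hw) hvw).mono fun p hp => ⟨v, hv, w, hw, hvw, hp⟩
    have walk : ∀ Y, Y ⊆ C i ∪ C j → Conn G Y → ∀ v ∈ Y, ∀ w ∈ Y,
        Relation.ReflTransGen (Joined (E i j)) (c v) (c w) := by
      intro Y hY hYc v hv w hw
      have := hYc.2 v hv w hw
      induction this with
      | refl => exact .refl
      | tail h1 h2 ih =>
        have hb := (reach_symm hv h1).1
        exact (ih hb).tail (step _ (hY hb) _ (hY h2.2) h2.1)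
    have h1 := walk _ subset_union_left (hCc i) (z i) (hz i) x hx
    have h2 := walk _ subset_union_right (hCc j) y hy (z j) (hz j)
    have h3 := step x (mem_union_left _ hx) y (mem_union_right _ hy) hxy
    have key : ∀ {a b : ℝ × ℝ}, Relation.ReflTransGen (Joined (E i j)) a b →
        a = b ∨ Joined (E i j) a b := by
      intro a b hab
      induction hab with
      | refl => exact .inl rfl
      | tail _ h ih =>
        rcases ih with rfl | ih
        · exact .inr h
        · exact .inr (ih.trans h)
    have h4 : Joined (E i j) (c (z i)) (c y) := by
      rcases key h1 with e | h
      · rw [e]; exact h3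
      · exact h.trans h3
    rcases key h2 with e | h
    · rw [← e]; exact h4
    · exact h4.trans h
  · intro i j k l hij hkl hik hil hjk hjl
    rw [Set.disjoint_left]
    rintro p ⟨v, hv, w, hw, hvw, hp⟩ ⟨x, hx, y, hy, hxy, hp'⟩
    have hne : ∀ a ∈ C i ∪ C j, ∀ b ∈ C k ∪ C l, a ≠ b := by
      rintro a ha _ hb rfl
      rcases mem_union.1 ha with ha | ha <;> rcases mem_union.1 hb with hb | hb
      · exact disjoint_left.1 (hCd i k hik) ha hb
      · exact disjoint_left.1 (hCd i l hil) ha hb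
      · exact disjoint_left.1 (hCd j k hjk) ha hb
      · exact disjoint_left.1 (hCd j l hjl) ha hb
    have hU1 : C i ∪ C j ⊆ U := union_subset (hCU i) (hCU j)
    have hU2 : C k ∪ C l ⊆ U := union_subset (hCU k) (hCU l)
    exact Set.disjoint_left.1 (hdis v (hU1 hv) w (hU1 hw) x (hU2 hx) y (hU2 hy) hvw hxy
      (hne v hv x hx) (hne v hv y hy) (hne w hw x hx) (hne w hw y hy)) hp hp'

end Planar

section Numeric

/-- The potential used in separator recursions. -/
def gPot (M : ℝ) : ℝ := 2 * M - M ^ (3 / 4 : ℝ)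

/-- The price of a root at scale `y`. -/
def ell (y : ℝ) : ℝ := 1 + 4 * Real.log y

lemma le_gPot {M : ℝ} (h : 1 ≤ M) : M ≤ gPot M := by
  have : M ^ (3 / 4 : ℝ) ≤ M ^ (1 : ℝ) := Real.rpow_le_rpow_of_exponent_le h (by norm_num)
  rw [Real.rpow_one] at this
  unfold gPot
  linarith

lemma gPot_le {M : ℝ} (h : 0 ≤ M) : gPot M ≤ 2 * M := by
  have : 0 ≤ M ^ (3 / 4 : ℝ) := Real.rpow_nonneg h _
  unfold gPot
  linarith

lemma natCast_le_gPot (n : ℕ) : (n : ℝ) ≤ gPot n := by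
  rcases Nat.eq_zero_or_pos n with rfl | h
  · simp [gPot]
  · exact le_gPot (by exact_mod_cast h)

lemma ell_add_one_le {x y : ℝ} (hx : 0 ≤ x) (hy : 4 / 3 ≤ y) (h : x ≤ 3 / 4 * y) :
    ell x + 1 ≤ ell y := by
  have h1 : 1 / 4 ≤ Real.log (4 / 3) := by
    have := Real.one_sub_inv_le_log_of_pos (show (0 : ℝ) < 4 / 3 by norm_num)
    norm_num at this ⊢
    linarith
  unfold ell
  rcases hx.eq_or_lt with rfl | hx
  · have := Real.log_le_log (by norm_num) hy
    rw [Real.log_zero]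
    linarith
  · have h2 := Real.log_le_log (mul_pos (by norm_num : (0 : ℝ) < 4 / 3) hx)
      (show 4 / 3 * x ≤ y by linarith)
    rw [Real.log_mul (by norm_num) hx.ne'] at h2
    linarith

lemma one_le_ell_natCast (n : ℕ) : 1 ≤ ell n := by
  have := Real.log_natCast_nonneg n
  unfold ell
  linarith

lemma one_le_ell {y : ℝ} (hy : 1 ≤ y) : 1 ≤ ell y := by
  have := Real.log_nonneg hy
  unfold ell
  linarith

lemma gPot_split (C : ℝ) : ∃ M₀ : ℝ, ∀ M M₁ M₂ : ℝ, M₀ ≤ M → 0 ≤ M₁ → 0 ≤ M₂ →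
    M₁ ≤ 3 / 4 * M → M₂ ≤ 3 / 4 * M → M ≤ M₁ + M₂ → M₁ + M₂ ≤ M + C * √M →
    gPot M₁ + gPot M₂ + C * M ^ (5 / 8 : ℝ) ≤ gPot M := by
  obtain ⟨δ, hδ, hδ4⟩ : ∃ δ : ℝ, 0 < δ ∧ (1 + δ) ≤ (3 / 4 : ℝ) ^ (-(1 / 4) : ℝ) := by
    refine ⟨(3 / 4 : ℝ) ^ (-(1 / 4) : ℝ) - 1, ?_, by linarith⟩
    have := Real.one_lt_rpow_of_pos_of_lt_one_of_neg (x := (3 / 4 : ℝ)) (z := -(1 / 4))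
      (by norm_num) (by norm_num) (by norm_num)
    linarith
  refine ⟨max 1 ((3 * |C| / δ) ^ (8 : ℝ)), fun M M₁ M₂ hM h1 h2 h3 h4 h5 h6 => ?_⟩
  have hM1 : 1 ≤ M := (le_max_left _ _).trans hM
  have hM0 : 0 < M := by linarith
  have hM8 : 3 * |C| / δ ≤ M ^ (1 / 8 : ℝ) := by
    have h := Real.rpow_le_rpow (by positivity) ((le_max_right _ _).trans hM)
      (show (0 : ℝ) ≤ 1 / 8 by norm_num)
    rw [← Real.rpow_mul (by positivity)] at h
    norm_num at h ⊢
    exact h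
  have low : ∀ x, 0 ≤ x → x ≤ 3 / 4 * M → x * (3 / 4 * M) ^ (-(1 / 4) : ℝ) ≤ x ^ (3 / 4 : ℝ) := by
    intro x hx hxM
    rcases hx.eq_or_lt with rfl | hx
    · simp
    · have e : x ^ (3 / 4 : ℝ) = x * x ^ (-(1 / 4) : ℝ) := by
        rw [show (3 / 4 : ℝ) = 1 + -(1 / 4) by norm_num, Real.rpow_add hx, Real.rpow_one]
      rw [e]
      exact mul_le_mul_of_nonneg_left
        (Real.rpow_le_rpow_of_nonpos hx hxM (by norm_num)) hx.le
  have e34 : M * (3 / 4 * M) ^ (-(1 / 4) : ℝ) = (3 / 4 : ℝ) ^ (-(1 / 4) : ℝ) * M ^ (3 / 4 : ℝ) := by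
    rw [Real.mul_rpow (by norm_num) hM0.le, show (3 / 4 : ℝ) = 1 + -(1 / 4) by norm_num,
      Real.rpow_add hM0, Real.rpow_one]
    ring
  have hp : 0 ≤ (3 / 4 * M) ^ (-(1 / 4) : ℝ) := Real.rpow_nonneg (by positivity) _
  have hsum : (1 + δ) * M ^ (3 / 4 : ℝ) ≤ M₁ ^ (3 / 4 : ℝ) + M₂ ^ (3 / 4 : ℝ) := by
    have := low M₁ h1 h3
    have := low M₂ h2 h4
    have : (1 + δ) * M ^ (3 / 4 : ℝ) ≤ (3 / 4 : ℝ) ^ (-(1 / 4) : ℝ) * M ^ (3 / 4 : ℝ) :=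
      mul_le_mul_of_nonneg_right hδ4 (Real.rpow_nonneg hM0.le _)
    have := mul_le_mul_of_nonneg_right h5 hp
    linarith
  have hs : √M ≤ M ^ (5 / 8 : ℝ) := by
    rw [Real.sqrt_eq_rpow]
    exact Real.rpow_le_rpow_of_exponent_le hM1 (by norm_num)
  have e58 : M ^ (5 / 8 : ℝ) * M ^ (1 / 8 : ℝ) = M ^ (3 / 4 : ℝ) := by
    rw [← Real.rpow_add hM0]
    norm_num
  have h58 : 0 ≤ M ^ (5 / 8 : ℝ) := Real.rpow_nonneg hM0.le _
  have hfin : 3 * |C| * M ^ (5 / 8 : ℝ) ≤ δ * M ^ (3 / 4 : ℝ) := by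
    rw [div_le_iff₀ hδ] at hM8
    rw [← e58]
    nlinarith
  have hC : C ≤ |C| := le_abs_self C
  have a1 : C * √M ≤ |C| * M ^ (5 / 8 : ℝ) :=
    (mul_le_mul_of_nonneg_right hC (Real.sqrt_nonneg M)).trans
      (mul_le_mul_of_nonneg_left hs (abs_nonneg C))
  have a2 : C * M ^ (5 / 8 : ℝ) ≤ |C| * M ^ (5 / 8 : ℝ) := mul_le_mul_of_nonneg_right hC h58
  unfold gPot
  linarith

lemma log_add_one_le {M : ℝ} (h : 1 ≤ M) : Real.log (M + 1) ≤ 16 * M ^ (1 / 8 : ℝ) := by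
  have h1 : M + 1 ≤ 2 * M := by linarith
  have h2 := Real.log_le_log (by linarith) h1
  rw [Real.log_mul (by norm_num) (by linarith)] at h2
  have h3 := Real.log_le_rpow_div (show (0 : ℝ) ≤ M by linarith) (show (0 : ℝ) < 1 / 8 by norm_num)
  have h4 : Real.log 2 ≤ 1 := by
    have := Real.log_two_lt_d9
    linarith
  have h5 : 1 ≤ M ^ (1 / 8 : ℝ) := Real.one_le_rpow h (by norm_num)
  have h6 : Real.log M ≤ 8 * M ^ (1 / 8 : ℝ) := by linarith
  linarith

lemma sqrt_mul_rpow {M : ℝ} (h : 0 < M) : √M * M ^ (1 / 8 : ℝ) = M ^ (5 / 8 : ℝ) := by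
  rw [Real.sqrt_eq_rpow, ← Real.rpow_add h]
  norm_num

lemma one_le_rpow_five_eighths {M : ℝ} (h : 1 ≤ M) : √M ≤ M ^ (5 / 8 : ℝ) := by
  rw [Real.sqrt_eq_rpow]
  exact Real.rpow_le_rpow_of_exponent_le h (by norm_num)

/-- A set of size `n` has at most `(n + 1) ^ s` subsets of size at most `s`. -/
lemma card_small_subsets {α : Type*} (U : Finset α) (s : ℕ) :
    (U.powerset.filter fun S => S.card ≤ s).card ≤ (U.card + 1) ^ s := by
  calc (U.powerset.filter fun S => S.card ≤ s).card
      ≤ ((range (s + 1)).biUnion fun i => U.powersetCard i).card := by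
        refine card_le_card fun S hS => ?_
        rw [mem_filter, mem_powerset] at hS
        exact mem_biUnion.2 ⟨S.card, mem_range.2 (by omega), mem_powersetCard.2 ⟨hS.1, rfl⟩⟩
    _ ≤ ∑ i ∈ range (s + 1), U.card.choose i := by
        refine card_biUnion_le.trans (le_of_eq ?_)
        simp
    _ ≤ ∑ i ∈ range (s + 1), U.card ^ i * 1 ^ (s - i) * s.choose i := by
        refine sum_le_sum fun i hi => ?_
        have h2 : 1 ≤ s.choose i := Nat.choose_pos (by have := mem_range.1 hi; omega)
        rw [one_pow, mul_one]
        calc U.card.choose i ≤ U.card ^ i := Nat.choose_le_pow _ _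
          _ ≤ U.card ^ i * s.choose i := Nat.le_mul_of_pos_right _ h2
    _ = (U.card + 1) ^ s := (add_pow _ _ _).symm

end Numeric

section GraphCount
variable {V : Type*}

lemma Conn.mono_graph {G H : SimpleGraph V} {Y : Finset V} (h : Conn G Y)
    (hGH : ∀ u ∈ Y, ∀ v ∈ Y, G.Adj u v → H.Adj u v) : Conn H Y := by
  refine ⟨h.1, fun a ha b hb => ?_⟩
  have := h.2 a ha b hb
  induction this with
  | refl => exact .refl
  | tail h1 h2 ih =>
    have hm := (reach_symm ha h1).1
    exact (ih hm).tail ⟨hGH _ hm _ h2.2 h2.1, h2.2⟩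

lemma MinorFree.anti_graph {G H : SimpleGraph V} {U : Finset V} (h : MinorFree G U)
    (hGH : ∀ u ∈ U, ∀ v ∈ U, H.Adj u v → G.Adj u v) : MinorFree H U := by
  rintro ⟨C, h1, h2, h3, h4⟩
  refine h ⟨C, h1, fun i => (h2 i).mono_graph fun u hu v hv => hGH u (h1 i hu) v (h1 i hv), h3,
    fun i j hij => ?_⟩
  obtain ⟨a, ha, b, hb, hab⟩ := h4 i j hij
  exact ⟨a, ha, b, hb, hGH a (h1 i ha) b (h1 j hb) hab⟩

lemma exists_cut_classical {G : SimpleGraph V} {U : Finset V} (hU : MinorFree G U)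
    (hM : (240 : ℝ) ^ 2 ≤ U.card) :
    ∃ S A B : Finset V, S ⊆ U ∧ Disjoint A B ∧ A ∪ B = U \ S ∧
      (∀ a ∈ A, ∀ b ∈ B, ¬ G.Adj a b) ∧ (S.card : ℝ) ≤ 20 * √(U.card : ℝ) ∧
      ((A ∪ S).card : ℝ) ≤ 3 / 4 * U.card ∧ ((B ∪ S).card : ℝ) ≤ 3 / 4 * U.card ∧
      (U.card : ℝ) ≤ (A ∪ S).card + (B ∪ S).card ∧
      ((A ∪ S).card + (B ∪ S).card : ℝ) ≤ U.card + 20 * √(U.card : ℝ) := by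
  obtain ⟨S, A, B, h1, h2, h3, h4, h5, h6, h7⟩ :=
    exists_balanced_separator hU (w := fun _ => 1) (fun _ => zero_le_one)
  simp only [sum_const, nsmul_eq_mul, mul_one] at h6 h7
  have h8 : A.card + B.card = (U \ S).card := by rw [← h3, card_union_of_disjoint h2]
  have h9 : (U \ S).card + S.card = U.card := card_sdiff_add_card_eq_card h1
  have hA : ((A ∪ S).card : ℝ) = A.card + S.card := by
    rw [card_union_of_disjoint]
    · push_cast; rfl
    · exact disjoint_sdiff_self_left.mono_left (h3 ▸ subset_union_left : A ⊆ U \ S)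
  have hB : ((B ∪ S).card : ℝ) = B.card + S.card := by
    rw [card_union_of_disjoint]
    · push_cast; rfl
    · exact disjoint_sdiff_self_left.mono_left (h3 ▸ subset_union_right : B ⊆ U \ S)
  have h8' : (A.card : ℝ) + B.card + S.card = U.card := by exact_mod_cast (by omega)
  have hs0 : 240 ≤ √(U.card : ℝ) := Real.le_sqrt_of_sq_le hM
  have hs1 := Real.mul_self_sqrt (Nat.cast_nonneg (α := ℝ) U.card)
  have hS0 : (0 : ℝ) ≤ S.card := Nat.cast_nonneg _
  refine ⟨S, A, B, h1, h2, h3, h4, h5, ?_, ?_, ?_, ?_⟩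
  · rw [hA]; nlinarith
  · rw [hB]; nlinarith
  · rw [hA, hB]; linarith
  · rw [hA, hB]; linarith

/-- Large vertex sets of graphs without `K₅` minor have balanced cuts. -/
lemma exists_cut [inst : DecidableEq V] {G : SimpleGraph V} {U : Finset V} (hU : MinorFree G U)
    (hM : (240 : ℝ) ^ 2 ≤ U.card) :
    ∃ S A B : Finset V, S ⊆ U ∧ Disjoint A B ∧ A ∪ B = U \ S ∧
      (∀ a ∈ A, ∀ b ∈ B, ¬ G.Adj a b) ∧ (S.card : ℝ) ≤ 20 * √(U.card : ℝ) ∧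
      ((A ∪ S).card : ℝ) ≤ 3 / 4 * U.card ∧ ((B ∪ S).card : ℝ) ≤ 3 / 4 * U.card ∧
      (U.card : ℝ) ≤ (A ∪ S).card + (B ∪ S).card ∧
      ((A ∪ S).card + (B ∪ S).card : ℝ) ≤ U.card + 20 * √(U.card : ℝ) := by
  obtain rfl : inst = fun _ _ => Classical.propDecidable _ := Subsingleton.elim _ _
  exact exists_cut_classical hU hM

/-- Graphs without `K₅` minor have linearly many edges. -/
theorem exists_edge_bound : ∃ C : ℝ, 0 ≤ C ∧ ∀ (V : Type) (G : SimpleGraph V) (U : Finset V),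
    MinorFree G U → (((U ×ˢ U).filter fun e => G.Adj e.1 e.2).card : ℝ) ≤ C * U.card := by
  obtain ⟨M₀, hM₀⟩ := gPot_split 20
  set a : ℝ := max (max M₀ (240 ^ 2)) 1 with ha
  have ha1 : 1 ≤ a := le_max_right _ _
  suffices h : ∀ (V : Type) (G : SimpleGraph V) (n : ℕ) (U : Finset V), U.card = n →
      MinorFree G U → (((U ×ˢ U).filter fun e => G.Adj e.1 e.2).card : ℝ) ≤ a * gPot U.card by
    refine ⟨a * 2, by positivity, fun V G U hU => (h V G _ U rfl hU).trans ?_⟩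
    have := gPot_le (Nat.cast_nonneg (α := ℝ) U.card)
    nlinarith
  intro V G n
  induction n using Nat.strong_induction_on with
  | _ n ih =>
  intro U hn hU
  by_cases hsmall : (U.card : ℝ) < max M₀ (240 ^ 2)
  · have h1 : (((U ×ˢ U).filter fun e => G.Adj e.1 e.2).card : ℝ) ≤ U.card * U.card := by
      exact_mod_cast (card_filter_le _ _).trans (card_product _ _).le
    have h2 := natCast_le_gPot U.card
    have h3 : (U.card : ℝ) ≤ a := hsmall.le.trans (le_max_left _ _)
    have h4 : (0 : ℝ) ≤ U.card := Nat.cast_nonneg _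
    nlinarith
  push Not at hsmall
  obtain ⟨S, A, B, h1, h2, h3, h4, h5, h6, h7, h8, h9⟩ :=
    exists_cut hU ((le_max_right _ _).trans hsmall)
  have hUpos : (0 : ℝ) < U.card := lt_of_lt_of_le (by norm_num) ((le_max_right _ _).trans hsmall)
  have hlt : ∀ W : Finset V, (W.card : ℝ) ≤ 3 / 4 * U.card → W.card < n := fun W hW => by
    have : (W.card : ℝ) < U.card := by linarith
    rw [← hn]; exact_mod_cast this
  have hAU : A ∪ S ⊆ U := union_subset
    ((subset_union_left.trans h3.subset).trans sdiff_subset) h1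
  have hBU : B ∪ S ⊆ U := union_subset
    ((subset_union_right.trans h3.subset).trans sdiff_subset) h1
  have i1 := ih _ (hlt _ h6) (A ∪ S) rfl (hU.mono hAU)
  have i2 := ih _ (hlt _ h7) (B ∪ S) rfl (hU.mono hBU)
  have hsub : ((U ×ˢ U).filter fun e => G.Adj e.1 e.2) ⊆
      (((A ∪ S) ×ˢ (A ∪ S)).filter fun e => G.Adj e.1 e.2) ∪
      (((B ∪ S) ×ˢ (B ∪ S)).filter fun e => G.Adj e.1 e.2) := by
    rintro ⟨u, v⟩ huv
    simp only [mem_filter, mem_product, mem_union] at huv ⊢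
    have cls : ∀ x ∈ U, x ∈ A ∨ x ∈ B ∨ x ∈ S := by
      intro x hx
      by_cases hxS : x ∈ S
      · exact .inr (.inr hxS)
      · have : x ∈ A ∪ B := h3 ▸ mem_sdiff.2 ⟨hx, hxS⟩
        rcases mem_union.1 this with h | h
        · exact .inl h
        · exact .inr (.inl h)
    have n1 := h4 u
    have n2 := h4 v
    have n3 := huv.2.symm
    rcases cls u huv.1.1 with h | h | h <;> rcases cls v huv.1.2 with h' | h' | h' <;>
      first
      | exact absurd huv.2 (n1 h v h')
      | exact absurd n3 (n2 h' u h)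
      | simp [h, h', huv.2]
  have h10 : (((U ×ˢ U).filter fun e => G.Adj e.1 e.2).card : ℝ) ≤
      ((((A ∪ S) ×ˢ (A ∪ S)).filter fun e => G.Adj e.1 e.2).card : ℝ) +
      ((((B ∪ S) ×ˢ (B ∪ S)).filter fun e => G.Adj e.1 e.2).card : ℝ) := by
    exact_mod_cast (card_le_card hsub).trans (card_union_le _ _)
  have h11 := hM₀ U.card (A ∪ S).card (B ∪ S).card ((le_max_left _ _).trans hsmall)
    (Nat.cast_nonneg _) (Nat.cast_nonneg _) h6 h7 h8 h9
  have h12 : (0 : ℝ) ≤ (U.card : ℝ) ^ (5 / 8 : ℝ) := Real.rpow_nonneg hUpos.le _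
  nlinarith

/-- The vertices of `U` whose parent is missing. -/
def roots {m : ℕ} (p : Fin m → Fin m) (U : Finset (Fin m)) : Finset (Fin m) :=
  U.filter fun t => p t = t ∨ p t ∉ U

lemma card_roots_sdiff {m c : ℕ} {p : Fin m → Fin m}
    (hc : ∀ s, (univ.filter fun t => p t = s ∧ t ≠ s).card ≤ c) (U H : Finset (Fin m)) :
    (roots p (U \ H)).card ≤ (roots p U).card + c * H.card := by
  have hsub : roots p (U \ H) ⊆
      roots p U ∪ H.biUnion fun s => univ.filter fun t => p t = s ∧ t ≠ s := by
    intro t ht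
    simp only [roots, mem_filter, mem_sdiff, mem_union, mem_biUnion, mem_univ, true_and] at ht ⊢
    obtain ⟨⟨htU, htH⟩, h⟩ := ht
    by_cases hpt : p t = t
    · exact .inl ⟨htU, .inl hpt⟩
    · by_cases hpU : p t ∈ U
      · right
        have : p t ∈ H := by
          by_contra hH
          exact (h.resolve_left hpt) ⟨hpU, hH⟩
        exact ⟨p t, this, rfl, fun h => hpt h.symm⟩
      · exact .inl ⟨htU, .inr hpU⟩
  refine (card_le_card hsub).trans ((card_union_le _ _).trans (Nat.add_le_add_left ?_ _))
  refine card_biUnion_le.trans ((sum_le_card_nsmul _ _ c fun s _ => hc s).trans ?_)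
  rw [smul_eq_mul, mul_comm]

/-- A set closed under parents and children inside `W` is determined by its roots. -/
lemma card_consistent {m : ℕ} {p : Fin m → Fin m} (hp : ∀ t, p t ≤ t) (W : Finset (Fin m)) :
    (W.powerset.filter fun A => ∀ t ∈ W, p t ∈ W → (t ∈ A ↔ p t ∈ A)).card ≤
      2 ^ (roots p W).card := by
  rw [← card_powerset]
  refine card_le_card_of_injOn (fun A => A ∩ roots p W)
    (fun A _ => mem_powerset.2 inter_subset_right) ?_
  intro A hA B hB hAB
  simp only [coe_filter, Set.mem_ofPred_eq, mem_powerset] at hA hB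
  have key : ∀ t, t ∈ W → (t ∈ A ↔ t ∈ B) := by
    intro t
    induction t using WellFoundedLT.induction with
    | _ t ih =>
    intro ht
    by_cases hr : t ∈ roots p W
    · have := congrArg (fun X => t ∈ X) hAB
      simpa [hr] using this
    · simp only [roots, mem_filter, not_and, not_or, not_not] at hr
      obtain ⟨h1, h2⟩ := hr ht
      rw [hA.2 t ht h2, hB.2 t ht h2]
      exact ih _ (lt_of_le_of_ne (hp t) h1) h2
  ext t
  constructor
  · exact fun h => (key t (hA.1 h)).1 h
  · exact fun h => (key t (hB.1 h)).2 h

lemma card_roots_sides {m : ℕ} {p : Fin m → Fin m} {U S A B : Finset (Fin m)}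
    (hd : Disjoint A B) (hAB : A ∪ B = U \ S)
    (hcons : ∀ t ∈ U \ S, p t ∈ U \ S → (t ∈ A ↔ p t ∈ A)) :
    (roots p (A ∪ S)).card + (roots p (B ∪ S)).card ≤ (roots p U).card + 2 * S.card := by
  have hmem : ∀ t ∈ U, t ∉ S → t ∈ A ∨ t ∈ B := fun t ht hS =>
    mem_union.1 (hAB ▸ mem_sdiff.2 ⟨ht, hS⟩)
  have hA : A ⊆ U \ S := hAB ▸ subset_union_left
  have hB : B ⊆ U \ S := hAB ▸ subset_union_right
  have e1 : roots p (A ∪ S) ⊆ (roots p U ∩ A) ∪ S := by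
    intro t ht
    simp only [roots, mem_filter, mem_union, mem_inter, not_or] at ht ⊢
    obtain ⟨h | h, h2⟩ := ht
    · left
      refine ⟨⟨(mem_sdiff.1 (hA h)).1, ?_⟩, h⟩
      rcases h2 with h2 | ⟨h2, h3⟩
      · exact .inl h2
      · right
        intro hU
        exact h2 ((hcons t (hA h) (mem_sdiff.2 ⟨hU, h3⟩)).1 h)
    · exact .inr h
  have e2 : roots p (B ∪ S) ⊆ (roots p U ∩ B) ∪ S := by
    intro t ht
    simp only [roots, mem_filter, mem_union, mem_inter, not_or] at ht ⊢
    obtain ⟨h | h, h2⟩ := ht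
    · left
      refine ⟨⟨(mem_sdiff.1 (hB h)).1, ?_⟩, h⟩
      rcases h2 with h2 | ⟨h2, h3⟩
      · exact .inl h2
      · right
        intro hU
        rcases hmem _ hU h3 with hA' | hB'
        · exact disjoint_left.1 hd ((hcons t (hB h) (mem_sdiff.2 ⟨hU, h3⟩)).2 hA') h
        · exact h2 hB'
    · exact .inr h
  have c1 := (card_le_card e1).trans (card_union_le _ _)
  have c2 := (card_le_card e2).trans (card_union_le _ _)
  have c3 : (roots p U ∩ A).card + (roots p U ∩ B).card ≤ (roots p U).card := by
    rw [← card_union_of_disjoint (hd.mono inter_subset_right inter_subset_right)]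
    exact card_le_card (union_subset inter_subset_left inter_subset_left)
  omega

/-- The graphs on `U` without `K₅` minor containing all edges from vertices to their parents. -/
def minorFreeGraphs {m : ℕ} (p : Fin m → Fin m) (U : Finset (Fin m)) :
    Finset (SimpleGraph (Fin m)) :=
  univ.filter fun Q => (∀ u v, Q.Adj u v → u ∈ U ∧ v ∈ U) ∧ MinorFree Q U ∧
    ∀ t ∈ U, p t ∈ U → p t ≠ t → Q.Adj t (p t)

/-- The restriction of a graph to a finite set of vertices. -/
def restrict (Q : SimpleGraph V) (W : Finset V) : SimpleGraph V where
  Adj u v := Q.Adj u v ∧ u ∈ W ∧ v ∈ W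
  symm := ⟨fun _ _ h => ⟨h.1.symm, h.2.2, h.2.1⟩⟩
  loopless := ⟨fun _ h => h.1.ne rfl⟩

lemma restrict_mem {m : ℕ} {p : Fin m → Fin m} {U W : Finset (Fin m)} {Q : SimpleGraph (Fin m)}
    (hQ : Q ∈ minorFreeGraphs p U) (hW : W ⊆ U) : restrict Q W ∈ minorFreeGraphs p W := by
  obtain ⟨_, h1, h2, h3⟩ := mem_filter.1 hQ
  exact mem_filter.2 ⟨mem_univ _, fun u v h => h.2, (h2.mono hW).anti_graph fun _ _ _ _ h => h.1,
    fun t ht hpt hne => ⟨h3 t (hW ht) (hW hpt) hne, ht, hpt⟩⟩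

lemma card_minorFreeGraphs_le_pow {m : ℕ} (p : Fin m → Fin m) (U : Finset (Fin m)) :
    (minorFreeGraphs p U).card ≤ 2 ^ (U.card * U.card) := by
  rw [← card_product, ← card_powerset]
  refine card_le_card_of_injOn (fun Q => (U ×ˢ U).filter fun e => Q.Adj e.1 e.2)
    (fun Q _ => mem_powerset.2 (filter_subset _ _)) ?_
  intro Q hQ Q' hQ' h
  have hQ := (mem_filter.1 hQ).2.1
  have hQ' := (mem_filter.1 hQ').2.1
  ext u v
  have := congrArg (fun X => (u, v) ∈ X) h
  simp only [mem_filter, mem_product, eq_iff_iff] at this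
  constructor
  · exact fun h => (this.1 ⟨hQ u v h, h⟩).2
  · exact fun h => (this.2 ⟨hQ' u v h, h⟩).2

end GraphCount

section GraphCount

lemma two_pow_le_exp (r : ℕ) : (2 : ℝ) ^ r ≤ Real.exp r := by
  have h2 : (2 : ℝ) ≤ Real.exp 1 := by
    have := Real.add_one_le_exp (1 : ℝ)
    linarith
  calc (2 : ℝ) ^ r ≤ Real.exp 1 ^ r := by gcongr
    _ = Real.exp r := by rw [← Real.exp_nat_mul, mul_one]

/-- Exponentially many graphs without `K₅` minor contain a given tree of bounded degree. -/
theorem exists_graph_count (c : ℕ) : ∃ a : ℝ, 0 ≤ a ∧ ∀ (m : ℕ) (p : Fin m → Fin m),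
    (∀ t, p t ≤ t) → (∀ s, (univ.filter fun t => p t = s ∧ t ≠ s).card ≤ c) →
    ∀ U : Finset (Fin m), ((minorFreeGraphs p U).card : ℝ) ≤
      Real.exp (a * gPot U.card + (roots p U).card * ell U.card) := by
  obtain ⟨M₀, hM₀⟩ := gPot_split (20 * (146 + c))
  set a : ℝ := max (max M₀ (240 ^ 2)) 1 with ha
  have ha1 : 1 ≤ a := le_max_right _ _
  refine ⟨a, by positivity, fun m p hp hc => ?_⟩
  suffices h : ∀ n, ∀ U : Finset (Fin m), U.card = n → ((minorFreeGraphs p U).card : ℝ) ≤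
      Real.exp (a * gPot U.card + (roots p U).card * ell U.card) from fun U => h _ U rfl
  intro n
  induction n using Nat.strong_induction_on with
  | _ n ih =>
  intro U hn
  have hell0 : ∀ j : ℕ, 0 ≤ ell j := fun j => zero_le_one.trans (one_le_ell_natCast j)
  by_cases hsmall : (U.card : ℝ) < max M₀ (240 ^ 2)
  · have h1 : ((minorFreeGraphs p U).card : ℝ) ≤ 2 ^ (U.card * U.card) := by
      exact_mod_cast card_minorFreeGraphs_le_pow p U
    refine h1.trans ((two_pow_le_exp _).trans (Real.exp_le_exp.2 ?_))
    have h2 := natCast_le_gPot U.card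
    have h3 : (U.card : ℝ) ≤ a := hsmall.le.trans (le_max_left _ _)
    have h4 : (0 : ℝ) ≤ U.card := Nat.cast_nonneg _
    have h5 : (0 : ℝ) ≤ (roots p U).card * ell U.card := mul_nonneg (Nat.cast_nonneg _) (hell0 _)
    push_cast
    nlinarith
  push Not at hsmall
  have hM1 : (240 : ℝ) ^ 2 ≤ U.card := (le_max_right _ _).trans hsmall
  set M : ℝ := (U.card : ℝ) with hM
  set r := (roots p U).card with hr
  set s : ℕ := ⌊20 * √M⌋₊ with hs
  have hMpos : 0 < M := lt_of_lt_of_le (by norm_num) hM1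
  have hs' : (s : ℝ) ≤ 20 * √M := Nat.floor_le (by positivity)
  set F : ℝ := Real.exp (a * gPot M + r * ell M - (s * (M + 1).log + r + c * s)) with hF
  set I : Finset (Finset (Fin m) × Finset (Fin m)) :=
    (U.powerset.filter fun S => S.card ≤ s).biUnion fun S =>
      ((U \ S).powerset.filter fun A => ∀ t ∈ U \ S, p t ∈ U \ S → (t ∈ A ↔ p t ∈ A)).image
        fun A => (S, A) with hI
  have hIcard : (I.card : ℝ) ≤ Real.exp (s * (M + 1).log + r + c * s) := by
    have h1 : I.card ≤ (U.card + 1) ^ s * 2 ^ (r + c * s) := by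
      refine card_biUnion_le.trans ((sum_le_card_nsmul _ _ (2 ^ (r + c * s)) ?_).trans ?_)
      · intro S hS
        rw [mem_filter] at hS
        refine card_image_le.trans ((card_consistent hp _).trans ?_)
        refine Nat.pow_le_pow_right (by norm_num) ((card_roots_sdiff hc U S).trans ?_)
        exact Nat.add_le_add_left (Nat.mul_le_mul_left _ hS.2) _
      · rw [smul_eq_mul]
        exact Nat.mul_le_mul_right _ (card_small_subsets U s)
    have h2 : (I.card : ℝ) ≤ (M + 1) ^ s * 2 ^ (r + c * s) := by
      rw [hM]; exact_mod_cast h1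
    refine h2.trans ?_
    have h3 : (M + 1) ^ s = Real.exp (s * (M + 1).log) := by
      rw [Real.exp_nat_mul, Real.exp_log (by linarith)]
    rw [h3, add_assoc, Real.exp_add]
    have := two_pow_le_exp (r + c * s)
    push_cast at this
    gcongr
  set I' := I.filter fun x => ((x.2 ∪ x.1).card : ℝ) ≤ 3 / 4 * M ∧
    (((U \ x.1) \ x.2 ∪ x.1).card : ℝ) ≤ 3 / 4 * M ∧
    M ≤ (x.2 ∪ x.1).card + ((U \ x.1) \ x.2 ∪ x.1).card ∧
    ((x.2 ∪ x.1).card + ((U \ x.1) \ x.2 ∪ x.1).card : ℝ) ≤ M + 20 * √M with hI'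
  have hsub : minorFreeGraphs p U ⊆ I'.biUnion fun x =>
      image₂ (· ⊔ ·) (minorFreeGraphs p (x.2 ∪ x.1)) (minorFreeGraphs p ((U \ x.1) \ x.2 ∪ x.1)) := by
    intro Q hQ
    have hQ' := (mem_filter.1 hQ).2
    obtain ⟨S, A, B, h1, h2, h3, h4, h5, h6, h7, h8, h9⟩ := exists_cut hQ'.2.1 hM1
    have hB : (U \ S) \ A = B := by
      rw [← h3, union_sdiff_left, sdiff_eq_self_of_disjoint h2.symm]
    have hAU : A ⊆ U \ S := h3 ▸ subset_union_left
    have hBU : B ⊆ U \ S := h3 ▸ subset_union_right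
    rw [mem_biUnion]
    refine ⟨(S, A), mem_filter.2 ⟨mem_biUnion.2 ⟨S, mem_filter.2 ⟨mem_powerset.2 h1,
      Nat.le_floor h5⟩, mem_image.2 ⟨A, mem_filter.2 ⟨mem_powerset.2 hAU, ?_⟩, rfl⟩⟩, ?_⟩, ?_⟩
    · intro t ht hpt
      by_cases hne : p t = t
      · rw [hne]
      have hadj := hQ'.2.2 t (mem_sdiff.1 ht).1 (mem_sdiff.1 hpt).1 hne
      rw [← h3, mem_union] at ht hpt
      constructor
      · intro hA
        exact hpt.resolve_right fun hb => h4 t hA _ hb hadj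
      · intro hA
        exact ht.resolve_right fun hb => h4 _ hA _ hb hadj.symm
    · simp only [hB]
      exact ⟨h6, h7, h8, h9⟩
    · simp only [hB]
      refine mem_image₂.2 ⟨restrict Q (A ∪ S), restrict_mem hQ ?_, restrict Q (B ∪ S),
        restrict_mem hQ ?_, ?_⟩
      · exact union_subset (hAU.trans sdiff_subset) h1
      · exact union_subset (hBU.trans sdiff_subset) h1
      · ext u v
        simp only [SimpleGraph.sup_adj, restrict, mem_union]
        constructor
        · rintro (h | h) <;> exact h.1
        · intro h
          have cls : ∀ x ∈ U, x ∈ A ∨ x ∈ B ∨ x ∈ S := by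
            intro x hx
            by_cases hxS : x ∈ S
            · exact .inr (.inr hxS)
            · have : x ∈ A ∪ B := h3 ▸ mem_sdiff.2 ⟨hx, hxS⟩
              rcases mem_union.1 this with h | h
              · exact .inl h
              · exact .inr (.inl h)
          have hu := hQ'.1 u v h
          have n1 := h4 u
          have n2 := h4 v
          rcases cls u hu.1 with h' | h' | h' <;> rcases cls v hu.2 with h'' | h'' | h'' <;>
            first
            | exact absurd h (n1 h' v h'')
            | exact absurd h.symm (n2 h'' u h')
            | simp [h, h', h'']
  have hterm : ∀ x ∈ I', ((image₂ (· ⊔ ·) (minorFreeGraphs p (x.2 ∪ x.1))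
      (minorFreeGraphs p ((U \ x.1) \ x.2 ∪ x.1))).card : ℝ) ≤ F := by
    rintro ⟨S, A⟩ hx
    rw [hI', mem_filter, hI, mem_biUnion] at hx
    obtain ⟨⟨S', hS', hx⟩, h6, h7, h8, h9⟩ := hx
    rw [mem_image] at hx
    obtain ⟨A', hA', hx⟩ := hx
    obtain ⟨rfl, rfl⟩ := Prod.mk.inj hx
    rw [mem_filter, mem_powerset] at hS' hA'
    simp only at h6 h7 h8 h9 ⊢
    set B := (U \ S') \ A' with hB
    have hlt : ∀ W : Finset (Fin m), (W.card : ℝ) ≤ 3 / 4 * M → W.card < n := fun W hW => by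
      have : (W.card : ℝ) < U.card := by linarith
      rw [← hn]; exact_mod_cast this
    have i1 := ih _ (hlt _ h6) _ rfl
    have i2 := ih _ (hlt _ h7) _ rfl
    have hroots := card_roots_sides (p := p) (U := U) (S := S') (A := A') (B := B)
      disjoint_sdiff (union_sdiff_of_subset hA'.1) hA'.2
    set M₁ : ℝ := ((A' ∪ S').card : ℝ)
    set M₂ : ℝ := ((B ∪ S').card : ℝ)
    set r₁ := (roots p (A' ∪ S')).card
    set r₂ := (roots p (B ∪ S')).card
    have hcard : ((image₂ (· ⊔ ·) (minorFreeGraphs p (A' ∪ S'))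
      (minorFreeGraphs p (B ∪ S'))).card : ℝ) ≤ (minorFreeGraphs p (A' ∪ S')).card *
        (minorFreeGraphs p (B ∪ S')).card := by exact_mod_cast card_image₂_le _ _ _
    have hS'0 : (0 : ℝ) ≤ S'.card := Nat.cast_nonneg _
    have hC := hM₀ M M₁ M₂ ((le_max_left _ _).trans hsmall) (Nat.cast_nonneg _)
      (Nat.cast_nonneg _) h6 h7 h8 (h9.trans (by
        have : 0 ≤ √M := Real.sqrt_nonneg _
        have hc0 : (0 : ℝ) ≤ c := Nat.cast_nonneg _
        nlinarith))
    have e1 : ell M₁ + 1 ≤ ell M := ell_add_one_le (Nat.cast_nonneg _) (by linarith) h6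
    have e2 : ell M₂ + 1 ≤ ell M := ell_add_one_le (Nat.cast_nonneg _) (by linarith) h7
    have hr' : (r₁ : ℝ) + r₂ ≤ r + 2 * s := by
      have : r₁ + r₂ ≤ r + 2 * s := hroots.trans (by have := hS'.2; omega)
      exact_mod_cast this
    refine hcard.trans ((mul_le_mul i1 i2 (Nat.cast_nonneg _) (Real.exp_pos _).le).trans ?_)
    rw [← Real.exp_add, hF]
    refine Real.exp_le_exp.2 ?_
    have k1 : (r₁ : ℝ) * ell M₁ ≤ r₁ * (ell M - 1) := by gcongr; linarith
    have k2 : (r₂ : ℝ) * ell M₂ ≤ r₂ * (ell M - 1) := by gcongr; linarith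
    have k3 : 0 ≤ ell M - 1 := by
      have := one_le_ell_natCast U.card
      linarith
    have k4 : ((r₁ : ℝ) + r₂) * (ell M - 1) ≤ (r + 2 * s) * (ell M - 1) := by gcongr
    have k5 : ell M - 1 ≤ 4 * (M + 1).log := by
      have := Real.log_le_log hMpos (by linarith : M ≤ M + 1)
      unfold ell
      linarith
    have k6 : (s : ℝ) * (ell M - 1) ≤ s * (4 * (M + 1).log) := by gcongr
    have hlog := log_add_one_le (by linarith : 1 ≤ M)
    have k7 : (s : ℝ) * (M + 1).log ≤ 20 * 16 * M ^ (5 / 8 : ℝ) := by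
      calc (s : ℝ) * (M + 1).log ≤ (20 * √M) * (16 * M ^ (1 / 8 : ℝ)) := by
            gcongr
            exact Real.log_nonneg (by linarith)
        _ = 20 * 16 * (√M * M ^ (1 / 8 : ℝ)) := by ring
        _ = _ := by rw [sqrt_mul_rpow hMpos]
    have k8 : (s : ℝ) ≤ 20 * M ^ (5 / 8 : ℝ) := by
      have := one_le_rpow_five_eighths (by linarith : 1 ≤ M)
      linarith
    have k9 : (c : ℝ) * s ≤ c * (20 * M ^ (5 / 8 : ℝ)) := by gcongr
    have k10 : 0 ≤ M ^ (5 / 8 : ℝ) := Real.rpow_nonneg hMpos.le _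
    have k11 : (20 * (146 + c)) * M ^ (5 / 8 : ℝ) ≤ a * ((20 * (146 + c)) * M ^ (5 / 8 : ℝ)) :=
      le_mul_of_one_le_left (by positivity) ha1
    have k12 : a * gPot M₁ + a * gPot M₂ + a * ((20 * (146 + c)) * M ^ (5 / 8 : ℝ)) ≤
        a * gPot M := by rw [← mul_add, ← mul_add]; gcongr
    linarith
  calc ((minorFreeGraphs p U).card : ℝ) ≤ ∑ x ∈ I', ((image₂ (· ⊔ ·)
        (minorFreeGraphs p (x.2 ∪ x.1)) (minorFreeGraphs p ((U \ x.1) \ x.2 ∪ x.1))).card : ℝ) := by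
        exact_mod_cast (card_le_card hsub).trans card_biUnion_le
    _ ≤ I'.card * F := by
        rw [← nsmul_eq_mul]
        exact sum_le_card_nsmul _ _ _ hterm
    _ ≤ I.card * F := by
        gcongr
        exact filter_subset _ _
    _ ≤ Real.exp (s * (M + 1).log + r + c * s) * F := by
        gcongr
    _ = Real.exp (a * gPot M + r * ell M) := by
        rw [hF, ← Real.exp_add]
        congr 1
        ring

/-- There are exponentially many monotone self-maps of `Fin m`. -/
lemma card_monotone_le (m : ℕ) :
    (univ.filter fun p : Fin m → Fin m => Monotone p).card ≤ 4 ^ m := by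
  have h4 : 4 ^ m = (univ : Finset (Fin (2 * m))).powerset.card := by
    rw [card_powerset, card_univ, Fintype.card_fin, pow_mul]
    norm_num
  rw [h4]
  let e : (Fin m → Fin m) → Fin m → Fin (2 * m) := fun p t => ⟨t + p t, by omega⟩
  refine card_le_card_of_injOn (fun p => univ.image (e p)) (fun _ _ => by simp) ?_
  intro p hp q hq h
  have hmono : ∀ p : Fin m → Fin m, p ∈ (univ.filter fun p : Fin m → Fin m => Monotone p) →
      StrictMono (e p) := by
    intro p hp i j hij
    have := (mem_filter.1 hp).2 hij.le
    simp only [e, Fin.lt_def, Fin.le_def] at *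
    omega
  have hr : Set.range (e p) = Set.range (e q) := by
    have := congrArg (fun X : Finset (Fin (2 * m)) => (X : Set (Fin (2 * m)))) h
    simpa using this
  have := StrictMono.range_inj (hmono p hp) (hmono q hq) |>.1 hr
  funext t
  have := congrFun this t
  simp only [e, Fin.mk.injEq] at this
  ext
  omega

end GraphCount

section Births

/-- `b` is the next element above `c` among the elements of `N` that are active at `x`. -/
def Cons {E : Type*} (N : Finset E) (act : E → Set ℝ) (H : ℝ → E → EReal) (x : ℝ) (c b : E) :
    Prop :=
  c ∈ N ∧ b ∈ N ∧ x ∈ act c ∧ x ∈ act b ∧ H x c < H x b ∧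
    ∀ e ∈ N, x ∈ act e → H x c < H x e → H x b ≤ H x e

lemma Cons.eq_of_between {E : Type*} {N : Finset E} {act : E → Set ℝ} {H : ℝ → E → EReal}
    (hinj : ∀ x, ∀ e ∈ N, ∀ f ∈ N, x ∈ act e → x ∈ act f → H x e = H x f → e = f)
    (hord : ∀ x y, ∀ e ∈ N, ∀ f ∈ N, x ∈ act e → x ∈ act f → y ∈ act e → y ∈ act f →
      H x e < H x f → H y e < H y f)
    {x y : ℝ} {c b c' b' : E} (h : Cons N act H x c b) (h' : Cons N act H x c' b')
    (hc : y ∈ act c) (hb : y ∈ act b) (hc' : y ∈ act c') (hb' : y ∈ act b') {v : EReal}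
    (h1 : H y c < v) (h2 : v < H y b) (h1' : H y c' < v) (h2' : v < H y b') :
    c = c' ∧ b = b' := by
  have key : ∀ {c b c' b' : E}, Cons N act H x c b → Cons N act H x c' b' → y ∈ act b →
      y ∈ act c' → v < H y b → H y c' < v → ¬ H x c < H x c' := by
    intro c b c' b' h h' hb hc' h2 h1' hlt
    have h3 := h.2.2.2.2.2 c' h'.1 h'.2.2.1 hlt
    rcases h3.eq_or_lt with h3 | h3
    · have := hinj x _ h.2.1 _ h'.1 h.2.2.2.1 h'.2.2.1 h3
      subst this
      exact absurd (h2.trans h1') (lt_irrefl _)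
    · have := hord x y _ h.2.1 _ h'.1 h.2.2.2.1 h'.2.2.1 hb hc' h3
      exact absurd ((h2.trans this).trans h1') (lt_irrefl _)
  have e1 : c = c' := hinj x _ h.1 _ h'.1 h.2.2.1 h'.2.2.1 <|
    le_antisymm (not_lt.1 (key h' h hb' hc h2' h1)) (not_lt.1 (key h h' hb hc' h2 h1'))
  subst e1
  refine ⟨rfl, hinj x _ h.2.1 _ h'.2.1 h.2.2.2.1 h'.2.2.2.1 <| le_antisymm ?_ ?_⟩
  · exact h.2.2.2.2.2 _ h'.2.1 h'.2.2.2.1 h'.2.2.2.2.1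
  · exact h'.2.2.2.2.2 _ h.2.1 h.2.2.2.1 h.2.2.2.2.1

lemma Cons.eq_of_left {E : Type*} {N : Finset E} {act : E → Set ℝ} {H : ℝ → E → EReal}
    (hinj : ∀ x, ∀ e ∈ N, ∀ f ∈ N, x ∈ act e → x ∈ act f → H x e = H x f → e = f)
    {x : ℝ} {c b b' : E} (h : Cons N act H x c b) (h' : Cons N act H x c b') : b = b' :=
  hinj x _ h.2.1 _ h'.2.1 h.2.2.2.1 h'.2.2.2.1 <| le_antisymm
    (h.2.2.2.2.2 _ h'.2.1 h'.2.2.2.1 h'.2.2.2.2.1) (h'.2.2.2.2.2 _ h.2.1 h.2.2.2.1 h.2.2.2.2.1)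

lemma Cons.eq_of_right {E : Type*} {N : Finset E} {act : E → Set ℝ} {H : ℝ → E → EReal}
    (hinj : ∀ x, ∀ e ∈ N, ∀ f ∈ N, x ∈ act e → x ∈ act f → H x e = H x f → e = f)
    {x : ℝ} {c c' b : E} (h : Cons N act H x c b) (h' : Cons N act H x c' b) : c = c' := by
  refine hinj x _ h.1 _ h'.1 h.2.2.1 h'.2.2.1 <| le_antisymm ?_ ?_
  · by_contra hlt
    exact absurd (h'.2.2.2.2.2 _ h.1 h.2.2.1 (not_le.1 hlt)) (not_le.2 h.2.2.2.2.1)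
  · by_contra hlt
    exact absurd (h.2.2.2.2.2 _ h'.1 h'.2.2.1 (not_le.1 hlt)) (not_le.2 h'.2.2.2.2.1)

/-- `y` is the element of `S` preceding `x`. -/
def Pred (S : Finset ℝ) (x y : ℝ) : Prop := y ∈ S ∧ y < x ∧ ∀ z ∈ S, z < x → z ≤ y

lemma exists_pred {S : Finset ℝ} {x : ℝ} (h : ∃ y ∈ S, y < x) : ∃ y, Pred S x y := by
  have hne : (S.filter (· < x)).Nonempty := by
    obtain ⟨y, hy, hyx⟩ := h
    exact ⟨y, mem_filter.2 ⟨hy, hyx⟩⟩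
  have := max'_mem _ hne
  rw [mem_filter] at this
  exact ⟨_, this.1, this.2, fun z hz hzx => le_max' _ _ (mem_filter.2 ⟨hz, hzx⟩)⟩

/-- Sweeping over the samples `S`, consecutive pairs are born at most `3|T| + 1` times. -/
lemma card_births {E : Type*} {T : Finset E} {bot top : E} {act : E → Set ℝ} {H : ℝ → E → EReal}
    (hI : ∀ e, (act e).OrdConnected)
    (hbot : act bot = Set.univ) (htop : act top = Set.univ) (hbt : ∀ x, H x bot < H x top)
    (hinj : ∀ x, ∀ e ∈ insert bot (insert top T), ∀ f ∈ insert bot (insert top T),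
      x ∈ act e → x ∈ act f → H x e = H x f → e = f)
    (hord : ∀ x y, ∀ e ∈ insert bot (insert top T), ∀ f ∈ insert bot (insert top T),
      x ∈ act e → x ∈ act f → y ∈ act e → y ∈ act f → H x e < H x f → H y e < H y f)
    (S : Finset ℝ) :
    ((S ×ˢ insert bot (insert top T) ×ˢ insert bot (insert top T)).filter fun q =>
      Cons (insert bot (insert top T)) act H q.1 q.2.1 q.2.2 ∧
        ∀ y, Pred S q.1 y → ¬ Cons (insert bot (insert top T)) act H y q.2.1 q.2.2).card ≤
      3 * T.card + 1 := by
  set N := insert bot (insert top T) with hN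
  set t : Finset (Option (E × Fin 3)) := insert none ((T ×ˢ univ).image some) with ht
  have hmem : ∀ e ∈ N, e = bot ∨ e = top ∨ e ∈ T := fun e he => by
    simpa [hN] using he
  have htc : t.card ≤ 3 * T.card + 1 := by
    refine (card_insert_le _ _).trans (Nat.add_le_add_right (card_image_le.trans ?_) 1)
    rw [card_product, card_univ, Fintype.card_fin, mul_comm]
  refine le_trans ?_ htc
  let r : ℝ × E × E → Option (E × Fin 3) → Prop := fun q o =>
    (o = some (q.2.1, 0) ∧ ∀ y ∈ S, y < q.1 → y ∉ act q.2.1) ∨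
    (o = some (q.2.2, 1) ∧ ∀ y ∈ S, y < q.1 → y ∉ act q.2.2) ∨
    (∃ e y, o = some (e, 2) ∧ Pred S q.1 y ∧ q.1 ∉ act e ∧ y ∈ act e ∧ y ∈ act q.2.1 ∧
      y ∈ act q.2.2 ∧ H y q.2.1 < H y e ∧ H y e < H y q.2.2) ∨
    (o = none ∧ (∀ y ∈ S, ¬ y < q.1) ∧ q.2 = (bot, top))
  refine card_le_card_of_forall_subsingleton r ?_ ?_
  · rintro ⟨x, c, b⟩ hq
    simp only [mem_filter, mem_product] at hq
    obtain ⟨⟨hx, hc, hb⟩, hcons, hpred⟩ := hq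
    have hT : ∀ e ∈ N, (∃ y, y ∉ act e) → e ∈ T := by
      rintro e he ⟨y, hy⟩
      rcases hmem e he with rfl | rfl | h
      · simp [hbot] at hy
      · simp [htop] at hy
      · exact h
    have hts : ∀ e ∈ T, ∀ i : Fin 3, some (e, i) ∈ t := fun e he i => by
      simp [ht, he]
    by_cases hex : ∃ y ∈ S, y < x
    · obtain ⟨y, hy⟩ := exists_pred hex
      have starts : ∀ e, x ∈ act e → y ∉ act e → ∀ z ∈ S, z < x → z ∉ act e := by
        intro e hxe hye z hz hzx hze
        exact hye ((hI e).out hze hxe ⟨hy.2.2 z hz hzx, hy.2.1.le⟩)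
      by_cases hyc : y ∈ act c
      swap
      · exact ⟨some (c, 0), hts c (hT c hc ⟨y, hyc⟩) 0, .inl ⟨rfl, starts c hcons.2.2.1 hyc⟩⟩
      by_cases hyb : y ∈ act b
      swap
      · exact ⟨some (b, 1), hts b (hT b hb ⟨y, hyb⟩) 1, .inr (.inl ⟨rfl,
            starts b hcons.2.2.2.1 hyb⟩)⟩
      have hlt := hord x y c hc b hb hcons.2.2.1 hcons.2.2.2.1 hyc hyb hcons.2.2.2.2.1
      have hnot := hpred y hy
      have : ∃ e ∈ N, y ∈ act e ∧ H y c < H y e ∧ H y e < H y b := by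
        by_contra hno
        push Not at hno
        exact hnot ⟨hc, hb, hyc, hyb, hlt, fun e he hye h => hno e he hye h⟩
      obtain ⟨e, he, hye, h1, h2⟩ := this
      have hxe : x ∉ act e := by
        intro hxe
        have h3 := hord y x c hc e he hyc hye hcons.2.2.1 hxe h1
        have h4 := hord y x e he b hb hye hyb hxe hcons.2.2.2.1 h2
        exact absurd (hcons.2.2.2.2.2 e he hxe h3) (not_le.2 h4)
      exact ⟨some (e, 2), hts e (hT e he ⟨x, hxe⟩) 2,
        .inr (.inr (.inl ⟨e, y, rfl, hy, hxe, hye, hyc, hyb, h1, h2⟩))⟩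
    · push Not at hex
      have hno : ∀ e, ∀ y ∈ S, y < x → y ∉ act e := fun e y hy hyx =>
        absurd hyx (not_lt.2 (hex y hy))
      by_cases hcT : c ∈ T
      · exact ⟨some (c, 0), hts c hcT 0, .inl ⟨rfl, hno c⟩⟩
      by_cases hbT : b ∈ T
      · exact ⟨some (b, 1), hts b hbT 1, .inr (.inl ⟨rfl, hno b⟩)⟩
      have h1 := hmem c hc
      have h2 := hmem b hb
      have h3 := hcons.2.2.2.2.1
      refine ⟨none, mem_insert_self _ _, .inr (.inr (.inr ⟨rfl, fun y hy => not_lt.2 (hex y hy),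
          ?_⟩))⟩
      rcases h1 with rfl | rfl | h1
      · rcases h2 with rfl | rfl | h2
        · exact absurd h3 (lt_irrefl _)
        · rfl
        · exact absurd h2 hbT
      · rcases h2 with rfl | rfl | h2
        · exact absurd (h3.trans (hbt x)) (lt_irrefl _)
        · exact absurd h3 (lt_irrefl _)
        · exact absurd h2 hbT
      · exact absurd h1 hcT
  · rintro o ho ⟨x, c, b⟩ ⟨hq, hr⟩ ⟨x', c', b'⟩ ⟨hq', hr'⟩
    simp only [mem_filter, mem_product] at hq hq'
    obtain ⟨⟨hx, hc, hb⟩, hcons, -⟩ := hq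
    obtain ⟨⟨hx', hc', hb'⟩, hcons', -⟩ := hq'
    have first : ∀ e, x ∈ act e → x' ∈ act e → (∀ y ∈ S, y < x → y ∉ act e) →
        (∀ y ∈ S, y < x' → y ∉ act e) → x = x' := by
      intro e h1 h2 h3 h4
      by_contra hne
      rcases lt_or_gt_of_ne hne with h | h
      · exact h4 x hx h h1
      · exact h3 x' hx' h h2
    simp only [r] at hr hr'
    rcases hr with ⟨rfl, h⟩ | ⟨rfl, h⟩ | ⟨e, y, rfl, hy, hxe, hye, hyc, hyb, h1, h2⟩ | ⟨rfl, h, h2⟩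
    · simp only [Option.some.injEq, Prod.mk.injEq, Fin.isValue, zero_ne_one, and_false, false_and,
        false_or, reduceCtorEq, or_false] at hr'
      rcases hr' with ⟨⟨rfl, -⟩, h'⟩ | ⟨e, y, ⟨-, h0⟩, -⟩
      · obtain rfl := first c hcons.2.2.1 hcons'.2.2.1 h h'
        rw [hcons.eq_of_left hinj hcons']
      · exact absurd h0 (by decide)
    · simp only [Option.some.injEq, Prod.mk.injEq, Fin.isValue, one_ne_zero, and_false, false_and,
        false_or, reduceCtorEq, or_false] at hr'
      rcases hr' with ⟨⟨rfl, -⟩, h'⟩ | ⟨e, y, ⟨-, h0⟩, -⟩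
      · obtain rfl := first b hcons.2.2.2.1 hcons'.2.2.2.1 h h'
        rw [hcons.eq_of_right hinj hcons']
      · exact absurd h0 (by decide)
    · rcases hr' with ⟨h0, h'⟩ | ⟨h0, h'⟩ | ⟨e', y', h0, hy', hxe', hye', hyc', hyb', h1',
          h2'⟩ | ⟨h0, -⟩
      · exact absurd (Prod.mk.inj (Option.some.inj h0)).2 (by decide)
      · exact absurd (Prod.mk.inj (Option.some.inj h0)).2 (by decide)
      · obtain ⟨rfl, -⟩ := Prod.mk.inj (Option.some.inj h0)
        have hxx : x = x' := by
          by_contra hne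
          rcases lt_or_gt_of_ne hne with h | h
          · exact hxe ((hI e).out hye hye' ⟨hy.2.1.le, hy'.2.2 x hx h⟩)
          · exact hxe' ((hI e).out hye' hye ⟨hy'.2.1.le, hy.2.2 x' hx' h⟩)
        subst hxx
        obtain rfl : y = y' := le_antisymm (hy'.2.2 y hy.1 hy.2.1) (hy.2.2 y' hy'.1 hy'.2.1)
        obtain ⟨rfl, rfl⟩ := hcons.eq_of_between hinj hord hcons' hyc hyb hyc' hyb' h1 h2 h1' h2'
        rfl
      · simp at h0
    · rcases hr' with ⟨h0, h'⟩ | ⟨h0, h'⟩ | ⟨e', y', h0, -⟩ | ⟨h0, h', h2'⟩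
      · simp at h0
      · simp at h0
      · simp at h0
      · have : x = x' := le_antisymm (not_lt.1 (h x' hx')) (not_lt.1 (h' x hx))
        rw [this, h2, h2']

end Births

section Cells

/-- Convex sets with convex complement that are closed upwards. -/
def Up (H : Set (ℝ × ℝ)) : Prop :=
  Convex ℝ H ∧ Convex ℝ Hᶜ ∧ ∀ x y y', (x, y) ∈ H → y ≤ y' → (x, y') ∈ H

lemma up_univ : Up Set.univ := ⟨convex_univ, by simp [convex_empty], fun _ _ _ _ _ => trivial⟩

lemma up_empty : Up ∅ := ⟨convex_empty, by simp [convex_univ], fun _ _ _ h _ => h⟩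

/-- The part between two upwards closed sets of a vertical slab. -/
def IsCell (C : Set (ℝ × ℝ)) : Prop :=
  ∃ (I : Set ℝ) (L A : Set (ℝ × ℝ)), I.OrdConnected ∧ Up L ∧ Up A ∧
    C = {z | z.1 ∈ I ∧ z ∈ L ∧ z ∉ A}

lemma IsCell.convex {C : Set (ℝ × ℝ)} (h : IsCell C) : Convex ℝ C := by
  obtain ⟨I, L, A, hI, hL, hA, rfl⟩ := h
  have h1 : Convex ℝ (Prod.fst ⁻¹' I : Set (ℝ × ℝ)) :=
    hI.convex.is_linear_preimage (IsLinearMap.mk (fun _ _ => rfl) fun _ _ => rfl)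
  exact (h1.inter (hL.1.inter hA.2.1))

lemma IsCell.exists_sides {C : Set (ℝ × ℝ)} (h : IsCell C) : ∃ L A : Set (ℝ × ℝ),
    Up L ∧ Up A ∧ ∀ z, z ∈ C ↔ z.1 ∈ Prod.fst '' C ∧ z ∈ L ∧ z ∉ A := by
  obtain ⟨I, L, A, hI, hL, hA, hC⟩ := h
  refine ⟨L, A, hL, hA, fun z => ⟨fun hz => ?_, fun hz => ?_⟩⟩
  · exact ⟨⟨z, hz, rfl⟩, by rw [hC] at hz; exact hz.2⟩
  · obtain ⟨⟨w, hw, hwz⟩, h2⟩ := hz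
    rw [hC] at hw ⊢
    exact ⟨hwz ▸ hw.1, h2⟩

/-- Two sets are adjacent when a segment covered by them joins them. -/
def cellGraph : SimpleGraph (Set (ℝ × ℝ)) where
  Adj A B := A ≠ B ∧ ∃ a ∈ A, ∃ b ∈ B, segment ℝ a b ⊆ A ∪ B
  symm := ⟨by
    rintro A B ⟨h, a, ha, b, hb, hs⟩
    exact ⟨h.symm, b, hb, a, ha, by rwa [segment_symm, Set.union_comm]⟩⟩
  loopless := ⟨fun _ h => h.1 rfl⟩

lemma mem_vertical_segment {x y y' : ℝ} (h : y ≤ y') {z : ℝ × ℝ} :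
    z ∈ segment ℝ (x, y) (x, y') ↔ z.1 = x ∧ y ≤ z.2 ∧ z.2 ≤ y' := by
  rw [← Prod.image_mk_segment_right, segment_eq_Icc h]
  constructor
  · rintro ⟨t, ht, rfl⟩
    exact ⟨rfl, ht⟩
  · rintro ⟨rfl, h2⟩
    exact ⟨z.2, h2, rfl⟩

/-- The horizontal walls of a vertical decomposition. -/
inductive Wall where
  | bot : Wall
  | top : Wall
  | cell : Set (ℝ × ℝ) → Wall

/-- The abscissas over which a wall extends. -/
def Wall.act : Wall → Set ℝ
  | bot => Set.univ
  | top => Set.univ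
  | cell C => Prod.fst '' C

/-- The ordinate of some point of a wall. -/
def Wall.height (x : ℝ) : Wall → EReal
  | bot => ⊥
  | top => ⊤
  | cell C => ((if h : ∃ y, (x, y) ∈ C then h.choose else 0 : ℝ) : EReal)

/-- The points above a wall, given the upper sides of the cells. -/
def Wall.over (A : Set (ℝ × ℝ) → Set (ℝ × ℝ)) : Wall → Set (ℝ × ℝ)
  | bot => Set.univ
  | top => ∅
  | cell C => A C

/-- The complement of the points below a wall, given the lower sides of the cells. -/
def Wall.upto (L : Set (ℝ × ℝ) → Set (ℝ × ℝ)) : Wall → Set (ℝ × ℝ)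
  | bot => Set.univ
  | top => ∅
  | cell C => L C

lemma Wall.exists_height {C : Set (ℝ × ℝ)} {x : ℝ} (h : x ∈ Prod.fst '' C) :
    ∃ y : ℝ, (x, y) ∈ C ∧ (Wall.cell C).height x = y := by
  have h' : ∃ y, (x, y) ∈ C := by
    obtain ⟨z, hz, rfl⟩ := h
    exact ⟨z.2, hz⟩
  exact ⟨h'.choose, h'.choose_spec, by simp [Wall.height, h']⟩

/-- Disjoint convex sets are ordered in the same way over all abscissas. -/
lemma order_preserved {C D : Set (ℝ × ℝ)} (hC : Convex ℝ C) (hD : Convex ℝ D) (hCD : Disjoint C D)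
    {x x' c d c' d' : ℝ} (h1 : (x, c) ∈ C) (h2 : (x, d) ∈ D) (h3 : (x', c') ∈ C)
    (h4 : (x', d') ∈ D) (h : c < d) : c' < d' := by
  by_contra hle
  push Not at hle
  set t := (d - c) / ((d - c) + (c' - d')) with ht
  have hpos : 0 < (d - c) + (c' - d') := by linarith
  have ht0 : 0 ≤ t := div_nonneg (by linarith) hpos.le
  have ht1 : t ≤ 1 := by
    rw [ht, div_le_one hpos]
    linarith
  have e : t * ((d - c) + (c' - d')) = d - c := div_mul_cancel₀ _ hpos.ne'
  have m1 := hC h1 h3 (sub_nonneg.2 ht1) ht0 (by ring)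
  have m2 := hD h2 h4 (sub_nonneg.2 ht1) ht0 (by ring)
  refine Set.disjoint_left.1 hCD m1 ?_
  convert m2 using 1
  ext
  · simp
  · simp
    linarith

end Cells

section Decomposition

/-- Disjoint cells together with their sides. -/
structure CellFamily (R : Finset (Set (ℝ × ℝ))) (L A : Set (ℝ × ℝ) → Set (ℝ × ℝ)) : Prop where
  cell : ∀ C ∈ R, IsCell C
  disj : ∀ C ∈ R, ∀ D ∈ R, C ≠ D → Disjoint C D
  upL : ∀ C ∈ R, Up (L C)
  upA : ∀ C ∈ R, Up (A C)
  mem_iff : ∀ C ∈ R, ∀ z, z ∈ C ↔ z.1 ∈ Prod.fst '' C ∧ z ∈ L C ∧ z ∉ A C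

/-- The walls of a family of cells. -/
def walls (R : Finset (Set (ℝ × ℝ))) : Finset Wall :=
  insert Wall.bot (insert Wall.top (R.image Wall.cell))

lemma mem_walls {R : Finset (Set (ℝ × ℝ))} {e : Wall} :
    e ∈ walls R ↔ e = .bot ∨ e = .top ∨ ∃ C ∈ R, Wall.cell C = e := by
  simp [walls]

lemma cell_mem_walls {R : Finset (Set (ℝ × ℝ))} {C : Set (ℝ × ℝ)} :
    Wall.cell C ∈ walls R ↔ C ∈ R := by
  simp [walls]

/-- The abscissas where `b` is the wall following `c`. -/
def slab (R : Finset (Set (ℝ × ℝ))) (c b : Wall) : Set ℝ :=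
  {x | Cons (walls R) Wall.act Wall.height x c b}

/-- The gap cell between `c` and `b` around the abscissa `x`. -/
def gapCell (R : Finset (Set (ℝ × ℝ))) (L A : Set (ℝ × ℝ) → Set (ℝ × ℝ)) (x : ℝ) (c b : Wall) :
    Set (ℝ × ℝ) :=
  {z | z.1 ∈ (slab R c b).ordConnectedComponent x ∧ z ∈ c.over A ∧ z ∉ b.upto L}

/-- The combinatorial type of an abscissa. -/
def sweepType (R : Finset (Set (ℝ × ℝ))) (x : ℝ) :
    Finset (Set (ℝ × ℝ)) × Finset (Set (ℝ × ℝ)) :=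
  (R.filter fun C => x ∈ Prod.fst '' C, R.filter fun C => ∃ a ∈ Prod.fst '' C, a ≤ x)

variable {R : Finset (Set (ℝ × ℝ))} {L A : Set (ℝ × ℝ) → Set (ℝ × ℝ)}

lemma Wall.act_ordConnected_of (hR : ∀ C ∈ R, IsCell C) :
    ∀ e ∈ walls R, (Wall.act e).OrdConnected := by
  intro e he
  rcases mem_walls.1 he with rfl | rfl | ⟨C, hC, rfl⟩
  · exact Set.ordConnected_univ
  · exact Set.ordConnected_univ
  · have h := (hR C hC).convex
    exact (h.is_linear_image (f := Prod.fst) (IsLinearMap.mk (fun _ _ => rfl) fun _ _ =>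
        rfl)).ordConnected

namespace CellFamily

lemma eq_of_mem (h : CellFamily R L A) {C D : Set (ℝ × ℝ)} (hC : C ∈ R) (hD : D ∈ R) {z : ℝ × ℝ}
    (h1 : z ∈ C) (h2 : z ∈ D) : C = D := by
  by_contra hne
  exact Set.disjoint_left.1 (h.disj C hC D hD hne) h1 h2

lemma vert (h : CellFamily R L A) {C : Set (ℝ × ℝ)} (hC : C ∈ R) {x a s b : ℝ}
    (h1 : (x, a) ∈ C) (h2 : (x, b) ∈ C) (ha : a ≤ s) (hb : s ≤ b) : (x, s) ∈ C :=
  (h.cell C hC).convex.segment_subset h1 h2 ((mem_vertical_segment (ha.trans hb)).2 ⟨rfl, ha, hb⟩)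

lemma mem_upper (h : CellFamily R L A) {C : Set (ℝ × ℝ)} (hC : C ∈ R) {x a s : ℝ}
    (h1 : (x, a) ∈ C) (ha : a ≤ s) (hs : (x, s) ∉ C) : (x, s) ∈ A C := by
  have := (h.mem_iff C hC (x, a)).1 h1
  have h2 := (h.upL C hC).2.2 x a s this.2.1 ha
  by_contra h3
  exact hs ((h.mem_iff C hC (x, s)).2 ⟨this.1, h2, h3⟩)

lemma notMem_lower (h : CellFamily R L A) {C : Set (ℝ × ℝ)} (hC : C ∈ R) {x a s : ℝ}
    (h1 : (x, a) ∈ C) (ha : s ≤ a) (hs : (x, s) ∉ C) : (x, s) ∉ L C := by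
  intro h2
  have := (h.mem_iff C hC (x, a)).1 h1
  exact hs ((h.mem_iff C hC (x, s)).2 ⟨this.1, h2, fun h3 =>
      this.2.2 ((h.upA C hC).2.2 x s a h3 ha)⟩)

lemma lt_of_mem_upper (h : CellFamily R L A) {C : Set (ℝ × ℝ)} (hC : C ∈ R) {x a s : ℝ}
    (h1 : (x, a) ∈ C) (h2 : (x, s) ∈ A C) : a < s := by
  by_contra hle
  exact ((h.mem_iff C hC (x, a)).1 h1).2.2 ((h.upA C hC).2.2 x s a h2 (not_lt.1 hle))

lemma lt_of_notMem_lower (h : CellFamily R L A) {C : Set (ℝ × ℝ)} (hC : C ∈ R) {x a s : ℝ}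
    (h1 : (x, a) ∈ C) (h2 : (x, s) ∉ L C) : s < a := by
  by_contra hle
  exact h2 ((h.upL C hC).2.2 x a s ((h.mem_iff C hC (x, a)).1 h1).2.1 (not_lt.1 hle))

lemma height_inj (h : CellFamily R L A) (x : ℝ) : ∀ e ∈ walls R, ∀ f ∈ walls R,
    x ∈ e.act → x ∈ f.act → e.height x = f.height x → e = f := by
  intro e he f hf hxe hxf hef
  rcases mem_walls.1 he with rfl | rfl | ⟨C, hC, rfl⟩ <;>
  rcases mem_walls.1 hf with rfl | rfl | ⟨D, hD, rfl⟩
  · rfl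
  · simp [Wall.height] at hef
  · simp [Wall.height] at hef
  · simp [Wall.height] at hef
  · rfl
  · simp [Wall.height] at hef
  · simp [Wall.height] at hef
  · simp [Wall.height] at hef
  · obtain ⟨y, hy, e1⟩ := Wall.exists_height hxe
    obtain ⟨y', hy', e2⟩ := Wall.exists_height hxf
    rw [e1, e2, EReal.coe_eq_coe_iff] at hef
    subst hef
    rw [h.eq_of_mem hC hD hy hy']

lemma height_ord (h : CellFamily R L A) (x x' : ℝ) : ∀ e ∈ walls R, ∀ f ∈ walls R,
    x ∈ e.act → x ∈ f.act → x' ∈ e.act → x' ∈ f.act → e.height x < f.height x →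
    e.height x' < f.height x' := by
  intro e he f hf hxe hxf hxe' hxf' hef
  rcases mem_walls.1 he with rfl | rfl | ⟨C, hC, rfl⟩ <;>
  rcases mem_walls.1 hf with rfl | rfl | ⟨D, hD, rfl⟩
  · simp [Wall.height] at hef
  · simp [Wall.height]
  · simp [Wall.height, EReal.bot_lt_coe]
  · simp [Wall.height] at hef
  · simp [Wall.height] at hef
  · simp [Wall.height] at hef
  · simp [Wall.height] at hef
  · simp [Wall.height, EReal.coe_lt_top]
  · obtain ⟨y, hy, e1⟩ := Wall.exists_height hxe
    obtain ⟨z, hz, e2⟩ := Wall.exists_height hxf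
    obtain ⟨y', hy', e1'⟩ := Wall.exists_height hxe'
    obtain ⟨z', hz', e2'⟩ := Wall.exists_height hxf'
    rw [e1, e2, EReal.coe_lt_coe_iff] at hef
    rw [e1', e2', EReal.coe_lt_coe_iff]
    refine order_preserved (h.cell C hC).convex (h.cell D hD).convex (h.disj C hC D hD ?_) hy hz hy'
      hz' hef
    rintro rfl
    rw [e1] at e2
    exact hef.ne (EReal.coe_eq_coe_iff.1 e2)

lemma exists_cons (h : CellFamily R L A) {x s : ℝ} (hz : ∀ C ∈ R, (x, s) ∉ C) :
    ∃ c b : Wall, x ∈ slab R c b ∧ c.height x < s ∧ (s : EReal) < b.height x ∧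
      (x, s) ∈ c.over A ∧ (x, s) ∉ b.upto L := by
  have hne : ∀ e ∈ walls R, x ∈ e.act → e.height x ≠ s := by
    intro e he hxe hs
    rcases mem_walls.1 he with rfl | rfl | ⟨C, hC, rfl⟩
    · exact EReal.coe_ne_bot _ hs.symm
    · exact EReal.coe_ne_top _ hs.symm
    · obtain ⟨y, hy, e1⟩ := Wall.exists_height hxe
      rw [e1, EReal.coe_eq_coe_iff] at hs
      exact hz C hC (hs ▸ hy)
  obtain ⟨c, hc, hcmax⟩ := exists_max_image
    ((walls R).filter fun e => x ∈ e.act ∧ e.height x < (s : EReal)) (fun e => e.height x)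
    ⟨.bot, mem_filter.2 ⟨mem_walls.2 (.inl rfl), trivial, EReal.bot_lt_coe s⟩⟩
  obtain ⟨b, hb, hbmin⟩ := exists_min_image
    ((walls R).filter fun e => x ∈ e.act ∧ (s : EReal) < e.height x) (fun e => e.height x)
    ⟨.top, mem_filter.2 ⟨mem_walls.2 (.inr (.inl rfl)), trivial, EReal.coe_lt_top s⟩⟩
  rw [mem_filter] at hc hb
  refine ⟨c, b, ⟨hc.1, hb.1, hc.2.1, hb.2.1, hc.2.2.trans hb.2.2, ?_⟩, hc.2.2, hb.2.2, ?_, ?_⟩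
  · intro e he hxe hce
    rcases lt_or_gt_of_ne (hne e he hxe) with h1 | h1
    · exact absurd hce (not_lt.2 (hcmax e (mem_filter.2 ⟨he, hxe, h1⟩)))
    · exact hbmin e (mem_filter.2 ⟨he, hxe, h1⟩)
  · rcases mem_walls.1 hc.1 with rfl | rfl | ⟨C, hC, rfl⟩
    · trivial
    · exact absurd hc.2.2 (by simp [Wall.height])
    · obtain ⟨y, hy, e1⟩ := Wall.exists_height hc.2.1
      rw [e1, EReal.coe_lt_coe_iff] at hc
      exact h.mem_upper hC hy hc.2.2.le (hz C hC)
  · rcases mem_walls.1 hb.1 with rfl | rfl | ⟨C, hC, rfl⟩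
    · exact absurd hb.2.2 (by simp [Wall.height])
    · exact fun h => h
    · obtain ⟨y, hy, e1⟩ := Wall.exists_height hb.2.1
      rw [e1, EReal.coe_lt_coe_iff] at hb
      exact h.notMem_lower hC hy hb.2.2.le (hz C hC)

lemma gapCell_between (h : CellFamily R L A) {x a s : ℝ} {c b : Wall}
    (hz : (a, s) ∈ gapCell R L A x c b) :
    a ∈ slab R c b ∧ c.height a < s ∧ (s : EReal) < b.height a := by
  obtain ⟨h1, h2, h3⟩ := hz
  have h4 : a ∈ slab R c b := Set.ordConnectedComponent_subset h1
  refine ⟨h4, ?_, ?_⟩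
  · rcases mem_walls.1 h4.1 with rfl | rfl | ⟨C, hC, rfl⟩
    · exact EReal.bot_lt_coe s
    · exact absurd h2 (fun h => h)
    · obtain ⟨y, hy, e1⟩ := Wall.exists_height h4.2.2.1
      rw [e1, EReal.coe_lt_coe_iff]
      exact h.lt_of_mem_upper hC hy h2
  · rcases mem_walls.1 h4.2.1 with rfl | rfl | ⟨C, hC, rfl⟩
    · exact absurd trivial h3
    · exact EReal.coe_lt_top s
    · obtain ⟨y, hy, e1⟩ := Wall.exists_height h4.2.2.2.1
      rw [e1, EReal.coe_lt_coe_iff]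
      exact h.lt_of_notMem_lower hC hy h3

lemma gapCell_eq (h : CellFamily R L A) {x x' : ℝ} {c b c' b' : Wall} {z : ℝ × ℝ}
    (h1 : z ∈ gapCell R L A x c b) (h2 : z ∈ gapCell R L A x' c' b') :
    c = c' ∧ gapCell R L A x c b = gapCell R L A x' c' b' := by
  obtain ⟨a, s⟩ := z
  obtain ⟨p1, q1, r1⟩ := h.gapCell_between h1
  obtain ⟨p2, q2, r2⟩ := h.gapCell_between h2
  obtain ⟨rfl, rfl⟩ := Cons.eq_of_between (fun x => h.height_inj x) (fun x x' => h.height_ord x x')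
    p1 p2 p1.2.2.1 p1.2.2.2.1 p2.2.2.1 p2.2.2.2.1 q1 r1 q2 r2
  refine ⟨rfl, ?_⟩
  have e1 := Set.ordConnectedComponent_eq (Set.mem_ordConnectedComponent.1 h1.1)
  have e2 := Set.ordConnectedComponent_eq (Set.mem_ordConnectedComponent.1 h2.1)
  unfold gapCell
  rw [e1, e2]

lemma isCell_gapCell (h : CellFamily R L A) {x : ℝ} {c b : Wall} (hc : c ∈ walls R)
    (hb : b ∈ walls R) : IsCell (gapCell R L A x c b) := by
  refine ⟨(slab R c b).ordConnectedComponent x, c.over A, b.upto L, inferInstance, ?_, ?_, rfl⟩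
  · rcases mem_walls.1 hc with rfl | rfl | ⟨C, hC, rfl⟩
    exacts [up_univ, up_empty, h.upA C hC]
  · rcases mem_walls.1 hb with rfl | rfl | ⟨C, hC, rfl⟩
    exacts [up_univ, up_empty, h.upL C hC]

lemma gapCell_disjoint (h : CellFamily R L A) {x : ℝ} {c b : Wall} {D : Set (ℝ × ℝ)}
    (hD : D ∈ R) : Disjoint (gapCell R L A x c b) D := by
  rw [Set.disjoint_left]
  rintro ⟨a, s⟩ hz hzD
  obtain ⟨h1, h2, h3⟩ := h.gapCell_between hz
  have haD : a ∈ (Wall.cell D).act := ⟨_, hzD, rfl⟩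
  obtain ⟨y, hy, e1⟩ := Wall.exists_height haD
  by_cases hlt : c.height a < (Wall.cell D).height a
  · have h4 := h1.2.2.2.2.2 (.cell D) (cell_mem_walls.2 hD) haD hlt
    rcases mem_walls.1 h1.2.1 with rfl | rfl | ⟨C, hC, rfl⟩
    · exact absurd h3 (by simp [Wall.height])
    · rw [e1] at h4
      exact absurd h4 (not_le.2 (EReal.coe_lt_top y))
    · obtain ⟨v, hv, e2⟩ := Wall.exists_height h1.2.2.2.1
      rw [e1, e2, EReal.coe_le_coe_iff] at h4
      rw [e2, EReal.coe_lt_coe_iff] at h3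
      obtain rfl := h.eq_of_mem hC hD hv (h.vert hD hzD hy h3.le h4)
      exact hz.2.2 ((h.mem_iff C hC _).1 hzD).2.1
  · rw [not_lt] at hlt
    rcases mem_walls.1 h1.1 with rfl | rfl | ⟨C, hC, rfl⟩
    · rw [e1] at hlt
      exact absurd hlt (not_le.2 (EReal.bot_lt_coe y))
    · exact absurd h2 (by simp [Wall.height])
    · obtain ⟨v, hv, e2⟩ := Wall.exists_height h1.2.2.1
      rw [e1, e2, EReal.coe_le_coe_iff] at hlt
      rw [e2, EReal.coe_lt_coe_iff] at h2
      obtain rfl := h.eq_of_mem hC hD hv (h.vert hD hy hzD hlt h2.le)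
      exact ((h.mem_iff C hC _).1 hzD).2.2 hz.2.1

lemma adj_gapCell (h : CellFamily R L A) {x : ℝ} {D : Set (ℝ × ℝ)} {b : Wall} (hD : D ∈ R)
    (hne : (gapCell R L A x (.cell D) b).Nonempty) (hb : b ∈ walls R) :
    cellGraph.Adj (gapCell R L A x (.cell D) b) D := by
  obtain ⟨⟨a, s⟩, hz⟩ := hne
  refine ⟨fun e => ?_, ?_⟩
  · have := h.gapCell_disjoint (x := x) (c := .cell D) (b := b) hD
    exact Set.disjoint_left.1 this hz (e ▸ hz)
  obtain ⟨h1, h2, h3⟩ := h.gapCell_between hz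
  obtain ⟨y, hy, e1⟩ := Wall.exists_height h1.2.2.1
  rw [e1, EReal.coe_lt_coe_iff] at h2
  refine ⟨_, hz, _, hy, ?_⟩
  rw [segment_symm]
  rintro ⟨a', s'⟩ hw
  obtain ⟨rfl, h4, h5⟩ := (mem_vertical_segment h2.le).1 hw
  dsimp only at h4 h5 ⊢
  by_cases hDz : (a', s') ∈ D
  · exact Or.inr hDz
  · refine Or.inl ⟨hz.1, h.mem_upper hD hy h4 hDz, fun hup => hz.2.2 ?_⟩
    rcases mem_walls.1 hb with rfl | rfl | ⟨C, hC, rfl⟩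
    · trivial
    · exact hup
    · exact (h.upL C hC).2.2 _ _ _ hup h5

lemma cons_congr (h : CellFamily R L A) {x x' : ℝ} {c b : Wall}
    (hx : sweepType R x = sweepType R x') (hc : x ∈ slab R c b) : x' ∈ slab R c b := by
  have hact : ∀ e ∈ walls R, x ∈ e.act ↔ x' ∈ e.act := by
    intro e he
    rcases mem_walls.1 he with rfl | rfl | ⟨C, hC, rfl⟩
    · exact Iff.rfl
    · exact Iff.rfl
    · have := congrArg (fun q => C ∈ q.1) hx
      simp only [sweepType, mem_filter, hC, true_and, eq_iff_iff] at this
      exact this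
  obtain ⟨h1, h2, h3, h4, h5, h6⟩ := hc
  have h3' := (hact c h1).1 h3
  have h4' := (hact b h2).1 h4
  refine ⟨h1, h2, h3', h4', h.height_ord x x' c h1 b h2 h3 h4 h3' h4' h5, ?_⟩
  intro e he hxe' hlt
  have hxe := (hact e he).2 hxe'
  by_contra hcon
  have h7 := h6 e he hxe (h.height_ord x' x c h1 e he h3' hxe' h3 hxe hlt)
  exact absurd (h.height_ord x' x e he b h2 hxe' h4' hxe h4 (not_le.1 hcon)) (not_lt.2 h7)

lemma sweepType_between (h : CellFamily R L A) {x w x' : ℝ} (hxx : sweepType R x = sweepType R x')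
    (h1 : x ≤ w) (h2 : w ≤ x') : sweepType R w = sweepType R x := by
  have key : ∀ C ∈ R, ((x ∈ Prod.fst '' C) ↔ (x' ∈ Prod.fst '' C)) ∧
      ((∃ a ∈ Prod.fst '' C, a ≤ x) ↔ (∃ a ∈ Prod.fst '' C, a ≤ x')) := by
    intro C hC
    have e1 := congrArg (fun q => C ∈ q.1) hxx
    have e2 := congrArg (fun q => C ∈ q.2) hxx
    simp only [sweepType, mem_filter, hC, true_and, eq_iff_iff] at e1 e2
    exact ⟨e1, e2⟩
  have hoc : ∀ C ∈ R, (Prod.fst '' C).OrdConnected := fun C hC =>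
    Wall.act_ordConnected_of h.cell (.cell C) (cell_mem_walls.2 hC)
  refine Prod.ext ?_ ?_
  · refine filter_congr fun C hC => ⟨fun hw => ?_, fun hx => ?_⟩
    · obtain ⟨a, ha, hax⟩ := (key C hC).2.2 ⟨w, hw, h2⟩
      exact (hoc C hC).out ha hw ⟨hax, h1⟩
    · exact (hoc C hC).out hx ((key C hC).1.1 hx) ⟨h1, h2⟩
  · refine filter_congr fun C hC => ⟨fun hw => ?_, fun hx => ?_⟩
    · obtain ⟨a, ha, haw⟩ := hw
      exact (key C hC).2.2 ⟨a, ha, haw.trans h2⟩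
    · obtain ⟨a, ha, haw⟩ := hx
      exact ⟨a, ha, haw.trans h1⟩

lemma exists_samples (R : Finset (Set (ℝ × ℝ))) :
    ∃ S : Finset ℝ, ∀ x, ∃ s ∈ S, sweepType R s = sweepType R x := by
  have hfin : (Set.range (sweepType R)).Finite := by
    refine ((R.powerset ×ˢ R.powerset).finite_toSet).subset ?_
    rintro _ ⟨x, rfl⟩
    rw [mem_coe, mem_product, mem_powerset, mem_powerset]
    exact ⟨filter_subset _ _, filter_subset _ _⟩
  have hf : ∀ t ∈ hfin.toFinset, ∃ x, sweepType R x = t := fun t ht => by simpa using ht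
  choose! f hf using hf
  refine ⟨hfin.toFinset.image f, fun x => ⟨f (sweepType R x), ?_, ?_⟩⟩
  · exact mem_image_of_mem _ (by simp)
  · exact hf _ (by simp)

lemma exists_birth (h : CellFamily R L A) {S : Finset ℝ}
    (hS : ∀ x, ∃ s ∈ S, sweepType R s = sweepType R x) {x : ℝ} {c b : Wall}
    (hx : x ∈ slab R c b) : ∃ x₀ ∈ S, x₀ ∈ (slab R c b).ordConnectedComponent x ∧
      ∀ y, Pred S x₀ y → y ∉ slab R c b := by
  have conv : ∀ {u v : ℝ}, sweepType R u = sweepType R v → u ∈ slab R c b →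
      Set.uIcc u v ⊆ slab R c b := by
    intro u v huv hu w hw
    rcases le_total u v with hle | hle
    · rw [Set.uIcc_of_le hle] at hw
      exact h.cons_congr (h.sweepType_between huv hw.1 hw.2).symm hu
    · rw [Set.uIcc_of_ge hle] at hw
      exact h.cons_congr ((h.sweepType_between huv.symm hw.1 hw.2).trans huv.symm).symm hu
  set J := (slab R c b).ordConnectedComponent x with hJ
  have hne : (S.filter fun s => s ∈ J).Nonempty := by
    obtain ⟨s, hs, hsx⟩ := hS x
    refine ⟨s, mem_filter.2 ⟨hs, ?_⟩⟩
    rw [hJ, Set.mem_ordConnectedComponent]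
    exact conv hsx.symm hx
  obtain ⟨x₀, hx₀, hmin⟩ := exists_min_image _ id hne
  rw [mem_filter] at hx₀
  refine ⟨x₀, hx₀.1, hx₀.2, fun y hy hyc => ?_⟩
  have hx₀c : x₀ ∈ slab R c b := Set.ordConnectedComponent_subset hx₀.2
  have hsub : Set.uIcc x₀ y ⊆ slab R c b := by
    rw [Set.uIcc_of_ge hy.2.1.le]
    intro w hw
    obtain ⟨s, hs, hsw⟩ := hS w
    rcases lt_or_ge s x₀ with hlt | hge
    · have hsy := hy.2.2 s hs hlt
      exact h.cons_congr ((h.sweepType_between hsw hsy hw.1).trans hsw) hyc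
    · exact h.cons_congr (h.sweepType_between hsw.symm hw.2 hge) hx₀c
  have hyJ : y ∈ J := by
    have e := Set.ordConnectedComponent_eq (Set.mem_ordConnectedComponent.1 hx₀.2)
    rw [hJ, e]
    exact Set.mem_ordConnectedComponent.2 hsub
  exact absurd (hmin y (mem_filter.2 ⟨hy.1, hyJ⟩)) (not_le.2 hy.2.1)

end CellFamily

/-- Vertical decomposition of the complement of disjoint cells. -/
theorem exists_vertical_decomposition (R : Finset (Set (ℝ × ℝ))) (hcell : ∀ C ∈ R, IsCell C)
    (hdisj : ∀ C ∈ R, ∀ D ∈ R, C ≠ D → Disjoint C D) :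
    ∃ (R' : Finset (Set (ℝ × ℝ))) (d : Set (ℝ × ℝ) → Option (Set (ℝ × ℝ))),
      R'.card ≤ 3 * R.card + 1 ∧ (∀ K ∈ R', IsCell K ∧ K.Nonempty) ∧
      (∀ K ∈ R', ∀ C ∈ R, Disjoint K C) ∧ (∀ K ∈ R', ∀ K' ∈ R', K ≠ K' → Disjoint K K') ∧
      (∀ z, (∃ C ∈ R, z ∈ C) ∨ ∃ K ∈ R', z ∈ K) ∧
      (∀ K ∈ R', ∀ C, d K = some C → C ∈ R ∧ cellGraph.Adj K C) ∧
      (∀ B ∈ R, ∀ x y y', (x, y) ∈ B → y < y' →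
        (∀ s, y < s → s < y' → ∀ C ∈ R, (x, s) ∉ C) →
        ∃ K ∈ R', d K = some B ∧ ∀ s, y < s → s < y' → (x, s) ∈ K) := by
  have hs : ∀ C, ∃ L A : Set (ℝ × ℝ), C ∈ R →
      Up L ∧ Up A ∧ ∀ z, z ∈ C ↔ z.1 ∈ Prod.fst '' C ∧ z ∈ L ∧ z ∉ A := by
    intro C
    by_cases hC : C ∈ R
    · obtain ⟨L, A, h⟩ := (hcell C hC).exists_sides
      exact ⟨L, A, fun _ => h⟩
    · exact ⟨∅, ∅, fun h => absurd h hC⟩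
  choose L A hLA using hs
  have h : CellFamily R L A := ⟨hcell, hdisj, fun C hC => (hLA C hC).1, fun C hC => (hLA C hC).2.1,
    fun C hC => (hLA C hC).2.2⟩
  obtain ⟨S, hS⟩ := CellFamily.exists_samples R
  set births := (S ×ˢ walls R ×ˢ walls R).filter fun q =>
    Cons (walls R) Wall.act Wall.height q.1 q.2.1 q.2.2 ∧
      ∀ y, Pred S q.1 y → ¬ Cons (walls R) Wall.act Wall.height y q.2.1 q.2.2 with hbirths
  let K : ℝ × Wall × Wall → Set (ℝ × ℝ) := fun q => gapCell R L A q.1 q.2.1 q.2.2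
  let R' := (births.filter fun q => (K q).Nonempty).image K
  have hR' : ∀ Q, Q ∈ R' ↔ ∃ q ∈ births, (K q).Nonempty ∧ K q = Q := by
    intro Q
    simp only [R', mem_image, mem_filter, and_assoc]
  let d : Set (ℝ × ℝ) → Option (Set (ℝ × ℝ)) := fun Q =>
    if hq : ∃ q ∈ births, (K q).Nonempty ∧ K q = Q then
      (match hq.choose.2.1 with
      | .bot => none
      | .top => none
      | .cell C => some C)
    else none
  have hd : ∀ q ∈ births, (K q).Nonempty → d (K q) = (match q.2.1 with
      | .bot => none
      | .top => none
      | .cell C => some C) := by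
    intro q hq hne
    have hex : ∃ q' ∈ births, (K q').Nonempty ∧ K q' = K q := ⟨q, hq, hne, rfl⟩
    have e : hex.choose.2.1 = q.2.1 := by
      obtain ⟨z, hz⟩ := hne
      have hz' := hz
      rw [← hex.choose_spec.2.2] at hz'
      exact (h.gapCell_eq hz' hz).1
    simp only [d, dif_pos hex, e]
  have hmemb : ∀ q ∈ births, q.2.1 ∈ walls R ∧ q.2.2 ∈ walls R := by
    intro q hq
    rw [hbirths, mem_filter, mem_product, mem_product] at hq
    exact hq.1.2
  have hcov : ∀ x s, (∀ C ∈ R, (x, s) ∉ C) → ∃ q ∈ births, (x, s) ∈ K q ∧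
      x ∈ (slab R q.2.1 q.2.2).ordConnectedComponent q.1 ∧
      x ∈ slab R q.2.1 q.2.2 ∧ q.2.1.height x < s ∧ (s : EReal) < q.2.2.height x := by
    intro x s hz
    obtain ⟨c, b, h1, h2, h3, h4, h5⟩ := h.exists_cons hz
    obtain ⟨x₀, hx₀, hx₀J, hpred⟩ := h.exists_birth hS h1
    have hx : x ∈ (slab R c b).ordConnectedComponent x₀ := by
      rw [Set.mem_ordConnectedComponent] at hx₀J ⊢
      rwa [Set.uIcc_comm]
    refine ⟨(x₀, c, b), ?_, ⟨hx, h4, h5⟩, hx, h1, h2, h3⟩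
    rw [hbirths, mem_filter, mem_product, mem_product]
    have hx₀c : x₀ ∈ slab R c b := Set.ordConnectedComponent_subset hx₀J
    exact ⟨⟨hx₀, h1.1, h1.2.1⟩, hx₀c, hpred⟩
  refine ⟨R', d, ?_, ?_, ?_, ?_, ?_, ?_, ?_⟩
  · refine card_image_le.trans ((card_filter_le _ _).trans ?_)
    refine (?_ : births.card ≤ 3 * (R.image Wall.cell).card + 1).trans
      (Nat.add_le_add_right (Nat.mul_le_mul_left 3 card_image_le) 1)
    let act' : Wall → Set ℝ := fun e => if e ∈ walls R then e.act else ∅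
    have hact' : ∀ e ∈ walls R, act' e = e.act := fun e he => if_pos he
    have := card_births (T := R.image Wall.cell) (bot := .bot) (top := .top) (act := act')
      (H := Wall.height) (fun e => by
        by_cases he : e ∈ walls R
        · rw [hact' e he]
          exact Wall.act_ordConnected_of hcell e he
        · simp only [act', if_neg he]
          exact Set.ordConnected_empty)
      (hact' _ (mem_walls.2 (.inl rfl))) (hact' _ (mem_walls.2 (.inr (.inl rfl))))
      (fun x => by simp [Wall.height])
      (fun x e he f hf h1 h2 => h.height_inj x e he f hf (by rwa [hact' e he] at h1)
        (by rwa [hact' f hf] at h2))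
      (fun x y e he f hf h1 h2 h3 h4 => h.height_ord x y e he f hf (by rwa [hact' e he] at h1)
        (by rwa [hact' f hf] at h2) (by rwa [hact' e he] at h3) (by rwa [hact' f hf] at h4)) S
    have hcons : ∀ x c b, Cons (walls R) act' Wall.height x c b ↔
        Cons (walls R) Wall.act Wall.height x c b := by
      intro x c b
      unfold Cons
      constructor
      · rintro ⟨h1, h2, h3, h4, h5, h6⟩
        rw [hact' c h1] at h3
        rw [hact' b h2] at h4
        exact ⟨h1, h2, h3, h4, h5, fun e he hx => h6 e he (by rwa [hact' e he])⟩
      · rintro ⟨h1, h2, h3, h4, h5, h6⟩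
        rw [← hact' c h1] at h3
        rw [← hact' b h2] at h4
        exact ⟨h1, h2, h3, h4, h5, fun e he hx => h6 e he (by rwa [hact' e he] at hx)⟩
    change ((S ×ˢ walls R ×ˢ walls R).filter fun q =>
      Cons (walls R) act' Wall.height q.1 q.2.1 q.2.2 ∧
        ∀ y, Pred S q.1 y → ¬ Cons (walls R) act' Wall.height y q.2.1 q.2.2).card ≤ _ at this
    simpa only [hcons] using this
  · intro Q hQ
    obtain ⟨q, hq, hne, rfl⟩ := (hR' Q).1 hQ
    exact ⟨h.isCell_gapCell (hmemb q hq).1 (hmemb q hq).2, hne⟩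
  · intro Q hQ C hC
    obtain ⟨q, hq, hne, rfl⟩ := (hR' Q).1 hQ
    exact h.gapCell_disjoint hC
  · intro Q hQ Q' hQ' hQQ
    obtain ⟨q, hq, hne, rfl⟩ := (hR' Q).1 hQ
    obtain ⟨q', hq', hne', rfl⟩ := (hR' Q').1 hQ'
    rw [Set.disjoint_left]
    intro z hz hz'
    exact hQQ (h.gapCell_eq hz hz').2
  · rintro ⟨x, s⟩
    by_cases hz : ∃ C ∈ R, (x, s) ∈ C
    · exact Or.inl hz
    · push Not at hz
      obtain ⟨q, hq, hqz, -⟩ := hcov x s hz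
      exact Or.inr ⟨K q, (hR' _).2 ⟨q, hq, ⟨_, hqz⟩, rfl⟩, hqz⟩
  · intro Q hQ C hC
    obtain ⟨q, hq, hne, rfl⟩ := (hR' Q).1 hQ
    rw [hd q hq hne] at hC
    obtain ⟨x, c, b⟩ := q
    cases c with
    | bot => simp at hC
    | top => simp at hC
    | cell D =>
      obtain rfl : D = C := by simpa using hC
      have hD := cell_mem_walls.1 (hmemb _ hq).1
      exact ⟨hD, h.adj_gapCell hD hne (hmemb _ hq).2⟩
  · intro B hB x y y' hy hyy hgap
    obtain ⟨s₀, hs₀, hs₀'⟩ := exists_between hyy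
    obtain ⟨q, hq, hqz, hxJ, hx, h1, h2⟩ := hcov x s₀ (hgap s₀ hs₀ hs₀')
    have hBx : x ∈ (Wall.cell B).act := ⟨_, hy, rfl⟩
    obtain ⟨v, hv, e1⟩ := Wall.exists_height hBx
    have hv₀ : v < s₀ := by
      by_contra hle
      exact hgap s₀ hs₀ hs₀' B hB (h.vert hB hy hv hs₀.le (not_lt.1 hle))
    obtain ⟨x₀, c, b⟩ := q
    dsimp only at hxJ hx h1 h2
    have hcB : c = .cell B := by
      have hle : (Wall.cell B).height x ≤ c.height x := by
        by_contra hlt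
        have h3 := hx.2.2.2.2.2 _ (cell_mem_walls.2 hB) hBx (not_le.1 hlt)
        have h4 := h2.trans_le h3
        rw [e1, EReal.coe_lt_coe_iff] at h4
        exact absurd h4 (not_lt.2 hv₀.le)
      rw [e1] at hle
      rcases mem_walls.1 hx.1 with rfl | rfl | ⟨C, hC, rfl⟩
      · exact absurd hle (not_le.2 (EReal.bot_lt_coe v))
      · exact absurd h1 (by simp [Wall.height])
      · obtain ⟨u, hu, e2⟩ := Wall.exists_height hx.2.2.1
        rw [e2, EReal.coe_le_coe_iff] at hle
        rw [e2, EReal.coe_lt_coe_iff] at h1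
        rcases le_or_gt u y with huy | huy
        · rw [h.eq_of_mem hC hB hu (h.vert hB hv hy hle huy)]
        · exact absurd hu (hgap u huy (h1.trans hs₀') C hC)
    subst hcB
    refine ⟨_, (hR' _).2 ⟨_, hq, ⟨_, hqz⟩, rfl⟩, hd _ hq ⟨_, hqz⟩, fun s hs1 hs2 => ?_⟩
    refine ⟨hxJ, h.mem_upper hB hy hs1.le (hgap s hs1 hs2 B hB), fun hup => ?_⟩
    dsimp only at hup
    rcases mem_walls.1 hx.2.1 with rfl | rfl | ⟨C, hC, rfl⟩
    · exact absurd h2 (by simp [Wall.height])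
    · exact hup
    · obtain ⟨u, hu, e2⟩ := Wall.exists_height hx.2.2.2.1
      rw [e2, EReal.coe_lt_coe_iff] at h2
      have hu' : y' ≤ u := by
        by_contra hlt
        exact hgap u (hs₀.trans h2) (not_le.1 hlt) C hC hu
      exact h.notMem_lower hC hu (hs2.le.trans hu') (hgap s hs1 hs2 C hC) hup

end Decomposition

section Partition

/-- A finite partition of the plane into nonempty cells. -/
structure IsCellPartition (𝒦 : Finset (Set (ℝ × ℝ))) : Prop where
  cell : ∀ K ∈ 𝒦, IsCell K
  nonempty : ∀ K ∈ 𝒦, K.Nonempty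
  disj : ∀ K ∈ 𝒦, ∀ K' ∈ 𝒦, K ≠ K' → Disjoint K K'
  cover : ∀ z, ∃ K ∈ 𝒦, z ∈ K

/-- If a segment covered by `C ∪ ...` accumulates from `D` to a point of `C`, then `C`, `D` are
adjacent. -/
lemma adj_of_mem_closure {C D : Set (ℝ × ℝ)} (hD : Convex ℝ D) (hCD : Disjoint C D)
    {a b : ℝ × ℝ} {u : ℝ} (hu : AffineMap.lineMap a b u ∈ C)
    (hcl : u ∈ closure {t : ℝ | AffineMap.lineMap a b t ∈ D}) : cellGraph.Adj C D := by
  have hconv : Convex ℝ {t : ℝ | AffineMap.lineMap a b t ∈ D} :=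
    hD.affine_preimage (AffineMap.lineMap a b : ℝ →ᵃ[ℝ] ℝ × ℝ)
  obtain ⟨j, hj⟩ : {t : ℝ | AffineMap.lineMap a b t ∈ D}.Nonempty :=
    closure_nonempty_iff.1 ⟨u, hcl⟩
  refine ⟨fun h => Set.disjoint_left.1 hCD (h ▸ hj) hj, _, hu, _, hj, ?_⟩
  rw [← image_segment, segment_eq_uIcc]
  rintro _ ⟨w, hw, rfl⟩
  rcases eq_or_ne w u with rfl | hwu
  · exact Or.inl hu
  right
  have hoc := hconv.ordConnected
  rcases le_total u j with hle | hle
  · rw [Set.uIcc_of_le hle] at hw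
    have huw : u < w := lt_of_le_of_ne hw.1 hwu.symm
    obtain ⟨v, hv1, hv2⟩ := mem_closure_iff.1 hcl (Set.Iio w) isOpen_Iio huw
    exact hoc.out hv2 hj ⟨le_of_lt hv1, hw.2⟩
  · rw [Set.uIcc_of_ge hle] at hw
    have huw : w < u := lt_of_le_of_ne hw.2 hwu
    obtain ⟨v, hv1, hv2⟩ := mem_closure_iff.1 hcl (Set.Ioi w) isOpen_Ioi huw
    exact hoc.out hj hv2 ⟨hw.1, le_of_lt hv1⟩

/-- A segment covered by two families of convex sets without adjacencies stays in one of them. -/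
lemma segment_side {A B : Finset (Set (ℝ × ℝ))} (hA : ∀ C ∈ A, Convex ℝ C)
    (hB : ∀ C ∈ B, Convex ℝ C) (hAB : ∀ C ∈ A, ∀ D ∈ B, Disjoint C D)
    (hadj : ∀ C ∈ A, ∀ D ∈ B, ¬ cellGraph.Adj C D) {a b : ℝ × ℝ}
    (hs : ∀ z ∈ segment ℝ a b, ∃ C ∈ A ∪ B, z ∈ C) (ha : ∃ C ∈ A, a ∈ C) :
    ∃ C ∈ A, b ∈ C := by
  by_contra hb
  let f : ℝ → ℝ × ℝ := AffineMap.lineMap a b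
  let s : Finset (Set (ℝ × ℝ)) → Set ℝ := fun F => ⋃ C ∈ F, {t | f t ∈ C}
  have hf : ∀ t ∈ Set.Icc (0 : ℝ) 1, f t ∈ segment ℝ a b := by
    intro t ht
    rw [segment_eq_image_lineMap]
    exact ⟨t, ht, rfl⟩
  have hcov : ∀ t ∈ Set.Icc (0 : ℝ) 1, t ∈ s A ∨ t ∈ s B := by
    intro t ht
    obtain ⟨C, hC, hz⟩ := hs _ (hf t ht)
    rcases mem_union.1 hC with hC | hC
    · exact Or.inl (Set.mem_biUnion hC hz)
    · exact Or.inr (Set.mem_biUnion hC hz)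
  have h0 : (0 : ℝ) ∈ s A := by
    obtain ⟨C, hC, hz⟩ := ha
    exact Set.mem_biUnion hC (by simpa [f] using hz)
  have h1 : (1 : ℝ) ∈ s B := by
    rcases hcov 1 (by simp) with h | h
    · simp only [s, Set.mem_iUnion] at h
      obtain ⟨C, hC, hz⟩ := h
      exact absurd ⟨C, hC, by simpa [f] using hz⟩ hb
    · exact h
  obtain ⟨u, hu, hu1, hu2⟩ := isPreconnected_closed_iff.1 (isPreconnected_Icc (a :=
      (0 : ℝ)) (b := 1))
    (closure (s A)) (closure (s B)) isClosed_closure isClosed_closure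
    (fun t ht => (hcov t ht).imp (fun h => subset_closure h) (fun h => subset_closure h))
    ⟨0, by simp, subset_closure h0⟩ ⟨1, by simp, subset_closure h1⟩
  have hcl : ∀ F : Finset (Set (ℝ × ℝ)), u ∈ closure (s F) → ∃ D ∈ F, u ∈ closure {t | f t ∈ D} := by
    intro F h
    have : closure (s F) = ⋃ C ∈ F, closure {t | f t ∈ C} := F.closure_biUnion _
    rw [this] at h
    simpa only [Set.mem_iUnion, exists_prop] using h
  rcases hcov u hu with h | h
  · obtain ⟨D, hD, hDu⟩ := hcl B hu2
    simp only [s, Set.mem_iUnion] at h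
    obtain ⟨C, hC, hz⟩ := h
    exact hadj C hC D hD (adj_of_mem_closure (hB D hD) (hAB C hC D hD) hz hDu)
  · obtain ⟨C, hC, hCu⟩ := hcl A hu1
    simp only [s, Set.mem_iUnion] at h
    obtain ⟨D, hD, hz⟩ := h
    exact hadj C hC D hD (adj_of_mem_closure (hA C hC) (hAB C hC D hD).symm hz hCu).symm

lemma drawn_cellGraph {𝒦 : Finset (Set (ℝ × ℝ))} (hne : ∀ K ∈ 𝒦, K.Nonempty)
    (hconv : ∀ K ∈ 𝒦, Convex ℝ K) (hdisj : ∀ K ∈ 𝒦, ∀ K' ∈ 𝒦, K ≠ K' → Disjoint K K') :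
    Drawn cellGraph 𝒦 := by
  let c : Set (ℝ × ℝ) → ℝ × ℝ := fun K => if h : K.Nonempty then h.some else 0
  have hc : ∀ K ∈ 𝒦, c K ∈ K := fun K hK => by
    simp only [c, dif_pos (hne K hK)]
    exact (hne K hK).some_mem
  have hseg : ∀ (D : Set (ℝ × ℝ)) (p q : ℝ × ℝ), segment ℝ p q ⊆ D → Joined D p q := by
    intro D p q h
    refine ⟨[q], by simp, ?_⟩
    rw [curve_cons, curve_singleton]
    exact Set.union_subset h (by simpa using h (right_mem_segment ℝ p q))
  refine ⟨c, fun K K' => K ∪ K', ?_, ?_⟩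
  · rintro K hK K' hK' ⟨-, a, ha, b, hb, hs⟩
    have h1 := hseg (K ∪ K') _ _ (((hconv K hK).segment_subset (hc K hK) ha).trans
      Set.subset_union_left)
    have h3 := hseg (K ∪ K') _ _ (((hconv K' hK').segment_subset hb (hc K' hK')).trans
      Set.subset_union_right)
    exact (h1.trans (hseg _ _ _ hs)).trans h3
  · intro K hK K' hK' D hD D' hD' _ _ h1 h2 h3 h4
    exact Set.disjoint_union_left.2 ⟨Set.disjoint_union_right.2 ⟨hdisj _ hK _ hD h1,
      hdisj _ hK _ hD' h2⟩, Set.disjoint_union_right.2 ⟨hdisj _ hK' _ hD h3, hdisj _ hK' _ hD' h4⟩⟩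

lemma IsCellPartition.minorFree {𝒦 : Finset (Set (ℝ × ℝ))} (h : IsCellPartition 𝒦) :
    MinorFree cellGraph 𝒦 :=
  (drawn_cellGraph h.nonempty (fun K hK => (h.cell K hK).convex) h.disj).minorFree

lemma IsCellPartition.eq_of_mem {𝒦 : Finset (Set (ℝ × ℝ))} (h : IsCellPartition 𝒦)
    {C D : Set (ℝ × ℝ)} (hC : C ∈ 𝒦) (hD : D ∈ 𝒦) {z : ℝ × ℝ} (h1 : z ∈ C) (h2 : z ∈ D) :
    C = D := by
  by_contra hne
  exact Set.disjoint_left.1 (h.disj C hC D hD hne) h1 h2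

/-- The union of a family of cells. -/
def region (F : Finset (Set (ℝ × ℝ))) : Set (ℝ × ℝ) := {z | ∃ K ∈ F, z ∈ K}

/-- Replacing one side of a separator by few cells. -/
lemma IsCellPartition.exists_sides {𝒦 S A B : Finset (Set (ℝ × ℝ))} (h : IsCellPartition 𝒦)
    (hS : S ⊆ 𝒦) (hABd : Disjoint A B) (hAB : A ∪ B = 𝒦 \ S)
    (hadj : ∀ a ∈ A, ∀ b ∈ B, ¬ cellGraph.Adj a b) :
    ∃ VA VB : Finset (Set (ℝ × ℝ)), VA.card ≤ 3 * S.card + 1 ∧ VB.card ≤ 3 * S.card + 1 ∧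
      region VA = region A ∧ region VB = region B ∧ IsCellPartition (S ∪ VA ∪ VB) ∧
      (S ∪ VA ∪ VB).card ≤ 4 * S.card + 1 ∧
      IsCellPartition (A ∪ S ∪ VB) ∧ IsCellPartition (B ∪ S ∪ VA) := by
  obtain ⟨R', -, hcard, hcell, hdS, hdd, hcov, -, -⟩ := exists_vertical_decomposition S
    (fun C hC => h.cell C (hS hC)) (fun C hC D hD => h.disj C (hS hC) D (hS hD))
  have hA𝒦 : ∀ K ∈ A, K ∈ 𝒦 ∧ K ∉ S := fun K hK => mem_sdiff.1 (hAB ▸ mem_union_left B hK)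
  have hB𝒦 : ∀ K ∈ B, K ∈ 𝒦 ∧ K ∉ S := fun K hK => mem_sdiff.1 (hAB ▸ mem_union_right A hK)
  have hdis : ∀ C ∈ A, ∀ D ∈ B, Disjoint C D := fun C hC D hD =>
    h.disj C (hA𝒦 C hC).1 D (hB𝒦 D hD).1 fun e => disjoint_left.1 hABd hC (e ▸ hD)
  have hcovAB : ∀ K ∈ R', ∀ z ∈ K, ∃ C ∈ A ∪ B, z ∈ C := by
    intro K hK z hz
    obtain ⟨C, hC, hzC⟩ := h.cover z
    by_cases hCS : C ∈ S
    · exact absurd hzC (Set.disjoint_left.1 (hdS K hK C hCS) hz)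
    · exact ⟨C, hAB ▸ mem_sdiff.2 ⟨hC, hCS⟩, hzC⟩
  have hcA : ∀ C ∈ A, Convex ℝ C := fun C hC => (h.cell C (hA𝒦 C hC).1).convex
  have hcB : ∀ C ∈ B, Convex ℝ C := fun C hC => (h.cell C (hB𝒦 C hC).1).convex
  have hdAB : ∀ z, z ∈ region A → z ∈ region B → False := by
    rintro z ⟨C, hC, hz⟩ ⟨D, hD, hz'⟩
    exact Set.disjoint_left.1 (hdis C hC D hD) hz hz'
  have hside : ∀ K ∈ R', (∀ z ∈ K, z ∈ region A) ∨ ∀ z ∈ K, z ∈ region B := by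
    intro K hK
    obtain ⟨z, hz⟩ := (hcell K hK).2
    have hseg : ∀ w ∈ K, segment ℝ z w ⊆ K := fun w hw => (hcell K hK).1.convex.segment_subset hz hw
    obtain ⟨C, hC, hzC⟩ := hcovAB K hK z hz
    rcases mem_union.1 hC with hC | hC
    · left
      intro w hw
      exact segment_side hcA hcB hdis hadj (fun v hv => hcovAB K hK v (hseg w hw hv)) ⟨C, hC, hzC⟩
    · right
      intro w hw
      exact segment_side hcB hcA (fun C hC D hD => (hdis D hD C hC).symm)
        (fun C hC D hD hh => hadj D hD C hC hh.symm)
        (fun v hv => by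
          rw [union_comm]
          exact hcovAB K hK v (hseg w hw hv)) ⟨C, hC, hzC⟩
  have hregS : ∀ z, z ∈ region S → z ∉ region A ∧ z ∉ region B := by
    rintro z ⟨C, hC, hz⟩
    constructor
    · rintro ⟨D, hD, hz'⟩
      have := h.eq_of_mem (hS hC) (hA𝒦 D hD).1 hz hz'
      exact (hA𝒦 D hD).2 (this ▸ hC)
    · rintro ⟨D, hD, hz'⟩
      have := h.eq_of_mem (hS hC) (hB𝒦 D hD).1 hz hz'
      exact (hB𝒦 D hD).2 (this ▸ hC)
  set VA := R'.filter fun K => ∀ z ∈ K, z ∈ region A with hVA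
  set VB := R'.filter fun K => ∀ z ∈ K, z ∈ region B with hVB
  have hregA : region VA = region A := by
    ext z
    constructor
    · rintro ⟨K, hK, hz⟩
      exact (mem_filter.1 hK).2 z hz
    · intro hz
      rcases hcov z with hzS | ⟨K, hK, hzK⟩
      · exact absurd hz (hregS z hzS).1
      · rcases hside K hK with h1 | h1
        · exact ⟨K, mem_filter.2 ⟨hK, h1⟩, hzK⟩
        · exact absurd (h1 z hzK) fun h2 => hdAB z hz h2
  have hregB : region VB = region B := by
    ext z
    constructor
    · rintro ⟨K, hK, hz⟩
      exact (mem_filter.1 hK).2 z hz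
    · intro hz
      rcases hcov z with hzS | ⟨K, hK, hzK⟩
      · exact absurd hz (hregS z hzS).2
      · rcases hside K hK with h1 | h1
        · exact absurd (h1 z hzK) fun h2 => hdAB z h2 hz
        · exact ⟨K, mem_filter.2 ⟨hK, h1⟩, hzK⟩
  have hVAR : VA ⊆ R' := filter_subset _ _
  have hVBR : VB ⊆ R' := filter_subset _ _
  have hall : ∀ z, z ∈ region S ∨ z ∈ region A ∨ z ∈ region B := by
    intro z
    obtain ⟨C, hC, hz⟩ := h.cover z
    by_cases hCS : C ∈ S
    · exact Or.inl ⟨C, hCS, hz⟩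
    · have : C ∈ A ∪ B := hAB ▸ mem_sdiff.2 ⟨hC, hCS⟩
      rcases mem_union.1 this with h1 | h1
      · exact Or.inr (Or.inl ⟨C, h1, hz⟩)
      · exact Or.inr (Or.inr ⟨C, h1, hz⟩)
  have mk : ∀ E V : Finset (Set (ℝ × ℝ)), E ⊆ 𝒦 → V ⊆ R' →
      (∀ z, z ∈ region E → z ∉ region V) → (∀ z, z ∈ region E ∨ z ∈ region V) →
      IsCellPartition (E ∪ V) := by
    intro E V hE hV hd hc
    have hd' : ∀ K ∈ E, ∀ K' ∈ V, Disjoint K K' := fun K hK K' hK' =>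
      Set.disjoint_left.2 fun z hz hz' => hd z ⟨K, hK, hz⟩ ⟨K', hK', hz'⟩
    refine ⟨?_, ?_, ?_, ?_⟩
    · intro K hK
      rcases mem_union.1 hK with hK | hK
      exacts [h.cell K (hE hK), (hcell K (hV hK)).1]
    · intro K hK
      rcases mem_union.1 hK with hK | hK
      exacts [h.nonempty K (hE hK), (hcell K (hV hK)).2]
    · intro K hK K' hK' hne
      rcases mem_union.1 hK with hK | hK <;> rcases mem_union.1 hK' with hK' | hK'
      · exact h.disj K (hE hK) K' (hE hK') hne
      · exact hd' K hK K' hK'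
      · exact (hd' K' hK' K hK).symm
      · exact hdd K (hV hK) K' (hV hK') hne
    · intro z
      rcases hc z with ⟨K, hK, hz⟩ | ⟨K, hK, hz⟩
      exacts [⟨K, mem_union_left _ hK, hz⟩, ⟨K, mem_union_right _ hK, hz⟩]
  have hunion : ∀ E F : Finset (Set (ℝ × ℝ)), ∀ z, z ∈ region (E ∪ F) ↔ z ∈ region E ∨ z ∈ region F := by
    intro E F z
    simp only [region, Set.mem_ofPred_eq, mem_union, or_and_right, exists_or]
  have hVAB : VA ∪ VB ⊆ R' := union_subset hVAR hVBR
  refine ⟨VA, VB, (card_le_card hVAR).trans hcard, (card_le_card hVBR).trans hcard, hregA, hregB,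
    ?_, ?_, ?_, ?_⟩
  · rw [union_assoc]
    refine mk _ _ hS hVAB (fun z hz => ?_) fun z => ?_
    · rw [hunion, hregA, hregB]
      exact fun h1 => h1.elim (hregS z hz).1 (hregS z hz).2
    · rw [hunion, hregA, hregB]
      exact hall z
  · rw [union_assoc]
    have := card_le_card hVAB
    refine (card_union_le _ _).trans ?_
    omega
  · refine mk _ _ (union_subset (fun K hK => (hA𝒦 K hK).1) hS) hVBR (fun z hz => ?_) fun z => ?_
    · rw [hregB]
      exact ((hunion _ _ z).1 hz).elim (fun h1 h2 => hdAB z h1 h2) fun h1 => (hregS z h1).2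
    · rw [hunion, hregB]
      have := hall z
      tauto
  · refine mk _ _ (union_subset (fun K hK => (hB𝒦 K hK).1) hS) hVAR (fun z hz => ?_) fun z => ?_
    · rw [hregA]
      exact ((hunion _ _ z).1 hz).elim (fun h1 h2 => hdAB z h2 h1) fun h1 => (hregS z h1).1
    · rw [hunion, hregA]
      have := hall z
      tauto

end Partition

section Traces

/-- Subsets of `P` cut out by convex sets with convex complement. -/
lemma card_halfplane_traces (P : Finset (ℝ × ℝ)) :
    (P.powerset.filter fun Q => ∃ H : Set (ℝ × ℝ), Convex ℝ H ∧ Convex ℝ Hᶜ ∧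
      Q = P.filter (· ∈ H)).card ≤ (P.card + 1) ^ 3 := by
  refine (card_le_card_shatterer _).trans (le_trans (card_le_card fun s hs => ?_)
    (card_small_subsets P 3))
  rw [mem_shatterer] at hs
  obtain ⟨t, ht, hst⟩ := hs.exists_superset
  rw [mem_filter, mem_powerset] at ht ⊢
  refine ⟨hst.trans ht.1, ?_⟩
  by_contra hcard
  have hdep : ¬ AffineIndependent ℝ (fun x : s => (x : ℝ × ℝ)) := by
    intro hind
    have h1 := hind.card_le_finrank_succ
    have h2 : Module.finrank ℝ (vectorSpan ℝ (Set.range fun x : s => (x : ℝ × ℝ))) ≤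
        Module.finrank ℝ (ℝ × ℝ) := Submodule.finrank_le _
    rw [Fintype.card_coe] at h1
    simp at h2
    omega
  obtain ⟨I, p, hp1, hp2⟩ := Convex.radon_partition hdep
  obtain ⟨u, hu, hsu⟩ := hs.subset_iff.1 (filter_subset (fun x => ∃ h : x ∈ s, (⟨x, h⟩ : s) ∈ I) s)
  obtain ⟨-, H, hH1, hH2, rfl⟩ := mem_filter.1 hu
  have key : ∀ x : s, x ∈ I ↔ (x : ℝ × ℝ) ∈ H := by
    rintro ⟨x, hx⟩
    have := congrArg (fun q => x ∈ q) hsu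
    simp only [mem_inter, mem_filter, hx, true_and, ht.1 (hst hx), eq_iff_iff, exists_true_left]
      at this
    exact this.symm
  have m1 : p ∈ H := convexHull_min (by
    rintro _ ⟨x, hx, rfl⟩
    exact (key x).1 hx) hH1 hp1
  have m2 : p ∈ Hᶜ := convexHull_min (by
    rintro _ ⟨x, hx, rfl⟩
    exact fun h => hx ((key x).2 h)) hH2 hp2
  exact m2 m1

/-- Cells cut out polynomially many subsets. -/
lemma card_cell_traces (P : Finset (ℝ × ℝ)) :
    (P.powerset.filter fun Q => ∃ K, IsCell K ∧ Q = P.filter (· ∈ K)).card ≤ (P.card + 1) ^ 12 := by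
  set T := P.powerset.filter fun Q => ∃ H : Set (ℝ × ℝ), Convex ℝ H ∧ Convex ℝ Hᶜ ∧
    Q = P.filter (· ∈ H) with hT
  have hmem : ∀ H : Set (ℝ × ℝ), Convex ℝ H → Convex ℝ Hᶜ → P.filter (· ∈ H) ∈ T := fun H h1 h2 =>
    mem_filter.2 ⟨mem_powerset.2 (filter_subset _ _), H, h1, h2, rfl⟩
  have hpre : ∀ I : Set ℝ, I.OrdConnected → Convex ℝ (Prod.fst ⁻¹' I : Set (ℝ × ℝ)) := fun I hI =>
    hI.convex.is_linear_preimage (IsLinearMap.mk (fun _ _ => rfl) fun _ _ => rfl)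
  have hsub : (P.powerset.filter fun Q => ∃ K, IsCell K ∧ Q = P.filter (· ∈ K)) ⊆
      ((T ×ˢ T) ×ˢ (T ×ˢ T)).image fun q => (q.1.1 ∩ q.1.2) ∩ (q.2.1 ∩ q.2.2) := by
    intro Q hQ
    obtain ⟨-, K, ⟨I, L, A, hI, hL, hA, rfl⟩, rfl⟩ := mem_filter.1 hQ
    rw [mem_image]
    refine ⟨((P.filter (· ∈ Prod.fst ⁻¹' (upperClosure I : Set ℝ)),
      P.filter (· ∈ Prod.fst ⁻¹' (lowerClosure I : Set ℝ))), (P.filter (· ∈ L), P.filter (· ∈ Aᶜ))),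
      ?_, ?_⟩
    · simp only [mem_product]
      refine ⟨⟨hmem _ (hpre _ (upperClosure I).upper.ordConnected) ?_,
        hmem _ (hpre _ (lowerClosure I).lower.ordConnected) ?_⟩, hmem _ hL.1 hL.2.1,
        by convert hmem Aᶜ hA.2.1 (by rw [compl_compl]; exact hA.1)⟩
      · rw [← Set.preimage_compl]
        exact hpre _ (upperClosure I).upper.compl.ordConnected
      · rw [← Set.preimage_compl]
        exact hpre _ (lowerClosure I).lower.compl.ordConnected
    · have hIc := hI.upperClosure_inter_lowerClosure
      have hIc' : ∀ x, x ∈ I ↔ x ∈ (upperClosure I : Set ℝ) ∧ x ∈ (lowerClosure I : Set ℝ) := by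
        intro x
        conv_lhs => rw [← hIc]
        rfl
      ext z
      simp only [mem_inter, mem_filter, Set.mem_preimage, Set.mem_ofPred_eq, Set.mem_compl_iff,
          hIc']
      tauto
  refine (card_le_card hsub).trans (card_image_le.trans ?_)
  have h3 : T.card ≤ (P.card + 1) ^ 3 := card_halfplane_traces P
  simp only [card_product]
  calc T.card * T.card * (T.card * T.card)
      ≤ (P.card + 1) ^ 3 * (P.card + 1) ^ 3 * ((P.card + 1) ^ 3 * (P.card + 1) ^ 3) := by gcongr
    _ = (P.card + 1) ^ 12 := by ring

end Traces

section RegionTraces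

/-- Unions of at most `m` subsets of `P` cut out by cells. -/
def smallUnions (m : ℕ) (P : Finset (ℝ × ℝ)) : Finset (Finset (ℝ × ℝ)) :=
  ((P.powerset.filter fun Q => ∃ K, IsCell K ∧ Q = P.filter (· ∈ K)).powerset.filter
    fun S => S.card ≤ m).image fun S => S.biUnion id

lemma mem_smallUnions {m : ℕ} {P : Finset (ℝ × ℝ)} {F : Finset (Set (ℝ × ℝ))}
    (hF : ∀ K ∈ F, IsCell K) (hm : F.card ≤ m) : P.filter (· ∈ region F) ∈ smallUnions m P := by
  refine mem_image.2 ⟨F.image fun K => P.filter (· ∈ K), mem_filter.2 ⟨mem_powerset.2 ?_,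
    card_image_le.trans hm⟩, ?_⟩
  · intro Q hQ
    obtain ⟨K, hK, rfl⟩ := mem_image.1 hQ
    exact mem_filter.2 ⟨mem_powerset.2 (filter_subset _ _), K, hF K hK, rfl⟩
  · ext z
    rw [mem_biUnion, mem_filter]
    constructor
    · rintro ⟨Q, hQ, h2⟩
      obtain ⟨K, hK, rfl⟩ := mem_image.1 hQ
      obtain ⟨h1, h2⟩ := mem_filter.1 h2
      exact ⟨h1, K, hK, h2⟩
    · rintro ⟨h1, K, hK, h2⟩
      exact ⟨_, mem_image_of_mem _ hK, mem_filter.2 ⟨h1, h2⟩⟩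

lemma card_smallUnions (m : ℕ) (P : Finset (ℝ × ℝ)) :
    (smallUnions m P).card ≤ (P.card + 2) ^ (12 * m) := by
  refine card_image_le.trans ((card_small_subsets _ m).trans ?_)
  rw [pow_mul]
  refine Nat.pow_le_pow_left ?_ m
  have h1 := card_cell_traces P
  have h2 : (P.card + 1) ^ 12 < (P.card + 2) ^ 12 := Nat.pow_lt_pow_left (by omega) (by norm_num)
  omega

/-- Subsets of `P` cut out by unions of cells of a partition into `N` cells. -/
def regionTraces (N : ℕ) (P : Finset (ℝ × ℝ)) : Finset (Finset (ℝ × ℝ)) :=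
  P.powerset.filter fun Q => ∃ 𝒦, IsCellPartition 𝒦 ∧ 𝒦.card = N ∧
    ∃ F ⊆ 𝒦, Q = P.filter (· ∈ region F)

lemma mem_regionTraces {P : Finset (ℝ × ℝ)} {𝒦 F : Finset (Set (ℝ × ℝ))}
    (h : IsCellPartition 𝒦) (hF : F ⊆ 𝒦) :
    P.filter (· ∈ region F) ∈ regionTraces 𝒦.card P :=
  mem_filter.2 ⟨mem_powerset.2 (filter_subset _ _), 𝒦, h, rfl, F, hF, rfl⟩

lemma regionTraces_subset (N : ℕ) (P : Finset (ℝ × ℝ)) : regionTraces N P ⊆ smallUnions N P := by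
  intro Q hQ
  obtain ⟨-, 𝒦, h, rfl, F, hF, rfl⟩ := mem_filter.1 hQ
  exact mem_smallUnions (fun K hK => h.cell K (hF hK)) (card_le_card hF)

lemma IsCellPartition.card_pos {𝒦 : Finset (Set (ℝ × ℝ))} (h : IsCellPartition 𝒦) :
    0 < 𝒦.card := by
  obtain ⟨K, hK, -⟩ := h.cover 0
  exact Finset.card_pos.2 ⟨K, hK⟩

/-- The size bounds for the two sides of a balanced separator. -/
def Balanced (N N₁ N₂ : ℝ) : Prop :=
  1 ≤ N₁ ∧ 1 ≤ N₂ ∧ N₁ ≤ 3 / 4 * N ∧ N₂ ≤ 3 / 4 * N ∧ N ≤ N₁ + N₂ ∧ N₁ + N₂ ≤ N + 142 * √N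

lemma card_sides {A S VB B VA 𝒦 : Finset (Set (ℝ × ℝ))} (hABd : Disjoint A B)
    (hAB : A ∪ B = 𝒦 \ S) (hS : S ⊆ 𝒦) (hVA : VA.card ≤ 3 * S.card + 1)
    (hVB : VB.card ≤ 3 * S.card + 1) (hs : (S.card : ℝ) ≤ 20 * √(𝒦.card : ℝ)) (h1 : 1 ≤ 𝒦.card) :
    ((A ∪ S ∪ VB).card : ℝ) ≤ A.card + 81 * √(𝒦.card : ℝ) ∧
    ((B ∪ S ∪ VA).card : ℝ) ≤ B.card + 81 * √(𝒦.card : ℝ) ∧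
    (𝒦.card : ℝ) ≤ (A ∪ S ∪ VB).card + (B ∪ S ∪ VA).card ∧
    ((A ∪ S ∪ VB).card : ℝ) + (B ∪ S ∪ VA).card ≤ 𝒦.card + 142 * √(𝒦.card : ℝ) := by
  have hsq : 1 ≤ √(𝒦.card : ℝ) := Real.one_le_sqrt.2 (by exact_mod_cast h1)
  have e1 : A.card + B.card = (𝒦 \ S).card := by rw [← hAB, card_union_of_disjoint hABd]
  have e2 : (𝒦 \ S).card + S.card = 𝒦.card := by
    have := card_sdiff_add_card_eq_card hS
    omega
  have u1 : (A ∪ S ∪ VB).card ≤ A.card + S.card + VB.card :=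
    (card_union_le _ _).trans (Nat.add_le_add_right (card_union_le _ _) _)
  have u2 : (B ∪ S ∪ VA).card ≤ B.card + S.card + VA.card :=
    (card_union_le _ _).trans (Nat.add_le_add_right (card_union_le _ _) _)
  have hAS : Disjoint A S := disjoint_left.2 fun K hK hKS =>
    (mem_sdiff.1 (hAB ▸ mem_union_left B hK)).2 hKS
  have l1 : A.card + S.card ≤ (A ∪ S ∪ VB).card := by
    rw [← card_union_of_disjoint hAS]
    exact card_le_card subset_union_left
  have l2 : B.card ≤ (B ∪ S ∪ VA).card := card_le_card (by
    rw [union_assoc]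
    exact subset_union_left)
  have e3 : (A.card : ℝ) + B.card + S.card = 𝒦.card := by
    have : A.card + B.card + S.card = 𝒦.card := by omega
    exact_mod_cast this
  have hVA' : (VA.card : ℝ) ≤ 3 * S.card + 1 := by exact_mod_cast hVA
  have hVB' : (VB.card : ℝ) ≤ 3 * S.card + 1 := by exact_mod_cast hVB
  have u1' : ((A ∪ S ∪ VB).card : ℝ) ≤ A.card + S.card + VB.card := by exact_mod_cast u1
  have u2' : ((B ∪ S ∪ VA).card : ℝ) ≤ B.card + S.card + VA.card := by exact_mod_cast u2
  have l1' : (A.card : ℝ) + S.card ≤ (A ∪ S ∪ VB).card := by exact_mod_cast l1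
  have l2' : (B.card : ℝ) ≤ (B ∪ S ∪ VA).card := by exact_mod_cast l2
  exact ⟨by linarith, by linarith, by linarith, by linarith⟩

lemma region_mono {F G : Finset (Set (ℝ × ℝ))} (h : F ⊆ G) : region F ⊆ region G := by
  rintro z ⟨K, hK, hz⟩
  exact ⟨K, h hK, hz⟩

lemma region_union (F G : Finset (Set (ℝ × ℝ))) : region (F ∪ G) = region F ∪ region G := by
  ext z
  simp only [region, Set.mem_ofPred_eq, mem_union, or_and_right, exists_or, Set.mem_union]

lemma IsCellPartition.disjoint_region {𝒦 F G : Finset (Set (ℝ × ℝ))} (h : IsCellPartition 𝒦)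
    (hF : F ⊆ 𝒦) (hG : G ⊆ 𝒦) (hFG : Disjoint F G) : Disjoint (region F) (region G) := by
  rw [Set.disjoint_left]
  rintro z ⟨K, hK, hz⟩ ⟨K', hK', hz'⟩
  have := h.eq_of_mem (hF hK) (hG hK') hz hz'
  exact disjoint_left.1 hFG hK (this ▸ hK')

/-- One recursion step for the traces of regions. -/
lemma card_regionTraces_step {N : ℕ} (hN : (972 : ℝ) ^ 2 ≤ N) (P : Finset (ℝ × ℝ)) {b : ℝ}
    (hb : ∀ N₁ N₂ : ℕ, Balanced N N₁ N₂ → ∀ P₁ P₂, P₁ ⊆ P → P₂ ⊆ P → Disjoint P₁ P₂ →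
      ((regionTraces N₁ P₁).card : ℝ) * (regionTraces N₂ P₂).card ≤ b) (hb0 : 0 ≤ b) :
    ((regionTraces N P).card : ℝ) ≤
      ((N : ℝ) + 1) ^ 2 * ((P.card : ℝ) + 2) ^ (36 * ⌊81 * √(N : ℝ)⌋₊) * b := by
  have hN1 : (1 : ℝ) ≤ N := le_trans (by norm_num) hN
  set m := ⌊81 * √(N : ℝ)⌋₊ with hm
  let idx := ((range (N + 1) ×ˢ range (N + 1)) ×ˢ
    (smallUnions m P ×ˢ smallUnions m P ×ˢ smallUnions m P)).filter fun q =>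
      Balanced N q.1.1 q.1.2 ∧ q.2.1 ⊆ P ∧ q.2.2.1 ⊆ P ∧ Disjoint q.2.1 q.2.2.1
  have hsub : regionTraces N P ⊆ idx.biUnion fun q =>
      (regionTraces q.1.1 q.2.1 ×ˢ regionTraces q.1.2 q.2.2.1).image fun r =>
        r.1 ∪ r.2 ∪ q.2.2.2 := by
    intro Q hQ
    obtain ⟨-, 𝒦, h, hcard, F, hF, rfl⟩ := mem_filter.1 hQ
    obtain ⟨S, A, B, hS, hABd, hAB, hadj, hs, hwA, hwB⟩ :=
      exists_balanced_separator h.minorFree (w := fun _ => 1) (fun _ => zero_le_one)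
    obtain ⟨VA, VB, hVA, hVB, hrA, hrB, hpS, hcS, hpA, hpB⟩ := h.exists_sides hS hABd hAB hadj
    obtain ⟨c1, c2, c3, c4⟩ := card_sides hABd hAB hS hVA hVB hs h.card_pos
    rw [hcard] at hs c1 c2 c3 c4
    simp only [sum_const, nsmul_eq_mul, mul_one, hcard] at hwA hwB
    have hsq : 972 ≤ √(N : ℝ) := Real.le_sqrt_of_sq_le hN
    have hsqN : √(N : ℝ) * √(N : ℝ) = N := Real.mul_self_sqrt (by positivity)
    have hbig : 81 * √(N : ℝ) ≤ N / 12 := by nlinarith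
    have bal : Balanced N (A ∪ S ∪ VB).card (B ∪ S ∪ VA).card :=
      ⟨by exact_mod_cast hpA.card_pos, by exact_mod_cast hpB.card_pos, by linarith, by linarith,
        c3, c4⟩
    have hcm : 4 * S.card + 1 ≤ m := by
      refine Nat.le_floor ?_
      push_cast
      linarith
    have hAK : A ⊆ 𝒦 := fun K hK => (mem_sdiff.1 (hAB ▸ mem_union_left B hK)).1
    have hBK : B ⊆ 𝒦 := fun K hK => (mem_sdiff.1 (hAB ▸ mem_union_right A hK)).1
    have hsm : ∀ V ⊆ S ∪ VA ∪ VB, P.filter (· ∈ region V) ∈ smallUnions m P := fun V hV =>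
      mem_smallUnions (fun K hK => hpS.cell K (hV hK)) (((card_le_card hV).trans hcS).trans hcm)
    refine mem_biUnion.2 ⟨(((A ∪ S ∪ VB).card, (B ∪ S ∪ VA).card), P.filter (· ∈ region A),
      P.filter (· ∈ region B), P.filter (· ∈ region (F ∩ S))), ?_, ?_⟩
    · refine mem_filter.2 ⟨?_, bal, filter_subset _ _, filter_subset _ _, ?_⟩
      · simp only [mem_product, mem_range, Nat.lt_succ_iff]
        refine ⟨⟨?_, ?_⟩, ?_, ?_, ?_⟩
        · have := bal.2.2.1
          exact_mod_cast (by linarith : ((A ∪ S ∪ VB).card : ℝ) ≤ N)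
        · have := bal.2.2.2.1
          exact_mod_cast (by linarith : ((B ∪ S ∪ VA).card : ℝ) ≤ N)
        · rw [← hrA]
          exact hsm VA (subset_union_right.trans subset_union_left)
        · rw [← hrB]
          exact hsm VB subset_union_right
        · exact hsm _ (inter_subset_right.trans (subset_union_left.trans subset_union_left))
      · refine disjoint_filter.2 fun z _ hz hz' => ?_
        exact Set.disjoint_left.1 (h.disjoint_region hAK hBK hABd) hz hz'
    · refine mem_image.2 ⟨((P.filter (· ∈ region A)).filter (· ∈ region (F ∩ A)),
        (P.filter (· ∈ region B)).filter (· ∈ region (F ∩ B))), mem_product.2 ⟨?_, ?_⟩, ?_⟩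
      · exact mem_regionTraces hpA (inter_subset_right.trans (subset_union_left.trans subset_union_left))
      · exact mem_regionTraces hpB (inter_subset_right.trans (subset_union_left.trans subset_union_left))
      · have hdec : region F = region (F ∩ A) ∪ region (F ∩ B) ∪ region (F ∩ S) := by
          have e : F = F ∩ A ∪ F ∩ B ∪ F ∩ S := by
            ext K
            have e1 := Finset.ext_iff.1 hAB K
            rw [mem_union, mem_sdiff] at e1
            have e2 := @hF K
            simp only [mem_union, mem_inter]
            tauto
          rw [← region_union, ← region_union, ← e]
        have h1 := region_mono (inter_subset_right : F ∩ A ⊆ A)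
        have h2 := region_mono (inter_subset_right : F ∩ B ⊆ B)
        ext z
        simp only [mem_union, mem_filter, hdec, Set.mem_union]
        constructor
        · rintro ((⟨⟨hz, -⟩, h3⟩ | ⟨⟨hz, -⟩, h3⟩) | ⟨hz, h3⟩)
          exacts [⟨hz, Or.inl (Or.inl h3)⟩, ⟨hz, Or.inl (Or.inr h3)⟩, ⟨hz, Or.inr h3⟩]
        · rintro ⟨hz, (h3 | h3) | h3⟩
          exacts [Or.inl (Or.inl ⟨⟨hz, h1 h3⟩, h3⟩), Or.inl (Or.inr ⟨⟨hz, h2 h3⟩, h3⟩), Or.inr ⟨hz,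
              h3⟩]
  have hcardU : ((smallUnions m P).card : ℝ) ≤ ((P.card : ℝ) + 2) ^ (12 * m) := by
    exact_mod_cast card_smallUnions m P
  have hidx : (idx.card : ℝ) ≤ ((N : ℝ) + 1) ^ 2 * ((P.card : ℝ) + 2) ^ (36 * m) := by
    calc (idx.card : ℝ)
        ≤ (((range (N + 1) ×ˢ range (N + 1)) ×ˢ
          (smallUnions m P ×ˢ smallUnions m P ×ˢ smallUnions m P)).card : ℝ) := by
            exact_mod_cast card_filter_le _ _
      _ = ((N : ℝ) + 1) ^ 2 * ((smallUnions m P).card * ((smallUnions m P).card *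
          (smallUnions m P).card)) := by
            simp only [card_product, card_range]
            push_cast
            ring
      _ ≤ ((N : ℝ) + 1) ^ 2 * (((P.card : ℝ) + 2) ^ (12 * m) * (((P.card : ℝ) + 2) ^ (12 * m) *
          ((P.card : ℝ) + 2) ^ (12 * m))) := by gcongr
      _ = _ := by
          rw [← pow_add, ← pow_add]
          congr 2
          ring
  calc ((regionTraces N P).card : ℝ)
      ≤ ((idx.biUnion fun q => (regionTraces q.1.1 q.2.1 ×ˢ regionTraces q.1.2 q.2.2.1).image fun r =>
        r.1 ∪ r.2 ∪ q.2.2.2).card : ℝ) := by exact_mod_cast card_le_card hsub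
    _ ≤ ∑ q ∈ idx, (((regionTraces q.1.1 q.2.1 ×ˢ regionTraces q.1.2 q.2.2.1).image fun r =>
        r.1 ∪ r.2 ∪ q.2.2.2).card : ℝ) := by exact_mod_cast card_biUnion_le
    _ ≤ ∑ q ∈ idx, b := by
        refine sum_le_sum fun q hq => ?_
        obtain ⟨-, h1, h2, h3, h4⟩ := mem_filter.1 hq
        refine le_trans ?_ (hb _ _ h1 _ _ h2 h3 h4)
        have := card_image_le (s := regionTraces q.1.1 q.2.1 ×ˢ regionTraces q.1.2 q.2.2.1)
          (f := fun r => r.1 ∪ r.2 ∪ q.2.2.2)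
        rw [card_product] at this
        exact_mod_cast this
    _ = idx.card * b := by simp
    _ ≤ _ := mul_le_mul_of_nonneg_right hidx hb0

lemma log_add_two_le {n N θ : ℝ} (hn : 0 ≤ n) (hN : 1 ≤ N) (hθ : 1 ≤ θ) :
    Real.log (n + 2) ≤ Real.log θ + Real.log (N + 1) + n / θ / N := by
  have hr : 0 ≤ n / θ := by positivity
  have e : n = θ * (n / θ) := by field_simp
  have h1 : n + 2 ≤ θ * (n / θ + 2) := by nlinarith
  have h2 : θ * (n / θ + 2) = θ * (N + 1) * ((n / θ + 2) / (N + 1)) := by field_simp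
  have h3 : Real.log ((n / θ + 2) / (N + 1)) ≤ (n / θ + 2) / (N + 1) - 1 :=
    Real.log_le_sub_one_of_pos (by positivity)
  have h4 : (n / θ + 2) / (N + 1) - 1 ≤ n / θ / N := by
    rw [div_sub_one (by positivity), div_le_div_iff₀ (by positivity) (by positivity)]
    nlinarith
  calc Real.log (n + 2) ≤ Real.log (θ * (N + 1) * ((n / θ + 2) / (N + 1))) := by
        rw [← h2]
        exact Real.log_le_log (by positivity) h1
    _ = Real.log θ + Real.log (N + 1) + Real.log ((n / θ + 2) / (N + 1)) := by
        rw [Real.log_mul (by positivity) (by positivity), Real.log_mul (by positivity) (by positivity)]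
    _ ≤ _ := by linarith

lemma pow_le_exp_log {x : ℝ} (hx : 0 < x) (k : ℕ) {y : ℝ} (h : k * Real.log x ≤ y) :
    x ^ k ≤ Real.exp y := by
  rw [← Real.exp_log hx, ← Real.exp_nat_mul]
  exact Real.exp_le_exp.2 h

/-- Regions of partitions into `N` cells cut out few subsets. -/
theorem exists_card_regionTraces_le : ∃ C : ℝ, 0 ≤ C ∧ ∀ (N : ℕ) (P : Finset (ℝ × ℝ)) (θ : ℝ),
    1 ≤ θ → ((regionTraces N P).card : ℝ) ≤
      Real.exp (C * (N * (1 + Real.log θ) + P.card / θ)) := by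
  obtain ⟨M₀, hM₀⟩ := gPot_split 46688
  obtain ⟨N₀, hN₀1, hN₀2⟩ : ∃ N₀ : ℝ, M₀ ≤ N₀ ∧ (972 : ℝ) ^ 2 ≤ N₀ :=
    ⟨max M₀ (972 ^ 2), le_max_left _ _, le_max_right _ _⟩
  set b : ℝ := 24 * N₀ with hb
  have hb0 : 24 * 972 ^ 2 ≤ b := by linarith
  have key : ∀ (N : ℕ) (P : Finset (ℝ × ℝ)) (θ : ℝ), 1 ≤ θ → 1 ≤ N →
      ((regionTraces N P).card : ℝ) ≤ Real.exp (24 * (1 + Real.log θ) * gPot N +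
        P.card / θ * (2 * b - b / √(N : ℝ))) := by
    intro N
    induction N using Nat.strong_induction_on with
    | _ N ih =>
    intro P θ hθ hN
    have hlθ : 0 ≤ Real.log θ := Real.log_nonneg hθ
    have hNr : (1 : ℝ) ≤ N := by exact_mod_cast hN
    have hsq1 : 1 ≤ √(N : ℝ) := Real.one_le_sqrt.2 hNr
    have hr : 0 ≤ (P.card : ℝ) / θ := by positivity
    rcases lt_or_ge (N : ℝ) N₀ with hlt | hge
    · have h1 : ((regionTraces N P).card : ℝ) ≤ ((P.card : ℝ) + 2) ^ (12 * N) := by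
        exact_mod_cast (card_le_card (regionTraces_subset N P)).trans (card_smallUnions N P)
      refine h1.trans (pow_le_exp_log (by positivity) _ ?_)
      have h2 := log_add_two_le (n := P.card) (N := 1) (by positivity) le_rfl hθ
      have h3 : Real.log (1 + 1) ≤ 1 := by
        have := Real.log_le_sub_one_of_pos (show (0 : ℝ) < 1 + 1 by norm_num)
        linarith
      rw [div_one] at h2
      have h2' : Real.log ((P.card : ℝ) + 2) ≤ Real.log θ + 1 + P.card / θ :=
        h2.trans (by gcongr)
      have h4 := natCast_le_gPot N
      have h5 : b / √(N : ℝ) ≤ b := div_le_self (by linarith) hsq1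
      have h6 : (P.card : ℝ) / θ * b ≤ P.card / θ * (2 * b - b / √(N : ℝ)) :=
        mul_le_mul_of_nonneg_left (by linarith) hr
      have h7 : ((12 * N : ℕ) : ℝ) * Real.log (P.card + 2) ≤
          12 * N * (Real.log θ + 1 + P.card / θ) := by
        push_cast
        exact mul_le_mul_of_nonneg_left h2' (by positivity)
      have h8 : (12 : ℝ) * N * (P.card / θ) ≤ P.card / θ * b := by
        rw [mul_comm]
        exact mul_le_mul_of_nonneg_left (by linarith) hr
      have h9 : (12 : ℝ) * N * (Real.log θ + 1) ≤ 24 * (1 + Real.log θ) * gPot N := by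
        nlinarith
      linarith
    · have h972 : (972 : ℝ) ^ 2 ≤ N := hN₀2.trans hge
      have hNpos : (0 : ℝ) < N := by linarith
      have hsq : 0 < √(N : ℝ) := by linarith
      set D : ℝ := 24 * (1 + Real.log θ) * (gPot N - 46688 * (N : ℝ) ^ (5 / 8 : ℝ)) +
        P.card / θ * (2 * b - 1.14 * (b / √(N : ℝ))) with hD
      refine (card_regionTraces_step h972 P (b := Real.exp D) ?_ (Real.exp_pos _).le).trans ?_
      · intro N₁ N₂ hbal P₁ P₂ hP₁ hP₂ hP
        obtain ⟨b1, b2, b3, b4, b5, b6⟩ := hbal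
        have hlt : ∀ N' : ℕ, (N' : ℝ) ≤ 3 / 4 * N → N' < N := fun N' h => by
          have : (N' : ℝ) < N := by linarith
          exact_mod_cast this
        have hsqi : ∀ N' : ℕ, (1 : ℝ) ≤ N' → (N' : ℝ) ≤ 3 / 4 * N →
            1.14 * (b / √(N : ℝ)) ≤ b / √(N' : ℝ) := by
          intro N' h1 h2
          have h3 : 0 < √(N' : ℝ) := Real.sqrt_pos.2 (by linarith)
          have h4 : √(N' : ℝ) ≤ 100 / 114 * √(N : ℝ) := by
            refine Real.sqrt_le_iff.2 ⟨by positivity, ?_⟩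
            rw [mul_pow, Real.sq_sqrt hNpos.le]
            linarith
          rw [le_div_iff₀ h3]
          calc 1.14 * (b / √(N : ℝ)) * √(N' : ℝ)
              ≤ 1.14 * (b / √(N : ℝ)) * (100 / 114 * √(N : ℝ)) := by
                have : 0 ≤ b := by linarith
                gcongr
            _ = b := by
                field_simp
                norm_num
        have i1 := ih N₁ (hlt _ b3) P₁ θ hθ (by exact_mod_cast b1)
        have i2 := ih N₂ (hlt _ b4) P₂ θ hθ (by exact_mod_cast b2)
        refine (mul_le_mul i1 i2 (by positivity) (Real.exp_pos _).le).trans ?_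
        rw [← Real.exp_add, Real.exp_le_exp, hD]
        have hg := hM₀ N N₁ N₂ (hN₀1.trans hge) (by linarith) (by linarith) b3 b4 b5
          (b6.trans (by linarith))
        have hg' := mul_le_mul_of_nonneg_left hg (show 0 ≤ 24 * (1 + Real.log θ) by linarith)
        have hPc : (P₁.card : ℝ) / θ + P₂.card / θ ≤ P.card / θ := by
          rw [← add_div]
          have : P₁.card + P₂.card ≤ P.card := by
            rw [← card_union_of_disjoint hP]
            exact card_le_card (union_subset hP₁ hP₂)
          have : (P₁.card : ℝ) + P₂.card ≤ P.card := by exact_mod_cast this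
          gcongr
        have hc0 : 0 ≤ 2 * b - 1.14 * (b / √(N : ℝ)) := by
          have : b / √(N : ℝ) ≤ b := div_le_self (by linarith) hsq1
          linarith
        have q1 : (P₁.card : ℝ) / θ * (2 * b - b / √(N₁ : ℝ)) ≤
            P₁.card / θ * (2 * b - 1.14 * (b / √(N : ℝ))) :=
          mul_le_mul_of_nonneg_left (by linarith [hsqi N₁ b1 b3]) (by positivity)
        have q2 : (P₂.card : ℝ) / θ * (2 * b - b / √(N₂ : ℝ)) ≤
            P₂.card / θ * (2 * b - 1.14 * (b / √(N : ℝ))) :=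
          mul_le_mul_of_nonneg_left (by linarith [hsqi N₂ b2 b4]) (by positivity)
        have q3 := mul_le_mul_of_nonneg_right hPc hc0
        linarith
      · have hl8 := log_add_one_le hNr
        have h58 := sqrt_mul_rpow hNpos
        have h2 := log_add_two_le (n := P.card) (N := N) (by positivity) hNr hθ
        have hm : ((36 * ⌊81 * √(N : ℝ)⌋₊ : ℕ) : ℝ) ≤ 2916 * √(N : ℝ) := by
          push_cast
          have := Nat.floor_le (show 0 ≤ 81 * √(N : ℝ) by positivity)
          linarith
        have e1 : ((N : ℝ) + 1) ^ 2 ≤ Real.exp (2 * Real.log (N + 1)) :=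
          pow_le_exp_log (by positivity) 2 (by norm_num)
        have hpos8 : 0 ≤ Real.log ((N : ℝ) + 1) := Real.log_nonneg (by linarith)
        have hlog2 : 0 ≤ Real.log ((P.card : ℝ) + 2) := Real.log_nonneg (by
          have : (0 : ℝ) ≤ P.card := by positivity
          linarith)
        have e2 : ((P.card : ℝ) + 2) ^ (36 * ⌊81 * √(N : ℝ)⌋₊) ≤
            Real.exp (2916 * √(N : ℝ) * Real.log (P.card + 2)) :=
          pow_le_exp_log (by positivity) _ (mul_le_mul_of_nonneg_right hm hlog2)
        calc ((N : ℝ) + 1) ^ 2 * ((P.card : ℝ) + 2) ^ (36 * ⌊81 * √(N : ℝ)⌋₊) * Real.exp D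
            ≤ Real.exp (2 * Real.log (N + 1)) *
              Real.exp (2916 * √(N : ℝ) * Real.log (P.card + 2)) * Real.exp D := by gcongr
          _ = Real.exp (2 * Real.log (N + 1) + 2916 * √(N : ℝ) * Real.log (P.card + 2) + D) := by
              rw [← Real.exp_add, ← Real.exp_add]
          _ ≤ _ := by
              rw [Real.exp_le_exp, hD]
              set x8 := (N : ℝ) ^ (1 / 8 : ℝ) with hx8
              set x58 := (N : ℝ) ^ (5 / 8 : ℝ) with hx58
              have g1 : √(N : ℝ) * Real.log (P.card + 2) ≤
                  √(N : ℝ) * (Real.log θ + 16 * x8 + P.card / θ / N) :=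
                mul_le_mul_of_nonneg_left (by linarith) hsq.le
              have g2 : √(N : ℝ) * (P.card / θ / N) = P.card / θ / √(N : ℝ) := by
                have : √(N : ℝ) * √(N : ℝ) = N := Real.mul_self_sqrt hNpos.le
                rw [eq_div_iff hsq.ne', mul_right_comm, this, mul_div_cancel₀ _ hNpos.ne']
              have g3 : √(N : ℝ) ≤ x58 := one_le_rpow_five_eighths hNr
              have g5 : x8 ≤ x58 := by
                rw [← h58]
                exact le_mul_of_one_le_left (by positivity) hsq1
              have g6 : √(N : ℝ) * Real.log θ ≤ x58 * Real.log θ :=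
                mul_le_mul_of_nonneg_right g3 hlθ
              have g7 : 2916 * (P.card / θ / √(N : ℝ)) ≤ 0.14 * (P.card / θ * (b / √(N : ℝ))) := by
                have : (P.card : ℝ) / θ * (b / √(N : ℝ)) = b * (P.card / θ / √(N : ℝ)) := by ring
                rw [this, ← mul_assoc]
                exact mul_le_mul_of_nonneg_right (by linarith) (by positivity)
              have g8 : 0 ≤ x58 * Real.log θ := by positivity
              have g9 : 0 ≤ x58 := by positivity
              have g10 : √(N : ℝ) * (Real.log θ + 16 * x8 + P.card / θ / N) =
                  √(N : ℝ) * Real.log θ + 16 * x58 + P.card / θ / √(N : ℝ) := by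
                rw [← g2, ← h58]
                ring
              linarith
  refine ⟨48 + 2 * b, by linarith, fun N P θ hθ => ?_⟩
  have hlθ : 0 ≤ Real.log θ := Real.log_nonneg hθ
  have hr : 0 ≤ (P.card : ℝ) / θ := by positivity
  rcases Nat.eq_zero_or_pos N with rfl | hN
  · have : regionTraces 0 P = ∅ := by
      refine filter_eq_empty_iff.2 ?_
      rintro Q - ⟨𝒦, h, h0, -⟩
      exact h.card_pos.ne' h0
    rw [this]
    simpa using (Real.exp_pos _).le
  · refine (key N P θ hθ hN).trans (Real.exp_le_exp.2 ?_)
    have h1 := gPot_le (M := N) (by positivity)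
    have h2 : 0 ≤ b / √(N : ℝ) := div_nonneg (by linarith) (Real.sqrt_nonneg _)
    have h3 : (P.card : ℝ) / θ * (2 * b - b / √(N : ℝ)) ≤ P.card / θ * (2 * b) :=
      mul_le_mul_of_nonneg_left (by linarith) hr
    have h4 : 24 * (1 + Real.log θ) * gPot N ≤ 24 * (1 + Real.log θ) * (2 * N) :=
      mul_le_mul_of_nonneg_left h1 (by linarith)
    have h5 : 0 ≤ b * (N * (1 + Real.log θ)) := by
      have : 0 ≤ b := by linarith
      positivity
    nlinarith

end RegionTraces

section Tokens

variable {m : ℕ} {p : Fin m → Fin m} {T U W : Finset (Fin m)} {P : Finset (ℝ × ℝ)} {N : ℕ}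
  {f : Fin m → ℝ × ℝ} {𝒦 𝒦' : Finset (Set (ℝ × ℝ))} {φ : Fin m → Finset (Set (ℝ × ℝ))}

/-- Disjoint connected families of cells `φ t`, touching along the forest `p` and containing the
points `f t`. -/
structure Realizes (p : Fin m → Fin m) (T U : Finset (Fin m)) (𝒦 : Finset (Set (ℝ × ℝ)))
    (φ : Fin m → Finset (Set (ℝ × ℝ))) (f : Fin m → ℝ × ℝ) : Prop where
  sub : ∀ t ∈ U, φ t ⊆ 𝒦
  conn : ∀ t ∈ U, Conn cellGraph (φ t)
  disj : ∀ t ∈ U, ∀ t' ∈ U, t ≠ t' → Disjoint (φ t) (φ t')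
  touch : ∀ t ∈ U, p t ∈ U → p t ≠ t → Touch cellGraph (φ t) (φ (p t))
  mem : ∀ t ∈ U, t ∈ T → f t ∈ region (φ t)

/-- Assignments of the points of `P` to the token nodes in `U` realized by partitions into `N`
cells. -/
structure IsTokenMap (p : Fin m → Fin m) (T U : Finset (Fin m)) (P : Finset (ℝ × ℝ)) (N : ℕ)
    (f : Fin m → ℝ × ℝ) : Prop where
  zero : ∀ t, t ∉ U ∩ T → f t = 0
  inj : ∀ t ∈ U ∩ T, ∀ t' ∈ U ∩ T, f t = f t' → t = t'
  image : (U ∩ T).image f = P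
  real : ∃ 𝒦 φ, IsCellPartition 𝒦 ∧ 𝒦.card = N ∧ Realizes p T U 𝒦 φ f

/-- The finite set of all token maps. -/
def tokenMaps (p : Fin m → Fin m) (T U : Finset (Fin m)) (P : Finset (ℝ × ℝ)) (N : ℕ) :
    Finset (Fin m → ℝ × ℝ) :=
  (Fintype.piFinset fun t => if t ∈ U ∩ T then P else {0}).filter (IsTokenMap p T U P N)

lemma mem_tokenMaps : f ∈ tokenMaps p T U P N ↔ IsTokenMap p T U P N f := by
  refine ⟨fun h => (mem_filter.1 h).2, fun h => mem_filter.2 ⟨Fintype.mem_piFinset.2 fun t => ?_,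
      h⟩⟩
  split_ifs with ht
  · exact h.image ▸ mem_image_of_mem f ht
  · exact mem_singleton.2 (h.zero t ht)

lemma IsTokenMap.card_eq (h : IsTokenMap p T U P N f) : P.card = (U ∩ T).card := by
  rw [← h.image]
  exact card_image_of_injOn fun t ht t' ht' => h.inj t ht t' ht'

lemma card_piFinset_ite (W : Finset (Fin m)) (P : Finset (ℝ × ℝ)) :
    (Fintype.piFinset fun t => if t ∈ W then P else {0}).card = P.card ^ W.card := by
  rw [Fintype.card_piFinset]
  simp only [apply_ite Finset.card, card_singleton]
  rw [prod_ite, prod_const_one, mul_one, prod_const]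
  congr 2
  ext t
  simp

lemma card_tokenMaps_le_pow (p : Fin m → Fin m) (T U : Finset (Fin m)) (P : Finset (ℝ × ℝ))
    (N : ℕ) : (tokenMaps p T U P N).card ≤ P.card ^ P.card := by
  rcases (tokenMaps p T U P N).eq_empty_or_nonempty with h | ⟨f, hf⟩
  · simp [h]
  · refine (card_filter_le _ _).trans ?_
    rw [card_piFinset_ite, ← (mem_tokenMaps.1 hf).card_eq]

lemma Realizes.restrict (h : Realizes p T U 𝒦 φ f) (hW : W ⊆ U) (hφ : ∀ t ∈ W, φ t ⊆ 𝒦') :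
    Realizes p T W 𝒦' φ fun t => if t ∈ W then f t else 0 where
  sub := hφ
  conn t ht := h.conn t (hW ht)
  disj t ht t' ht' := h.disj t (hW ht) t' (hW ht')
  touch t ht hpt := h.touch t (hW ht) (hW hpt)
  mem t ht htT := by
    rw [if_pos ht]
    exact h.mem t (hW ht) htT

lemma IsTokenMap.restrict (h : IsTokenMap p T U P N f) (hr : Realizes p T U 𝒦 φ f) (hW : W ⊆ U)
    (h𝒦' : IsCellPartition 𝒦') (hφ : ∀ t ∈ W, φ t ⊆ 𝒦') {P' : Finset (ℝ × ℝ)}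
    (hP' : (W ∩ T).image f = P') :
    IsTokenMap p T W P' 𝒦'.card fun t => if t ∈ W then f t else 0 where
  zero t ht := by
    split_ifs with h1
    · refine h.zero t fun h2 => ht (mem_inter.2 ⟨h1, (mem_inter.1 h2).2⟩)
    · rfl
  inj t ht t' ht' e := by
    rw [mem_inter] at ht ht'
    rw [if_pos ht.1, if_pos ht'.1] at e
    exact h.inj t (mem_inter.2 ⟨hW ht.1, ht.2⟩) t' (mem_inter.2 ⟨hW ht'.1, ht'.2⟩) e
  image := by
    rw [← hP']
    refine image_congr fun t ht => ?_
    exact if_pos (mem_inter.1 ht).1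
  real := ⟨𝒦', φ, h𝒦', rfl, hr.restrict hW hφ⟩

/-- Subsets of `P` cut out by regions made of cells of partitions with at most `M` cells. -/
def smallTraces (M : ℕ) (P : Finset (ℝ × ℝ)) : Finset (Finset (ℝ × ℝ)) :=
  (range (M + 1)).biUnion fun N => regionTraces N P

lemma mem_smallTraces {M : ℕ} {F : Finset (Set (ℝ × ℝ))}
    (h : IsCellPartition 𝒦) (hF : F ⊆ 𝒦) (hM : 𝒦.card ≤ M) :
    P.filter (· ∈ region F) ∈ smallTraces M P :=
  mem_biUnion.2 ⟨𝒦.card, mem_range.2 (by omega), mem_regionTraces h hF⟩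

/-- The ways of splitting a realization along a separator: `H` are the nodes hit by the separator,
`U₁` those on the first side. -/
structure IsTokenSplit (p : Fin m → Fin m) (T U : Finset (Fin m)) (P : Finset (ℝ × ℝ)) (N : ℕ)
    (k : ℝ) (f : Fin m → ℝ × ℝ) (N₁ N₂ : ℕ) (H U₁ : Finset (Fin m)) (X₁ X₂ : Finset (ℝ × ℝ)) :
    Prop where
  H_sub : H ⊆ U
  U_sub : U₁ ⊆ U \ H
  cons : ∀ t ∈ U \ H, p t ∈ U \ H → (t ∈ U₁ ↔ p t ∈ U₁)
  card_H : (H.card : ℝ) ≤ 20 * √(N : ℝ)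
  X₁_mem : X₁ ∈ smallTraces ⌊81 * √(N : ℝ)⌋₊ P
  X₂_mem : X₂ ∈ smallTraces ⌊81 * √(N : ℝ)⌋₊ P
  left : IsTokenMap p T U₁ (X₁ \ (H ∩ T).image f) N₁ fun t => if t ∈ U₁ then f t else 0
  right : IsTokenMap p T ((U \ H) \ U₁) (X₂ \ (H ∩ T).image f) N₂
    fun t => if t ∈ (U \ H) \ U₁ then f t else 0
  N₁_le : N₁ + k * U₁.card ≤ 2 / 3 * (N + k * U.card) + 81 * √(N : ℝ)
  N₂_le : N₂ + k * ((U \ H) \ U₁).card ≤ 2 / 3 * (N + k * U.card) + 81 * √(N : ℝ)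
  add_le : (N₁ + k * U₁.card) + (N₂ + k * ((U \ H) \ U₁).card) ≤ N + k * U.card + 142 * √(N : ℝ)

lemma Realizes.image_side (hr : Realizes p T U 𝒦 φ f) (h : IsTokenMap p T U P N f)
    (h𝒦 : IsCellPartition 𝒦) {A : Finset (Set (ℝ × ℝ))} (hA : A ⊆ 𝒦) {H : Finset (Fin m)}
    (hW : ∀ t, t ∈ W ↔ t ∈ U ∧ t ∉ H ∧ φ t ⊆ A) (hH : H ⊆ U)
    (hd : ∀ t ∈ U, t ∉ H → φ t ⊆ A ∨ Disjoint (φ t) A) :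
    (W ∩ T).image f = P.filter (· ∈ region A) \ (H ∩ T).image f := by
  ext z
  simp only [mem_image, mem_sdiff, mem_filter, mem_inter, not_exists, not_and]
  constructor
  · rintro ⟨t, ⟨htW, htT⟩, rfl⟩
    obtain ⟨htU, htH, htA⟩ := (hW t).1 htW
    refine ⟨⟨h.image ▸ mem_image_of_mem f (mem_inter.2 ⟨htU, htT⟩),
      region_mono htA (hr.mem t htU htT)⟩, fun t' ht' e => htH ?_⟩
    rw [← h.inj t' (mem_inter.2 ⟨hH ht'.1, ht'.2⟩) t (mem_inter.2 ⟨htU, htT⟩) e]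
    exact ht'.1
  · rintro ⟨⟨hzP, K, hK, hzK⟩, hz⟩
    rw [← h.image, mem_image] at hzP
    obtain ⟨t, ht, rfl⟩ := hzP
    obtain ⟨htU, htT⟩ := mem_inter.1 ht
    have htH : t ∉ H := fun htH => hz t ⟨htH, htT⟩ rfl
    obtain ⟨K', hK', hzK'⟩ := hr.mem t htU htT
    have hKK' := h𝒦.eq_of_mem (hA hK) (hr.sub t htU hK') hzK hzK'
    refine ⟨t, ⟨(hW t).2 ⟨htU, htH, (hd t htU htH).resolve_right fun hdis => ?_⟩, htT⟩, rfl⟩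
    exact disjoint_left.1 hdis hK' (hKK' ▸ hK)

lemma IsTokenMap.exists_split (h : IsTokenMap p T U P N f) {k : ℝ} (hk : 0 ≤ k) :
    ∃ (N₁ N₂ : ℕ) (H U₁ : Finset (Fin m)) (X₁ X₂ : Finset (ℝ × ℝ)),
      IsTokenSplit p T U P N k f N₁ N₂ H U₁ X₁ X₂ := by
  obtain ⟨𝒦, φ, h𝒦, hN, hr⟩ := h.real
  have hrep : ∀ t, ∃ K, t ∈ U → K ∈ φ t := fun t => by
    by_cases ht : t ∈ U
    · obtain ⟨K, hK⟩ := (hr.conn t ht).1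
      exact ⟨K, fun _ => hK⟩
    · exact ⟨∅, fun h => absurd h ht⟩
  choose rep hrep using hrep
  set w : Set (ℝ × ℝ) → ℝ := fun K => 1 + k * (U.filter fun t => rep t = K).card with hw
  have hsum : ∀ A : Finset (Set (ℝ × ℝ)),
      ∑ K ∈ A, w K = A.card + k * (U.filter fun t => rep t ∈ A).card := by
    intro A
    rw [hw, sum_add_distrib, ← mul_sum, sum_const, nsmul_eq_mul, mul_one]
    congr 2
    rw [← Nat.cast_sum]
    congr 1
    have hfib := card_eq_sum_card_fiberwise (s := U.filter fun t => rep t ∈ A) (f := rep) (t := A)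
      fun t ht => (mem_filter.1 ht).2
    rw [hfib]
    refine sum_congr rfl fun K hK => ?_
    congr 1
    ext t
    simp only [mem_filter]
    constructor
    · rintro ⟨h1, rfl⟩
      exact ⟨⟨h1, hK⟩, rfl⟩
    · rintro ⟨⟨h1, -⟩, h2⟩
      exact ⟨h1, h2⟩
  obtain ⟨S, A, B, hS, hABd, hAB, hadj, hs, hwA, hwB⟩ :=
    exists_balanced_separator h𝒦.minorFree (w := w) (fun K => by positivity)
  obtain ⟨VA, VB, hVA, hVB, hrA, hrB, hpS, hcS, hpA, hpB⟩ := h𝒦.exists_sides hS hABd hAB hadj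
  obtain ⟨c1, c2, -, c4⟩ := card_sides hABd hAB hS hVA hVB hs h𝒦.card_pos
  have hmem : ∀ K, K ∈ A ∨ K ∈ B ↔ K ∈ 𝒦 ∧ K ∉ S := fun K => by
    have := Finset.ext_iff.1 hAB K
    rwa [mem_union, mem_sdiff] at this
  have hAK : A ⊆ 𝒦 := fun K hK => ((hmem K).1 (Or.inl hK)).1
  have hBK : B ⊆ 𝒦 := fun K hK => ((hmem K).1 (Or.inr hK)).1
  set H := U.filter fun t => ¬ Disjoint (φ t) S with hH
  have hmemH : ∀ t ∈ U, t ∉ H → Disjoint (φ t) S := fun t ht htH => by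
    by_contra hd
    exact htH (mem_filter.2 ⟨ht, hd⟩)
  have hside : ∀ t ∈ U, t ∉ H → φ t ⊆ A ∨ φ t ⊆ B := by
    intro t ht htH
    have hsub : ∀ K ∈ φ t, K ∈ A ∨ K ∈ B := fun K hK =>
      (hmem K).2 ⟨hr.sub t ht hK, fun hKS => disjoint_left.1 (hmemH t ht htH) hK hKS⟩
    by_cases hd : Disjoint (φ t) A
    · right
      exact fun K hK => (hsub K hK).resolve_left (disjoint_left.1 hd hK)
    · left
      refine (hr.conn t ht).subset_of_closed (Y := φ t) Subset.rfl (fun u hu v hv huv => ?_) hd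
      exact (hsub v hv).resolve_right fun hvB => hadj u hu v hvB huv
  have hne : ∀ t ∈ U, φ t ⊆ A → ¬ φ t ⊆ B := fun t ht h1 h2 =>
    disjoint_left.1 hABd (h1 (hrep t ht)) (h2 (hrep t ht))
  set U₁ := (U \ H).filter fun t => φ t ⊆ A with hU₁
  have hmem₁ : ∀ t, t ∈ U₁ ↔ t ∈ U ∧ t ∉ H ∧ φ t ⊆ A := fun t => by
    rw [hU₁, mem_filter, mem_sdiff, and_assoc]
  have hmem₂ : ∀ t, t ∈ (U \ H) \ U₁ ↔ t ∈ U ∧ t ∉ H ∧ φ t ⊆ B := fun t => by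
    rw [mem_sdiff, mem_sdiff, hmem₁]
    constructor
    · rintro ⟨⟨h1, h2⟩, h3⟩
      exact ⟨h1, h2, (hside t h1 h2).resolve_left fun h4 => h3 ⟨h1, h2, h4⟩⟩
    · rintro ⟨h1, h2, h3⟩
      exact ⟨⟨h1, h2⟩, fun h4 => hne t h1 h4.2.2 h3⟩
  have hdisAB : ∀ t ∈ U, t ∉ H → (φ t ⊆ A ∨ Disjoint (φ t) A) ∧ (φ t ⊆ B ∨ Disjoint (φ t) B) := by
    intro t ht htH
    rcases hside t ht htH with h1 | h1
    · exact ⟨Or.inl h1, Or.inr (disjoint_of_subset_left h1 hABd)⟩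
    · exact ⟨Or.inr (disjoint_of_subset_left h1 hABd.symm), Or.inl h1⟩
  have hHU : H ⊆ U := filter_subset _ _
  have hcm : (S ∪ VA ∪ VB).card ≤ ⌊81 * √(N : ℝ)⌋₊ := by
    refine Nat.le_floor ?_
    have h1 : 1 ≤ √(N : ℝ) := Real.one_le_sqrt.2 (by
      rw [← hN]
      exact_mod_cast h𝒦.card_pos)
    have h2 : ((S ∪ VA ∪ VB).card : ℝ) ≤ 4 * S.card + 1 := by exact_mod_cast hcS
    rw [hN] at hs
    linarith
  have hu₁ : (U₁.card : ℝ) ≤ (U.filter fun t => rep t ∈ A).card := by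
    exact_mod_cast card_le_card fun t ht => mem_filter.2
      ⟨((hmem₁ t).1 ht).1, ((hmem₁ t).1 ht).2.2 (hrep t ((hmem₁ t).1 ht).1)⟩
  have hu₂ : (((U \ H) \ U₁).card : ℝ) ≤ (U.filter fun t => rep t ∈ B).card := by
    exact_mod_cast card_le_card fun t ht => mem_filter.2
      ⟨((hmem₂ t).1 ht).1, ((hmem₂ t).1 ht).2.2 (hrep t ((hmem₂ t).1 ht).1)⟩
  have hu : (U₁.card : ℝ) + ((U \ H) \ U₁).card ≤ U.card := by
    have h1 := card_sdiff_add_card_eq_card (filter_subset (fun t => φ t ⊆ A) (U \ H))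
    have h2 : (U \ H).card ≤ U.card := card_le_card sdiff_subset
    have h3 : U₁.card + ((U \ H) \ U₁).card ≤ U.card := by
      rw [hU₁]
      omega
    exact_mod_cast h3
  have hfull : (U.filter fun t => rep t ∈ 𝒦) = U :=
    filter_true_of_mem fun t ht => hr.sub t ht (hrep t ht)
  rw [hsum, hsum, hfull, hN] at hwA hwB
  rw [hN] at c1 c2 c4 hs
  have hku₁ := mul_le_mul_of_nonneg_left hu₁ hk
  have hku₂ := mul_le_mul_of_nonneg_left hu₂ hk
  have hku := mul_le_mul_of_nonneg_left hu hk
  refine ⟨(A ∪ S ∪ VB).card, (B ∪ S ∪ VA).card, H, U₁, P.filter (· ∈ region A),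
    P.filter (· ∈ region B), hHU, filter_subset _ _, ?_, ?_, ?_, ?_, ?_, ?_, by linarith,
    by linarith, by linarith⟩
  · intro t ht hpt
    rw [mem_sdiff] at ht hpt
    by_cases hne' : p t = t
    · rw [hne']
    obtain ⟨a, ha, b, hb, hab⟩ := hr.touch t ht.1 hpt.1 hne'
    rw [hmem₁, hmem₁]
    constructor
    · rintro ⟨-, -, h3⟩
      exact ⟨hpt.1, hpt.2, (hside _ hpt.1 hpt.2).resolve_right fun h4 =>
          hadj a (h3 ha) b (h4 hb) hab⟩
    · rintro ⟨-, -, h3⟩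
      exact ⟨ht.1, ht.2, (hside _ ht.1 ht.2).resolve_right fun h4 =>
        hadj b (h3 hb) a (h4 ha) hab.symm⟩
  · refine le_trans ?_ hs
    have hpick : ∀ t, ∃ K, t ∈ H → K ∈ φ t ∧ K ∈ S := fun t => by
      by_cases ht : t ∈ H
      · obtain ⟨K, h1, h2⟩ := not_disjoint_iff.1 (mem_filter.1 ht).2
        exact ⟨K, fun _ => ⟨h1, h2⟩⟩
      · exact ⟨∅, fun h => absurd h ht⟩
    choose pick hpick using hpick
    have : H.card ≤ S.card := by
      refine card_le_card_of_injOn pick (fun t ht => (hpick t ht).2) fun t ht t' ht' e => ?_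
      by_contra hne
      exact disjoint_left.1 (hr.disj t (hHU ht) t' (hHU ht') hne) (hpick t ht).1
        (e ▸ (hpick t' ht').1)
    exact_mod_cast this
  · rw [← hrA]
    exact mem_smallTraces hpS (subset_union_right.trans subset_union_left) hcm
  · rw [← hrB]
    exact mem_smallTraces hpS subset_union_right hcm
  · exact h.restrict hr (fun t ht => ((hmem₁ t).1 ht).1) hpA
      (fun t ht => ((hmem₁ t).1 ht).2.2.trans (subset_union_left.trans subset_union_left))
      (hr.image_side h h𝒦 hAK hmem₁ hHU fun t ht htH => (hdisAB t ht htH).1)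
  · exact h.restrict hr (fun t ht => ((hmem₂ t).1 ht).1) hpB
      (fun t ht => ((hmem₂ t).1 ht).2.2.trans (subset_union_left.trans subset_union_left))
      (hr.image_side h h𝒦 hBK hmem₂ hHU fun t ht htH => (hdisAB t ht htH).2)

end Tokens

section TokenCount

lemma gPot_mono {a b : ℝ} (ha : 1 ≤ a) (hab : a ≤ b) : gPot a ≤ gPot b := by
  have ha0 : 0 < a := by linarith
  have h1 : a ^ (3 / 4 : ℝ) ≤ a := by
    simpa using Real.rpow_le_rpow_of_exponent_le ha (show (3 / 4 : ℝ) ≤ 1 by norm_num)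
  have h2 : (b / a) ^ (3 / 4 : ℝ) ≤ b / a := by
    simpa using Real.rpow_le_rpow_of_exponent_le ((one_le_div ha0).2 hab)
      (show (3 / 4 : ℝ) ≤ 1 by norm_num)
  have h3 : b ^ (3 / 4 : ℝ) = a ^ (3 / 4 : ℝ) * (b / a) ^ (3 / 4 : ℝ) := by
    rw [← Real.mul_rpow ha0.le (div_nonneg (by linarith) ha0.le), mul_div_cancel₀ _ ha0.ne']
  have h4 : a ^ (3 / 4 : ℝ) * (b / a) ^ (3 / 4 : ℝ) ≤ a ^ (3 / 4 : ℝ) * (b / a) :=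
    mul_le_mul_of_nonneg_left h2 (by positivity)
  have h5 : a ^ (3 / 4 : ℝ) * (b / a) - a ^ (3 / 4 : ℝ) ≤ b - a := by
    have e : a ^ (3 / 4 : ℝ) * (b / a) - a ^ (3 / 4 : ℝ) = a ^ (3 / 4 : ℝ) * ((b - a) / a) := by
      field_simp
    rw [e]
    calc a ^ (3 / 4 : ℝ) * ((b - a) / a) ≤ a * ((b - a) / a) :=
          mul_le_mul_of_nonneg_right h1 (div_nonneg (by linarith) ha0.le)
      _ = b - a := by field_simp
  unfold gPot
  linarith

lemma gPot_split_of_one_le {C : ℝ} (hC : 0 ≤ C) : ∃ M₀ : ℝ, ∀ M M₁ M₂ : ℝ, M₀ ≤ M → 1 ≤ M₁ →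
    1 ≤ M₂ → M₁ ≤ 3 / 4 * M → M₂ ≤ 3 / 4 * M → M₁ + M₂ ≤ M + C * √M →
    gPot M₁ + gPot M₂ + C * M ^ (5 / 8 : ℝ) ≤ gPot M := by
  obtain ⟨M₀, hM₀⟩ := gPot_split C
  refine ⟨M₀, fun M M₁ M₂ h h1 h2 h3 h4 h5 => ?_⟩
  have hs : 0 ≤ C * √M := by positivity
  rcases le_total M (M₁ + M₂) with h6 | h6
  · exact hM₀ M M₁ M₂ h (by linarith) (by linarith) h3 h4 h6 h5
  rcases le_total M (M₁ + 3 / 4 * M) with h7 | h7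
  · have := hM₀ M M₁ (M - M₁) h (by linarith) (by linarith) h3 (by linarith) (by linarith)
      (by linarith)
    linarith [gPot_mono h2 (show M₂ ≤ M - M₁ by linarith)]
  · have := hM₀ M (M / 4) (3 / 4 * M) h (by linarith) (by linarith) (by linarith) le_rfl
      (by linarith) (by linarith)
    linarith [gPot_mono h2 h4, gPot_mono h1 (show M₁ ≤ M / 4 by linarith)]

/-- Few subsets of `U` have at most `s` elements. -/
lemma card_small_subsets_le {α : Type*} (U : Finset α) (s : ℕ) {θ : ℝ} (hθ : 1 ≤ θ) :
    ((U.powerset.filter fun S => S.card ≤ s).card : ℝ) ≤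
      Real.exp (s * Real.log θ + U.card / θ) := by
  have hθ0 : 0 < θ := by linarith
  have h1 : ((U.powerset.filter fun S => S.card ≤ s).card : ℝ) ≤
      ∑ S ∈ U.powerset, θ ^ s * θ⁻¹ ^ S.card := by
    rw [card_eq_sum_ones, Nat.cast_sum, sum_filter]
    refine sum_le_sum fun S _ => ?_
    split_ifs with hS
    · rw [inv_pow, ← div_eq_mul_inv, le_div_iff₀ (by positivity), Nat.cast_one, one_mul]
      exact pow_le_pow_right₀ hθ hS
    · positivity
  refine h1.trans ?_
  have h2 : ∑ S ∈ U.powerset, θ⁻¹ ^ S.card = (θ⁻¹ + 1) ^ U.card := by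
    have := prod_add_one (f := fun _ : α => θ⁻¹) U
    simp only [prod_const] at this
    exact this.symm
  rw [← mul_sum, h2, Real.exp_add, Real.exp_nat_mul, Real.exp_log hθ0]
  gcongr
  rw [div_eq_mul_inv, Real.exp_nat_mul]
  gcongr
  exact Real.add_one_le_exp _

lemma exists_card_smallTraces_le : ∃ C : ℝ, 0 ≤ C ∧ ∀ (M : ℕ) (P : Finset (ℝ × ℝ)) (θ : ℝ),
    1 ≤ θ → ((smallTraces M P).card : ℝ) ≤
      Real.exp (M + C * (M * (1 + Real.log θ) + P.card / θ)) := by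
  obtain ⟨C, hC, h⟩ := exists_card_regionTraces_le
  refine ⟨C, hC, fun M P θ hθ => ?_⟩
  have hl := Real.log_nonneg hθ
  calc ((smallTraces M P).card : ℝ) ≤ ∑ N ∈ range (M + 1), ((regionTraces N P).card : ℝ) := by
        exact_mod_cast card_biUnion_le
    _ ≤ ∑ N ∈ range (M + 1), Real.exp (C * (M * (1 + Real.log θ) + P.card / θ)) := by
        refine sum_le_sum fun N hN => (h N P θ hθ).trans ?_
        have hNM : (N : ℝ) ≤ M := by exact_mod_cast Nat.lt_succ_iff.1 (mem_range.1 hN)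
        gcongr
    _ = ((M : ℝ) + 1) * Real.exp (C * (M * (1 + Real.log θ) + P.card / θ)) := by
        simp
    _ ≤ _ := by
        rw [Real.exp_add]
        gcongr
        exact Real.add_one_le_exp _

variable {m : ℕ} {p : Fin m → Fin m} {T U : Finset (Fin m)} {P : Finset (ℝ × ℝ)} {N : ℕ}

lemma card_tokenMaps_step {c : ℕ} (hp : ∀ t, p t ≤ t)
    (hc : ∀ s, (univ.filter fun t => p t = s ∧ t ≠ s).card ≤ c) {k κ B : ℝ} (hk : 0 ≤ k)
    (hκ : 0 < κ) (hPκ : (P.card : ℝ) ≤ κ) (hB : 0 ≤ B) (L : ℕ)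
    (hL : (2 / 3 * (N + k * U.card) + 81 * √(N : ℝ)) ≤ L)
    (hb : ∀ f N₁ N₂ H U₁ X₁ X₂, IsTokenMap p T U P N f → IsTokenSplit p T U P N k f N₁ N₂ H U₁ X₁ X₂ →
      ((tokenMaps p T U₁ (X₁ \ (H ∩ T).image f) N₁).card : ℝ) *
        (tokenMaps p T ((U \ H) \ U₁) (X₂ \ (H ∩ T).image f) N₂).card ≤ B / κ ^ (H ∩ T).card) :
    ((tokenMaps p T U P N).card : ℝ) ≤
      ((L : ℝ) + 1) ^ 2 * ((U.powerset.filter fun S => S.card ≤ ⌊20 * √(N : ℝ)⌋₊).card *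
        2 ^ ((roots p U).card + c * ⌊20 * √(N : ℝ)⌋₊)) *
        ((smallTraces ⌊81 * √(N : ℝ)⌋₊ P).card : ℝ) ^ 2 * B := by
  set s := ⌊20 * √(N : ℝ)⌋₊ with hs
  set Y := smallTraces ⌊81 * √(N : ℝ)⌋₊ P with hY
  set HI : Finset (Finset (Fin m) × Finset (Fin m)) :=
    (U.powerset.filter fun S => S.card ≤ s).biUnion fun S =>
      ((U \ S).powerset.filter fun A => ∀ t ∈ U \ S, p t ∈ U \ S → (t ∈ A ↔ p t ∈ A)).image
        fun A => (S, A) with hHI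
  have hHIcard : HI.card ≤ (U.powerset.filter fun S => S.card ≤ s).card *
      2 ^ ((roots p U).card + c * s) := by
    refine card_biUnion_le.trans ((sum_le_card_nsmul _ _ (2 ^ ((roots p U).card + c * s)) ?_).trans
      (smul_eq_mul _ _).le)
    intro S hS
    rw [mem_filter] at hS
    refine card_image_le.trans ((card_consistent hp _).trans ?_)
    refine Nat.pow_le_pow_right (by norm_num) ((card_roots_sdiff hc U S).trans ?_)
    exact Nat.add_le_add_left (Nat.mul_le_mul_left _ hS.2) _
  set I := (range (L + 1) ×ˢ range (L + 1)) ×ˢ (HI ×ˢ (Y ×ˢ Y)) with hI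
  let G : (ℕ × ℕ) × (Finset (Fin m) × Finset (Fin m)) × Finset (ℝ × ℝ) × Finset (ℝ × ℝ) →
      Finset (Fin m → ℝ × ℝ) := fun q =>
    (Fintype.piFinset fun t => if t ∈ q.2.1.1 ∩ T then P else {0}).filter fun g =>
      ∃ f, IsTokenMap p T U P N f ∧
        IsTokenSplit p T U P N k f q.1.1 q.1.2 q.2.1.1 q.2.1.2 q.2.2.1 q.2.2.2 ∧
        (q.2.1.1 ∩ T).image g = (q.2.1.1 ∩ T).image f
  let E : (ℕ × ℕ) × (Finset (Fin m) × Finset (Fin m)) × Finset (ℝ × ℝ) × Finset (ℝ × ℝ) →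
      (Fin m → ℝ × ℝ) → Finset (Fin m → ℝ × ℝ) := fun q g =>
    image₂ (fun a b => g + a + b)
      (tokenMaps p T q.2.1.2 (q.2.2.1 \ (q.2.1.1 ∩ T).image g) q.1.1)
      (tokenMaps p T ((U \ q.2.1.1) \ q.2.1.2) (q.2.2.2 \ (q.2.1.1 ∩ T).image g) q.1.2)
  have hsub : tokenMaps p T U P N ⊆ I.biUnion fun q => (G q).biUnion (E q) := by
    intro f hf
    have hf' := mem_tokenMaps.1 hf
    obtain ⟨N₁, N₂, H, U₁, X₁, X₂, h⟩ := hf'.exists_split hk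
    set g : Fin m → ℝ × ℝ := fun t => if t ∈ H ∩ T then f t else 0 with hg
    have hgi : (H ∩ T).image g = (H ∩ T).image f := image_congr fun t ht => if_pos ht
    refine mem_biUnion.2 ⟨((N₁, N₂), (H, U₁), (X₁, X₂)), ?_, mem_biUnion.2 ⟨g, ?_, ?_⟩⟩
    · have hN₁ : N₁ ≤ L := by
        have h1 : 0 ≤ k * U₁.card := by positivity
        exact_mod_cast (by linarith [h.N₁_le] : (N₁ : ℝ) ≤ L)
      have hN₂ : N₂ ≤ L := by
        have h1 : 0 ≤ k * ((U \ H) \ U₁).card := by positivity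
        exact_mod_cast (by linarith [h.N₂_le] : (N₂ : ℝ) ≤ L)
      simp only [hI, mem_product, mem_range, Nat.lt_succ_iff]
      refine ⟨⟨hN₁, hN₂⟩, ?_, h.X₁_mem, h.X₂_mem⟩
      exact mem_biUnion.2 ⟨H, mem_filter.2 ⟨mem_powerset.2 h.H_sub, Nat.le_floor h.card_H⟩,
        mem_image.2 ⟨U₁, mem_filter.2 ⟨mem_powerset.2 h.U_sub, h.cons⟩, rfl⟩⟩
    · refine mem_filter.2 ⟨Fintype.mem_piFinset.2 fun t => ?_, f, hf', h, hgi⟩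
      simp only [hg]
      split_ifs with ht
      · refine hf'.image ▸ mem_image_of_mem f (mem_inter.2 ⟨h.H_sub (mem_inter.1 ht).1,
          (mem_inter.1 ht).2⟩)
      · exact mem_singleton_self _
    · refine mem_image₂.2 ⟨_, mem_tokenMaps.2 (hgi ▸ h.left), _, mem_tokenMaps.2 (hgi ▸ h.right),
          ?_⟩
      funext t
      simp only [hg, Pi.add_apply, mem_inter, mem_sdiff]
      have hz := hf'.zero t
      rw [mem_inter, not_and] at hz
      have h1 : t ∈ U₁ → t ∈ U ∧ t ∉ H := fun ht => mem_sdiff.1 (h.U_sub ht)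
      have h2 := @h.H_sub t
      by_cases a1 : t ∈ U₁
      · simp [a1, (h1 a1).2]
      · by_cases a2 : t ∈ H
        · by_cases a3 : t ∈ T
          · simp [a1, a2, a3]
          · simp [a1, a2, a3, hz]
        · by_cases a3 : t ∈ U
          · simp [a1, a2, a3]
          · simp [a1, a2, a3, hz]
  have hinner : ∀ q ∈ I, (((G q).biUnion (E q)).card : ℝ) ≤ B := by
    intro q _
    set h := (q.2.1.1 ∩ T).card with hh
    have hE : ∀ g ∈ G q, ((E q g).card : ℝ) ≤ B / κ ^ h := by
      intro g hg
      obtain ⟨-, f, hf, hsplit, hgi⟩ := mem_filter.1 hg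
      refine le_trans ?_ (hb f _ _ _ _ _ _ hf hsplit)
      rw [← hgi]
      exact_mod_cast card_image₂_le _ _ _
    have hGq : ((G q).card : ℝ) ≤ κ ^ h := by
      have h1 : (G q).card ≤ P.card ^ h := (card_filter_le _ _).trans_eq (card_piFinset_ite _ _)
      calc ((G q).card : ℝ) ≤ (P.card : ℝ) ^ h := by exact_mod_cast h1
        _ ≤ κ ^ h := by gcongr
    calc (((G q).biUnion (E q)).card : ℝ) ≤ ∑ g ∈ G q, ((E q g).card : ℝ) := by
          exact_mod_cast card_biUnion_le
      _ ≤ (G q).card * (B / κ ^ h) := by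
          rw [← nsmul_eq_mul]
          exact sum_le_card_nsmul _ _ _ hE
      _ ≤ κ ^ h * (B / κ ^ h) := by gcongr
      _ = B := by field_simp
  calc ((tokenMaps p T U P N).card : ℝ)
      ≤ ∑ q ∈ I, (((G q).biUnion (E q)).card : ℝ) := by
        exact_mod_cast (card_le_card hsub).trans card_biUnion_le
    _ ≤ I.card * B := by
        rw [← nsmul_eq_mul]
        exact sum_le_card_nsmul _ _ _ hinner
    _ ≤ _ := by
        refine mul_le_mul_of_nonneg_right ?_ hB
        have h1 : (HI.card : ℝ) ≤ (U.powerset.filter fun S => S.card ≤ s).card *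
            2 ^ ((roots p U).card + c * s) := by exact_mod_cast hHIcard
        calc (I.card : ℝ) = ((L : ℝ) + 1) ^ 2 * HI.card * (Y.card : ℝ) ^ 2 := by
              simp only [hI, card_product, card_range]
              push_cast
              ring
          _ ≤ _ := by gcongr

end TokenCount

section TokenBound

lemma log_add_one_sq_le {x : ℝ} (hx : 1 ≤ x) : ((x ^ 2 + 1) ^ 2 : ℝ) ≤ Real.exp (4 * x) := by
  have h1 : x ^ 2 + 1 ≤ (x + 1) ^ 2 := by nlinarith
  calc (x ^ 2 + 1) ^ 2 ≤ ((x + 1) ^ 2) ^ 2 := by gcongr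
    _ ≤ (Real.exp x ^ 2) ^ 2 := by
        gcongr
        exact Real.add_one_le_exp x
    _ = Real.exp (4 * x) := by
        rw [← pow_mul, ← Real.exp_nat_mul]
        norm_num

lemma sqrt_mul_one_add_log_le {y : ℝ} (hy : 1 ≤ y) :
    √y * (1 + Real.log y) ≤ 17 * y ^ (5 / 8 : ℝ) := by
  have h0 : 0 < y := by linarith
  have h1 := log_add_one_le hy
  have h2 := Real.log_le_log h0 (by linarith : y ≤ y + 1)
  have h3 := sqrt_mul_rpow h0
  have h4 := one_le_rpow_five_eighths hy
  have h5 : √y * Real.log y ≤ √y * (16 * y ^ (1 / 8 : ℝ)) :=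
    mul_le_mul_of_nonneg_left (by linarith) (Real.sqrt_nonneg y)
  nlinarith

variable {m : ℕ} {p : Fin m → Fin m} {T U : Finset (Fin m)} {P : Finset (ℝ × ℝ)} {N : ℕ}

set_option maxHeartbeats 2000000 in
/-- The main count: few token maps are realizable. -/
theorem exists_card_tokenMaps_le (c : ℕ) : ∃ K : ℝ, 0 ≤ K ∧ ∀ (m : ℕ) (p : Fin m → Fin m)
    (T : Finset (Fin m)), (∀ t, p t ≤ t) →
    (∀ s, (univ.filter fun t => p t = s ∧ t ≠ s).card ≤ c) → ∀ k : ℝ, 1 ≤ k →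
    ∀ (U : Finset (Fin m)) (P : Finset (ℝ × ℝ)) (N : ℕ) (y : ℝ), 1 ≤ y →
      N + k * U.card ≤ k ^ 2 * y → ((tokenMaps p T U P N).card : ℝ) ≤
        k ^ P.card * Real.exp (k * (K * gPot y) + (roots p U).card * ell y) := by
  obtain ⟨C, hC, hsmall⟩ := exists_card_smallTraces_le
  set D : ℝ := 200 + 100 * c + 200 * C with hD
  have hD0 : 200 ≤ D := by
    have : (0 : ℝ) ≤ c := Nat.cast_nonneg c
    linarith
  obtain ⟨M₀, hM₀⟩ := gPot_split_of_one_le (C := 17 * D) (by linarith)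
  obtain ⟨y₀, hy₀1, hy₀2⟩ : ∃ y₀ : ℝ, M₀ ≤ y₀ ∧ (972 : ℝ) ^ 2 ≤ y₀ :=
    ⟨max M₀ (972 ^ 2), le_max_left _ _, le_max_right _ _⟩
  have hly₀ : 0 ≤ Real.log y₀ := Real.log_nonneg (by linarith)
  refine ⟨max 1 (y₀ * Real.log y₀), by positivity, fun m p T hp hc k hk => ?_⟩
  set K : ℝ := max 1 (y₀ * Real.log y₀) with hK
  have hK1 : 1 ≤ K := le_max_left _ _
  have hk0 : 0 < k := by linarith
  suffices h : ∀ (n : ℕ) (U : Finset (Fin m)) (P : Finset (ℝ × ℝ)) (N : ℕ) (y : ℝ), y ≤ n → 1 ≤ y →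
      N + k * U.card ≤ k ^ 2 * y → ((tokenMaps p T U P N).card : ℝ) ≤
        k ^ P.card * Real.exp (k * (K * gPot y) + (roots p U).card * ell y) from
    fun U P N y hy hz => h ⌈y⌉₊ U P N y (Nat.le_ceil y) hy hz
  intro n
  induction n with
  | zero =>
    intro U P N y h1 h2
    norm_num at h1
    linarith
  | succ n ih =>
  intro U P N y hyn hy hz
  have hr0 : (0 : ℝ) ≤ (roots p U).card := Nat.cast_nonneg _
  have hpos : 0 ≤ k ^ P.card * Real.exp (k * (K * gPot y) + (roots p U).card * ell y) :=
      by positivity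
  rcases (tokenMaps p T U P N).eq_empty_or_nonempty with he | ⟨f₀, hf₀⟩
  · rw [he]
    simpa using hpos
  have hf₀ := mem_tokenMaps.1 hf₀
  have hUy : (U.card : ℝ) ≤ k * y := by
    have h1 : k * U.card ≤ k * (k * y) := by
      have : (0 : ℝ) ≤ N := Nat.cast_nonneg N
      nlinarith
    exact le_of_mul_le_mul_left h1 hk0
  have hPU : (P.card : ℝ) ≤ U.card := by
    rw [hf₀.card_eq]
    exact_mod_cast card_le_card inter_subset_left
  have hPy : (P.card : ℝ) ≤ k * y := hPU.trans hUy
  have hell1 := one_le_ell hy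
  have hgy := le_gPot hy
  rcases lt_or_ge y y₀ with hlt | hge
  · calc ((tokenMaps p T U P N).card : ℝ) ≤ (P.card : ℝ) ^ P.card := by
          exact_mod_cast card_tokenMaps_le_pow p T U P N
      _ ≤ (k * y₀) ^ P.card := by
          have : k * y ≤ k * y₀ := by gcongr
          gcongr
          linarith
      _ = k ^ P.card * y₀ ^ P.card := mul_pow _ _ _
      _ ≤ _ := by
          refine mul_le_mul_of_nonneg_left (pow_le_exp_log (by linarith) _ ?_) (by positivity)
          have h1 : (P.card : ℝ) * Real.log y₀ ≤ k * y₀ * Real.log y₀ := by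
            have : k * y ≤ k * y₀ := by gcongr
            exact mul_le_mul_of_nonneg_right (by linarith) hly₀
          have h2 : k * (y₀ * Real.log y₀) ≤ k * (K * gPot y) := by
            refine mul_le_mul_of_nonneg_left ?_ hk0.le
            exact (le_max_right 1 _).trans (le_mul_of_one_le_right (by linarith) (by linarith))
          have h3 : 0 ≤ (roots p U).card * ell y := by positivity
          linarith
  have hy2 : (972 : ℝ) ^ 2 ≤ y := hy₀2.trans hge
  have hsq : 972 ≤ √y := Real.le_sqrt_of_sq_le hy2
  have hsqy : √y * √y = y := Real.mul_self_sqrt (by linarith)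
  set x : ℝ := k * √y with hx
  have hx1 : 1 ≤ x := one_le_mul_of_one_le_of_one_le hk (by linarith)
  have hxx : x ^ 2 = k ^ 2 * y := by
    rw [hx, mul_pow, Real.sq_sqrt (by linarith)]
  have hl0 : 0 ≤ Real.log y := Real.log_nonneg hy
  set l : ℝ := Real.log y with hl
  have hlsq : Real.log (√y) = l / 2 := by rw [Real.log_sqrt (by linarith)]
  have hNx : √(N : ℝ) ≤ x := by
    refine Real.sqrt_le_iff.2 ⟨by linarith, ?_⟩
    rw [hxx]
    have : 0 ≤ k * U.card := by positivity
    linarith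
  have hs : ((⌊20 * √(N : ℝ)⌋₊ : ℕ) : ℝ) ≤ 20 * x :=
    (Nat.floor_le (by positivity)).trans (by linarith)
  have hM : ((⌊81 * √(N : ℝ)⌋₊ : ℕ) : ℝ) ≤ 81 * x :=
    (Nat.floor_le (by positivity)).trans (by linarith)
  set s := ⌊20 * √(N : ℝ)⌋₊ with hsdef
  set M := ⌊81 * √(N : ℝ)⌋₊ with hMdef
  have hkyx : k * y / √y = x := by
    rw [hx, div_eq_iff (by linarith), mul_assoc, hsqy]
  set r : ℝ := ((roots p U).card : ℝ) with hr
  have hxy : k * (81 * √y) ≤ k ^ 2 * y / 12 := by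
    have h1 : 81 * √y ≤ y / 12 := by nlinarith
    have h2 : k * (81 * √y) ≤ k * (y / 12) := by gcongr
    have h3 : k * (y / 12) ≤ k * (k * (y / 12)) := by
      exact le_mul_of_one_le_left (by positivity) hk
    calc k * (81 * √y) ≤ k * (k * (y / 12)) := h2.trans h3
      _ = k ^ 2 * y / 12 := by ring
  set z : ℝ := N + k * U.card with hzdef
  -- the bound for the pairs of children
  set Q : ℝ := k * (K * (gPot y - 17 * D * y ^ (5 / 8 : ℝ))) + (r + c * (20 * x)) * (4 * l) +
    20 * x * l with hQ
  have hb : ∀ f N₁ N₂ H U₁ X₁ X₂, IsTokenMap p T U P N f →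
      IsTokenSplit p T U P N k f N₁ N₂ H U₁ X₁ X₂ →
      ((tokenMaps p T U₁ (X₁ \ (H ∩ T).image f) N₁).card : ℝ) *
        (tokenMaps p T ((U \ H) \ U₁) (X₂ \ (H ∩ T).image f) N₂).card ≤
      k ^ P.card * Real.exp Q / (k * y) ^ (H ∩ T).card := by
    intro f N₁ N₂ H U₁ X₁ X₂ hf h
    set U₂ := (U \ H) \ U₁ with hU₂
    set P₁ := X₁ \ (H ∩ T).image f with hP₁
    set P₂ := X₂ \ (H ∩ T).image f with hP₂
    have hcards : P₁.card + P₂.card + (H ∩ T).card = P.card := by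
      rw [h.left.card_eq, h.right.card_eq, hf.card_eq, ← card_union_of_disjoint,
        ← card_union_of_disjoint]
      · congr 1
        ext t
        have h1 := @h.H_sub t
        have h2 := @h.U_sub t
        simp only [mem_union, mem_inter, mem_sdiff] at h2 ⊢
        tauto
      · rw [disjoint_left]
        intro t ht ht'
        have h2 := @h.U_sub t
        simp only [mem_union, mem_inter, mem_sdiff] at h2 ht ht'
        tauto
      · rw [disjoint_left]
        intro t ht ht'
        simp only [mem_inter, mem_sdiff] at ht ht'
        tauto
    have hh : ((H ∩ T).card : ℝ) ≤ 20 * x := by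
      have h1 : ((H ∩ T).card : ℝ) ≤ H.card := by exact_mod_cast card_le_card inter_subset_left
      linarith [h.card_H]
    have hroots : ((roots p U₁).card : ℝ) + (roots p U₂).card ≤ r + c * (20 * x) := by
      have h1 := card_roots_sides (p := p) (U := U \ H) (S := ∅) (A := U₁) (B := U₂)
        disjoint_sdiff (by rw [sdiff_empty, hU₂, union_sdiff_of_subset h.U_sub])
        (by simpa using h.cons)
      simp only [union_empty, card_empty, mul_zero, add_zero] at h1
      have h2 := h1.trans (card_roots_sdiff hc U H)
      have h3 : ((roots p U₁).card : ℝ) + (roots p U₂).card ≤ r + c * H.card := by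
        rw [hr]
        exact_mod_cast h2
      have h4 : (c : ℝ) * H.card ≤ c * (20 * x) :=
        mul_le_mul_of_nonneg_left (by linarith [h.card_H]) (Nat.cast_nonneg c)
      linarith
    -- scales of the children
    have hscale : ∀ z' : ℝ, z' ≤ 2 / 3 * z + 81 * √(N : ℝ) →
        1 ≤ max 1 (z' / k ^ 2) ∧ max 1 (z' / k ^ 2) ≤ 3 / 4 * y ∧
          z' ≤ k ^ 2 * max 1 (z' / k ^ 2) := by
      intro z' hz'
      refine ⟨le_max_left _ _, max_le (by linarith) ?_, ?_⟩
      · rw [div_le_iff₀ (by positivity)]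
        have : 81 * √(N : ℝ) ≤ k * (81 * √y) := by
          rw [mul_left_comm, ← hx]
          linarith
        linarith
      · calc z' = k ^ 2 * (z' / k ^ 2) := by field_simp
          _ ≤ _ := mul_le_mul_of_nonneg_left (le_max_right _ _) (by positivity)
    obtain ⟨a1, a2, a3⟩ := hscale _ h.N₁_le
    obtain ⟨b1, b2, b3⟩ := hscale _ h.N₂_le
    set z₁ : ℝ := N₁ + k * U₁.card with hz₁
    set z₂ : ℝ := N₂ + k * U₂.card with hz₂
    set y₁ := max 1 (z₁ / k ^ 2) with hy₁
    set y₂ := max 1 (z₂ / k ^ 2) with hy₂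
    have hz₁0 : 0 ≤ z₁ / k ^ 2 := by positivity
    have hz₂0 : 0 ≤ z₂ / k ^ 2 := by positivity
    have hsum : y₁ + y₂ ≤ y + 17 * D * √y := by
      have e1 : y₁ ≤ 1 + z₁ / k ^ 2 := max_le (by linarith) (by linarith)
      have e2 : y₂ ≤ 1 + z₂ / k ^ 2 := max_le (by linarith) (by linarith)
      have e3 : z₁ / k ^ 2 + z₂ / k ^ 2 ≤ y + 142 * √y := by
        rw [← add_div, div_le_iff₀ (by positivity)]
        have e4 : 142 * √(N : ℝ) ≤ 142 * √y * k ^ 2 := by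
          have : x ≤ √y * k ^ 2 := by
            calc x ≤ x * k := le_mul_of_one_le_right (by linarith) hk
              _ = √y * k ^ 2 := by rw [hx]; ring
          linarith
        have := h.add_le
        linarith
      have e5 : 17 * 200 * √y ≤ 17 * D * √y := by gcongr
      linarith
    have i1 := ih U₁ P₁ N₁ y₁ (by push_cast at hyn; linarith) a1 a3
    have i2 := ih U₂ P₂ N₂ y₂ (by push_cast at hyn; linarith) b1 b3
    have hg := hM₀ y y₁ y₂ (hy₀1.trans hge) a1 b1 a2 b2 hsum
    have e1 : ell y₁ + 1 ≤ ell y := ell_add_one_le (by linarith) (by linarith) a2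
    have e2 : ell y₂ + 1 ≤ ell y := ell_add_one_le (by linarith) (by linarith) b2
    have hel : ell y = 1 + 4 * l := rfl
    have k1 : ((roots p U₁).card : ℝ) * ell y₁ ≤ (roots p U₁).card * (4 * l) :=
      mul_le_mul_of_nonneg_left (by linarith) (Nat.cast_nonneg _)
    have k2 : ((roots p U₂).card : ℝ) * ell y₂ ≤ (roots p U₂).card * (4 * l) :=
      mul_le_mul_of_nonneg_left (by linarith) (Nat.cast_nonneg _)
    have k3 := mul_le_mul_of_nonneg_right hroots (show 0 ≤ 4 * l by linarith)
    have k4 : k * (K * (gPot y₁ + gPot y₂)) ≤ k * (K * (gPot y - 17 * D * y ^ (5 / 8 : ℝ))) := by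
      gcongr
      linarith
    rw [le_div_iff₀ (by positivity)]
    have hyh : y ^ (H ∩ T).card ≤ Real.exp (20 * x * l) :=
      pow_le_exp_log (by linarith) _ (mul_le_mul_of_nonneg_right hh hl0)
    calc ((tokenMaps p T U₁ P₁ N₁).card : ℝ) * (tokenMaps p T U₂ P₂ N₂).card *
          (k * y) ^ (H ∩ T).card
        ≤ (k ^ P₁.card * Real.exp (k * (K * gPot y₁) + (roots p U₁).card * ell y₁)) *
          (k ^ P₂.card * Real.exp (k * (K * gPot y₂) + (roots p U₂).card * ell y₂)) *
          (k ^ (H ∩ T).card * Real.exp (20 * x * l)) := by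
            rw [mul_pow]
            gcongr
      _ = k ^ P.card * Real.exp ((k * (K * gPot y₁) + (roots p U₁).card * ell y₁) +
          (k * (K * gPot y₂) + (roots p U₂).card * ell y₂) + 20 * x * l) := by
            rw [← hcards]
            simp only [pow_add, Real.exp_add]
            ring
      _ ≤ k ^ P.card * Real.exp Q := by
            gcongr
            rw [hQ]
            linarith
  have hstep := card_tokenMaps_step (U := U) (P := P) (N := N) (T := T) hp hc (k := k) (κ := k * y)
    (B := k ^ P.card * Real.exp Q) hk0.le (by positivity) hPy (by positivity) ⌊x ^ 2⌋₊ ?_ hb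
  swap
  · have h1 : 81 * √(N : ℝ) ≤ k * (81 * √y) := by
      rw [mul_left_comm, ← hx]
      linarith
    have h2 := Nat.lt_floor_add_one (x ^ 2)
    have h3 : (1 : ℝ) * 972 ^ 2 ≤ k ^ 2 * y := by
      gcongr
      exact one_le_pow₀ hk
    linarith
  refine hstep.trans ?_
  have f1 : ((⌊x ^ 2⌋₊ : ℝ) + 1) ^ 2 ≤ Real.exp (4 * x) := by
    refine le_trans ?_ (log_add_one_sq_le hx1)
    have := Nat.floor_le (show 0 ≤ x ^ 2 by positivity)
    gcongr
  have f2 : ((U.powerset.filter fun S => S.card ≤ s).card : ℝ) ≤ Real.exp (10 * x * l + x) := by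
    refine (card_small_subsets_le U s (show 1 ≤ √y by linarith)).trans (Real.exp_le_exp.2 ?_)
    have h1 : (U.card : ℝ) / √y ≤ x := by
      rw [← hkyx]
      gcongr
    have h2 : (s : ℝ) * Real.log (√y) ≤ 20 * x * (l / 2) := by
      rw [hlsq]
      exact mul_le_mul_of_nonneg_right hs (by linarith)
    linarith
  have f3 : (2 : ℝ) ^ ((roots p U).card + c * s) ≤ Real.exp (r + c * (20 * x)) := by
    refine (two_pow_le_exp _).trans (Real.exp_le_exp.2 ?_)
    push_cast
    have := mul_le_mul_of_nonneg_left hs (Nat.cast_nonneg (α := ℝ) c)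
    linarith
  have f4 : ((smallTraces M P).card : ℝ) ≤ Real.exp (81 * x + C * (81 * x * (1 + l / 2) + x)) := by
    refine (hsmall M P (√y) (by linarith)).trans (Real.exp_le_exp.2 ?_)
    have h1 : (P.card : ℝ) / √y ≤ x := by
      rw [← hkyx]
      gcongr
    rw [hlsq]
    have h2 : (M : ℝ) * (1 + l / 2) ≤ 81 * x * (1 + l / 2) :=
      mul_le_mul_of_nonneg_right hM (by linarith)
    have h3 : C * (M * (1 + l / 2) + P.card / √y) ≤ C * (81 * x * (1 + l / 2) + x) :=
      mul_le_mul_of_nonneg_left (by linarith) hC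
    linarith
  calc ((⌊x ^ 2⌋₊ : ℝ) + 1) ^ 2 * ((U.powerset.filter fun S => S.card ≤ s).card *
        2 ^ ((roots p U).card + c * s)) * ((smallTraces M P).card : ℝ) ^ 2 *
        (k ^ P.card * Real.exp Q)
      ≤ Real.exp (4 * x) * (Real.exp (10 * x * l + x) * Real.exp (r + c * (20 * x))) *
        Real.exp (81 * x + C * (81 * x * (1 + l / 2) + x)) ^ 2 * (k ^ P.card * Real.exp Q) := by
          gcongr
    _ = k ^ P.card * Real.exp (4 * x + (10 * x * l + x + (r + c * (20 * x))) +
        2 * (81 * x + C * (81 * x * (1 + l / 2) + x)) + Q) := by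
          rw [← Real.exp_nat_mul, Nat.cast_ofNat, Real.exp_add _ Q, Real.exp_add (_ + _) (2 * _),
            Real.exp_add (4 * x), Real.exp_add (10 * x * l + x)]
          ring
    _ ≤ k ^ P.card * Real.exp (k * (K * gPot y) + r * ell y) := by
          refine mul_le_mul_of_nonneg_left (Real.exp_le_exp.2 ?_) (by positivity)
          have g1 : x * (1 + l) ≤ k * (17 * y ^ (5 / 8 : ℝ)) := by
            rw [hx, mul_assoc]
            exact mul_le_mul_of_nonneg_left (sqrt_mul_one_add_log_le hy) hk0.le
          have g2 : D * (x * (1 + l)) ≤ k * (K * (17 * D * y ^ (5 / 8 : ℝ))) := by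
            have h58 : 0 ≤ y ^ (5 / 8 : ℝ) := by positivity
            calc D * (x * (1 + l)) ≤ D * (k * (17 * y ^ (5 / 8 : ℝ))) := by gcongr
              _ = k * (1 * (17 * D * y ^ (5 / 8 : ℝ))) := by ring
              _ ≤ _ := by gcongr
          have g3 : 0 ≤ x * l := by positivity
          have g4 : 0 ≤ C * x := by positivity
          have g5 : 0 ≤ C * (x * l) := by positivity
          have g6 : (0 : ℝ) ≤ c * x := by positivity
          have g7 : (0 : ℝ) ≤ c * (x * l) := by positivity
          have g8 : D * (x * (1 + l)) = 200 * x + 200 * (x * l) + 100 * (c * x) + 100 * (c * (x * l))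
            + 200 * (C * x) + 200 * (C * (x * l)) := by rw [hD]; ring
          have hel : ell y = 1 + 4 * l := rfl
          rw [hQ, hel]
          linarith

end TokenBound

section Arcs

lemma isCompact_segment (a b : ℝ × ℝ) : IsCompact (segment ℝ a b) := by
  rw [segment_eq_image]
  exact isCompact_Icc.image (by fun_prop)

lemma isCompact_curve : ∀ l, IsCompact (curve l)
  | [] => isCompact_empty
  | [_] => isCompact_singleton
  | a :: b :: t => (isCompact_segment a b).union (isCompact_curve (b :: t))

lemma isPreconnected_curve (a : ℝ × ℝ) (t : List (ℝ × ℝ)) : IsPreconnected (curve (a :: t)) := by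
  induction t generalizing a with
  | nil => exact isPreconnected_singleton
  | cons b t ih =>
    exact (convex_segment a b).isPreconnected.union b (right_mem_segment ℝ a b)
      (head_mem_curve b t) (ih b)

/-- The end of the polyline starting at `a` with further points `t`. -/
def lastPt : ℝ × ℝ → List (ℝ × ℝ) → ℝ × ℝ
  | a, [] => a
  | _, b :: t => lastPt b t

@[simp] lemma lastPt_nil (a : ℝ × ℝ) : lastPt a [] = a := rfl
@[simp] lemma lastPt_cons (a b : ℝ × ℝ) (t : List (ℝ × ℝ)) : lastPt a (b :: t) = lastPt b t := rfl

lemma lastPt_mem_curve (a : ℝ × ℝ) (t : List (ℝ × ℝ)) : lastPt a t ∈ curve (a :: t) := by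
  induction t generalizing a with
  | nil => exact rfl
  | cons b t ih => exact .inr (ih b)

lemma lastPt_append (a : ℝ × ℝ) (t : List (ℝ × ℝ)) (b : ℝ × ℝ) : lastPt a (t ++ [b]) = b := by
  induction t generalizing a with
  | nil => rfl
  | cons c t ih => exact ih c

/-- Consecutive segments are nondegenerate and each meets the rest only in its end. -/
def Simple : ℝ × ℝ → List (ℝ × ℝ) → Prop
  | _, [] => True
  | a, b :: t => a ≠ b ∧ (∀ z ∈ segment ℝ a b, z ∈ curve (b :: t) → z = b) ∧ Simple b t

lemma Simple.head_notMem {a b : ℝ × ℝ} {t : List (ℝ × ℝ)} (h : Simple a (b :: t)) :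
    a ∉ curve (b :: t) := fun h' => h.1 (h.2.1 a (left_mem_segment ℝ a b) h')

lemma Simple.head_ne_last {a : ℝ × ℝ} {t : List (ℝ × ℝ)} (h : Simple a t) (ht : t ≠ []) :
    a ≠ lastPt a t := by
  cases t with
  | nil => exact absurd rfl ht
  | cons b t =>
    intro h'
    exact h.head_notMem (by rw [h']; exact lastPt_mem_curve b t)

lemma segment_subset_left {a b p : ℝ × ℝ} (hp : p ∈ segment ℝ a b) :
    segment ℝ a p ⊆ segment ℝ a b :=
  (convex_segment a b).segment_subset (left_mem_segment ℝ a b) hp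

lemma segment_subset_right {a b p : ℝ × ℝ} (hp : p ∈ segment ℝ a b) :
    segment ℝ p b ⊆ segment ℝ a b :=
  (convex_segment a b).segment_subset hp (right_mem_segment ℝ a b)

lemma mem_segment_split {a b p z : ℝ × ℝ} (hp : p ∈ segment ℝ a b) (hz : z ∈ segment ℝ a b) :
    z ∈ segment ℝ a p ∨ z ∈ segment ℝ p b := by
  rw [segment_eq_image_lineMap] at hp hz
  obtain ⟨s, hs, rfl⟩ := hp
  obtain ⟨u, hu, rfl⟩ := hz
  have key : ∀ x y w : ℝ, x ≤ w → w ≤ y → AffineMap.lineMap a b w ∈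
      segment ℝ (AffineMap.lineMap a b x : ℝ × ℝ) (AffineMap.lineMap a b y) := fun x y w h1 h2 => by
    rw [← image_segment]
    exact ⟨w, by rw [segment_eq_Icc (h1.trans h2)]; exact ⟨h1, h2⟩, rfl⟩
  rcases le_total u s with h | h
  · left
    simpa using key 0 s u hu.1 h
  · right
    simpa using key s 1 u h hu.2

lemma eq_of_mem_segments {a b p z : ℝ × ℝ} (hp : p ∈ segment ℝ a b) (hz : z ∈ segment ℝ a p)
    (hz' : z ∈ segment ℝ p b) : z = p := by
  have h1 := dist_add_dist_of_mem_segment hp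
  have h2 := dist_add_dist_of_mem_segment hz
  have h3 := dist_add_dist_of_mem_segment hz'
  have h4 := dist_triangle a z b
  rw [dist_comm p z] at h3
  exact dist_le_zero.1 (by linarith)

/-- The part of a simple polyline after one of its points. -/
lemma Simple.exists_tail {a p : ℝ × ℝ} {t : List (ℝ × ℝ)} (h : Simple a t)
    (hp : p ∈ curve (a :: t)) : ∃ t', Simple p t' ∧ lastPt p t' = lastPt a t ∧
      curve (p :: t') ⊆ curve (a :: t) ∧ t'.length ≤ t.length := by
  induction t generalizing a with
  | nil =>
    obtain rfl : p = a := hp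
    exact ⟨[], trivial, rfl, subset_rfl, le_rfl⟩
  | cons b t ih =>
    by_cases hpt : p ∈ curve (b :: t)
    · obtain ⟨t', h1, h2, h3, h4⟩ := ih h.2.2 hpt
      exact ⟨t', h1, h2, h3.trans Set.subset_union_right, h4.trans (Nat.le_succ _)⟩
    · have hp' : p ∈ segment ℝ a b := hp.resolve_right hpt
      refine ⟨b :: t, ⟨fun hpb => hpt (hpb ▸ head_mem_curve b t), fun z hz hz' =>
        h.2.1 z (segment_subset_right hp' hz) hz', h.2.2⟩, rfl, ?_, le_rfl⟩
      exact Set.union_subset_union_left _ (segment_subset_right hp')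

/-- Every polyline contains a simple one with the same ends. -/
lemma exists_simple (a : ℝ × ℝ) (t : List (ℝ × ℝ)) : ∃ t', Simple a t' ∧
    lastPt a t' = lastPt a t ∧ curve (a :: t') ⊆ curve (a :: t) ∧ t'.length ≤ t.length := by
  induction t generalizing a with
  | nil => exact ⟨[], trivial, rfl, subset_rfl, le_rfl⟩
  | cons b t ih =>
    obtain ⟨s, h1, h2, h3, h4⟩ := ih b
    have hcomp : IsCompact (segment ℝ a b ∩ curve (b :: s)) :=
      (isCompact_segment a b).inter (isCompact_curve _)
    obtain ⟨p, ⟨hpab, hps⟩, hmin⟩ := hcomp.exists_isMinOn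
      ⟨b, right_mem_segment ℝ a b, head_mem_curve b s⟩
      (continuous_const.dist continuous_id : Continuous fun z => dist a z).continuousOn
    obtain ⟨t', e1, e2, e3, e4⟩ := h1.exists_tail hps
    by_cases hap : a = p
    · subst hap
      refine ⟨t', e1, e2.trans h2, (e3.trans h3).trans Set.subset_union_right, ?_⟩
      simp only [List.length_cons]
      omega
    · refine ⟨p :: t', ⟨hap, fun z hz hz' => ?_, e1⟩, e2.trans h2, ?_, ?_⟩
      · have hz1 : dist a p ≤ dist a z := hmin ⟨segment_subset_left hpab hz, e3 hz'⟩
        have hz2 := dist_add_dist_of_mem_segment hz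
        exact dist_le_zero.1 (by linarith)
      · exact Set.union_subset_union (segment_subset_left hpab) (e3.trans h3)
      · simp only [List.length_cons]
        omega

/-- Cutting a simple polyline at one of its interior points. -/
lemma Simple.exists_split {a p : ℝ × ℝ} {t : List (ℝ × ℝ)} (h : Simple a t)
    (hp : p ∈ curve (a :: t)) (hpa : p ≠ a) (hpl : p ≠ lastPt a t) :
    ∃ t₁ t₂, t₁ ≠ [] ∧ t₂ ≠ [] ∧ Simple a t₁ ∧ Simple p t₂ ∧ lastPt a t₁ = p ∧
      lastPt p t₂ = lastPt a t ∧ curve (a :: t₁) ∪ curve (p :: t₂) = curve (a :: t) ∧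
      (∀ z ∈ curve (a :: t₁), z ∈ curve (p :: t₂) → z = p) ∧
      t₁.length + t₂.length ≤ t.length + 1 := by
  induction t generalizing a with
  | nil => exact absurd hp hpa
  | cons b t ih =>
    by_cases hpt : p ∈ curve (b :: t)
    · by_cases hpb : p = b
      · subst hpb
        cases t with
        | nil => exact absurd rfl hpl
        | cons c t =>
          refine ⟨[p], c :: t, by simp, by simp, ⟨h.1, fun z _ hz => hz, trivial⟩, h.2.2, rfl, rfl,
            ?_, ?_, ?_⟩
          · ext z
            simp only [curve, Set.mem_union, Set.mem_singleton_iff]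
            constructor
            · rintro ((hz | rfl) | hz)
              exacts [.inl hz, .inl (right_mem_segment ℝ a z), .inr hz]
            · rintro (hz | hz)
              exacts [.inl (.inl hz), .inr hz]
          · rintro z (hz | hz) hz'
            exacts [h.2.1 z hz hz', hz]
          · simp only [List.length_cons, List.length_nil]
            omega
      · obtain ⟨t₁, t₂, e1, e2, e3, e4, e5, e6, e7, e8, e9⟩ := ih h.2.2 hpt hpb hpl
        refine ⟨b :: t₁, t₂, by simp, e2, ⟨h.1, fun z hz hz' => h.2.1 z hz ?_, e3⟩, e4, e5, e6, ?_,
            ?_,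
          ?_⟩
        · exact e7 ▸ Or.inl hz'
        · rw [curve_cons, curve_cons, Set.union_assoc, e7]
        · rintro z (hz | hz) hz'
          · have hzb := h.2.1 z hz (e7 ▸ Or.inr hz')
            exact e8 z (hzb ▸ head_mem_curve b t₁) hz'
          · exact e8 z hz hz'
        · simp only [List.length_cons]
          omega
    · have hp' : p ∈ segment ℝ a b := hp.resolve_right hpt
      have hpb : p ≠ b := fun hpb => hpt (hpb ▸ head_mem_curve b t)
      refine ⟨[p], b :: t, by simp, by simp, ⟨hpa.symm, fun z _ hz => hz, trivial⟩,
        ⟨hpb, fun z hz hz' => h.2.1 z (segment_subset_right hp' hz) hz', h.2.2⟩, rfl, rfl, ?_, ?_,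
          ?_⟩
      · rw [curve_cons, curve_cons, curve_cons, ← Set.union_assoc]
        congr 1
        rw [curve_singleton, Set.union_eq_self_of_subset_right
          (Set.singleton_subset_iff.2 (right_mem_segment ℝ a p))]
        refine subset_antisymm (Set.union_subset (segment_subset_left hp')
          (segment_subset_right hp')) fun z hz => mem_segment_split hp' hz
      · rintro z (hz | hz) hz'
        · rcases hz' with hz' | hz'
          · exact eq_of_mem_segments hp' hz hz'
          · have hzb := h.2.1 z (segment_subset_left hp' hz) hz'
            exact absurd (eq_of_mem_segments hp' (hzb ▸ hz) (right_mem_segment ℝ p b)).symm hpb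
        · exact hz
      · simp only [List.length_cons, List.length_nil]
        omega

end Arcs

section ArcCells

lemma up_halfplane (α β γ : ℝ) (hβ : 0 ≤ β) : Up {w | 0 ≤ α * w.1 + β * w.2 + γ} ∧
    Up {w | 0 < α * w.1 + β * w.2 + γ} := by
  have hlin : IsLinearMap ℝ fun w : ℝ × ℝ => α * w.1 + β * w.2 :=
    ⟨fun x y => by simp only [Prod.fst_add, Prod.snd_add]; ring,
      fun c x => by simp only [Prod.smul_fst, Prod.smul_snd, smul_eq_mul]; ring⟩
  have h1 := convex_halfSpace_ge hlin (-γ)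
  have h2 := convex_halfSpace_lt hlin (-γ)
  have h3 := convex_halfSpace_gt hlin (-γ)
  have h4 := convex_halfSpace_le hlin (-γ)
  have e1 : {w : ℝ × ℝ | 0 ≤ α * w.1 + β * w.2 + γ} = {w | -γ ≤ α * w.1 + β * w.2} := by
    ext w
    simp only [Set.mem_ofPred_eq]
    constructor <;> intro h <;> linarith
  have e2 : {w : ℝ × ℝ | 0 < α * w.1 + β * w.2 + γ} = {w | -γ < α * w.1 + β * w.2} := by
    ext w
    simp only [Set.mem_ofPred_eq]
    constructor <;> intro h <;> linarith
  rw [e1, e2]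
  refine ⟨⟨h1, ?_, fun x y y' h hy => ?_⟩, ⟨h3, ?_, fun x y y' h hy => ?_⟩⟩
  · have e : {w : ℝ × ℝ | -γ ≤ α * w.1 + β * w.2}ᶜ = {w | α * w.1 + β * w.2 < -γ} := by
      ext w
      simp
    exact e ▸ h2
  · simp only [Set.mem_ofPred_eq] at h ⊢
    nlinarith
  · have e : {w : ℝ × ℝ | -γ < α * w.1 + β * w.2}ᶜ = {w | α * w.1 + β * w.2 ≤ -γ} := by
      ext w
      simp
    exact e ▸ h4
  · simp only [Set.mem_ofPred_eq] at h ⊢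
    nlinarith

lemma isCell_singleton (z : ℝ × ℝ) : IsCell {z} := by
  obtain ⟨h1, h2⟩ := up_halfplane 0 1 (-z.2) zero_le_one
  refine ⟨{z.1}, _, _, Set.ordConnected_singleton, h1, h2, ?_⟩
  ext w
  simp only [Set.mem_singleton_iff, Set.mem_ofPred_eq, not_lt, Prod.ext_iff]
  constructor
  · rintro ⟨h1, h2⟩
    refine ⟨h1, ?_, ?_⟩ <;> linarith
  · rintro ⟨h1, h2, h3⟩
    refine ⟨h1, ?_⟩
    linarith

lemma mem_openSegment_iff {a b w : ℝ × ℝ} : w ∈ openSegment ℝ a b ↔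
    ∃ s, 0 < s ∧ s < 1 ∧ w.1 = a.1 + s * (b.1 - a.1) ∧ w.2 = a.2 + s * (b.2 - a.2) := by
  rw [openSegment_eq_image']
  constructor
  · rintro ⟨s, hs, rfl⟩
    exact ⟨s, hs.1, hs.2, by simp, by simp⟩
  · rintro ⟨s, h0, h1, h2, h3⟩
    exact ⟨s, ⟨h0, h1⟩, Prod.ext (by simp [h2]) (by simp [h3])⟩

lemma isCell_openSegment_of_lt {a b : ℝ × ℝ} (h : a.1 < b.1) : IsCell (openSegment ℝ a b) := by
  have hd : 0 < b.1 - a.1 := by linarith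
  obtain ⟨h1, h2⟩ := up_halfplane (-(b.2 - a.2)) (b.1 - a.1)
    (a.1 * (b.2 - a.2) - a.2 * (b.1 - a.1)) hd.le
  refine ⟨Set.Ioo a.1 b.1, _, _, Set.ordConnected_Ioo, h1, h2, ?_⟩
  ext w
  simp only [mem_openSegment_iff, Set.mem_Ioo, Set.mem_ofPred_eq, not_lt]
  constructor
  · rintro ⟨s, hs0, hs1, h1, h2⟩
    rw [h1, h2]
    refine ⟨⟨by nlinarith, by nlinarith⟩, by nlinarith, by nlinarith⟩
  · rintro ⟨⟨h1, h2⟩, h3, h4⟩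
    refine ⟨(w.1 - a.1) / (b.1 - a.1), div_pos (by linarith) hd, (div_lt_one hd).2 (by linarith),
      by field_simp; ring, ?_⟩
    have h5 : (w.2 - a.2) * (b.1 - a.1) = (w.1 - a.1) * (b.2 - a.2) := by linarith
    field_simp
    linarith

lemma isCell_openSegment_vertical {a b : ℝ × ℝ} (h : a.1 = b.1) (h' : a.2 < b.2) :
    IsCell (openSegment ℝ a b) := by
  obtain ⟨-, h1⟩ := up_halfplane 0 1 (-a.2) zero_le_one
  obtain ⟨h2, -⟩ := up_halfplane 0 1 (-b.2) zero_le_one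
  refine ⟨{a.1}, _, _, Set.ordConnected_singleton, h1, h2, ?_⟩
  have hd : 0 < b.2 - a.2 := by linarith
  ext w
  simp only [mem_openSegment_iff, Set.mem_singleton_iff, Set.mem_ofPred_eq, not_le]
  constructor
  · rintro ⟨s, hs0, hs1, h1, h2⟩
    rw [h1, h2, h]
    refine ⟨by ring, by nlinarith, by nlinarith⟩
  · rintro ⟨h1, h3, h4⟩
    refine ⟨(w.2 - a.2) / (b.2 - a.2), div_pos (by linarith) hd, (div_lt_one hd).2 (by linarith),
      by rw [h1, h]; ring, ?_⟩
    field_simp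
    ring

lemma isCell_openSegment (a b : ℝ × ℝ) : IsCell (openSegment ℝ a b) := by
  rcases lt_trichotomy a.1 b.1 with h | h | h
  · exact isCell_openSegment_of_lt h
  · rcases lt_trichotomy a.2 b.2 with h' | h' | h'
    · exact isCell_openSegment_vertical h h'
    · rw [Prod.ext h h', openSegment_same]
      exact isCell_singleton b
    · rw [openSegment_symm]
      exact isCell_openSegment_vertical h.symm h'
  · rw [openSegment_symm]
    exact isCell_openSegment_of_lt h

/-- The open segments and inner bends of a polyline. -/
def inner : ℝ × ℝ → List (ℝ × ℝ) → Finset (Set (ℝ × ℝ))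
  | _, [] => ∅
  | a, [b] => {openSegment ℝ a b}
  | a, b :: c :: t => insert (openSegment ℝ a b) (insert {b} (inner b (c :: t)))

/-- The last segment of a polyline, starting from its end. -/
def lastEnd : ℝ × ℝ → List (ℝ × ℝ) → (ℝ × ℝ) × (ℝ × ℝ)
  | a, [] => (a, a)
  | a, [b] => (b, a)
  | _, b :: c :: t => lastEnd b (c :: t)

lemma lastEnd_fst (a : ℝ × ℝ) (t : List (ℝ × ℝ)) : (lastEnd a t).1 = lastPt a t := by
  induction t generalizing a with
  | nil => rfl
  | cons b t ih =>
    cases t with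
    | nil => rfl
    | cons c t => exact ih b

lemma openSegment_mem_inner (a b : ℝ × ℝ) (t : List (ℝ × ℝ)) :
    openSegment ℝ a b ∈ inner a (b :: t) := by
  cases t with
  | nil => exact mem_singleton_self _
  | cons c t => exact mem_insert_self _ _

lemma lastEnd_mem_inner (a b : ℝ × ℝ) (t : List (ℝ × ℝ)) :
    openSegment ℝ (lastEnd a (b :: t)).1 (lastEnd a (b :: t)).2 ∈ inner a (b :: t) := by
  induction t generalizing a b with
  | nil => exact mem_singleton.2 (openSegment_symm ℝ b a)
  | cons c t ih => exact mem_insert_of_mem (mem_insert_of_mem (ih b c))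

lemma card_inner_le (a : ℝ × ℝ) (t : List (ℝ × ℝ)) : (inner a t).card ≤ 2 * t.length := by
  induction t generalizing a with
  | nil => simp [inner]
  | cons b t ih =>
    cases t with
    | nil => simp [inner]
    | cons c t =>
      refine (card_insert_le _ _).trans ?_
      have h1 := card_insert_le {b} (inner b (c :: t))
      have h2 := ih b
      rw [List.length_cons]
      omega

lemma mem_inner_cons {a b c : ℝ × ℝ} {t : List (ℝ × ℝ)} {C : Set (ℝ × ℝ)} :
    C ∈ inner a (b :: c :: t) ↔ C = openSegment ℝ a b ∨ C = {b} ∨ C ∈ inner b (c :: t) := by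
  rw [inner, mem_insert, mem_insert]

lemma openSegment_nonempty (a b : ℝ × ℝ) : (openSegment ℝ a b).Nonempty := by
  rw [openSegment_eq_image']
  exact (Set.nonempty_Ioo.2 zero_lt_one).image _

lemma isCell_of_mem_inner {a : ℝ × ℝ} {t : List (ℝ × ℝ)} {C : Set (ℝ × ℝ)} (h : C ∈ inner a t) :
    IsCell C ∧ C.Nonempty := by
  induction t generalizing a with
  | nil => exact absurd h (notMem_empty C)
  | cons b t ih =>
    cases t with
    | nil =>
      obtain rfl := mem_singleton.1 h
      exact ⟨isCell_openSegment a b, openSegment_nonempty a b⟩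
    | cons c t =>
      rcases mem_inner_cons.1 h with rfl | rfl | h
      exacts [⟨isCell_openSegment a b, openSegment_nonempty a b⟩,
        ⟨isCell_singleton b, Set.singleton_nonempty b⟩, ih h]

lemma closure_subset_curve {a : ℝ × ℝ} {t : List (ℝ × ℝ)} {C : Set (ℝ × ℝ)} (h : C ∈ inner a t) :
    closure C ⊆ curve (a :: t) := by
  induction t generalizing a with
  | nil => exact absurd h (notMem_empty C)
  | cons b t ih =>
    cases t with
    | nil =>
      obtain rfl := mem_singleton.1 h
      rw [closure_openSegment]
      exact Set.subset_union_left
    | cons c t =>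
      rcases mem_inner_cons.1 h with rfl | rfl | h
      · rw [closure_openSegment]
        exact Set.subset_union_left
      · rw [closure_singleton, Set.singleton_subset_iff]
        exact .inr (head_mem_curve b _)
      · exact (ih h).trans Set.subset_union_right

lemma mem_segment_iff_openSegment {a b z : ℝ × ℝ} :
    z ∈ segment ℝ a b ↔ z = a ∨ z = b ∨ z ∈ openSegment ℝ a b := by
  rw [← insert_endpoints_openSegment, Set.mem_insert_iff, Set.mem_insert_iff]

lemma ne_of_mem_openSegment {a b z : ℝ × ℝ} (hab : a ≠ b) (hz : z ∈ openSegment ℝ a b) :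
    z ≠ a ∧ z ≠ b := by
  constructor
  · rintro rfl
    exact hab (left_mem_openSegment_iff.1 hz)
  · rintro rfl
    exact hab (right_mem_openSegment_iff.1 hz)

lemma region_insert (C : Set (ℝ × ℝ)) (F : Finset (Set (ℝ × ℝ))) (z : ℝ × ℝ) :
    z ∈ region (insert C F) ↔ z ∈ C ∨ z ∈ region F := by
  constructor
  · rintro ⟨K, hK, hz⟩
    rcases mem_insert.1 hK with rfl | hK
    exacts [.inl hz, .inr ⟨K, hK, hz⟩]
  · rintro (hz | ⟨K, hK, hz⟩)
    exacts [⟨C, mem_insert_self _ _, hz⟩, ⟨K, mem_insert_of_mem hK, hz⟩]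

lemma Simple.mem_region_inner {a b : ℝ × ℝ} {t : List (ℝ × ℝ)} (h : Simple a (b :: t))
    (z : ℝ × ℝ) : z ∈ region (inner a (b :: t)) ↔
      z ∈ curve (a :: b :: t) ∧ z ≠ a ∧ z ≠ lastPt a (b :: t) := by
  induction t generalizing a b with
  | nil =>
    have h1 : z ∈ region (inner a [b]) ↔ z ∈ openSegment ℝ a b := by
      simp [region, inner]
    rw [h1, curve_cons, curve_singleton, Set.mem_union, mem_segment_iff_openSegment,
      Set.mem_singleton_iff, lastPt_cons, lastPt_nil]
    have := @ne_of_mem_openSegment a b z h.1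
    tauto
  | cons c t ih =>
    have ih := ih h.2.2
    have h1 := @ne_of_mem_openSegment a b z h.1
    have h2 := h.2.1 z
    have h3 := h.head_notMem
    have h4 := h.2.2.head_ne_last (by simp)
    have h5 := lastPt_mem_curve b (c :: t)
    rw [inner, region_insert, region_insert, ih, curve_cons a b, Set.mem_union, lastPt_cons a,
      Set.mem_singleton_iff]
    rw [@mem_segment_iff_openSegment a b z]
    have h2 : z ∈ openSegment ℝ a b → z ∈ curve (b :: c :: t) → z = b := fun hz =>
      h2 (openSegment_subset_segment ℝ a b hz)
    constructor
    · rintro (hz | rfl | ⟨hz, hz1, hz2⟩)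
      · refine ⟨.inl (.inr (.inr hz)), (h1 hz).1, ?_⟩
        rintro rfl
        exact (h1 hz).2 (h2 hz h5)
      · exact ⟨.inl (.inr (.inl rfl)), h.1.symm, h4⟩
      · exact ⟨.inr hz, fun hza => h3 (hza ▸ hz), hz2⟩
    · rintro ⟨(rfl | rfl | hz) | hz, hz1, hz2⟩
      · exact absurd rfl hz1
      · exact .inr (.inl rfl)
      · exact .inl hz
      · by_cases hzb : z = b
        exacts [.inr (.inl hzb), .inr (.inr ⟨hz, hzb, hz2⟩)]

lemma Simple.disjoint_inner {a : ℝ × ℝ} {t : List (ℝ × ℝ)} (h : Simple a t)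
    {C D : Set (ℝ × ℝ)} (hC : C ∈ inner a t) (hD : D ∈ inner a t) (hCD : C ≠ D) :
    Disjoint C D := by
  induction t generalizing a with
  | nil => exact absurd hC (notMem_empty C)
  | cons b t ih =>
    cases t with
    | nil => exact absurd ((mem_singleton.1 hC).trans (mem_singleton.1 hD).symm) hCD
    | cons c t =>
      have hmem : ∀ K ∈ inner b (c :: t), ∀ z ∈ K, z ∈ curve (b :: c :: t) ∧ z ≠ b :=
        fun K hK z hz => by
          have := (h.2.2.mem_region_inner z).1 ⟨K, hK, hz⟩
          exact ⟨this.1, this.2.1⟩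
      have h1 : Disjoint (openSegment ℝ a b) {b} :=
        Set.disjoint_singleton_right.2 fun hb => (ne_of_mem_openSegment h.1 hb).2 rfl
      have h2 : ∀ K ∈ inner b (c :: t), Disjoint (openSegment ℝ a b) K := fun K hK =>
        Set.disjoint_left.2 fun z hz hz' => (hmem K hK z hz').2
          (h.2.1 z (openSegment_subset_segment ℝ a b hz) (hmem K hK z hz').1)
      have h3 : ∀ K ∈ inner b (c :: t), Disjoint {b} K := fun K hK =>
        Set.disjoint_singleton_left.2 fun hb => (hmem K hK b hb).2 rfl
      rcases mem_inner_cons.1 hC with rfl | rfl | hC <;> rcases mem_inner_cons.1 hD with rfl | rfl | hD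
      exacts [absurd rfl hCD, h1, h2 D hD, h1.symm, absurd rfl hCD, h3 D hD, (h2 C hC).symm,
        (h3 C hC).symm, ih h.2.2 hC hD]

lemma adj_singleton_openSegment {a b : ℝ × ℝ} (hab : a ≠ b) :
    cellGraph.Adj {a} (openSegment ℝ a b) := by
  obtain ⟨m, hm⟩ := openSegment_nonempty a b
  have hm' := openSegment_subset_segment ℝ a b hm
  refine ⟨fun h => hab (left_mem_openSegment_iff.1 (h ▸ Set.mem_singleton a)), a, rfl, m, hm,
    fun z hz => ?_⟩
  rcases mem_segment_iff_openSegment.1 (segment_subset_left hm' hz) with rfl | rfl | h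
  · exact .inl rfl
  · exact absurd (eq_of_mem_segments hm' hz (right_mem_segment ℝ m z)).symm
      (ne_of_mem_openSegment hab hm).2
  · exact .inr h

lemma Simple.conn_inner {a b : ℝ × ℝ} {t : List (ℝ × ℝ)} (h : Simple a (b :: t)) :
    Conn cellGraph (inner a (b :: t)) := by
  induction t generalizing a b with
  | nil => exact conn_singleton _
  | cons c t ih =>
    refine ((ih h.2.2).insert (openSegment_mem_inner b c t)
      (adj_singleton_openSegment h.2.2.1).symm).insert (mem_insert_self _ _) ?_
    rw [openSegment_symm]
    exact adj_singleton_openSegment h.1.symm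

lemma Simple.eq_first {a b : ℝ × ℝ} {t : List (ℝ × ℝ)} (h : Simple a (b :: t))
    {C : Set (ℝ × ℝ)} (hC : C ∈ inner a (b :: t)) (ha : a ∈ closure C) : C = openSegment ℝ a b := by
  cases t with
  | nil => exact mem_singleton.1 hC
  | cons c t =>
    rcases mem_inner_cons.1 hC with rfl | rfl | hC
    · rfl
    · rw [closure_singleton] at ha
      exact absurd ha h.1
    · exact absurd (closure_subset_curve hC ha) h.head_notMem

lemma Simple.eq_last {a b : ℝ × ℝ} {t : List (ℝ × ℝ)} (h : Simple a (b :: t))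
    {C : Set (ℝ × ℝ)} (hC : C ∈ inner a (b :: t)) (ha : lastPt a (b :: t) ∈ closure C) :
    C = openSegment ℝ (lastEnd a (b :: t)).1 (lastEnd a (b :: t)).2 := by
  induction t generalizing a b with
  | nil => exact (mem_singleton.1 hC).trans (openSegment_symm ℝ a b)
  | cons c t ih =>
    have h1 := h.2.2.head_ne_last (by simp)
    rcases mem_inner_cons.1 hC with rfl | rfl | hC
    · rw [closure_openSegment] at ha
      exact absurd (h.2.1 _ ha (lastPt_mem_curve b (c :: t))).symm h1
    · rw [closure_singleton] at ha
      exact absurd ha.symm h1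
    · exact ih h.2.2 hC ha

lemma Simple.lastEnd_ne {a b : ℝ × ℝ} {t : List (ℝ × ℝ)} (h : Simple a (b :: t)) :
    (lastEnd a (b :: t)).1 ≠ (lastEnd a (b :: t)).2 := by
  induction t generalizing a b with
  | nil => exact h.1.symm
  | cons c t ih => exact ih h.2.2

end ArcCells

section ArcSystems

/-- The set of points of a finite family of polylines together with a finite set. -/
def support (X : Finset (ℝ × ℝ)) (A : Finset ((ℝ × ℝ) × List (ℝ × ℝ))) : Set (ℝ × ℝ) :=
  {z | z ∈ X ∨ ∃ l ∈ A, z ∈ curve (l.1 :: l.2)}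

/-- Simple polylines with ends in `X` that only meet in `X`, some of which decompose the
sets of the family `D`. -/
structure IsArcSystem (D : Set (Set (ℝ × ℝ))) (X : Finset (ℝ × ℝ))
    (A O : Finset ((ℝ × ℝ) × List (ℝ × ℝ))) : Prop where
  simple : ∀ l ∈ A, Simple l.1 l.2
  ne : ∀ l ∈ A, l.2 ≠ []
  fst_mem : ∀ l ∈ A, l.1 ∈ X
  last_mem : ∀ l ∈ A, lastPt l.1 l.2 ∈ X
  ends : ∀ l ∈ A, ∀ x ∈ X, x ∈ curve (l.1 :: l.2) → x = l.1 ∨ x = lastPt l.1 l.2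
  inter : ∀ l ∈ A, ∀ l' ∈ A, l ≠ l' → ∀ z ∈ curve (l.1 :: l.2), z ∈ curve (l'.1 :: l'.2) → z ∈ X
  sub : O ⊆ A
  inside : ∀ l ∈ O, ∃ K ∈ D, curve (l.1 :: l.2) ⊆ K
  covered : ∀ K ∈ D, ∀ z ∈ K, ∃ l ∈ O, curve (l.1 :: l.2) ⊆ K ∧ z ∈ curve (l.1 :: l.2)

variable {D : Set (Set (ℝ × ℝ))} {X : Finset (ℝ × ℝ)} {A O : Finset ((ℝ × ℝ) × List (ℝ × ℝ))}

lemma isCompact_support (X : Finset (ℝ × ℝ)) (A : Finset ((ℝ × ℝ) × List (ℝ × ℝ))) :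
    IsCompact (support X A) := by
  have h : support X A = (X : Set (ℝ × ℝ)) ∪ ⋃ l ∈ A, curve (l.1 :: l.2) := by
    ext z
    simp [support]
  rw [h]
  exact X.finite_toSet.isCompact.union (A.isCompact_biUnion fun l _ => isCompact_curve _)

/-- Replacing an arc by the two arcs into which it is divided by one of its points. -/
lemma IsArcSystem.exists_split (h : IsArcSystem D X A O) {p : ℝ × ℝ}
    {l : (ℝ × ℝ) × List (ℝ × ℝ)} (hl : l ∈ A) (hp : p ∈ curve (l.1 :: l.2)) (hpX : p ∉ X) :
    ∃ A' O', IsArcSystem D (insert p X) A' O' ∧ A'.card ≤ A.card + 1 ∧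
      ∑ l ∈ A', l.2.length ≤ ∑ l ∈ A, l.2.length + 1 ∧
      support (insert p X) A' = support X A := by
  have hpa : p ≠ l.1 := fun e => hpX (e ▸ h.fst_mem l hl)
  have hpl : p ≠ lastPt l.1 l.2 := fun e => hpX (e ▸ h.last_mem l hl)
  obtain ⟨t₁, t₂, h1, h2, hs1, hs2, hl1, hl2, hU, hI, hlen⟩ :=
    (h.simple l hl).exists_split hp hpa hpl
  have hm1 : p ∈ curve (l.1 :: t₁) := hl1 ▸ lastPt_mem_curve l.1 t₁
  have hm2 : p ∈ curve (p :: t₂) := head_mem_curve p t₂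
  have hsub1 : curve (l.1 :: t₁) ⊆ curve (l.1 :: l.2) := hU ▸ Set.subset_union_left
  have hsub2 : curve (p :: t₂) ⊆ curve (l.1 :: l.2) := hU ▸ Set.subset_union_right
  have hpA : ∀ l' ∈ A, p ∈ curve (l'.1 :: l'.2) → l' = l := fun l' hl' hp' => by
    by_contra hne
    exact hpX (h.inter l' hl' l hl hne p hp' hp)
  have hA' : ∀ l', l' ∈ insert (l.1, t₁) (insert (p, t₂) (A.erase l)) ↔
      l' = (l.1, t₁) ∨ l' = (p, t₂) ∨ l' ≠ l ∧ l' ∈ A := fun l' => by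
    rw [mem_insert, mem_insert, mem_erase]
  refine ⟨insert (l.1, t₁) (insert (p, t₂) (A.erase l)),
    if l ∈ O then insert (l.1, t₁) (insert (p, t₂) (O.erase l)) else O,
    ⟨?_, ?_, ?_, ?_, ?_, ?_, ?_, ?_, ?_⟩, ?_, ?_, ?_⟩
  · intro l' hl'
    rcases (hA' l').1 hl' with rfl | rfl | hl'
    exacts [hs1, hs2, h.simple l' hl'.2]
  · intro l' hl'
    rcases (hA' l').1 hl' with rfl | rfl | hl'
    exacts [h1, h2, h.ne l' hl'.2]
  · intro l' hl'
    rcases (hA' l').1 hl' with rfl | rfl | hl'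
    exacts [mem_insert_of_mem (h.fst_mem l hl), mem_insert_self _ _,
      mem_insert_of_mem (h.fst_mem l' hl'.2)]
  · intro l' hl'
    rcases (hA' l').1 hl' with rfl | rfl | hl'
    · exact hl1 ▸ mem_insert_self _ _
    · exact hl2 ▸ mem_insert_of_mem (h.last_mem l hl)
    · exact mem_insert_of_mem (h.last_mem l' hl'.2)
  · intro l' hl' x hx hxl
    rcases (hA' l').1 hl' with rfl | rfl | hl₀
    · rcases mem_insert.1 hx with rfl | hx
      · exact .inr hl1.symm
      · refine (h.ends l hl x hx (hsub1 hxl)).imp_right fun e => ?_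
        have : x ∈ curve (p :: t₂) := by
          rw [e, ← hl2]
          exact lastPt_mem_curve p t₂
        exact (hI x hxl this).trans hl1.symm
    · rcases mem_insert.1 hx with rfl | hx
      · exact .inl rfl
      · refine (h.ends l hl x hx (hsub2 hxl)).imp (fun e => ?_) fun e => e.trans hl2.symm
        exact hI x (e ▸ head_mem_curve l.1 t₁) hxl
    · rcases mem_insert.1 hx with rfl | hx
      · exact absurd (hpA l' hl₀.2 hxl) hl₀.1
      · exact h.ends l' hl₀.2 x hx hxl
  · intro l' hl' l'' hl'' hne z hz hz'
    rcases (hA' l').1 hl' with rfl | rfl | hl' <;> rcases (hA' l'').1 hl'' with rfl | rfl | hl''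
    · exact absurd rfl hne
    · exact hI z hz hz' ▸ mem_insert_self _ _
    · exact mem_insert_of_mem (h.inter l hl l'' hl''.2 hl''.1.symm z (hsub1 hz) hz')
    · exact hI z hz' hz ▸ mem_insert_self _ _
    · exact absurd rfl hne
    · exact mem_insert_of_mem (h.inter l hl l'' hl''.2 hl''.1.symm z (hsub2 hz) hz')
    · exact mem_insert_of_mem (h.inter l' hl'.2 l hl hl'.1 z hz (hsub1 hz'))
    · exact mem_insert_of_mem (h.inter l' hl'.2 l hl hl'.1 z hz (hsub2 hz'))
    · exact mem_insert_of_mem (h.inter l' hl'.2 l'' hl''.2 hne z hz hz')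
  · split_ifs with hO
    · exact insert_subset_insert _ (insert_subset_insert _ (erase_subset_erase _ h.sub))
    · exact fun l' hl' => (hA' l').2 (.inr (.inr ⟨fun e => hO (e ▸ hl'), h.sub hl'⟩))
  · intro l' hl'
    split_ifs at hl' with hO
    · rw [mem_insert, mem_insert, mem_erase] at hl'
      obtain ⟨K, hK, hlK⟩ := h.inside l hO
      rcases hl' with rfl | rfl | hl'
      exacts [⟨K, hK, hsub1.trans hlK⟩, ⟨K, hK, hsub2.trans hlK⟩, h.inside l' hl'.2]
    · exact h.inside l' hl'
  · intro K hK z hz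
    obtain ⟨l', hl', hlK, hzl⟩ := h.covered K hK z hz
    split_ifs with hO
    · by_cases e : l' = l
      · subst e
        rw [← hU] at hzl
        rcases hzl with hz1 | hz2
        · exact ⟨(l'.1, t₁), mem_insert_self _ _, hsub1.trans hlK, hz1⟩
        · exact ⟨(p, t₂), mem_insert_of_mem (mem_insert_self _ _), hsub2.trans hlK, hz2⟩
      · exact ⟨l', mem_insert_of_mem (mem_insert_of_mem (mem_erase.2 ⟨e, hl'⟩)), hlK, hzl⟩
    · exact ⟨l', hl', hlK, hzl⟩
  · have := card_insert_le (l.1, t₁) (insert (p, t₂) (A.erase l))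
    have := card_insert_le (p, t₂) (A.erase l)
    have := card_erase_add_one hl
    omega
  · have e := add_sum_erase A (fun l => l.2.length) hl
    have e1 : ∀ (l' : (ℝ × ℝ) × List (ℝ × ℝ)) (S : Finset ((ℝ × ℝ) × List (ℝ × ℝ))),
        ∑ l ∈ insert l' S, l.2.length ≤ l'.2.length + ∑ l ∈ S, l.2.length := fun l' S => by
      by_cases hS : l' ∈ S
      · rw [insert_eq_of_mem hS]
        omega
      · rw [sum_insert hS]
    have e2 := e1 (l.1, t₁) (insert (p, t₂) (A.erase l))
    have e3 := e1 (p, t₂) (A.erase l)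
    simp only at e e2 e3
    omega
  · ext z
    constructor
    · rintro (hz | ⟨l', hl', hz⟩)
      · rcases mem_insert.1 hz with rfl | hz
        exacts [.inr ⟨l, hl, hp⟩, .inl hz]
      · rcases (hA' l').1 hl' with rfl | rfl | hl'
        exacts [.inr ⟨l, hl, hsub1 hz⟩, .inr ⟨l, hl, hsub2 hz⟩, .inr ⟨l', hl'.2, hz⟩]
    · rintro (hz | ⟨l', hl', hz⟩)
      · exact .inl (mem_insert_of_mem hz)
      · by_cases e : l' = l
        · subst e
          rw [← hU] at hz
          rcases hz with hz | hz
          · exact .inr ⟨_, (hA' _).2 (.inl rfl), hz⟩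
          · exact .inr ⟨_, (hA' _).2 (.inr (.inl rfl)), hz⟩
        · exact .inr ⟨l', (hA' _).2 (.inr (.inr ⟨e, hl'⟩)), hz⟩

/-- Every point of the support can be made a node. -/
lemma IsArcSystem.exists_insert (h : IsArcSystem D X A O) {p : ℝ × ℝ} (hp : p ∈ support X A) :
    ∃ A' O', IsArcSystem D (insert p X) A' O' ∧ A'.card ≤ A.card + 1 ∧
      ∑ l ∈ A', l.2.length ≤ ∑ l ∈ A, l.2.length + 1 ∧
      support (insert p X) A' = support X A := by
  by_cases hpX : p ∈ X
  · rw [insert_eq_of_mem hpX]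
    exact ⟨A, O, h, Nat.le_succ _, Nat.le_succ _, rfl⟩
  · rcases hp with hp | ⟨l, hl, hp⟩
    exacts [absurd hp hpX, h.exists_split hl hp hpX]

/-- A segment between two nodes that avoids the support can be added to an arc system. -/
lemma IsArcSystem.insert_segment (h : IsArcSystem D X A O) {p q : ℝ × ℝ} (hp : p ∈ X) (hq : q ∈ X)
    (hpq : p ≠ q) (hd : ∀ z ∈ segment ℝ p q, z ∈ support X A → z = p ∨ z = q) :
    IsArcSystem D X (insert (p, [q]) A) O := by
  have hc : curve [p, q] = segment ℝ p q := by
    rw [curve_cons, curve_singleton]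
    exact Set.union_eq_left.2 (Set.singleton_subset_iff.2 (right_mem_segment ℝ p q))
  have hX : ∀ z ∈ segment ℝ p q, z ∈ support X A → z ∈ X := fun z hz hz' => by
    rcases hd z hz hz' with rfl | rfl
    exacts [hp, hq]
  refine ⟨?_, ?_, ?_, ?_, ?_, ?_, h.sub.trans (subset_insert _ _), h.inside, h.covered⟩
  · exact forall_mem_insert .. |>.2 ⟨⟨hpq, fun z _ hz => hz, trivial⟩, h.simple⟩
  · exact forall_mem_insert .. |>.2 ⟨by simp, h.ne⟩
  · exact forall_mem_insert .. |>.2 ⟨hp, h.fst_mem⟩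
  · exact forall_mem_insert .. |>.2 ⟨hq, h.last_mem⟩
  · refine forall_mem_insert .. |>.2 ⟨fun x hx hx' => hd x (hc ▸ hx') (.inl hx), h.ends⟩
  · intro l hl l' hl' hne z hz hz'
    rcases mem_insert.1 hl with rfl | hl <;> rcases mem_insert.1 hl' with rfl | hl'
    · exact absurd rfl hne
    · exact hX z (hc ▸ hz) (.inr ⟨l', hl', hz'⟩)
    · exact hX z (hc ▸ hz') (.inr ⟨l, hl, hz⟩)
    · exact h.inter l hl l' hl' hne z hz hz'

lemma support_insert_segment (p q : ℝ × ℝ) (X : Finset (ℝ × ℝ))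
    (A : Finset ((ℝ × ℝ) × List (ℝ × ℝ))) :
    support X (insert (p, [q]) A) = support X A ∪ segment ℝ p q := by
  have hc : curve [p, q] = segment ℝ p q := by
    rw [curve_cons, curve_singleton]
    exact Set.union_eq_left.2 (Set.singleton_subset_iff.2 (right_mem_segment ℝ p q))
  ext z
  constructor
  · rintro (hz | ⟨l, hl, hz⟩)
    · exact .inl (.inl hz)
    · rcases mem_insert.1 hl with rfl | hl
      exacts [.inr (hc ▸ hz), .inl (.inr ⟨l, hl, hz⟩)]
  · rintro ((hz | ⟨l, hl, hz⟩) | hz)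
    exacts [.inl hz, .inr ⟨l, mem_insert_of_mem hl, hz⟩,
      .inr ⟨_, mem_insert_self _ _, hc.symm ▸ hz⟩]

/-- A disconnected compact set has two points that are not joined inside the set, but are joined by
a segment whose interior avoids the set. -/
lemma exists_gap_segment {Z : Set (ℝ × ℝ)} (hZ : IsCompact Z) (hn : ¬ IsPreconnected Z) :
    ∃ p ∈ Z, ∃ q ∈ Z, p ≠ q ∧ (∀ z ∈ segment ℝ p q, z ∈ Z → z = p ∨ z = q) ∧
      ∀ S ⊆ Z, IsPreconnected S → p ∈ S → q ∉ S := by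
  rw [isPreconnected_closed_iff] at hn
  push Not at hn
  obtain ⟨t, t', ht, ht', hsub, h1, h2, h3⟩ := hn
  obtain ⟨⟨p, q⟩, ⟨hp, hq⟩, hmin⟩ := ((hZ.inter_right ht).prod (hZ.inter_right ht')).exists_isMinOn
    (h1.prod h2) (f := fun w => dist w.1 w.2) (by fun_prop)
  have hmin : ∀ a ∈ Z ∩ t, ∀ b ∈ Z ∩ t', dist p q ≤ dist a b := fun a ha b hb =>
    hmin (show (a, b) ∈ (Z ∩ t) ×ˢ (Z ∩ t') from ⟨ha, hb⟩)
  have hpq : p ≠ q := by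
    rintro rfl
    exact (Set.eq_empty_iff_forall_notMem.1 h3) p ⟨hp.1, hp.2, hq.2⟩
  refine ⟨p, hp.1, q, hq.1, hpq, fun z hz hzZ => ?_, fun S hS hSc hpS hqS => ?_⟩
  · have hd := dist_add_dist_of_mem_segment hz
    rcases hsub hzZ with hz' | hz'
    · have := hmin z ⟨hzZ, hz'⟩ q hq
      have h0 : dist p z = 0 := le_antisymm (by linarith) dist_nonneg
      exact .inl (dist_eq_zero.1 h0).symm
    · have := hmin p hp z ⟨hzZ, hz'⟩
      have h0 : dist z q = 0 := le_antisymm (by linarith) dist_nonneg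
      exact .inr (dist_eq_zero.1 h0)
  · obtain ⟨z, hz, hz'⟩ := isPreconnected_closed_iff.1 hSc t t' ht ht' (hS.trans hsub)
      ⟨p, hpS, hp.2⟩ ⟨q, hqS, hq.2⟩
    exact (Set.eq_empty_iff_forall_notMem.1 h3) z ⟨hS hz, hz'⟩

/-- Arc systems can be connected by few segments. -/
theorem IsArcSystem.exists_connected (m : ℕ) : ∀ {X A O}, IsArcSystem D X A O →
    ∀ F : Finset (ℝ × ℝ), F.card ≤ m →
    (∀ z ∈ support X A, ∃ f ∈ F, ∃ S ⊆ support X A, IsPreconnected S ∧ z ∈ S ∧ f ∈ S) →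
    ∃ X' A' O', IsArcSystem D X' A' O' ∧ X ⊆ X' ∧ X'.card ≤ X.card + 2 * m ∧
      A'.card ≤ A.card + 3 * m ∧
      ∑ l ∈ A', l.2.length ≤ ∑ l ∈ A, l.2.length + 3 * m ∧ IsPreconnected (support X' A') := by
  induction m with
  | zero =>
    intro X A O h F hF hrep
    refine ⟨X, A, O, h, subset_rfl, le_rfl, le_rfl, le_rfl, ?_⟩
    have : support X A = ∅ := Set.eq_empty_iff_forall_notMem.2 fun z hz => by
      obtain ⟨f, hf, -⟩ := hrep z hz
      rw [card_eq_zero.1 (Nat.le_zero.1 hF)] at hf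
      exact notMem_empty f hf
    rw [this]
    exact isPreconnected_empty
  | succ m ih =>
    intro X A O h F hF hrep
    by_cases hc : IsPreconnected (support X A)
    · exact ⟨X, A, O, h, subset_rfl, by omega, by omega, by omega, hc⟩
    obtain ⟨p, hp, q, hq, hpq, hseg, hsep⟩ := exists_gap_segment (isCompact_support X A) hc
    obtain ⟨A₁, O₁, h₁, hA₁, hl₁, hs₁⟩ := h.exists_insert hp
    obtain ⟨A₂, O₂, h₂, hA₂, hl₂, hs₂⟩ := h₁.exists_insert (p := q) (hs₁ ▸ hq)
    have hs : support (insert q (insert p X)) A₂ = support X A := hs₂.trans hs₁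
    have h₃ := h₂.insert_segment (mem_insert_of_mem (mem_insert_self p X)) (mem_insert_self q _) hpq
      (by rwa [hs])
    obtain ⟨f, hf, S, hS, hSc, hpS, hfS⟩ := hrep p hp
    obtain ⟨g, hg, S', hS', hSc', hqS', hgS'⟩ := hrep q hq
    have hfg : f ≠ g := by
      rintro rfl
      exact hsep (S ∪ S') (Set.union_subset hS hS') (hSc.union f hfS hgS' hSc') (.inl hpS)
        (.inr hqS')
    have hsup := support_insert_segment p q (insert q (insert p X)) A₂
    rw [hs] at hsup
    have hJ : IsPreconnected (S ∪ segment ℝ p q ∪ S') :=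
      (hSc.union p hpS (left_mem_segment ℝ p q) (convex_segment p q).isPreconnected).union q
        (.inr (right_mem_segment ℝ p q)) hqS' hSc'
    have hJs : S ∪ segment ℝ p q ∪ S' ⊆ support X A ∪ segment ℝ p q :=
      Set.union_subset (Set.union_subset (hS.trans Set.subset_union_left) Set.subset_union_right)
        (hS'.trans Set.subset_union_left)
    have hcard : (F.erase g).card ≤ m := by
      rw [card_erase_of_mem hg]
      omega
    have hfe : f ∈ F.erase g := mem_erase.2 ⟨hfg, hf⟩
    obtain ⟨X', A', O', h', hX', hXc, hAc, hlc, hpre⟩ := ih h₃ (F.erase g) hcard (by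
      rw [hsup]
      rintro z (hz | hz)
      · obtain ⟨e, he, T, hT, hTc, hzT, heT⟩ := hrep z hz
        by_cases heg : e = g
        · subst heg
          exact ⟨f, hfe, T ∪ (S ∪ segment ℝ p q ∪ S'),
            Set.union_subset (hT.trans Set.subset_union_left) hJs,
            hTc.union e heT (.inr hgS') hJ, .inl hzT, .inr (.inl (.inl hfS))⟩
        · exact ⟨e, mem_erase.2 ⟨heg, he⟩, T, hT.trans Set.subset_union_left, hTc, hzT, heT⟩
      · exact ⟨f, hfe, _, hJs, hJ, .inl (.inr hz), .inl (.inl hfS)⟩)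
    have e1 := card_insert_le q (insert p X)
    have e2 := card_insert_le p X
    have e3 := card_insert_le (p, [q]) A₂
    have e4 : ∑ l ∈ insert (p, [q]) A₂, l.2.length ≤ ∑ l ∈ A₂, l.2.length + 1 := by
      by_cases hS : (p, [q]) ∈ A₂
      · rw [insert_eq_of_mem hS]
        omega
      · rw [sum_insert hS, add_comm]
        rfl
    refine ⟨X', A', O', h', ?_, by omega, by omega, by omega, hpre⟩
    exact ((subset_insert p X).trans (subset_insert q _)).trans hX'

end ArcSystems

section Nodes

variable {D : Set (Set (ℝ × ℝ))} {X : Finset (ℝ × ℝ)} {A O : Finset ((ℝ × ℝ) × List (ℝ × ℝ))}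

/-- The points and the arcs of an arc system. -/
abbrev Node (X : Finset (ℝ × ℝ)) (A : Finset ((ℝ × ℝ) × List (ℝ × ℝ))) :=
  {x // x ∈ X} ⊕ {l // l ∈ A}

/-- The cells into which a point or an arc is divided. -/
def base : Node X A → Finset (Set (ℝ × ℝ))
  | .inl x => {{x.1}}
  | .inr l => inner l.1.1 l.1.2

lemma IsArcSystem.exists_cons (h : IsArcSystem D X A O) {l : (ℝ × ℝ) × List (ℝ × ℝ)} (hl : l ∈ A) :
    ∃ a b t, l = (a, b :: t) ∧ Simple a (b :: t) := by
  have h1 := h.simple l hl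
  obtain ⟨a, t⟩ := l
  cases t with
  | nil => exact absurd rfl (h.ne _ hl)
  | cons b t => exact ⟨a, b, t, rfl, h1⟩

lemma IsArcSystem.mem_inner (h : IsArcSystem D X A O) {l : (ℝ × ℝ) × List (ℝ × ℝ)} (hl : l ∈ A)
    {C : Set (ℝ × ℝ)} (hC : C ∈ inner l.1 l.2) {z : ℝ × ℝ} (hz : z ∈ C) :
    z ∈ curve (l.1 :: l.2) ∧ z ∉ X := by
  obtain ⟨a, b, t, rfl, hs⟩ := h.exists_cons hl
  have := (hs.mem_region_inner z).1 ⟨C, hC, hz⟩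
  refine ⟨this.1, fun hX => ?_⟩
  rcases h.ends _ hl z hX this.1 with e | e
  exacts [this.2.1 e, this.2.2 e]

lemma isCell_of_mem_base {w : Node X A} {C : Set (ℝ × ℝ)} (hC : C ∈ base w) :
    IsCell C ∧ C.Nonempty := by
  rcases w with x | l
  · obtain rfl := mem_singleton.1 hC
    exact ⟨isCell_singleton _, Set.singleton_nonempty _⟩
  · exact isCell_of_mem_inner hC

lemma IsArcSystem.disjoint_base (h : IsArcSystem D X A O) {w w' : Node X A} {C C' : Set (ℝ × ℝ)}
    (hC : C ∈ base w) (hC' : C' ∈ base w') (hne : w ≠ w' ∨ C ≠ C') : Disjoint C C' := by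
  rcases w with x | l <;> rcases w' with x' | l'
  · obtain rfl := mem_singleton.1 hC
    obtain rfl := mem_singleton.1 hC'
    refine Set.disjoint_singleton.2 fun e => ?_
    rcases hne with hne | hne
    exacts [hne (by rw [Subtype.ext e]), hne (by rw [e])]
  · obtain rfl := mem_singleton.1 hC
    exact Set.disjoint_singleton_left.2 fun hx => (h.mem_inner l'.2 hC' hx).2 x.2
  · obtain rfl := mem_singleton.1 hC'
    exact Set.disjoint_singleton_right.2 fun hx => (h.mem_inner l.2 hC hx).2 x'.2
  · by_cases e : l = l'
    · subst e
      rcases hne with hne | hne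
      exacts [absurd rfl hne, (h.simple l.1 l.2).disjoint_inner hC hC' hne]
    · refine Set.disjoint_left.2 fun z hz hz' => ?_
      have h1 := h.mem_inner l.2 hC hz
      have h2 := h.mem_inner l'.2 hC' hz'
      exact h1.2 (h.inter l.1 l.2 l'.1 l'.2 (fun e' => e (Subtype.ext e')) z h1.1 h2.1)

lemma IsArcSystem.conn_base (h : IsArcSystem D X A O) (w : Node X A) : Conn cellGraph (base w) := by
  rcases w with x | l
  · exact conn_singleton _
  · obtain ⟨a, b, t, e, hs⟩ := h.exists_cons l.2
    simp only [base, e]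
    exact hs.conn_inner

lemma card_base_le : (univ.biUnion (base : Node X A → _)).card ≤ X.card + 2 * ∑ l ∈ A, l.2.length := by
  refine card_biUnion_le.trans ?_
  rw [Fintype.sum_sum_type]
  refine add_le_add ?_ ?_
  · simp [base]
  · rw [mul_sum, ← sum_attach A]
    exact sum_le_sum fun l _ => card_inner_le _ _

/-- The first or the last segment of an arc, starting from the end of the arc. -/
def arcEnd (l : (ℝ × ℝ) × List (ℝ × ℝ)) : Bool → (ℝ × ℝ) × (ℝ × ℝ)
  | true => (l.1, l.2.headD l.1)
  | false => lastEnd l.1 l.2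

/-- The ends of the arcs. -/
abbrev End (A : Finset ((ℝ × ℝ) × List (ℝ × ℝ))) := {l // l ∈ A} × Bool

/-- The node of an end. -/
abbrev End.pt (e : End A) : ℝ × ℝ := (arcEnd e.1.1 e.2).1

/-- The second point of an end. -/
abbrev End.dir (e : End A) : ℝ × ℝ := (arcEnd e.1.1 e.2).2

lemma IsArcSystem.end_props (h : IsArcSystem D X A O) (e : End A) : e.pt ∈ X ∧ e.pt ≠ e.dir ∧
    openSegment ℝ e.pt e.dir ∈ inner e.1.1.1 e.1.1.2 ∧ e.pt ∈ curve (e.1.1.1 :: e.1.1.2) := by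
  obtain ⟨⟨l, hl⟩, i⟩ := e
  have h1 := h.fst_mem l hl
  have h2 := h.last_mem l hl
  obtain ⟨a, b, t, rfl, hs⟩ := h.exists_cons hl
  cases i
  · refine ⟨?_, hs.lastEnd_ne, lastEnd_mem_inner a b t, ?_⟩
    · exact Set.mem_of_eq_of_mem (s := (X : Set (ℝ × ℝ))) (lastEnd_fst a (b :: t)) h2
    · exact Set.mem_of_eq_of_mem (lastEnd_fst a (b :: t)) (lastPt_mem_curve a (b :: t))
  · exact ⟨h1, hs.1, openSegment_mem_inner a b t, head_mem_curve a _⟩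

lemma IsArcSystem.exists_end (h : IsArcSystem D X A O) {x : ℝ × ℝ} (hx : x ∈ X) (l : {l // l ∈ A})
    (hxl : x ∈ curve (l.1.1 :: l.1.2)) : ∃ e : End A, e.1 = l ∧ e.pt = x := by
  rcases h.ends l.1 l.2 x hx hxl with e | e
  · exact ⟨(l, true), rfl, e.symm⟩
  · exact ⟨(l, false), rfl, (lastEnd_fst _ _).trans e.symm⟩

lemma IsArcSystem.eq_end (h : IsArcSystem D X A O) {x : ℝ × ℝ} (hx : x ∈ X) (l : {l // l ∈ A})
    {C : Set (ℝ × ℝ)} (hC : C ∈ inner l.1.1 l.1.2) (hxC : x ∈ closure C) :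
    ∃ e : End A, e.1 = l ∧ e.pt = x ∧ C = openSegment ℝ e.pt e.dir := by
  obtain ⟨l, hl⟩ := l
  have hxl := h.ends l hl x hx (closure_subset_curve hC hxC)
  obtain ⟨a, b, t, rfl, hs⟩ := h.exists_cons hl
  rcases hxl with rfl | rfl
  · exact ⟨(⟨_, hl⟩, true), rfl, rfl, hs.eq_first hC hxC⟩
  · exact ⟨(⟨_, hl⟩, false), rfl, lastEnd_fst _ _, hs.eq_last hC hxC⟩

/-- Whether a segment goes to the right, to the left, up or down. -/
def cls (x b : ℝ × ℝ) : Fin 4 :=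
  if x.1 < b.1 then 0 else if b.1 < x.1 then 1 else if x.2 < b.2 then 2 else 3

/-- The slope of a segment, measured away from its first point. -/
def slp (x b : ℝ × ℝ) : ℝ := (b.2 - x.2) / |b.1 - x.1|

lemma exists_smul_of_cls {x b b' : ℝ × ℝ} (hb : x ≠ b) (hb' : x ≠ b') (hc : cls x b = cls x b')
    (hs : slp x b = slp x b') : ∃ c : ℝ, 0 < c ∧ b'.1 - x.1 = c * (b.1 - x.1) ∧
      b'.2 - x.2 = c * (b.2 - x.2) := by
  unfold cls at hc
  unfold slp at hs
  rcases lt_trichotomy x.1 b.1 with h1 | h1 | h1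
  · have h2 : x.1 < b'.1 := by
      by_contra h2
      rw [if_pos h1, if_neg h2] at hc
      split_ifs at hc <;> simp at hc
    rw [abs_of_pos (by linarith), abs_of_pos (by linarith)] at hs
    have h3 : 0 < b.1 - x.1 := by linarith
    have h4 : 0 < b'.1 - x.1 := by linarith
    refine ⟨(b'.1 - x.1) / (b.1 - x.1), div_pos h4 h3, by field_simp, ?_⟩
    rw [div_eq_div_iff h3.ne' h4.ne'] at hs
    field_simp
    linarith
  · have h0 : x.2 ≠ b.2 := fun h => hb (Prod.ext h1 h)
    rw [if_neg (by linarith), if_neg (by linarith)] at hc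
    have h2 : x.1 = b'.1 := by
      by_contra h2
      rcases lt_or_gt_of_ne h2 with h2 | h2
      · rw [if_pos h2] at hc
        split_ifs at hc <;> simp at hc
      · rw [if_neg h2.not_gt, if_pos h2] at hc
        split_ifs at hc <;> simp at hc
    have h0' : x.2 ≠ b'.2 := fun h => hb' (Prod.ext h2 h)
    rw [if_neg (not_lt_of_ge h2.ge), if_neg (not_lt_of_ge h2.le)] at hc
    refine ⟨(b'.2 - x.2) / (b.2 - x.2), ?_, by rw [← h1, ← h2]; simp, ?_⟩
    · rcases lt_or_gt_of_ne h0 with h3 | h3 <;> rcases lt_or_gt_of_ne h0' with h4 | h4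
      · exact div_pos (by linarith) (by linarith)
      · rw [if_pos h3, if_neg h4.not_gt] at hc
        simp at hc
      · rw [if_neg h3.not_gt, if_pos h4] at hc
        simp at hc
      · exact div_pos_of_neg_of_neg (by linarith) (by linarith)
    · rw [div_mul_cancel₀]
      exact sub_ne_zero.2 (Ne.symm h0)
  · have h2 : b'.1 < x.1 := by
      by_contra h2
      rw [if_neg h1.not_gt, if_pos h1, if_neg h2] at hc
      split_ifs at hc <;> simp at hc
    rw [abs_of_neg (by linarith), abs_of_neg (by linarith)] at hs
    have h3 : b.1 - x.1 < 0 := by linarith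
    have h4 : b'.1 - x.1 < 0 := by linarith
    refine ⟨(b'.1 - x.1) / (b.1 - x.1), div_pos_of_neg_of_neg h4 h3, ?_, ?_⟩
    · rw [div_mul_cancel₀ _ h3.ne]
    · rw [div_eq_div_iff (by linarith) (by linarith)] at hs
      rw [div_mul_eq_mul_div, eq_div_iff h3.ne]
      linarith

lemma openSegment_overlap {x b b' : ℝ × ℝ} (hb : x ≠ b) (hb' : x ≠ b') (hc : cls x b = cls x b')
    (hs : slp x b = slp x b') : ¬ Disjoint (openSegment ℝ x b) (openSegment ℝ x b') := by
  obtain ⟨c, hc0, h1, h2⟩ := exists_smul_of_cls hb hb' hc hs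
  have hm : 0 < min 1 c := lt_min one_pos hc0
  have hm1 := min_le_left 1 c
  have hm2 := min_le_right 1 c
  refine Set.not_disjoint_iff.2 ⟨(x.1 + min 1 c / 2 * (b.1 - x.1), x.2 + min 1 c / 2 * (b.2 - x.2)),
    mem_openSegment_iff.2 ⟨_, by linarith, by linarith, rfl, rfl⟩,
    mem_openSegment_iff.2 ⟨min 1 c / 2 / c, by positivity, ?_, ?_, ?_⟩⟩
  · rw [div_lt_one hc0]
    linarith
  · rw [h1]
    field_simp
  · rw [h2]
    field_simp

lemma cls_slp_of_mem {x b : ℝ × ℝ} {σ ε s : ℝ} (hσ : |σ| = 1) (hε : 0 < ε)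
    (h : (x.1 + ε * σ, s) ∈ openSegment ℝ x b) :
    (b.1 - x.1) / |b.1 - x.1| = σ ∧ b.1 ≠ x.1 ∧ slp x b = (s - x.2) / ε := by
  obtain ⟨t, h0, h1, h2, h3⟩ := mem_openSegment_iff.1 h
  simp only at h2 h3
  have hσ0 : σ ≠ 0 := fun h => by simp [h] at hσ
  have h4 : b.1 - x.1 = ε / t * σ := by
    field_simp
    linarith
  have h5 : b.2 - x.2 = (s - x.2) / t := by
    field_simp
    linarith
  have h6 : |b.1 - x.1| = ε / t := by
    rw [h4, abs_mul, hσ, mul_one, abs_of_pos (div_pos hε h0)]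
  have h7 : 0 < ε / t := div_pos hε h0
  refine ⟨?_, fun e => ?_, ?_⟩
  · rw [h6, h4, mul_div_cancel_left₀ _ h7.ne']
  · rw [e, sub_self, abs_zero] at h6
    exact h7.ne h6
  · rw [slp, h6, h5]
    field_simp

lemma cls_eq_iff {x b b' : ℝ × ℝ} (hb : b.1 ≠ x.1) (hb' : b'.1 ≠ x.1) :
    cls x b = cls x b' ↔ (b.1 - x.1) / |b.1 - x.1| = (b'.1 - x.1) / |b'.1 - x.1| := by
  have key : ∀ c : ℝ × ℝ, c.1 ≠ x.1 → (x.1 < c.1 ∧ cls x c = 0 ∧ (c.1 - x.1) / |c.1 - x.1| = 1) ∨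
      (c.1 < x.1 ∧ cls x c = 1 ∧ (c.1 - x.1) / |c.1 - x.1| = -1) := fun c hc => by
    rcases lt_or_gt_of_ne hc with h | h
    · refine .inr ⟨h, by rw [cls, if_neg h.not_gt, if_pos h], ?_⟩
      rw [abs_of_neg (by linarith), div_neg, div_self (by linarith)]
    · refine .inl ⟨h, by rw [cls, if_pos h], ?_⟩
      rw [abs_of_pos (by linarith), div_self (by linarith)]
  rcases key b hb with ⟨-, h1, h2⟩ | ⟨-, h1, h2⟩ <;> rcases key b' hb' with ⟨-, h3, h4⟩ | ⟨-, h3,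
    h4⟩ <;>
    rw [h1, h2, h3, h4] <;> norm_num

lemma mem_openSegment_of_lt {x b : ℝ × ℝ} {ε : ℝ} (hε : 0 < ε) (h : ε < |b.1 - x.1|) :
    (x.1 + ε * ((b.1 - x.1) / |b.1 - x.1|), x.2 + ε * slp x b) ∈ openSegment ℝ x b := by
  have h0 : 0 < |b.1 - x.1| := hε.trans h
  refine mem_openSegment_iff.2 ⟨ε / |b.1 - x.1|, div_pos hε h0, (div_lt_one h0).2 h, ?_, ?_⟩
  · ring
  · simp only [slp]
    ring

lemma IsArcSystem.end_injective (h : IsArcSystem D X A O) {e e' : End A} (hp : e.pt = e'.pt)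
    (hc : cls e.pt e.dir = cls e'.pt e'.dir) (hs : slp e.pt e.dir = slp e'.pt e'.dir) : e = e' := by
  have h1 := h.end_props e
  have h2 := h.end_props e'
  have h3 : ¬ Disjoint (openSegment ℝ e.pt e.dir) (openSegment ℝ e'.pt e'.dir) := by
    have h1' := h1.2.1
    rw [hp] at h1' hc hs ⊢
    exact openSegment_overlap h1' h2.2.1 hc hs
  have h4 : e.1 = e'.1 := by
    by_contra hne
    exact h3 (h.disjoint_base (w := .inr e.1) (w' := .inr e'.1) h1.2.2.1 h2.2.2.1
      (.inl fun e => hne (Sum.inr_injective e)))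
  obtain ⟨l, i⟩ := e
  obtain ⟨l', i'⟩ := e'
  obtain rfl : l = l' := h4
  have h5 := (h.simple l.1 l.2).head_ne_last (h.ne l.1 l.2)
  rw [← lastEnd_fst] at h5
  cases i <;> cases i'
  exacts [rfl, absurd hp.symm h5, absurd hp h5, rfl]

end Nodes

section Pointers

variable {D : Set (Set (ℝ × ℝ))} {X : Finset (ℝ × ℝ)} {A O : Finset ((ℝ × ℝ) × List (ℝ × ℝ))}

lemma Conn.union_adjacent {V : Type*} {G : SimpleGraph V} {S T : Finset V} (hS : Conn G S)
    (hT : ∀ t ∈ T, ∃ s ∈ S, G.Adj s t) : Conn G (S ∪ T) := by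
  induction T using Finset.induction_on with
  | empty => rwa [union_empty]
  | insert t T _ ih =>
    obtain ⟨s, hs, hst⟩ := hT t (mem_insert_self _ _)
    rw [union_insert]
    exact (ih fun t' ht' => hT t' (mem_insert_of_mem ht')).insert (mem_union_left _ hs) hst

/-- The plane is divided into few cells, and disjoint connected sets of cells are assigned to the
nodes in such a way that nodes facing each other vertically touch. -/
lemma IsArcSystem.exists_fibers (h : IsArcSystem D X A O) :
    ∃ (𝒦 : Finset (Set (ℝ × ℝ))) (φ : Node X A → Finset (Set (ℝ × ℝ))), IsCellPartition 𝒦 ∧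
      𝒦.card ≤ 4 * (X.card + 2 * ∑ l ∈ A, l.2.length) + 1 ∧ (∀ w, φ w ⊆ 𝒦) ∧
      (∀ w, Conn cellGraph (φ w)) ∧ (∀ w w', w ≠ w' → Disjoint (φ w) (φ w')) ∧
      (∀ w, base w ⊆ φ w) ∧
      ∀ (w w' : Node X A), ∀ C ∈ base w, ∀ C' ∈ base w', ∀ x y y', (x, y) ∈ C → y < y' →
        (x, y') ∈ C' → (∀ s, y < s → s < y' → ∀ w'' : Node X A, ∀ E ∈ base w'', (x, s) ∉ E) →
        Touch cellGraph (φ w) (φ w') := by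
  set R : Finset (Set (ℝ × ℝ)) := univ.biUnion (base : Node X A → _) with hRdef
  have hR : ∀ C, C ∈ R ↔ ∃ w : Node X A, C ∈ base w := fun C => by
    rw [hRdef, mem_biUnion]
    simp only [mem_univ, true_and]
  have hRd : ∀ C ∈ R, ∀ C' ∈ R, C ≠ C' → Disjoint C C' := fun C hC C' hC' hne => by
    obtain ⟨w, hw⟩ := (hR C).1 hC
    obtain ⟨w', hw'⟩ := (hR C').1 hC'
    exact h.disjoint_base hw hw' (.inr hne)
  have hRc : ∀ C ∈ R, IsCell C ∧ C.Nonempty := fun C hC => by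
    obtain ⟨w, hw⟩ := (hR C).1 hC
    exact isCell_of_mem_base hw
  obtain ⟨R', d, hcard, hcell, hdR, hd, hcov, hadj, hgap⟩ :=
    exists_vertical_decomposition R (fun C hC => (hRc C hC).1) hRd
  have hf : ∀ (w : Node X A) K, K ∈ base w ∪ R'.filter (fun K => ∃ C ∈ base w, d K = some C) ↔
      K ∈ base w ∨ K ∈ R' ∧ ∃ C ∈ base w, d K = some C := fun w K => by
    rw [mem_union, mem_filter]
  have hbase : ∀ (w w' : Node X A) C, C ∈ base w → C ∈ base w' → w = w' := fun w w' C hw hw' => by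
    by_contra hne
    have := h.disjoint_base hw hw' (.inl hne)
    rw [disjoint_self] at this
    exact (isCell_of_mem_base hw).2.ne_empty this
  have hnot : ∀ K ∈ R', ∀ C ∈ R, K ≠ C := fun K hK C hC e => by
    have := hdR K hK C hC
    rw [e, disjoint_self] at this
    exact (hRc C hC).2.ne_empty this
  refine ⟨R ∪ R', fun w => base w ∪ R'.filter (fun K => ∃ C ∈ base w, d K = some C),
    ⟨?_, ?_, ?_, ?_⟩, ?_, ?_, ?_, ?_, ?_, ?_⟩
  · intro K hK
    rcases mem_union.1 hK with hK | hK
    exacts [(hRc K hK).1, (hcell K hK).1]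
  · intro K hK
    rcases mem_union.1 hK with hK | hK
    exacts [(hRc K hK).2, (hcell K hK).2]
  · intro K hK K' hK' hne
    rcases mem_union.1 hK with hK | hK <;> rcases mem_union.1 hK' with hK' | hK'
    exacts [hRd K hK K' hK' hne, (hdR K' hK' K hK).symm, hdR K hK K' hK', hd K hK K' hK' hne]
  · intro z
    rcases hcov z with ⟨K, hK, hz⟩ | ⟨K, hK, hz⟩
    exacts [⟨K, mem_union_left _ hK, hz⟩, ⟨K, mem_union_right _ hK, hz⟩]
  · have h1 := card_union_le R R'
    have h2 : R.card ≤ _ := card_base_le (X := X) (A := A)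
    omega
  · intro w K hK
    rcases (hf w K).1 hK with hK | hK
    exacts [mem_union_left _ ((hR K).2 ⟨w, hK⟩), mem_union_right _ hK.1]
  · intro w
    refine (h.conn_base w).union_adjacent fun K hK => ?_
    obtain ⟨hK, C, hC, hdK⟩ := mem_filter.1 hK
    exact ⟨C, hC, (hadj K hK C hdK).2.symm⟩
  · intro w w' hne
    refine disjoint_left.2 fun K hK hK' => ?_
    rcases (hf w K).1 hK with h1 | ⟨h1, C, hC, h2⟩ <;>
      rcases (hf w' K).1 hK' with h3 | ⟨h3, C', hC', h4⟩
    · exact hne (hbase w w' K h1 h3)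
    · exact hnot K h3 K ((hR K).2 ⟨w, h1⟩) rfl
    · exact hnot K h1 K ((hR K).2 ⟨w', h3⟩) rfl
    · rw [h2] at h4
      exact hne (hbase w w' C hC (Option.some.inj h4 ▸ hC'))
  · exact fun w => subset_union_left
  · intro w w' C hC C' hC' x y y' hy hyy hy' hs
    obtain ⟨K, hK, hdK, hKs⟩ := hgap C ((hR C).2 ⟨w, hC⟩) x y y' hy hyy fun s h1 h2 E hE => by
      obtain ⟨w'', hw''⟩ := (hR E).1 hE
      exact hs s h1 h2 w'' E hw''
    refine ⟨K, (hf w K).2 (.inr ⟨hK, C, hC, hdK⟩), C', (hf w' C').2 (.inl hC'),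
      hnot K hK C' ((hR C').2 ⟨w', hC'⟩), (x, (y + y') / 2), hKs _ (by linarith) (by linarith),
      (x, y'), hy', fun z hz => ?_⟩
    obtain ⟨z1, z2⟩ := z
    obtain ⟨e, h1, h2⟩ := (mem_vertical_segment (by linarith)).1 hz
    simp only at e h1 h2
    subst e
    rcases h2.lt_or_eq with h2 | rfl
    exacts [.inl (hKs _ (by linarith) h2), .inr hy']

/-- `e'` is directly below `e` among the ends in the same direction at the same point. -/
def Covers (e' e : End A) : Prop := e'.pt = e.pt ∧ cls e'.pt e'.dir = cls e.pt e.dir ∧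
  slp e'.pt e'.dir < slp e.pt e.dir ∧ ∀ e'' : End A, e''.pt = e.pt →
    cls e''.pt e''.dir = cls e.pt e.dir → slp e'.pt e'.dir < slp e''.pt e''.dir →
    slp e.pt e.dir ≤ slp e''.pt e''.dir

/-- `e` is the lowest end in its direction at its point. -/
def Lowest (e : End A) : Prop := ∀ e' : End A, e'.pt = e.pt →
  cls e'.pt e'.dir = cls e.pt e.dir → slp e.pt e.dir ≤ slp e'.pt e'.dir

lemma slp_eq_zero {x b : ℝ × ℝ} (h : b.1 = x.1) : slp x b = 0 := by
  rw [slp, h, sub_self, abs_zero, div_zero]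

lemma cls_of_eq {x b b' : ℝ × ℝ} (h : b.1 = x.1) (hc : cls x b' = cls x b) : b'.1 = x.1 := by
  unfold cls at hc
  rw [h] at hc
  simp only [lt_self_iff_false, if_false] at hc
  by_contra hne
  rcases lt_or_gt_of_ne hne with h1 | h1
  · rw [if_neg h1.not_gt, if_pos h1] at hc
    split_ifs at hc <;> simp at hc
  · rw [if_pos h1] at hc
    split_ifs at hc <;> simp at hc

/-- Near a point of an arc system, only the ends at the point are visible. -/
lemma IsArcSystem.exists_radius (h : IsArcSystem D X A O) {x : ℝ × ℝ} (hx : x ∈ X) :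
    ∃ r > 0, ∀ z : ℝ × ℝ, dist z x < r → ∀ (w : Node X A), ∀ C ∈ base w, z ∈ C →
      z = x ∨ ∃ e : End A, e.pt = x ∧ C = openSegment ℝ e.pt e.dir := by
  set F : Finset (Set (ℝ × ℝ)) :=
    (univ.biUnion (base : Node X A → _)).filter fun C => x ∉ closure C
  have ho : IsOpen (⋂ C ∈ F, (closure C)ᶜ) :=
    isOpen_biInter_finset fun C _ => isClosed_closure.isOpen_compl
  have hxo : x ∈ ⋂ C ∈ F, (closure C)ᶜ := by
    simp only [Set.mem_iInter]
    exact fun C hC => (mem_filter.1 hC).2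
  obtain ⟨r, hr, hball⟩ := Metric.isOpen_iff.1 ho x hxo
  refine ⟨r, hr, fun z hz w C hC hzC => ?_⟩
  have hxC : x ∈ closure C := by
    by_contra hxC
    have hF : C ∈ F := mem_filter.2 ⟨mem_biUnion.2 ⟨w, mem_univ _, hC⟩, hxC⟩
    exact Set.mem_iInter₂.1 (hball hz) C hF (subset_closure hzC)
  rcases w with y | l
  · obtain rfl := mem_singleton.1 hC
    rw [closure_singleton] at hxC
    exact .inl (hzC.trans hxC.symm)
  · obtain ⟨e, -, he⟩ := h.eq_end hx l hC hxC
    exact .inr ⟨e, he⟩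

/-- An end directly below another one faces it. -/
lemma IsArcSystem.exists_facing (h : IsArcSystem D X A O) {e e' : End A} (hc : Covers e' e) :
    ∃ x y y', (x, y) ∈ openSegment ℝ e'.pt e'.dir ∧ y < y' ∧ (x, y') ∈ openSegment ℝ e.pt e.dir ∧
      ∀ s, y < s → s < y' → ∀ w'' : Node X A, ∀ E ∈ base w'', (x, s) ∉ E := by
  obtain ⟨hp, hcl, hs, hbet⟩ := hc
  obtain ⟨r, hr, hball⟩ := h.exists_radius (h.end_props e).1
  have hb : e.dir.1 ≠ e.pt.1 := fun h0 => by
    rw [hp] at hcl hs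
    rw [slp_eq_zero h0, slp_eq_zero (cls_of_eq h0 hcl)] at hs
    exact lt_irrefl _ hs
  have hb' : e'.dir.1 ≠ e'.pt.1 := fun h0 => by
    rw [hp] at hcl hs h0
    rw [slp_eq_zero h0, slp_eq_zero (cls_of_eq h0 hcl.symm)] at hs
    exact lt_irrefl _ hs
  set x := e.pt with hx
  set m := slp x e.dir with hm
  set m' := slp e'.pt e'.dir with hm'
  set σ := (e.dir.1 - x.1) / |e.dir.1 - x.1| with hσdef
  have hσ' : (e'.dir.1 - x.1) / |e'.dir.1 - x.1| = σ := by
    rw [hp] at hb' hcl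
    exact (cls_eq_iff hb' hb).1 hcl
  have h0 : 0 < |e.dir.1 - x.1| := abs_pos.2 (sub_ne_zero.2 hb)
  have h0' : 0 < |e'.dir.1 - x.1| := abs_pos.2 (sub_ne_zero.2 (hp ▸ hb'))
  have hσ : |σ| = 1 := by rw [hσdef, abs_div, abs_abs, div_self h0.ne']
  have hM : 0 < 1 + |m| + |m'| := by positivity
  obtain ⟨ε, hε, hεlt⟩ := exists_between (lt_min (lt_min h0 h0') (div_pos hr hM))
  have hε1 : ε < |e.dir.1 - x.1| := hεlt.trans_le ((min_le_left _ _).trans (min_le_left _ _))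
  have hε2 : ε < |e'.dir.1 - x.1| := hεlt.trans_le ((min_le_left _ _).trans (min_le_right _ _))
  have hε3 : ε * (1 + |m| + |m'|) < r := (lt_div_iff₀ hM).1 (hεlt.trans_le (min_le_right _ _))
  refine ⟨x.1 + ε * σ, x.2 + ε * m', x.2 + ε * m, ?_, by nlinarith, mem_openSegment_of_lt hε hε1,
    ?_⟩
  · have := mem_openSegment_of_lt (x := x) (b := e'.dir) hε hε2
    rw [hσ', show slp x e'.dir = m' by rw [hm', hp]] at this
    rw [hp]
    exact this
  · intro s hs1 hs2 w C hC hzC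
    have hm1 : |m| < 1 + |m| + |m'| := by linarith [abs_nonneg m']
    have hm2 : |m'| < 1 + |m| + |m'| := by linarith [abs_nonneg m]
    have hd : dist (x.1 + ε * σ, s) x < r := by
      rw [Prod.dist_eq, max_lt_iff, Real.dist_eq, Real.dist_eq]
      constructor
      · simp only [add_sub_cancel_left, abs_mul, hσ, abs_of_pos hε]
        nlinarith [abs_nonneg m, abs_nonneg m']
      · simp only [abs_lt]
        constructor
        · nlinarith [neg_abs_le m', mul_lt_mul_of_pos_left hm2 hε]
        · nlinarith [le_abs_self m, mul_lt_mul_of_pos_left hm1 hε]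
    rcases hball _ hd w C hC hzC with hz | ⟨e'', he, rfl⟩
    · have := congrArg Prod.fst hz
      simp only [add_eq_left, mul_eq_zero] at this
      rcases this with h1 | h1
      · exact hε.ne' h1
      · simp [h1] at hσ
    · rw [he] at hzC
      obtain ⟨h1, h2, h3⟩ := cls_slp_of_mem hσ hε hzC
      have h4 := hbet e'' he (by rw [he]; exact (cls_eq_iff h2 hb).2 h1)
      rw [he, h3] at h4
      have h5 : (s - x.2) / ε < m := by
        rw [div_lt_iff₀ hε]
        linarith
      have h6 : m' < (s - x.2) / ε := by
        rw [lt_div_iff₀ hε]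
        linarith
      exact absurd (h4 h6) (not_le.2 h5)

/-- The pointer of the end `e` leads from its arc to `w`. -/
def PointsTo (e : End A) (w : Node X A) : Prop :=
  (∃ x : {x // x ∈ X}, w = .inl x ∧ x.1 = e.pt ∧ Lowest e) ∨ ∃ e', Covers e' e ∧ w = .inr e'.1

/-- The graph whose edges are the pointers. -/
def pointerGraph (X : Finset (ℝ × ℝ)) (A : Finset ((ℝ × ℝ) × List (ℝ × ℝ))) :
    SimpleGraph (Node X A) :=
  SimpleGraph.fromRel fun w w' => ∃ e : End A, w = .inr e.1 ∧ PointsTo e w'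

lemma IsArcSystem.card_lowest_le (h : IsArcSystem D X A O) (x : ℝ × ℝ) :
    (univ.filter fun e : End A => e.pt = x ∧ Lowest e).card ≤ 4 := by
  have := card_le_card_of_injOn (s := univ.filter fun e : End A => e.pt = x ∧ Lowest e)
    (t := (univ : Finset (Fin 4))) (fun e => cls e.pt e.dir) (fun _ _ => mem_coe.2 (mem_univ _)) ?_
  · simpa using this
  · intro e he e' he' hc
    obtain ⟨-, h1, h2⟩ := mem_filter.1 (mem_coe.1 he)
    obtain ⟨-, h3, h4⟩ := mem_filter.1 (mem_coe.1 he')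
    have hp : e.pt = e'.pt := h1.trans h3.symm
    exact h.end_injective hp hc (le_antisymm (h2 e' hp.symm hc.symm) (h4 e hp hc))

lemma IsArcSystem.covers_left_unique (h : IsArcSystem D X A O) {e e₁ e₂ : End A}
    (h1 : Covers e₁ e) (h2 : Covers e₂ e) : e₁ = e₂ := by
  obtain ⟨p1, c1, s1, b1⟩ := h1
  obtain ⟨p2, c2, s2, b2⟩ := h2
  refine h.end_injective (p1.trans p2.symm) (c1.trans c2.symm) (le_antisymm ?_ ?_)
  · exact not_lt.1 fun h3 => (b2 e₁ p1 c1 h3).not_gt s1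
  · exact not_lt.1 fun h3 => (b1 e₂ p2 c2 h3).not_gt s2

lemma IsArcSystem.covers_right_unique (h : IsArcSystem D X A O) {e e₁ e₂ : End A}
    (h1 : Covers e e₁) (h2 : Covers e e₂) : e₁ = e₂ := by
  obtain ⟨p1, c1, s1, b1⟩ := h1
  obtain ⟨p2, c2, s2, b2⟩ := h2
  have hp : e₁.pt = e₂.pt := p1.symm.trans p2
  have hc : cls e₁.pt e₁.dir = cls e₂.pt e₂.dir := c1.symm.trans c2
  exact h.end_injective hp hc (le_antisymm (b1 e₂ hp.symm hc.symm s2) (b2 e₁ hp hc s1))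

lemma IsArcSystem.card_neighbors_le (h : IsArcSystem D X A O) (w : Node X A) :
    (univ.filter fun w' => (pointerGraph X A).Adj w w').card ≤ 6 := by
  rcases w with x | l
  · refine (card_le_card (t := (univ.filter fun e : End A => e.pt = x.1 ∧ Lowest e).image
      fun e => (.inr e.1 : Node X A)) fun w' hw' => ?_).trans
      (card_image_le.trans ((h.card_lowest_le x.1).trans (by norm_num)))
    obtain ⟨-, hne, ⟨e, he, -⟩ | ⟨e, he, hp⟩⟩ := mem_filter.1 hw'
    · cases he
    · rcases hp with ⟨x', hx, hx', hl⟩ | ⟨e', -, hx⟩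
      · obtain rfl := Sum.inl_injective hx
        exact mem_image.2 ⟨e, mem_filter.2 ⟨mem_univ _, hx'.symm, hl⟩, he.symm⟩
      · cases hx
  · have key : ∀ i : Bool, ∃ S : Finset (Node X A), S.card ≤ 3 ∧
        (∀ w', PointsTo (l, i) w' → w' ∈ S) ∧ ∀ e, Covers (l, i) e → .inr e.1 ∈ S := fun i => by
      have hx : (arcEnd l.1 i).1 ∈ X := (h.end_props (l, i)).1
      refine ⟨{.inl ⟨_, hx⟩} ∪ ((univ.filter fun e' : End A => Covers e' (l, i)).image
        (fun e => (.inr e.1 : Node X A)) ∪ (univ.filter fun e' : End A => Covers (l, i) e').image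
        (fun e => (.inr e.1 : Node X A))), ?_, ?_, ?_⟩
      · have h1 : (univ.filter fun e' : End A => Covers e' (l, i)).card ≤ 1 :=
          card_le_one.2 fun a ha b hb =>
            h.covers_left_unique (mem_filter.1 ha).2 (mem_filter.1 hb).2
        have h2 : (univ.filter fun e' : End A => Covers (l, i) e').card ≤ 1 :=
          card_le_one.2 fun a ha b hb =>
            h.covers_right_unique (mem_filter.1 ha).2 (mem_filter.1 hb).2
        refine (card_union_le _ _).trans ?_
        rw [card_singleton]
        have h3 := (card_union_le ((univ.filter fun e' : End A => Covers e' (l, i)).image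
          (fun e => (.inr e.1 : Node X A))) ((univ.filter fun e' : End A => Covers (l, i) e').image
          (fun e => (.inr e.1 : Node X A)))).trans
          (add_le_add (card_image_le.trans h1) (card_image_le.trans h2))
        omega
      · rintro w' (⟨x, rfl, hx, -⟩ | ⟨e', he', rfl⟩)
        · exact mem_union_left _ (mem_singleton.2 (congrArg _ (Subtype.ext hx)))
        · exact mem_union_right _ (mem_union_left _
            (mem_image_of_mem _ (mem_filter.2 ⟨mem_univ _, he'⟩)))
      · exact fun e he => mem_union_right _ (mem_union_right _
            (mem_image.2 ⟨e, mem_filter.2 ⟨mem_univ _, he⟩, rfl⟩))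
    obtain ⟨S, hS, hS1, hS2⟩ := key true
    obtain ⟨T, hT, hT1, hT2⟩ := key false
    refine (card_le_card (t := S ∪ T) fun w' hw' => ?_).trans ((card_union_le _ _).trans (by omega))
    obtain ⟨-, hne, ⟨⟨l', i⟩, he, hp⟩ | ⟨e, he, hp⟩⟩ := mem_filter.1 hw'
    · obtain rfl := Sum.inr_injective he
      cases i
      exacts [mem_union_right _ (hT1 w' hp), mem_union_left _ (hS1 w' hp)]
    · rcases hp with ⟨x', hx, -⟩ | ⟨⟨l', i⟩, hc, hx⟩
      · cases hx
      · obtain rfl := Sum.inr_injective hx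
        subst he
        cases i
        exacts [mem_union_right _ (hT2 e hc), mem_union_left _ (hS2 e hc)]

lemma IsArcSystem.exists_pointer (h : IsArcSystem D X A O) (e : End A) :
    PointsTo e (.inl ⟨e.pt, (h.end_props e).1⟩ : Node X A) ∨ ∃ e', Covers e' e := by
  by_cases hl : Lowest e
  · exact .inl (.inl ⟨_, rfl, rfl, hl⟩)
  · unfold Lowest at hl
    push Not at hl
    obtain ⟨e₁, hp, hc, hs⟩ := hl
    obtain ⟨e', he', hmax⟩ := exists_max_image (univ.filter fun e' : End A => e'.pt = e.pt ∧
      cls e'.pt e'.dir = cls e.pt e.dir ∧ slp e'.pt e'.dir < slp e.pt e.dir)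
      (fun e => slp e.pt e.dir) ⟨e₁, mem_filter.2 ⟨mem_univ _, hp, hc, hs⟩⟩
    obtain ⟨-, h1, h2, h3⟩ := mem_filter.1 he'
    refine .inr ⟨e', h1, h2, h3, fun e'' hp'' hc'' hs'' => not_lt.1 fun hlt => ?_⟩
    exact hs''.not_ge (hmax e'' (mem_filter.2 ⟨mem_univ _, hp'', hc'', hlt⟩))

/-- The arcs at a point are linked to the point by pointers. -/
lemma IsArcSystem.mem_iff_of_closed (h : IsArcSystem D X A O) (S : Finset (Node X A))
    (hS : ∀ a ∈ S, ∀ b ∉ S, ¬ (pointerGraph X A).Adj a b) (N : ℕ) : ∀ e : End A,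
    (univ.filter fun e' : End A => e'.pt = e.pt ∧ cls e'.pt e'.dir = cls e.pt e.dir ∧
      slp e'.pt e'.dir < slp e.pt e.dir).card ≤ N →
    ((.inr e.1 : Node X A) ∈ S ↔ (.inl ⟨e.pt, (h.end_props e).1⟩ : Node X A) ∈ S) := by
  have hcl : ∀ a b : Node X A, a ≠ b → (∃ e : End A, a = .inr e.1 ∧ PointsTo e b) →
      (a ∈ S ↔ b ∈ S) := fun a b hab hp => by
    have hadj : (pointerGraph X A).Adj a b := ⟨hab, .inl hp⟩
    exact ⟨fun ha => by_contra fun hb => hS a ha b hb hadj,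
      fun hb => by_contra fun ha => hS b hb a ha hadj.symm⟩
  induction N with
  | zero =>
    intro e he
    rcases h.exists_pointer e with hp | ⟨e', h1, h2, h3, -⟩
    · exact hcl _ _ (by simp) ⟨e, rfl, hp⟩
    · exact absurd (mem_filter.2 ⟨mem_univ e', h1, h2, h3⟩)
        (eq_empty_iff_forall_notMem.1 (card_eq_zero.1 (Nat.le_zero.1 he)) e')
  | succ N ih =>
    intro e he
    rcases h.exists_pointer e with hp | ⟨e', hc⟩
    · exact hcl _ _ (by simp) ⟨e, rfl, hp⟩
    · have h1 : ((.inr e.1 : Node X A) ∈ S ↔ (.inr e'.1 : Node X A) ∈ S) := by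
        by_cases heq : e.1 = e'.1
        · rw [heq]
        · exact hcl _ _ (fun he => heq (Sum.inr_injective he)) ⟨e, rfl, .inr ⟨e', hc, rfl⟩⟩
      rw [h1, ih e' ?_]
      · simp only [hc.1]
      · refine Nat.le_of_lt_succ (lt_of_lt_of_le (card_lt_card ?_) he)
        refine (ssubset_iff_of_subset fun e'' he'' => ?_).2 ⟨e', mem_filter.2 ⟨mem_univ _, hc.1,
            hc.2.1,
          hc.2.2.1⟩, fun h' => lt_irrefl _ (mem_filter.1 h').2.2.2⟩
        obtain ⟨-, q1, q2, q3⟩ := mem_filter.1 he''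
        exact mem_filter.2 ⟨mem_univ _, q1.trans hc.1, q2.trans hc.2.1, q3.trans hc.2.2.1⟩

/-- The pointer graph of a connected arc system is connected. -/
lemma IsArcSystem.exists_adj_notMem (h : IsArcSystem D X A O)
    (hconn : IsPreconnected (support X A)) (S : Finset (Node X A)) (hne : S.Nonempty)
    (hu : S ≠ univ) : ∃ a ∈ S, ∃ b ∉ S, (pointerGraph X A).Adj a b := by
  by_contra hcon
  push Not at hcon
  have hinc : ∀ (x : {x // x ∈ X}) (l : {l // l ∈ A}), x.1 ∈ curve (l.1.1 :: l.1.2) →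
      ((.inr l : Node X A) ∈ S ↔ (.inl x : Node X A) ∈ S) := fun x l hxl => by
    obtain ⟨e, rfl, he⟩ := h.exists_end x.2 l hxl
    rw [h.mem_iff_of_closed S hcon _ e le_rfl]
    simp only [he]
  let s : Node X A → Set (ℝ × ℝ) := Sum.elim (fun x => {x.1}) fun l => curve (l.1.1 :: l.1.2)
  have hs : ∀ w, IsClosed (s w) := by
    rintro (x | l)
    exacts [isClosed_singleton, (isCompact_curve _).isClosed]
  have hsub : ∀ w, s w ⊆ support X A := by
    rintro (x | l) z hz
    exacts [.inl ((show z = x.1 from hz) ▸ x.2), .inr ⟨l.1, l.2, hz⟩]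
  have hsn : ∀ w, (s w).Nonempty := by
    rintro (x | l)
    exacts [Set.singleton_nonempty _, ⟨_, head_mem_curve _ _⟩]
  have hcl : ∀ T : Finset (Node X A), IsClosed (⋃ w ∈ T, s w) := fun T =>
    T.finite_toSet.isClosed_biUnion fun w _ => hs w
  have hint : ∀ T : Finset (Node X A), T.Nonempty →
      (support X A ∩ ⋃ w ∈ T, s w).Nonempty := fun T ⟨w, hw⟩ => by
    obtain ⟨z, hz⟩ := hsn w
    exact ⟨z, hsub w hz, Set.mem_iUnion₂.2 ⟨w, hw, hz⟩⟩
  have hcov : support X A ⊆ (⋃ w ∈ S, s w) ∪ ⋃ w ∈ Sᶜ, s w := fun z hz => by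
    obtain ⟨w, hw⟩ : ∃ w, z ∈ s w := by
      rcases hz with hz | ⟨l, hl, hz⟩
      exacts [⟨.inl ⟨z, hz⟩, rfl⟩, ⟨.inr ⟨l, hl⟩, hz⟩]
    by_cases hwS : w ∈ S
    · exact .inl (Set.mem_iUnion₂.2 ⟨w, hwS, hw⟩)
    · exact .inr (Set.mem_iUnion₂.2 ⟨w, mem_compl.2 hwS, hw⟩)
  have hne' : Sᶜ.Nonempty := by
    rwa [nonempty_iff_ne_empty, Ne, compl_eq_empty_iff]
  obtain ⟨z, -, hz1, hz2⟩ := isPreconnected_closed_iff.1 hconn _ _ (hcl S) (hcl Sᶜ) hcov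
    (hint S hne) (hint Sᶜ hne')
  obtain ⟨w, hw, hzw⟩ := Set.mem_iUnion₂.1 hz1
  obtain ⟨w', hw', hzw'⟩ := Set.mem_iUnion₂.1 hz2
  rw [mem_compl] at hw'
  rcases w with x | l <;> rcases w' with x' | l'
  · exact hw' (Subtype.ext ((show z = x.1 from hzw).symm.trans hzw') ▸ hw)
  · exact hw' ((hinc x l' ((show z = x.1 from hzw) ▸ hzw')).2 hw)
  · exact hw' ((hinc x' l ((show z = x'.1 from hzw') ▸ hzw)).1 hw)
  · have hll : l ≠ l' := fun e => hw' (e ▸ hw)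
    have hzX := h.inter l.1 l.2 l'.1 l'.2 (fun e => hll (Subtype.ext e)) z hzw hzw'
    exact hw' ((hinc ⟨z, hzX⟩ l' hzw').2 ((hinc ⟨z, hzX⟩ l hzw).1 hw))

end Pointers

section Encoding

/-- Breadth first search: the vertices of a connected graph can be enumerated in such a way that
the parents are increasing. -/
lemma exists_bfs_aux {W : Type*} [Fintype W] [Nonempty W] (B : SimpleGraph W)
    (hc : ∀ S : Finset W, S.Nonempty → S ≠ univ → ∃ a ∈ S, ∃ b ∉ S, B.Adj a b) (k : ℕ)
    (hk : k < Fintype.card W) : ∃ (v : ℕ → W) (p : ℕ → ℕ),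
      (∀ i ≤ k, ∀ j ≤ k, v i = v j → i = j) ∧ p 0 = 0 ∧
      (∀ i ≤ k, 0 < i → p i < i ∧ B.Adj (v i) (v (p i))) ∧ (∀ i j, i ≤ j → j ≤ k → p i ≤ p j) ∧
      ∀ i < p k, ∀ w, B.Adj (v i) w → ∃ j ≤ k, v j = w := by
  induction k with
  | zero =>
    refine ⟨fun _ => Classical.arbitrary W, fun _ => 0, ?_, rfl, ?_, ?_, ?_⟩
    · intro i hi j hj _
      omega
    · intro i hi h0
      omega
    · exact fun _ _ _ _ => le_rfl
    · exact fun i hi => absurd hi (Nat.not_lt_zero i)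
  | succ k ih =>
    obtain ⟨v, p, hinj, hp0, hadj, hmono, hcl⟩ := ih (by omega)
    have hS : (range (k + 1)).image v ≠ univ := fun e => by
      have h1 := card_image_le (s := range (k + 1)) (f := v)
      rw [e, card_univ, card_range] at h1
      omega
    obtain ⟨a, ha, b, hb, hab⟩ := hc _ ⟨v 0, mem_image_of_mem v (mem_range.2 (by omega))⟩ hS
    have hex : ∃ i, i ≤ k ∧ ∃ w, B.Adj (v i) w ∧ ∀ j ≤ k, v j ≠ w := by
      obtain ⟨i, hi, rfl⟩ := mem_image.1 ha
      exact ⟨i, Nat.lt_succ_iff.1 (mem_range.1 hi), b, hab, fun j hj e =>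
        hb (mem_image.2 ⟨j, mem_range.2 (Nat.lt_succ_iff.2 hj), e⟩)⟩
    obtain ⟨hik, w, hw, hnew⟩ := Nat.find_spec hex
    have hmin := fun i (hi : i < Nat.find hex) => Nat.find_min hex hi
    set i₀ := Nat.find hex
    have hpk : p k ≤ i₀ := not_lt.1 fun hlt => by
      obtain ⟨j, hj, e⟩ := hcl i₀ hlt w hw
      exact hnew j hj e
    have hv : ∀ i ≤ k, Function.update v (k + 1) w i = v i := fun i hi =>
      Function.update_of_ne (by omega) _ _
    have hp : ∀ i ≤ k, Function.update p (k + 1) i₀ i = p i := fun i hi =>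
      Function.update_of_ne (by omega) _ _
    refine ⟨Function.update v (k + 1) w, Function.update p (k + 1) i₀, ?_, ?_, ?_, ?_, ?_⟩
    · intro i hi j hj e
      rcases Nat.le_succ_iff.1 hi with hi | rfl <;> rcases Nat.le_succ_iff.1 hj with hj | rfl
      · rw [hv i hi, hv j hj] at e
        exact hinj i hi j hj e
      · rw [hv i hi, Function.update_self] at e
        exact absurd e (hnew i hi)
      · rw [hv j hj, Function.update_self] at e
        exact absurd e.symm (hnew j hj)
      · rfl
    · rw [hp 0 (Nat.zero_le k), hp0]
    · intro i hi h0
      rcases Nat.le_succ_iff.1 hi with hi | rfl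
      · have := hadj i hi h0
        rw [hp i hi, hv i hi, hv (p i) (by omega)]
        exact this
      · rw [Function.update_self, Function.update_self, hv i₀ hik]
        exact ⟨by omega, hw.symm⟩
    · intro i j hij hj
      rcases Nat.le_succ_iff.1 hj with hj | rfl
      · rw [hp i (by omega), hp j hj]
        exact hmono i j hij hj
      · rw [Function.update_self]
        rcases Nat.le_succ_iff.1 hij with hi | rfl
        · rw [hp i hi]
          exact (hmono i k hi le_rfl).trans hpk
        · rw [Function.update_self]
    · intro i hi w' hw'
      rw [Function.update_self] at hi
      rw [hv i (by omega)] at hw'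
      by_contra hno
      push Not at hno
      refine hmin i hi ⟨by omega, w', hw', fun j hj e => hno j (by omega) ?_⟩
      rw [hv j hj, e]

lemma exists_bfs {W : Type*} [Fintype W] [Nonempty W] (B : SimpleGraph W)
    (hc : ∀ S : Finset W, S.Nonempty → S ≠ univ → ∃ a ∈ S, ∃ b ∉ S, B.Adj a b) {m : ℕ}
    (hm : Fintype.card W = m) : ∃ (v : Fin m ≃ W) (p : Fin m → Fin m), Monotone p ∧
      (∀ t, p t ≤ t) ∧ (∀ t, p t = t → t.1 = 0) ∧ ∀ t, p t ≠ t → B.Adj (v t) (v (p t)) := by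
  have hpos : 0 < Fintype.card W := Fintype.card_pos
  obtain ⟨v, p, hinj, hp0, hadj, hmono, -⟩ := exists_bfs_aux B hc (Fintype.card W - 1) (by omega)
  rw [hm] at hpos hinj hadj hmono
  have hple : ∀ t : Fin m, p t ≤ t := fun t => by
    rcases Nat.eq_zero_or_pos t.1 with h0 | h0
    · rw [h0, hp0]
    · exact (hadj t (by omega) h0).1.le
  have hvi : Function.Injective fun t : Fin m => v t := fun t s e =>
    Fin.ext (hinj t (by omega) s (by omega) e)
  have hvb := (Fintype.bijective_iff_injective_and_card _).2 ⟨hvi, by rw [Fintype.card_fin, hm]⟩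
  refine ⟨Equiv.ofBijective _ hvb, fun t => ⟨p t, (hple t).trans_lt t.2⟩, fun t s hts =>
    hmono t s hts (by omega), hple, fun t ht => ?_, fun t ht => ?_⟩
  · by_contra h0
    exact (hadj t (by omega) (Nat.pos_of_ne_zero h0)).1.ne (congrArg Fin.val ht)
  · have h0 : t.1 ≠ 0 := fun h0 => ht (Fin.ext (by simp only [h0, hp0]))
    exact (hadj t (by omega) (Nat.pos_of_ne_zero h0)).2

lemma Conn.biUnion {V V' : Type*} {G : SimpleGraph V} {Q : SimpleGraph V'} {Y : Finset V'}
    {φ : V' → Finset V} (hY : Conn Q Y) (hφ : ∀ y ∈ Y, Conn G (φ y))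
    (ht : ∀ y y', Q.Adj y y' → Touch G (φ y) (φ y')) : Conn G (Y.biUnion φ) := by
  obtain ⟨⟨y₀, hy₀⟩, hr⟩ := hY
  obtain ⟨x₀, hx₀⟩ := (hφ y₀ hy₀).1
  refine ⟨⟨x₀, mem_biUnion.2 ⟨y₀, hy₀, hx₀⟩⟩, fun a ha b hb => ?_⟩
  obtain ⟨y, hy, hay⟩ := mem_biUnion.1 ha
  obtain ⟨y', hy', hby'⟩ := mem_biUnion.1 hb
  have hin : ∀ z ∈ Y, ∀ c ∈ φ z, ∀ d ∈ φ z,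
      Relation.ReflTransGen (fun x y => G.Adj x y ∧ y ∈ Y.biUnion φ) c d := fun z hz c hc d hd =>
    reach_mono (subset_biUnion_of_mem φ hz) ((hφ z hz).2 c hc d hd)
  have hmain : ∀ z, Relation.ReflTransGen (fun x y => Q.Adj x y ∧ y ∈ Y) y z → z ∈ Y ∧
      ∀ d ∈ φ z, Relation.ReflTransGen (fun x y => G.Adj x y ∧ y ∈ Y.biUnion φ) a d :=
    fun z hz => by
      induction hz with
      | refl => exact ⟨hy, hin y hy a hay⟩
      | tail _ hstep ih =>
        obtain ⟨c, hc, e, he, hce⟩ := ht _ _ hstep.1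
        exact ⟨hstep.2, fun d hd => ((ih.2 c hc).tail ⟨hce, mem_biUnion.2 ⟨_, hstep.2, he⟩⟩).trans
          (hin _ hstep.2 e he d hd)⟩
  exact (hmain y' (hr y hy y' hy')).2 b hby'

/-- A graph whose vertices are represented by disjoint connected sets, such that adjacent vertices
are represented by touching sets, has no `K₅` minor. -/
lemma MinorFree.of_fibers {V V' : Type*} {G : SimpleGraph V} {Q : SimpleGraph V'} {K : Finset V}
    {U : Finset V'} {φ : V' → Finset V} (h : MinorFree G K) (hK : ∀ t, φ t ⊆ K)
    (hφ : ∀ t, Conn G (φ t)) (hd : ∀ t t', t ≠ t' → Disjoint (φ t) (φ t'))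
    (ht : ∀ t t', Q.Adj t t' → Touch G (φ t) (φ t')) : MinorFree Q U := by
  rintro ⟨C, -, hC, hCd, hCt⟩
  refine h ⟨fun i => (C i).biUnion φ, fun i => biUnion_subset.2 fun t _ => hK t,
    fun i => (hC i).biUnion (fun t _ => hφ t) ht, fun i j hij => ?_, fun i j hij => ?_⟩
  · refine disjoint_biUnion_left _ _ _ |>.2 fun t hti => disjoint_biUnion_right _ _ _ |>.2
      fun t' htj => hd t t' ?_
    rintro rfl
    exact disjoint_left.1 (hCd i j hij) hti htj
  · obtain ⟨t, hti, t', htj, hadj⟩ := hCt i j hij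
    obtain ⟨a, ha, b, hb, hab⟩ := ht t t' hadj
    exact ⟨a, mem_biUnion.2 ⟨t, hti, ha⟩, b, mem_biUnion.2 ⟨t', htj, hb⟩, hab⟩

variable {D : Set (Set (ℝ × ℝ))} {X : Finset (ℝ × ℝ)} {A O : Finset ((ℝ × ℝ) × List (ℝ × ℝ))}

/-- The pointers and the incidences of an arc system. -/
def nodeGraph (X : Finset (ℝ × ℝ)) (A : Finset ((ℝ × ℝ) × List (ℝ × ℝ))) :
    SimpleGraph (Node X A) :=
  pointerGraph X A ⊔ SimpleGraph.fromRel fun w w' => ∃ x l, w = .inl x ∧ w' = .inr l ∧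
    x.1 ∈ curve (l.1.1 :: l.1.2)

lemma IsArcSystem.nodeGraph_adj (h : IsArcSystem D X A O) (x : {x // x ∈ X}) (l : {l // l ∈ A}) :
    (nodeGraph X A).Adj (.inl x) (.inr l) ↔ x.1 ∈ curve (l.1.1 :: l.1.2) := by
  constructor
  · rintro (⟨-, ⟨e, he, -⟩ | ⟨e, he, hp⟩⟩ | ⟨-, ⟨x', l', hx, hl, hm⟩ | ⟨x', l', hx, -⟩⟩)
    · cases he
    · obtain rfl := Sum.inr_injective he
      rcases hp with ⟨x', hx, hx', -⟩ | ⟨e', -, hx⟩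
      · obtain rfl := Sum.inl_injective hx
        rw [hx']
        exact (h.end_props e).2.2.2
      · cases hx
    · obtain rfl := Sum.inl_injective hx
      obtain rfl := Sum.inr_injective hl
      exact hm
    · cases hx
  · exact fun hm => .inr ⟨by simp, .inl ⟨x, l, rfl, rfl, hm⟩⟩

/-- The node of an arc system at which a vertex is represented. -/
def pos : Node X A → ℝ × ℝ := Sum.elim (fun x => x.1) fun _ => 0

/-- A connected arc system can be encoded by graphs without `K₅` minor and a token map. -/
theorem IsArcSystem.exists_code (h : IsArcSystem D X A O) (hconn : IsPreconnected (support X A))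
    (hne : X.Nonempty) {P : Finset (ℝ × ℝ)} (hP : P ⊆ X) {m : ℕ} (hm : X.card + A.card = m) :
    ∃ (v : Fin m ≃ Node X A) (p : Fin m → Fin m) (N : ℕ), Monotone p ∧ (∀ t, p t ≤ t) ∧
      (∀ t, p t = t → t.1 = 0) ∧ (∀ s, (univ.filter fun t => p t = s ∧ t ≠ s).card ≤ 6) ∧
      N ≤ 4 * (X.card + 2 * ∑ l ∈ A, l.2.length) + 1 ∧
      (nodeGraph X A).comap v ∈ minorFreeGraphs p univ ∧
      (fun t => if pos (v t) ∈ P ∧ (v t).isLeft then pos (v t) else 0) ∈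
        tokenMaps p (univ.filter fun t => pos (v t) ∈ P ∧ (v t).isLeft) univ P N := by
  have hNe : Nonempty (Node X A) := ⟨.inl ⟨_, hne.choose_spec⟩⟩
  obtain ⟨v, p, hmono, hple, hp0, hadj⟩ := exists_bfs (pointerGraph X A)
    (h.exists_adj_notMem hconn) (m := m) (by simpa using hm)
  obtain ⟨𝒦, φ, hK, hcard, hsub, hφc, hφd, hbase, hgap⟩ := h.exists_fibers
  have hpt : ∀ e : End A, ∀ w : Node X A, PointsTo e w → Touch cellGraph (φ w) (φ (.inr e.1)) := by
    rintro e w (⟨x, rfl, hx, -⟩ | ⟨e', hc, rfl⟩)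
    · obtain ⟨-, h1, h2, -⟩ := h.end_props e
      refine ⟨{x.1}, hbase _ (mem_singleton_self _), _, hbase (.inr e.1) h2, ?_⟩
      rw [hx]
      exact adj_singleton_openSegment h1
    · obtain ⟨x, y, y', h1, h2, h3, h4⟩ := h.exists_facing hc
      exact hgap (.inr e'.1) (.inr e.1) _ (h.end_props e').2.2.1 _ (h.end_props e).2.2.1 x y y' h1 h2
        h3 h4
  have hB : ∀ w w', (pointerGraph X A).Adj w w' → Touch cellGraph (φ w) (φ w') := by
    rintro w w' ⟨-, ⟨e, rfl, hp⟩ | ⟨e, rfl, hp⟩⟩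
    exacts [(hpt e w' hp).symm, hpt e w hp]
  have hI : ∀ (x : {x // x ∈ X}) (l : {l // l ∈ A}), x.1 ∈ curve (l.1.1 :: l.1.2) →
      Touch cellGraph (φ (.inl x)) (φ (.inr l)) := fun x l hm => by
    obtain ⟨e, rfl, he⟩ := h.exists_end x.2 l hm
    obtain ⟨-, h1, h2, -⟩ := h.end_props e
    refine ⟨{x.1}, hbase _ (mem_singleton_self _), _, hbase (.inr e.1) h2, ?_⟩
    rw [← he]
    exact adj_singleton_openSegment h1
  have hQ : ∀ w w', (nodeGraph X A).Adj w w' → Touch cellGraph (φ w) (φ w') := by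
    rintro w w' (hw | ⟨-, ⟨x, l, rfl, rfl, hm⟩ | ⟨x, l, rfl, rfl, hm⟩⟩)
    exacts [hB w w' hw, hI x l hm, (hI x l hm).symm]
  have hφd' : ∀ t t' : Fin m, t ≠ t' → Disjoint (φ (v t)) (φ (v t')) := fun t t' hne =>
    hφd _ _ fun e => hne (v.injective e)
  have hpos : ∀ w : Node X A, w.isLeft → ∃ x : {x // x ∈ X}, w = .inl x ∧ pos w = x.1 := by
    rintro (x | l) hw
    exacts [⟨x, rfl, rfl⟩, absurd hw (by simp)]
  refine ⟨v, p, 𝒦.card, hmono, hple, hp0, fun s => ?_, hcard, ?_, ?_⟩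
  · refine le_trans ?_ (h.card_neighbors_le (v s))
    refine card_le_card_of_injOn v (fun t ht => ?_) v.injective.injOn
    obtain ⟨-, rfl, hts⟩ := mem_filter.1 (mem_coe.1 ht)
    exact mem_coe.2 (mem_filter.2 ⟨mem_univ _, (hadj t hts.symm).symm⟩)
  · refine mem_filter.2 ⟨mem_univ _, fun _ _ _ => ⟨mem_univ _, mem_univ _⟩, ?_,
      fun t _ _ ht => .inl (hadj t ht)⟩
    exact hK.minorFree.of_fibers (φ := fun t => φ (v t)) (fun t => hsub _) (fun t => hφc _) hφd'
      fun t t' ht => hQ _ _ ht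
  · have hT : ∀ t, t ∈ univ ∩ univ.filter (fun t => pos (v t) ∈ P ∧ (v t).isLeft) ↔
        pos (v t) ∈ P ∧ (v t).isLeft := fun t => by simp
    refine mem_tokenMaps.2 ⟨fun t ht => if_neg (mt (hT t).2 ht), fun t ht t' ht' e => ?_, ?_, 𝒦,
      fun t => φ (v t), hK, rfl, fun t _ => hsub _, fun t _ => hφc _, fun t _ t' _ => hφd' t t',
      fun t _ _ ht => hB _ _ (hadj t ht), fun t _ ht => ?_⟩
    · have h1 := (hT t).1 ht
      have h2 := (hT t').1 ht'
      simp only [if_pos h1, if_pos h2] at e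
      obtain ⟨x, hx, hpx⟩ := hpos _ h1.2
      obtain ⟨x', hx', hpx'⟩ := hpos _ h2.2
      refine v.injective ?_
      rw [hx, hx', Subtype.ext (hpx.symm.trans (e.trans hpx'))]
    · ext z
      constructor
      · intro hz
        obtain ⟨t, ht, rfl⟩ := mem_image.1 hz
        have h1 := (hT t).1 ht
        simp only [if_pos h1]
        exact h1.1
      · intro hz
        have h1 : pos (v (v.symm (.inl ⟨z, hP hz⟩))) ∈ P ∧ (v (v.symm (.inl ⟨z, hP hz⟩))).isLeft := by
          rw [v.apply_symm_apply]
          exact ⟨hz, rfl⟩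
        refine mem_image.2 ⟨v.symm (.inl ⟨z, hP hz⟩), (hT _).2 h1, ?_⟩
        simp only [if_pos h1]
        rw [v.apply_symm_apply]
        rfl
    · have h1 := (mem_filter.1 ht).2
      obtain ⟨x, hx, hpx⟩ := hpos _ h1.2
      simp only [if_pos h1]
      rw [hpx, hx]
      exact ⟨{x.1}, hbase _ (mem_singleton_self _), rfl⟩

end Encoding

section Drawings

lemma polylineOf_eq_curve (a b : ℝ × ℝ) (t : List (ℝ × ℝ)) :
    polylineOf (a :: b :: t) = curve (a :: b :: t) := by
  induction t generalizing a b with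
  | nil => simp [polylineOf, curve, Set.insert_eq_of_mem (right_mem_segment ℝ a b)]
  | cons c t ih =>
    rw [curve_cons, ← ih b c]
    simp only [polylineOf, List.tail_cons, List.zip_cons_cons, List.mem_cons,
      Set.iUnion_iUnion_eq_or_left]

variable {n : ℕ} {G : SimpleGraph (Fin n)} {π : Fin n → ℝ × ℝ}
  {bends : Fin n → Fin n → List (ℝ × ℝ)}

lemma edgeCurve_eq_curve (π : Fin n → ℝ × ℝ) (bends : Fin n → Fin n → List (ℝ × ℝ))
    (u v : Fin n) : edgeCurve π bends u v = curve (π u :: (bends u v ++ [π v])) := by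
  unfold edgeCurve
  cases bends u v with
  | nil => exact polylineOf_eq_curve _ _ _
  | cons b t => exact polylineOf_eq_curve _ _ _

lemma drawn_of_isPolylineDrawing (h : IsPolylineDrawing G π bends) : Drawn G univ := by
  refine ⟨π, edgeCurve π bends, fun v _ w _ _ => ⟨bends v w ++ [π w], by simp, ?_⟩,
    fun v _ w _ x _ y _ hvw hxy h1 h2 h3 h4 => ?_⟩
  · rw [edgeCurve_eq_curve]
  · rw [Set.disjoint_iff_inter_eq_empty, h.inter v w x y hvw hxy (by simp [h1, h2]),
      Set.image_eq_empty]
    ext z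
    simp only [Set.mem_inter_iff, Set.mem_insert_iff, Set.mem_singleton_iff,
        Set.mem_empty_iff_false,
      iff_false]
    rintro ⟨rfl | rfl, rfl | rfl⟩ <;> contradiction

/-- The edges of a graph on `Fin n`, as increasing pairs. -/
def edgePairs (G : SimpleGraph (Fin n)) : Finset (Fin n × Fin n) :=
  univ.filter fun e => e.1 < e.2 ∧ G.Adj e.1 e.2

lemma mem_edgePairs {e : Fin n × Fin n} : e ∈ edgePairs G ↔ e.1 < e.2 ∧ G.Adj e.1 e.2 := by
  simp [edgePairs]

lemma edgePairs_ne {e e' : Fin n × Fin n} (he : e ∈ edgePairs G) (he' : e' ∈ edgePairs G)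
    (hne : e ≠ e') : s(e.1, e.2) ≠ s(e'.1, e'.2) := fun h => by
  have h1 := (mem_edgePairs.1 he).1
  have h2 := (mem_edgePairs.1 he').1
  rcases Sym2.eq_iff.1 h with ⟨h3, h4⟩ | ⟨h3, h4⟩
  · exact hne (Prod.ext h3 h4)
  · rw [h3, h4] at h1
    exact h1.asymm h2

lemma sum_edgePairs_le (h : IsPolylineDrawing G π bends) :
    ∑ e ∈ edgePairs G, ((bends e.1 e.2).length : ℝ) ≤ totalBends G bends := by
  set g : Fin n × Fin n → ℝ := fun e => if G.Adj e.1 e.2 then ((bends e.1 e.2).length : ℝ) else 0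
    with hg
  have hg0 : ∀ e, 0 ≤ g e := fun e => by
    simp only [hg]
    split_ifs <;> positivity
  have h1 : ∑ e ∈ edgePairs G, ((bends e.1 e.2).length : ℝ) = ∑ e ∈ edgePairs G, g e :=
    sum_congr rfl fun e he => (if_pos (mem_edgePairs.1 he).2).symm
  have h2 : ∑ e ∈ edgePairs G, g e = ∑ e ∈ (edgePairs G).image Prod.swap, g e := by
    rw [sum_image fun _ _ _ _ h => Prod.swap_injective h]
    refine sum_congr rfl fun e _ => ?_
    simp only [hg, Prod.fst_swap, Prod.snd_swap, G.adj_comm e.2 e.1, h.symm e.1 e.2,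
      List.length_reverse]
  have h3 : Disjoint (edgePairs G) ((edgePairs G).image Prod.swap) := by
    refine disjoint_left.2 fun e he he' => ?_
    obtain ⟨e', hm, rfl⟩ := mem_image.1 he'
    exact (mem_edgePairs.1 he).1.asymm (mem_edgePairs.1 hm).1
  have h4 : ∑ e ∈ edgePairs G, g e + ∑ e ∈ (edgePairs G).image Prod.swap, g e ≤ ∑ e, g e := by
    rw [← sum_union h3]
    exact sum_le_sum_of_subset_of_nonneg (subset_univ _) fun e _ _ => hg0 e
  have h5 : ∑ e, g e = 2 * totalBends G bends := by
    unfold totalBends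
    rw [Fintype.sum_prod_type, mul_div_cancel₀ _ (two_ne_zero)]
  linarith

/-- The loop-erased edges of a drawing form an arc system. -/
lemma exists_arcSystem (hπ : Function.Injective π) (h : IsPolylineDrawing G π bends) :
    ∃ (D : Set (Set (ℝ × ℝ))) (A : Finset ((ℝ × ℝ) × List (ℝ × ℝ))),
      IsArcSystem D (univ.image π) A A ∧ A.card ≤ (edgePairs G).card ∧
      ∑ l ∈ A, l.2.length ≤ ∑ e ∈ edgePairs G, ((bends e.1 e.2).length + 1) ∧
      (∀ K ∈ D, IsPreconnected K ∧ ∃ u v, G.Adj u v ∧ π u ∈ K ∧ π v ∈ K ∧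
        ∀ w, π w ∈ K → w = u ∨ w = v) ∧
      (∀ u v, G.Adj u v → ∃ K ∈ D, π u ∈ K ∧ π v ∈ K) ∧
      ∀ K ∈ D, ∀ K' ∈ D, K ≠ K' → K ∩ K' ⊆ Set.range π := by
  choose L hsimple hlast hcurve hlen using fun e : Fin n × Fin n =>
    exists_simple (π e.1) (bends e.1 e.2 ++ [π e.2])
  simp only [lastPt_append, ← edgeCurve_eq_curve, List.length_append, List.length_singleton]
    at hlast hcurve hlen
  set l : Fin n × Fin n → (ℝ × ℝ) × List (ℝ × ℝ) := fun e => (π e.1, L e) with hl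
  have hinj : ∀ e e', l e = l e' → e = e' := fun e e' hee => by
    obtain ⟨h1, h2⟩ := Prod.ext_iff.1 hee
    simp only [hl] at h1 h2
    refine Prod.ext (hπ h1) (hπ ?_)
    rw [← hlast e, ← hlast e', h1, h2]
  have hends : ∀ e, π e.1 ∈ curve (π e.1 :: L e) ∧ π e.2 ∈ curve (π e.1 :: L e) := fun e =>
    ⟨head_mem_curve _ _, by simpa only [hlast e] using lastPt_mem_curve (π e.1) (L e)⟩
  have honly : ∀ e ∈ edgePairs G, ∀ w, π w ∈ curve (π e.1 :: L e) → w = e.1 ∨ w = e.2 :=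
    fun e he w hw => by
      by_contra hne
      push Not at hne
      exact h.noVertex e.1 e.2 w (mem_edgePairs.1 he).2 hne.1 hne.2 (hcurve e hw)
  have hmeet : ∀ e ∈ edgePairs G, ∀ e' ∈ edgePairs G, e ≠ e' → ∀ z ∈ curve (π e.1 :: L e),
      z ∈ curve (π e'.1 :: L e') → z ∈ Set.range π := fun e he e' he' hne z hz hz' => by
    have h1 := (h.inter e.1 e.2 e'.1 e'.2 (mem_edgePairs.1 he).2 (mem_edgePairs.1 he').2
      (edgePairs_ne he he' hne)).subset ⟨hcurve e hz, hcurve e' hz'⟩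
    exact Set.image_subset_range _ _ h1
  refine ⟨{K | ∃ e ∈ edgePairs G, K = curve (π e.1 :: L e)}, (edgePairs G).image l,
    ⟨?_, ?_, ?_, ?_, ?_, ?_, subset_rfl, ?_, ?_⟩, card_image_le, ?_, ?_, ?_, ?_⟩
  · rw [forall_mem_image]
    exact fun e _ => hsimple e
  · rw [forall_mem_image]
    intro e he hnil
    have h1 := hlast e
    simp only [hl] at hnil
    rw [hnil, lastPt_nil] at h1
    exact (mem_edgePairs.1 he).1.ne (hπ h1)
  · rw [forall_mem_image]
    exact fun e _ => mem_image_of_mem π (mem_univ _)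
  · rw [forall_mem_image]
    exact fun e _ => mem_image.2 ⟨e.2, mem_univ _, (hlast e).symm⟩
  · rw [forall_mem_image]
    intro e he x hx hxe
    obtain ⟨w, -, rfl⟩ := mem_image.1 hx
    rcases honly e he w hxe with rfl | rfl
    exacts [.inl rfl, .inr (hlast e).symm]
  · rw [forall_mem_image]
    intro e he
    rw [forall_mem_image]
    intro e' he' hne z hz hz'
    obtain ⟨w, rfl⟩ := hmeet e he e' he' (fun hee => hne (hee ▸ rfl)) z hz hz'
    exact mem_image_of_mem π (mem_univ _)
  · rw [forall_mem_image]
    exact fun e he => ⟨_, ⟨e, he, rfl⟩, subset_rfl⟩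
  · rintro _ ⟨e, he, rfl⟩ z hz
    exact ⟨l e, mem_image_of_mem l he, subset_rfl, hz⟩
  · rw [sum_image fun e _ e' _ => hinj e e']
    exact sum_le_sum fun e _ => hlen e
  · rintro _ ⟨e, he, rfl⟩
    exact ⟨isPreconnected_curve _ _, e.1, e.2, (mem_edgePairs.1 he).2, (hends e).1, (hends e).2,
      honly e he⟩
  · intro u v huv
    rcases lt_or_gt_of_ne huv.ne with hlt | hlt
    · exact ⟨_, ⟨(u, v), mem_edgePairs.2 ⟨hlt, huv⟩, rfl⟩, hends (u, v)⟩
    · exact ⟨_, ⟨(v, u), mem_edgePairs.2 ⟨hlt, huv.symm⟩, rfl⟩, (hends (v, u)).symm⟩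
  · rintro _ ⟨e, he, rfl⟩ _ ⟨e', he', rfl⟩ hne z ⟨hz, hz'⟩
    exact hmeet e he e' he' (fun hee => hne (hee ▸ rfl)) z hz hz'

/-- Adjacent vertices are those joined by a chain of arcs that avoids all other vertices. -/
lemma IsArcSystem.adj_iff {D : Set (Set (ℝ × ℝ))} {X : Finset (ℝ × ℝ)}
    {A O : Finset ((ℝ × ℝ) × List (ℝ × ℝ))} (h : IsArcSystem D X A O)
    (hD : ∀ K ∈ D, IsPreconnected K ∧ ∃ u v, G.Adj u v ∧ π u ∈ K ∧ π v ∈ K ∧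
      ∀ w, π w ∈ K → w = u ∨ w = v)
    (hG : ∀ u v, G.Adj u v → ∃ K ∈ D, π u ∈ K ∧ π v ∈ K)
    (hI : ∀ K ∈ D, ∀ K' ∈ D, K ≠ K' → K ∩ K' ⊆ Set.range π) (u v : Fin n) :
    G.Adj u v ↔ u ≠ v ∧ ∃ s ∈ O, ∃ s' ∈ O, π u ∈ curve (s.1 :: s.2) ∧ π v ∈ curve (s'.1 :: s'.2) ∧
      Relation.ReflTransGen (fun l l' => l' ∈ O ∧ ∃ z ∈ X, (z ∈ Set.range π → z = π u ∨ z = π v) ∧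
        z ∈ curve (l.1 :: l.2) ∧ z ∈ curve (l'.1 :: l'.2)) s s' := by
  have hends : ∀ K ∈ D, u ≠ v → π u ∈ K → π v ∈ K →
      G.Adj u v ∧ ∀ w, π w ∈ K → w = u ∨ w = v := fun K hK hne hu hv => by
    obtain ⟨-, x, y, hxy, -, -, hw⟩ := hD K hK
    rcases hw u hu with rfl | rfl <;> rcases hw v hv with rfl | rfl
    exacts [absurd rfl hne, ⟨hxy, hw⟩, ⟨hxy.symm, fun w hw' => (hw w hw').symm⟩, absurd rfl hne]
  constructor
  · intro huv
    obtain ⟨K, hK, hu, hv⟩ := hG u v huv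
    obtain ⟨s, hs, hsK, hus⟩ := h.covered K hK _ hu
    obtain ⟨s', hs', hsK', hvs'⟩ := h.covered K hK _ hv
    refine ⟨huv.ne, s, hs, s', hs', hus, hvs', ?_⟩
    by_contra hreach
    set r := fun l l' : (ℝ × ℝ) × List (ℝ × ℝ) => l' ∈ O ∧ ∃ z ∈ X,
      (z ∈ Set.range π → z = π u ∨ z = π v) ∧ z ∈ curve (l.1 :: l.2) ∧ z ∈ curve (l'.1 :: l'.2)
    have hclosed : ∀ B : Finset ((ℝ × ℝ) × List (ℝ × ℝ)), IsClosed (⋃ l ∈ B, curve (l.1 :: l.2)) :=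
      fun B => (B.isCompact_biUnion fun l _ => isCompact_curve _).isClosed
    set B := O.filter fun l => curve (l.1 :: l.2) ⊆ K
    obtain ⟨z, hzK, hz1, hz2⟩ := isPreconnected_closed_iff.1 (hD K hK).1 _ _
      (hclosed (B.filter fun l => Relation.ReflTransGen r s l))
      (hclosed (B.filter fun l => ¬ Relation.ReflTransGen r s l))
      (fun z hz => by
        obtain ⟨l, hl, hlK, hzl⟩ := h.covered K hK z hz
        by_cases hr : Relation.ReflTransGen r s l
        · exact .inl (Set.mem_biUnion (mem_coe.2 (mem_filter.2 ⟨mem_filter.2 ⟨hl, hlK⟩, hr⟩)) hzl)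
        · exact .inr (Set.mem_biUnion (mem_coe.2 (mem_filter.2 ⟨mem_filter.2 ⟨hl, hlK⟩, hr⟩)) hzl))
      ⟨_, hu, Set.mem_biUnion (mem_coe.2 (mem_filter.2 ⟨mem_filter.2 ⟨hs, hsK⟩, .refl⟩)) hus⟩
      ⟨_, hv, Set.mem_biUnion (mem_coe.2 (mem_filter.2 ⟨mem_filter.2 ⟨hs', hsK'⟩, hreach⟩)) hvs'⟩
    obtain ⟨l, hl, hzl⟩ := Set.mem_iUnion₂.1 hz1
    obtain ⟨l', hl', hzl'⟩ := Set.mem_iUnion₂.1 hz2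
    obtain ⟨hlB, hr⟩ := mem_filter.1 hl
    obtain ⟨hlB', hr'⟩ := mem_filter.1 hl'
    have hlO' := (mem_filter.1 hlB').1
    refine hr' (hr.tail ⟨hlO', z, h.inter l (h.sub (mem_filter.1 hlB).1) l' (h.sub hlO')
      (fun e => hr' (e ▸ hr)) z hzl hzl', ?_, hzl, hzl'⟩)
    rintro ⟨w, rfl⟩
    exact ((hends K hK huv.ne hu hv).2 w hzK).imp (congrArg π) (congrArg π)
  · rintro ⟨hne, s, hs, s', -, hus, hvs', hr⟩
    have hmain : G.Adj u v ∨ ∃ K ∈ D, curve (s'.1 :: s'.2) ⊆ K ∧ π u ∈ K := by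
      clear hvs'
      induction hr with
      | refl =>
        obtain ⟨K, hK, hsK⟩ := h.inside s hs
        exact .inr ⟨K, hK, hsK, hsK hus⟩
      | tail _ hstep ih =>
        obtain ⟨hl', z, -, hz, hzl, hzl'⟩ := hstep
        obtain hadj | ⟨K, hK, hlK, hu⟩ := ih
        · exact .inl hadj
        obtain ⟨K', hK', hlK'⟩ := h.inside _ hl'
        rcases eq_or_ne K K' with rfl | hKK
        · exact .inr ⟨K, hK, hlK', hu⟩
        rcases hz (hI K hK K' hK' hKK ⟨hlK hzl, hlK' hzl'⟩) with rfl | rfl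
        · exact .inr ⟨K', hK', hlK', hlK' hzl'⟩
        · exact .inl (hends K hK hne hu (hlK hzl)).1
    obtain hadj | ⟨K, hK, hsK, hu⟩ := hmain
    exacts [hadj, (hends K hK hne hu (hsK hvs')).1]

/-- The adjacency encoded by a graph, a map recognizing the vertices, and the sets of the nodes
that are vertices, points and arcs. -/
def Decoded {m : ℕ} (π : Fin n → ℝ × ℝ) (Q : SimpleGraph (Fin m)) (f : Fin m → ℝ × ℝ)
    (T X O : Finset (Fin m)) (u v : Fin n) : Prop :=
  u ≠ v ∧ ∃ a ∈ T, ∃ b ∈ T, f a = π u ∧ f b = π v ∧ ∃ s ∈ O, ∃ s' ∈ O, Q.Adj a s ∧ Q.Adj b s' ∧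
    Relation.ReflTransGen (fun r r' => r' ∈ O ∧ ∃ t ∈ X, (t ∈ T → f t = π u ∨ f t = π v) ∧
      Q.Adj t r ∧ Q.Adj t r') s s'

lemma IsArcSystem.decoded_iff {m : ℕ} {D : Set (Set (ℝ × ℝ))} {X : Finset (ℝ × ℝ)}
    {A O : Finset ((ℝ × ℝ) × List (ℝ × ℝ))} (h : IsArcSystem D X A O) (hP : univ.image π ⊆ X)
    (v : Fin m ≃ Node X A) (i j : Fin n) :
    Decoded π ((nodeGraph X A).comap v)
      (fun t => if pos (v t) ∈ univ.image π ∧ (v t).isLeft then pos (v t) else 0)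
      (univ.filter fun t => pos (v t) ∈ univ.image π ∧ (v t).isLeft)
      (univ.filter fun t => (v t).isLeft) (univ.filter fun t => ∃ l, v t = .inr l ∧ l.1 ∈ O) i j ↔
    i ≠ j ∧ ∃ s ∈ O, ∃ s' ∈ O, π i ∈ curve (s.1 :: s.2) ∧ π j ∈ curve (s'.1 :: s'.2) ∧
      Relation.ReflTransGen (fun l l' => l' ∈ O ∧ ∃ z ∈ X, (z ∈ Set.range π → z = π i ∨ z = π j) ∧
        z ∈ curve (l.1 :: l.2) ∧ z ∈ curve (l'.1 :: l'.2)) s s' := by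
  have hadj : ∀ x l, ((nodeGraph X A).comap v).Adj (v.symm (.inl x)) (v.symm (.inr l)) ↔
      x.1 ∈ curve (l.1.1 :: l.1.2) := fun x l => by
    rw [SimpleGraph.comap_adj, v.apply_symm_apply, v.apply_symm_apply, h.nodeGraph_adj]
  set f : Fin m → ℝ × ℝ :=
    fun t => if pos (v t) ∈ univ.image π ∧ (v t).isLeft then pos (v t) else 0 with hf
  set T : Finset (Fin m) := univ.filter fun t => pos (v t) ∈ univ.image π ∧ (v t).isLeft with hT
  have hX : ∀ t, t ∈ univ.filter (fun t => (v t).isLeft) ↔ ∃ x, t = v.symm (.inl x) := fun t => by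
    rw [mem_filter_univ, Sum.isLeft_iff]
    simp only [Equiv.eq_symm_apply]
  have hO : ∀ t, t ∈ univ.filter (fun t => ∃ l, v t = .inr l ∧ l.1 ∈ O) ↔
      ∃ l : {l // l ∈ A}, t = v.symm (.inr l) ∧ l.1 ∈ O := fun t => by
    rw [mem_filter_univ]
    simp only [Equiv.eq_symm_apply]
  have hTx : ∀ x, v.symm (.inl x) ∈ T ↔ x.1 ∈ Set.range π := fun x => by
    simp [hT, pos]
  have hfx : ∀ x, v.symm (.inl x) ∈ T → f (v.symm (.inl x)) = x.1 := fun x hx => by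
    refine (if_pos (mem_filter.1 hx).2).trans ?_
    rw [v.apply_symm_apply]
    rfl
  have hstep : ∀ l l' : {l // l ∈ A}, (∃ t ∈ univ.filter fun t => (v t).isLeft,
      (t ∈ T → f t = π i ∨ f t = π j) ∧ ((nodeGraph X A).comap v).Adj t (v.symm (.inr l)) ∧
        ((nodeGraph X A).comap v).Adj t (v.symm (.inr l'))) ↔
      ∃ z ∈ X, (z ∈ Set.range π → z = π i ∨ z = π j) ∧ z ∈ curve (l.1.1 :: l.1.2) ∧
        z ∈ curve (l'.1.1 :: l'.1.2) := fun l l' => by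
    constructor
    · rintro ⟨t, ht, htT, h1, h2⟩
      obtain ⟨x, rfl⟩ := (hX t).1 ht
      refine ⟨x.1, x.2, fun hx => ?_, (hadj x l).1 h1, (hadj x l').1 h2⟩
      rw [← hfx x ((hTx x).2 hx)]
      exact htT ((hTx x).2 hx)
    · rintro ⟨z, hz, hzP, h1, h2⟩
      refine ⟨v.symm (.inl ⟨z, hz⟩), (hX _).2 ⟨_, rfl⟩, fun ht => ?_, (hadj _ l).2 h1,
        (hadj _ l').2 h2⟩
      rw [hfx _ ht]
      exact hzP ((hTx _).1 ht)
  refine and_congr_right fun _ => ⟨?_, ?_⟩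
  · rintro ⟨a, ha, b, hb, hai, hbj, s, hs, s', hs', has, hbs', hr⟩
    have hTX : ∀ t ∈ T, ∃ x, t = v.symm (.inl x) := fun t ht =>
      (hX t).1 (mem_filter.2 ⟨mem_univ _, (mem_filter.1 ht).2.2⟩)
    obtain ⟨x, rfl⟩ := hTX a ha
    obtain ⟨y, rfl⟩ := hTX b hb
    obtain ⟨l, rfl, hl⟩ := (hO s).1 hs
    obtain ⟨l', rfl, hl'⟩ := (hO s').1 hs'
    rw [hadj, ← hfx x ha, hai] at has
    rw [hadj, ← hfx y hb, hbj] at hbs'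
    refine ⟨l.1, hl, l'.1, hl', has, hbs', ?_⟩
    suffices hmain : ∀ r, Relation.ReflTransGen _ (v.symm (.inr l)) r → ∃ l' : {l // l ∈ A},
        r = v.symm (.inr l') ∧ Relation.ReflTransGen _ l.1 l'.1 by
      obtain ⟨l₁, h1, h2⟩ := hmain _ hr
      rwa [← Sum.inr_injective (v.symm.injective h1)] at h2
    intro r hr
    induction hr with
    | refl => exact ⟨l, rfl, .refl⟩
    | tail _ hst ih =>
      obtain ⟨l₁, rfl, h1⟩ := ih
      obtain ⟨l₂, rfl, h2⟩ := (hO _).1 hst.1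
      exact ⟨l₂, rfl, h1.tail ⟨h2, (hstep l₁ l₂).1 hst.2⟩⟩
  · rintro ⟨s, hs, s', hs', his, hjs', hr⟩
    have hπ : ∀ k, v.symm (.inl ⟨π k, hP (mem_image_of_mem π (mem_univ k))⟩) ∈ T := fun k =>
      (hTx _).2 ⟨k, rfl⟩
    refine ⟨_, hπ i, _, hπ j, hfx _ (hπ i), hfx _ (hπ j), v.symm (.inr ⟨s, h.sub hs⟩),
      (hO _).2 ⟨_, rfl, hs⟩, v.symm (.inr ⟨s', h.sub hs'⟩), (hO _).2 ⟨_, rfl, hs'⟩,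
      (hadj _ _).2 his, (hadj _ _).2 hjs', ?_⟩
    suffices hmain : ∀ l, Relation.ReflTransGen _ s l → ∃ hl : l ∈ O, Relation.ReflTransGen _
        (v.symm (.inr ⟨s, h.sub hs⟩)) (v.symm (.inr ⟨l, h.sub hl⟩)) from (hmain s' hr).2
    intro l hr
    induction hr with
    | refl => exact ⟨hs, .refl⟩
    | tail _ hst ih =>
      obtain ⟨hl, h1⟩ := ih
      exact ⟨hst.1, h1.tail ⟨(hO _).2 ⟨_, rfl, hst.1⟩, (hstep ⟨_, h.sub hl⟩ ⟨_,
          h.sub hst.1⟩).2 hst.2⟩⟩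

/-- Every graph with a drawing has a short code. -/
theorem exists_drawing_code : ∃ C : ℝ, 1 ≤ C ∧ ∀ n : ℕ, 1 ≤ n → ∀ β : ℝ, 0 ≤ β →
    ∀ π : Fin n → ℝ × ℝ, Function.Injective π → ∀ (G : SimpleGraph (Fin n)) bends,
    IsPolylineDrawing G π bends → totalBends G bends ≤ β →
    ∃ (m : ℕ) (p : Fin m → Fin m) (Q : SimpleGraph (Fin m)) (T X O : Finset (Fin m)) (N : ℕ)
      (f : Fin m → ℝ × ℝ), m ≤ C * n ∧ Monotone p ∧ (∀ t, p t ≤ t) ∧ (∀ t, p t = t → t.1 = 0) ∧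
      (∀ s, (univ.filter fun t => p t = s ∧ t ≠ s).card ≤ 6) ∧ Q ∈ minorFreeGraphs p univ ∧
      N ≤ C * (n + β) ∧ f ∈ tokenMaps p T univ (univ.image π) N ∧
      ∀ u v, G.Adj u v ↔ Decoded π Q f T X O u v := by
  obtain ⟨c, hc, hedges⟩ := exists_edge_bound
  refine ⟨37 + 16 * c, by linarith, fun n hn β hβ π hπ G bends hG hbends => ?_⟩
  have hn1 : (1 : ℝ) ≤ n := by exact_mod_cast hn
  have hE : ((edgePairs G).card : ℝ) ≤ c * n := by
    have h1 := hedges _ G univ (drawn_of_isPolylineDrawing hG).minorFree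
    rw [card_univ, Fintype.card_fin] at h1
    refine le_trans ?_ h1
    exact_mod_cast card_le_card fun e he => mem_filter.2 ⟨by simp, (mem_edgePairs.1 he).2⟩
  obtain ⟨D, A₀, h₀, hA₀, hlen₀, hD, hDG, hDI⟩ := exists_arcSystem hπ hG
  have hX₀ : (univ.image π).card = n := by
    rw [card_image_of_injective _ hπ, card_univ, Fintype.card_fin]
  obtain ⟨X, A, O, h, hX, hXn, hAn, hlen, hconn⟩ := h₀.exists_connected n (univ.image π) hX₀.le
    (fun z hz => by
      rcases hz with hz | ⟨l, hl, hz⟩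
      · exact ⟨z, hz, {z}, Set.singleton_subset_iff.2 (.inl hz), isPreconnected_singleton, rfl, rfl⟩
      · exact ⟨l.1, h₀.fst_mem l hl, _, fun z hz => .inr ⟨l, hl, hz⟩, isPreconnected_curve l.1 l.2,
          hz, head_mem_curve _ _⟩)
  have hne : X.Nonempty := ⟨π ⟨0, hn⟩, hX (mem_image_of_mem π (mem_univ _))⟩
  obtain ⟨v, p, N, hmono, hp, hp0, hpc, hN, hQ, hf⟩ := h.exists_code hconn hne hX rfl
  rw [hX₀] at hXn
  have h1 : (A.card : ℝ) ≤ c * n + 3 * n := by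
    have h2 : (A.card : ℝ) ≤ (edgePairs G).card + 3 * n := by exact_mod_cast hAn.trans (by omega)
    linarith
  have h2 : (X.card : ℝ) ≤ 3 * n := by exact_mod_cast hXn.trans (by omega)
  have h3 : (∑ l ∈ A, l.2.length : ℝ) ≤ β + c * n + 3 * n := by
    have h4 : (∑ l ∈ A, l.2.length : ℝ) ≤
        ∑ e ∈ edgePairs G, ((bends e.1 e.2).length + 1 : ℝ) + 3 * n := by
      exact_mod_cast hlen.trans (by omega)
    rw [sum_add_distrib, sum_const, nsmul_one] at h4
    linarith [sum_edgePairs_le hG]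
  refine ⟨X.card + A.card, p, _, _, _, _, N, _, ?_, hmono, hp, hp0, hpc, hQ, ?_, hf, fun i j =>
    (h.adj_iff hD hDG hDI i j).trans (h.decoded_iff hX v i j).symm⟩
  · push_cast
    nlinarith
  · have h4 : (N : ℝ) ≤ 4 * (X.card + 2 * ∑ l ∈ A, l.2.length) + 1 := by exact_mod_cast hN
    have h5 : 0 ≤ c * n := by positivity
    have h6 : 0 ≤ c * β := by positivity
    push_cast at h4
    linarith

end Drawings

section Counting

lemma card_biUnion_le_mul {α γ : Type*} {s : Finset α} {F : α → Finset γ} {a b : ℝ}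
    (hb : 0 ≤ b) (hs : s.card ≤ a) (hF : ∀ x ∈ s, ((F x).card : ℝ) ≤ b) :
    ((s.biUnion F).card : ℝ) ≤ a * b :=
  calc ((s.biUnion F).card : ℝ) ≤ ∑ x ∈ s, ((F x).card : ℝ) := by exact_mod_cast card_biUnion_le
    _ ≤ s.card * b := by rw [← nsmul_eq_mul]; exact sum_le_card_nsmul _ _ _ hF
    _ ≤ a * b := by gcongr

lemma ell_le {y : ℝ} (hy : 0 ≤ y) : ell y ≤ 1 + 4 * y := by
  have := Real.log_le_self hy
  unfold ell
  linarith

/-- The token maps and their numbers of cells, for a tree and a bound on the number of cells. -/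
lemma exists_mul_card_tokenMaps_le (C : ℝ) (hC : 1 ≤ C) : ∃ L : ℝ, ∀ (m : ℕ) (p : Fin m → Fin m)
    (T : Finset (Fin m)) (P : Finset (ℝ × ℝ)) (n N : ℕ) (k : ℝ), (∀ t, p t ≤ t) →
    (∀ s, (univ.filter fun t => p t = s ∧ t ≠ s).card ≤ 6) → (roots p univ).card ≤ 1 →
    1 ≤ n → 1 ≤ k → P.card = n → m ≤ C * n → N ≤ C * (n * k) →
    (C * (n * k) + 1) * ((tokenMaps p T univ P N).card : ℝ) ≤ k ^ n * Real.exp (L * n) := by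
  obtain ⟨K, hK, hcount⟩ := exists_card_tokenMaps_le 6
  refine ⟨C + 2 + (4 * K * C + 8 * C + 1), fun m p T P n N k hp hc hr hn hk hP hm hN => ?_⟩
  have hn1 : (1 : ℝ) ≤ n := by exact_mod_cast hn
  have hk0 : 0 < k := by linarith
  have hnk : 1 ≤ n * k := one_le_mul_of_one_le_of_one_le hn1 hk
  have hexp : (C + 1) * n ^ 2 ≤ Real.exp ((C + 2) * n) := by
    have h1 : (n : ℝ) ≤ Real.exp n := by linarith [Real.add_one_le_exp (n : ℝ)]
    have h2 : C + 1 ≤ Real.exp (C * n) :=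
      (Real.add_one_le_exp C).trans (Real.exp_le_exp.2 (le_mul_of_one_le_right (by linarith) hn1))
    calc (C + 1) * n ^ 2 ≤ Real.exp (C * n) * Real.exp n ^ 2 := by gcongr
      _ = Real.exp ((C + 2) * n) := by
        rw [← Real.exp_nat_mul, ← Real.exp_add]
        congr 1
        push_cast
        ring
  rcases le_or_gt k n with hkn | hkn
  · have hy1 : 1 ≤ 2 * C * n / k := (one_le_div hk0).2 (by nlinarith)
    have hky : k * (2 * C * n / k) = 2 * C * n := by field_simp
    have hyn : 2 * C * n / k ≤ 2 * C * n := div_le_self (by positivity) hk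
    have h1 := hcount m p T hp hc k hk univ P N (2 * C * n / k) hy1 (by
      rw [card_univ, Fintype.card_fin, pow_two, mul_assoc, hky]
      nlinarith)
    have h2 : k * (K * gPot (2 * C * n / k)) ≤ 4 * K * C * n :=
      calc k * (K * gPot (2 * C * n / k)) ≤ k * (K * (2 * (2 * C * n / k))) := by
            gcongr
            exact gPot_le (by positivity)
        _ = 2 * K * (k * (2 * C * n / k)) := by ring
        _ = 4 * K * C * n := by rw [hky]; ring
    have h3 : (roots p univ).card * ell (2 * C * n / k) ≤ (8 * C + 1) * n := by
      have h4 : 0 ≤ ell (2 * C * n / k) := by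
        have := Real.log_nonneg hy1
        unfold ell
        positivity
      calc (roots p univ).card * ell (2 * C * n / k) ≤ 1 * ell (2 * C * n / k) := by
            gcongr
            exact_mod_cast hr
        _ ≤ (8 * C + 1) * n := by linarith [ell_le (y := 2 * C * n / k) (by linarith)]
    rw [hP] at h1
    calc (C * (n * k) + 1) * ((tokenMaps p T univ P N).card : ℝ)
        ≤ ((C + 1) * n ^ 2) * (k ^ n * Real.exp ((4 * K * C + 8 * C + 1) * n)) := by
          gcongr
          · nlinarith
          · refine h1.trans ?_
            gcongr
            linarith
      _ ≤ Real.exp ((C + 2) * n) * (k ^ n * Real.exp ((4 * K * C + 8 * C + 1) * n)) := by gcongr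
      _ = k ^ n * Real.exp ((C + 2 + (4 * K * C + 8 * C + 1)) * n) := by
        rw [mul_left_comm, ← Real.exp_add, ← add_mul]
  · have h1 : ((tokenMaps p T univ P N).card : ℝ) ≤ n ^ n := by
      have := card_tokenMaps_le_pow p T univ P N
      rw [hP] at this
      exact_mod_cast this
    obtain ⟨r, rfl⟩ := Nat.exists_eq_add_of_le' hn
    set x : ℝ := ((r + 1 : ℕ) : ℝ)
    calc (C * (x * k) + 1) * ((tokenMaps p T univ P N).card : ℝ)
        ≤ ((C + 1) * (x * k)) * x ^ (r + 1) := by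
          gcongr
          linarith
      _ = (C + 1) * x ^ 2 * (x ^ r * k) := by ring
      _ ≤ Real.exp ((C + 2) * x) * (k ^ r * k) := by gcongr
      _ ≤ Real.exp ((C + 2 + (4 * K * C + 8 * C + 1)) * x) * (k ^ r * k) := by
          have : 0 ≤ K * C := mul_nonneg hK (by linarith)
          gcongr Real.exp (?_ * x) * _
          linarith
      _ = k ^ (r + 1) * Real.exp ((C + 2 + (4 * K * C + 8 * C + 1)) * x) := by ring

/-- The graphs with short codes. -/
lemma exists_card_decoded_le (C : ℝ) (hC : 1 ≤ C) : ∃ L : ℝ, ∀ (n : ℕ) (k : ℝ)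
    (π : Fin n → ℝ × ℝ), Function.Injective π → 1 ≤ n → 1 ≤ k →
    ∃ S : Finset (SimpleGraph (Fin n)), (S.card : ℝ) ≤ k ^ n * Real.exp (L * n) ∧
    ∀ G : SimpleGraph (Fin n), (∃ (m : ℕ) (p : Fin m → Fin m) (Q : SimpleGraph (Fin m))
      (T X O : Finset (Fin m)) (N : ℕ) (f : Fin m → ℝ × ℝ), m ≤ C * n ∧ Monotone p ∧
      (∀ t, p t ≤ t) ∧ (∀ t, p t = t → t.1 = 0) ∧
      (∀ s, (univ.filter fun t => p t = s ∧ t ≠ s).card ≤ 6) ∧ Q ∈ minorFreeGraphs p univ ∧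
      N ≤ C * (n * k) ∧ f ∈ tokenMaps p T univ (univ.image π) N ∧
      ∀ u v, G.Adj u v ↔ Decoded π Q f T X O u v) → G ∈ S := by
  obtain ⟨a, ha, hgraphs⟩ := exists_graph_count 6
  obtain ⟨L, hL⟩ := exists_mul_card_tokenMaps_le C hC
  refine ⟨C + (2 * C + (2 * a * C + 4 * C + 1 + (3 * C + L))), fun n k π hπ hn hk => ?_⟩
  have hn1 : (1 : ℝ) ≤ n := by exact_mod_cast hn
  have hk0 : 0 < k := by linarith
  set trees : (m : ℕ) → Finset (Fin m → Fin m) := fun m => univ.filter fun p => Monotone p ∧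
    (∀ t, p t ≤ t) ∧ (∀ t, p t = t → t.1 = 0) ∧
    ∀ s, (univ.filter fun t => p t = s ∧ t ≠ s).card ≤ 6
  refine ⟨(range (⌊C * n⌋₊ + 1)).biUnion fun m => (trees m).biUnion fun p =>
    (minorFreeGraphs p univ).biUnion fun Q => univ.biUnion fun B : Finset (Fin m) × Finset (Fin m) ×
      Finset (Fin m) => (range (⌊C * (n * k)⌋₊ + 1)).biUnion fun N =>
        (tokenMaps p B.1 univ (univ.image π) N).image fun f =>
          SimpleGraph.fromRel (Decoded π Q f B.1 B.2.1 B.2.2), ?_, ?_⟩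
  · have hC0 : 0 ≤ C * (n * k) + 1 := by positivity
    have hexp : ∀ x y z : ℝ, Real.exp (x * n) * (z * Real.exp (y * n)) =
        z * Real.exp ((x + y) * n) := fun x y z => by
      rw [mul_left_comm, ← Real.exp_add, ← add_mul]
    rw [← hexp, ← hexp, ← hexp, ← hexp]
    refine card_biUnion_le_mul (by positivity) ?_ fun m hm => ?_
    · rw [card_range]
      push_cast
      linarith [Real.add_one_le_exp (C * n), Nat.floor_le (show 0 ≤ C * n by positivity)]
    have hm' : (m : ℝ) ≤ C * n := (Nat.le_floor_iff (by positivity)).1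
      (Nat.le_of_lt_succ (mem_range.1 hm))
    have hpow : ∀ j : ℕ, (2 : ℝ) ^ (j * m) ≤ Real.exp (j * C * n) := fun j => by
      refine (two_pow_le_exp _).trans (Real.exp_le_exp.2 ?_)
      push_cast
      rw [mul_assoc]
      gcongr
    refine card_biUnion_le_mul (by positivity) ?_ fun p hp => ?_
    · have h1 : (trees m).card ≤ 2 ^ (2 * m) := by
        rw [pow_mul]
        exact (card_le_card (monotone_filter_right _ fun _ _ h => h.1)).trans (card_monotone_le m)
      exact (Nat.cast_le.2 h1).trans (by exact_mod_cast hpow 2)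
    obtain ⟨-, -, hple, hp0, hpc⟩ := mem_filter.1 hp
    have hroots : (roots p univ).card ≤ 1 := card_le_one.2 fun t ht s hs => by
      have h0 : ∀ t ∈ roots p univ, t.1 = 0 := fun t ht =>
        (mem_filter.1 ht).2.elim (hp0 t) fun h => absurd (mem_univ _) h
      exact Fin.ext ((h0 t ht).trans (h0 s hs).symm)
    refine card_biUnion_le_mul (by positivity) ?_ fun Q _ => ?_
    · refine (hgraphs m p hple hpc univ).trans (Real.exp_le_exp.2 ?_)
      rw [card_univ, Fintype.card_fin]
      have h1 : a * gPot m ≤ 2 * a * C * n :=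
        calc a * gPot m ≤ a * (2 * m) := by gcongr; exact gPot_le (Nat.cast_nonneg m)
          _ ≤ a * (2 * (C * n)) := by gcongr
          _ = 2 * a * C * n := by ring
      have h2 : (roots p univ).card * ell m ≤ 1 * ell m := by
        have := one_le_ell_natCast m
        gcongr
        exact_mod_cast hroots
      linarith [ell_le (Nat.cast_nonneg m : (0 : ℝ) ≤ m)]
    refine card_biUnion_le_mul (by positivity) ?_ fun B _ => ?_
    · refine le_trans (le_of_eq ?_) (hpow 3)
      simp only [card_univ, Fintype.card_prod, Fintype.card_finset, Fintype.card_fin]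
      push_cast
      ring
    rw [← mul_div_cancel₀ (k ^ n * Real.exp (L * n)) (show C * (n * k) + 1 ≠ 0 by positivity),
      mul_div_assoc]
    refine card_biUnion_le_mul (by positivity) ?_ fun N hN => ?_
    · rw [card_range]
      push_cast
      linarith [Nat.floor_le (show 0 ≤ C * (n * k) by positivity)]
    rw [← mul_div_assoc, le_div_iff₀' (by positivity)]
    refine le_trans ?_ (hL m p B.1 (univ.image π) n N k hple hpc hroots hn hk ?_ hm' ?_)
    · gcongr
      exact card_image_le
    · rw [card_image_of_injective _ hπ, card_univ, Fintype.card_fin]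
    · exact (Nat.le_floor_iff (by positivity)).1 (Nat.le_of_lt_succ (mem_range.1 hN))
  · rintro G ⟨m, p, Q, T, X, O, N, f, hm, hmono, hp, hp0, hpc, hQ, hN, hf, hG⟩
    simp only [mem_biUnion, mem_image]
    refine ⟨m, mem_range.2 (Nat.lt_succ_of_le (Nat.le_floor hm)), p,
      mem_filter.2 ⟨mem_univ _, hmono, hp, hp0, hpc⟩, Q, hQ, (T, X, O), mem_univ _, N,
      mem_range.2 (Nat.lt_succ_of_le (Nat.le_floor hN)), f, hf, ?_⟩
    ext u v
    rw [SimpleGraph.fromRel_adj, ← hG, ← hG, G.adj_comm v u, or_self]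
    exact ⟨fun h => h.2, fun h => ⟨h.ne, h⟩⟩

end Counting

end PolylineCount

/-- There is a constant `C` such that for every `n ≥ 1`, every `β ≥ 0`, and every
injective vertex mapping `π : Fin n → ℝ²`, the number of simple graphs on `Fin n`
admitting a polyline drawing with vertex mapping `π` and at most `β` total bends
is at most `2^{n·log₂(1 + β/n) + C·n}`. -/
theorem count_graphs_with_beta_bends :
    ∃ C : ℝ, ∀ n : ℕ, 1 ≤ n → ∀ β : ℝ, 0 ≤ β →
      ∀ π : Fin n → ℝ × ℝ, Function.Injective π →
      (Nat.card {G : SimpleGraph (Fin n) //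
          ∃ bends : Fin n → Fin n → List (ℝ × ℝ),
            IsPolylineDrawing G π bends ∧ totalBends G bends ≤ β} : ℝ) ≤
        (2 : ℝ) ^ ((n : ℝ) * Real.logb 2 (1 + β / (n : ℝ)) + C * (n : ℝ)) := by
  obtain ⟨C, hC, hcode⟩ := PolylineCount.exists_drawing_code
  obtain ⟨L, hL⟩ := PolylineCount.exists_card_decoded_le C hC
  refine ⟨L / Real.log 2, fun n hn β hβ π hπ => ?_⟩
  have hn0 : (0 : ℝ) < n := by exact_mod_cast hn
  have hk : 1 ≤ 1 + β / n := le_add_of_nonneg_right (by positivity)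
  obtain ⟨S, hS, hmem⟩ := hL n (1 + β / n) π hπ hn hk
  have hnk : (n : ℝ) * (1 + β / n) = n + β := by field_simp
  have hsub : Nat.card {G : SimpleGraph (Fin n) // ∃ bends : Fin n → Fin n → List (ℝ × ℝ),
      IsPolylineDrawing G π bends ∧ totalBends G bends ≤ β} ≤ S.card := by
    refine (Nat.card_mono S.finite_toSet fun G hG => ?_).trans (by simp)
    obtain ⟨bends, hG, hbends⟩ := hG
    refine hmem G ?_
    rw [hnk]
    exact hcode n hn β hβ π hπ G bends hG hbends
  refine (Nat.cast_le.2 hsub).trans (hS.trans (le_of_eq ?_))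
  have h2 : Real.log 2 ≠ 0 := (Real.log_pos one_lt_two).ne'
  rw [Real.rpow_add two_pos, mul_comm (n : ℝ), Real.rpow_mul two_pos.le,
    Real.rpow_logb two_pos (by norm_num) (by linarith), Real.rpow_natCast,
      Real.rpow_def_of_pos two_pos]
  congr 2
  field_simp
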